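/- Let n ≥ 1, let A ⊂ ℝ^{n+1} be a bounded open set, and let u₀ : A → ℝ be locally Lipschitz continuous with u₀(x) → ∞ as x → x₀ for every x₀ ∈ ∂A. Then there exists a relatively open set Ω ⊂ ℝ^{n+1} × [0,∞) and a function u : Ω → ℝ such that: u solves graphical mean curvature flow, i.e. ∂u/∂t = √(1+|Du|²) · div( Du/√(1+|Du|²) ) on Ω ∖ (Ω₀ × {0}); u is smooth for t > 0 and continuous up to t = 0; Ω₀ = A; u(·,0) = u₀ on A; and u(x,t) → ∞ as (x,t) → ∂Ω, where ∂Ω denotes the relative boundary of Ω in ℝ^{n+1} × [0,∞). -/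

import Mathlib

open Set Filter Topology Metric

noncomputable section

/-- Divergence of a vector field on Euclidean space. -/
def vecDiv {m : ℕ} (X : EuclideanSpace ℝ (Fin m) → EuclideanSpace ℝ (Fin m))
    (x : EuclideanSpace ℝ (Fin m)) : ℝ :=
  ∑ i, fderiv ℝ X x (EuclideanSpace.single i 1) i

/-- Spatial gradient of a time-dependent function. -/
def spatialGrad {m : ℕ} (u : EuclideanSpace ℝ (Fin m) × ℝ → ℝ)
    (x : EuclideanSpace ℝ (Fin m)) (t : ℝ) : EuclideanSpace ℝ (Fin m) :=
  gradient (fun y => u (y, t)) x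

/-- The gradient function `v = √(1+|Du|²)` of the graph of `u(·,t)`. -/
def gradFn {m : ℕ} (u : EuclideanSpace ℝ (Fin m) × ℝ → ℝ)
    (x : EuclideanSpace ℝ (Fin m)) (t : ℝ) : ℝ :=
  Real.sqrt (1 + ‖spatialGrad u x t‖ ^ 2)

/-- Graphical mean curvature flow equation
`∂u/∂t = √(1+|Du|²) · div(Du/√(1+|Du|²))` at the point `(x,t)`. -/
def mcfEqAt {m : ℕ} (u : EuclideanSpace ℝ (Fin m) × ℝ → ℝ)
    (x : EuclideanSpace ℝ (Fin m)) (t : ℝ) : Prop :=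
  deriv (fun s => u (x, s)) t
    = gradFn u x t * vecDiv (fun y => (gradFn u y t)⁻¹ • spatialGrad u y t) x

section

open Finset (sum_congr mul_sum sum_add_distrib sum_nonneg sum_le_sum sum_sub_distrib single_le_sum
  sum_comm sum_neg_distrib sum_mul)

/-- Euclidean space. -/
local notation "𝔼" d:max => EuclideanSpace ℝ (Fin d)

/-- A nonprincipal ultrafilter on the natural numbers, as a filter. -/
local notation "𝔲" => (hyperfilter ℕ : Filter ℕ)

/-- A finite symmetric lattice stencil decomposing `(1+|p|²) I - p pᵀ` with weights that are
polynomials in `p`, uniformly positive for `|pᵢ| ≤ Λ`. -/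
structure Stencil (d : ℕ) (Λ : ℝ) where
  S : Type
  [fin : Fintype S]
  neg : S → S
  dir : S → Fin d → ℤ
  dir_neg : ∀ s, dir (neg s) = -dir s
  ι : Fin d → S
  dir_ι : ∀ i, dir (ι i) = Pi.single i 1
  P : S → MvPolynomial (Fin d) ℝ
  P_neg : ∀ s, P (neg s) = P s
  neg_neg : ∀ s, neg (neg s) = s
  c : ℝ
  c_pos : 0 < c
  c_le : ∀ p : Fin d → ℝ, (∀ i, |p i| ≤ Λ) → ∀ s, c ≤ MvPolynomial.eval p (P s)
  sum_P : ∀ (p : Fin d → ℝ) (a b : Fin d),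
    ∑ s, MvPolynomial.eval p (P s) * (dir s a : ℝ) * (dir s b : ℝ)
      = 2 * ((1 + ∑ i, p i ^ 2) * (if a = b then 1 else 0) - p a * p b)

attribute [instance] Stencil.fin

/-- The sign `±1` attached to a Boolean. -/
def boolSign (b : Bool) : ℤ := if b then 1 else -1

/-- Product weights on sign patterns. -/
def signWeight {J : Type*} [Fintype J] (m : J → ℝ) (ε : J → Bool) : ℝ :=
  ∏ j, (1 + (boolSign (ε j) : ℝ) * m j) / 2

lemma sum_signWeight_mul_mul {J : Type*} [Fintype J] [DecidableEq J] (m : J → ℝ) (i j : J) :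
    ∑ ε : J → Bool, signWeight m ε * (boolSign (ε i) : ℝ) * (boolSign (ε j) : ℝ)
      = if i = j then 1 else m i * m j := by
  have key : ∀ g : J → Bool → ℝ, ∑ ε : J → Bool, ∏ l, g l (ε l) = ∏ l, ∑ b, g l b := by
    intro g
    rw [Finset.prod_univ_sum, Fintype.piFinset_univ]
  have hs : ∀ b : Bool, ((boolSign b : ℤ) : ℝ) * (boolSign b : ℝ) = 1 := by
    intro b; cases b <;> simp [boolSign]
  split_ifs with hij
  · subst hij
    have : ∀ ε : J → Bool, signWeight m ε * (boolSign (ε i) : ℝ) * (boolSign (ε i) : ℝ)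
        = ∏ l, (1 + (boolSign (ε l) : ℝ) * m l) / 2 := by
      intro ε; rw [mul_assoc, hs, mul_one]; rfl
    simp_rw [this]
    rw [key (fun l b => (1 + (boolSign b : ℝ) * m l) / 2)]
    apply Finset.prod_eq_one
    intro l _
    simp [boolSign]; ring
  · have : ∀ ε : J → Bool, signWeight m ε * (boolSign (ε i) : ℝ) * (boolSign (ε j) : ℝ)
        = ∏ l, ((1 + (boolSign (ε l) : ℝ) * m l) / 2 * (if l = i then (boolSign (ε l) : ℝ) else 1)
          * (if l = j then (boolSign (ε l) : ℝ) else 1)) := by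
      intro ε
      rw [Finset.prod_mul_distrib, Finset.prod_mul_distrib]
      simp [signWeight]
    simp_rw [this]
    rw [key (fun l b => (1 + (boolSign b : ℝ) * m l) / 2 * (if l = i then (boolSign b : ℝ) else 1)
          * (if l = j then (boolSign b : ℝ) else 1))]
    have h2 : ∀ l, (∑ b, (1 + (boolSign b : ℝ) * m l) / 2 * (if l = i then (boolSign b : ℝ) else 1)
          * (if l = j then (boolSign b : ℝ) else 1))
        = (if l = i then m l else 1) * (if l = j then m l else 1) := by
      intro l
      by_cases h1 : l = i
      · have : l ≠ j := fun h => hij (h1.symm.trans h)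
        simp [h1, hij, boolSign]; ring
      · by_cases h3 : l = j
        · have : j ≠ i := fun h => hij h.symm
          simp [h3, this, boolSign]; ring
        · simp [h1, h3, boolSign]; ring
    simp_rw [h2]
    rw [Finset.prod_mul_distrib]
    simp

lemma sum_signWeight_sum_mul_sum {n d : ℕ} (m : Fin d → ℝ) (a b : Fin d) :
    ∑ ε : Fin n × Fin d → Bool, signWeight (fun q => m q.2) ε *
        ((∑ l, boolSign (ε (l, a)) : ℤ) : ℝ) * ((∑ l, boolSign (ε (l, b)) : ℤ) : ℝ)
      = (n : ℝ) ^ 2 * (m a * m b) + (if a = b then n * (1 - m a ^ 2) else 0) := by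
  have h1 : ∀ ε : Fin n × Fin d → Bool, signWeight (fun q => m q.2) ε *
        ((∑ l, boolSign (ε (l, a)) : ℤ) : ℝ) * ((∑ l, boolSign (ε (l, b)) : ℤ) : ℝ)
      = ∑ l, ∑ l', signWeight (fun q => m q.2) ε * (boolSign (ε (l, a)) : ℝ)
        * (boolSign (ε (l', b)) : ℝ) := by
    intro ε
    push_cast
    rw [mul_assoc, Finset.sum_mul_sum, mul_sum]
    refine sum_congr rfl fun l _ => ?_
    rw [mul_sum]
    refine sum_congr rfl fun l' _ => ?_
    ring
  simp_rw [h1]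
  rw [sum_comm]
  have h2 : ∀ l : Fin n, ∑ ε : Fin n × Fin d → Bool, ∑ l', signWeight (fun q => m q.2) ε *
      (boolSign (ε (l, a)) : ℝ) * (boolSign (ε (l', b)) : ℝ)
      = n * (m a * m b) + (if a = b then (1 - m a ^ 2) else 0) := by
    intro l
    rw [sum_comm]
    simp_rw [sum_signWeight_mul_mul (fun q : Fin n × Fin d => m q.2)]
    by_cases hab : a = b
    · subst hab
      have : ∀ l' : Fin n, (if ((l, a) : Fin n × Fin d) = (l', a) then (1 : ℝ) else m a * m a)
          = m a * m a + (if l = l' then 1 - m a ^ 2 else 0) := by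
        intro l'
        by_cases h : l = l' <;> simp [h]; ring
      simp_rw [this]
      simp [sum_add_distrib]
    · have : ∀ l' : Fin n, ((l, a) : Fin n × Fin d) ≠ (l', b) := by
        intro l' h; exact hab (Prod.ext_iff.1 h).2
      simp [this, hab]
  simp_rw [h2]
  simp only [Finset.sum_const, Finset.card_univ, Fintype.card_fin, nsmul_eq_mul]
  split_ifs <;> ring

/-- The vectors `p_j e_i - p_i e_j` (coordinate `c`), as polynomials. -/
def rotPoly {d : ℕ} (q : Fin d × Fin d) (c : Fin d) : MvPolynomial (Fin d) ℝ :=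
  (if c = q.1 then MvPolynomial.X q.2 else 0) - (if c = q.2 then MvPolynomial.X q.1 else 0)

lemma eval_rotPoly {d : ℕ} (p : Fin d → ℝ) (q : Fin d × Fin d) (c : Fin d) :
    MvPolynomial.eval p (rotPoly q c) = (if c = q.1 then p q.2 else 0)
      - (if c = q.2 then p q.1 else 0) := by
  unfold rotPoly
  split_ifs <;> simp

lemma sum_rotPoly_mul {d : ℕ} (p : Fin d → ℝ) (a b : Fin d) :
    ∑ q : Fin d × Fin d, (1 / 2 : ℝ) * (MvPolynomial.eval p (rotPoly q a)
      * MvPolynomial.eval p (rotPoly q b))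
      = (∑ i, p i ^ 2) * (if a = b then 1 else 0) - p a * p b := by
  simp_rw [eval_rotPoly, Fintype.sum_prod_type]
  have : ∀ i j : Fin d, (1 / 2 : ℝ) * (((if a = i then p j else 0) - (if a = j then p i else 0))
      * ((if b = i then p j else 0) - (if b = j then p i else 0)))
      = (1/2) * ((if a = i then (if b = i then p j ^ 2 else 0) else 0)
        - (if a = i then (if b = j then p i * p j else 0) else 0)
        - (if b = i then (if a = j then p i * p j else 0) else 0)
        + (if a = j then (if b = j then p i ^ 2 else 0) else 0)) := by
    intro i j
    split_ifs <;> ring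
  simp_rw [this]
  simp only [← mul_sum, sum_add_distrib, sum_sub_distrib]
  have h3 : ∑ x : Fin d, ∑ y : Fin d, (if a = y then if b = y then p x ^ 2 else 0 else 0)
      = if b = a then ∑ i, p i ^ 2 else 0 := by
    simp
  have h4 : ∑ x : Fin d, ∑ y : Fin d, (if a = x then if b = x then p y ^ 2 else 0 else 0)
      = if b = a then ∑ i, p i ^ 2 else 0 := by
    rw [sum_comm]; exact h3
  have h5 : ∑ x : Fin d, ∑ y : Fin d, (if a = x then if b = y then p x * p y else 0 else 0)
      = p a * p b := by
    simp
  have h6 : ∑ x : Fin d, ∑ y : Fin d, (if b = x then if a = y then p x * p y else 0 else 0)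
      = p a * p b := by
    simp [mul_comm]
  rw [h3, h4, h5, h6]
  by_cases hab : a = b
  · subst hab; simp; ring
  · have : b ≠ a := fun h => hab h.symm
    simp [hab, this]; ring

lemma abs_eval_rotPoly_le {d : ℕ} {Λ : ℝ} (p : Fin d → ℝ) (hp : ∀ i, |p i| ≤ Λ)
    (q : Fin d × Fin d) (c : Fin d) : |MvPolynomial.eval p (rotPoly q c)| ≤ 2 * Λ := by
  rw [eval_rotPoly]
  have h1 := hp q.1
  have h2 := hp q.2
  have h0 : 0 ≤ Λ := (abs_nonneg _).trans h1
  refine (abs_sub _ _).trans ?_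
  split_ifs <;> (try simp only [abs_zero]) <;> linarith

theorem nonempty_stencil (d : ℕ) {Λ : ℝ} (hΛ : 0 ≤ Λ) : Nonempty (Stencil d Λ) := by
  set K : ℝ := 4 * Λ + 1 with hK
  have hKpos : 0 < K := by positivity
  obtain ⟨n, hn⟩ := exists_nat_ge ((d : ℝ) ^ 2 * K ^ 2 + 1)
  have hn0 : (0 : ℝ) < n := lt_of_lt_of_le (by positivity) hn
  let Wp : Fin d × Fin d → (Fin n × Fin d → Bool) → MvPolynomial (Fin d) ℝ := fun q ε =>
    MvPolynomial.C (K ^ 2 / (2 * (n : ℝ) ^ 2)) * ∏ j : Fin n × Fin d,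
      (MvPolynomial.C (1 / 2 : ℝ) * (1 + MvPolynomial.C ((boolSign (ε j) : ℝ) / K) * rotPoly q j.2))
  let Ap : Fin d → MvPolynomial (Fin d) ℝ := fun a =>
    1 - MvPolynomial.C (1 / (2 * (n : ℝ))) * ∑ q : Fin d × Fin d,
      (MvPolynomial.C (K ^ 2) - rotPoly q a ^ 2)
  have hW : ∀ p q ε, MvPolynomial.eval p (Wp q ε) = K ^ 2 / (2 * n ^ 2) *
      signWeight (fun j : Fin n × Fin d => MvPolynomial.eval p (rotPoly q j.2) / K) ε := by
    intro p q ε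
    simp only [Wp, map_mul, MvPolynomial.eval_C, map_prod, map_add, map_one, signWeight]
    congr 1
    refine Finset.prod_congr rfl fun j _ => ?_
    field_simp
  have hA : ∀ p a, MvPolynomial.eval p (Ap a) = 1 - 1 / (2 * n) * ∑ q : Fin d × Fin d,
      (K ^ 2 - MvPolynomial.eval p (rotPoly q a) ^ 2) := by
    intro p a
    simp [Ap]
  let P0 : Fin d ⊕ ((Fin d × Fin d) × (Fin n × Fin d → Bool)) → MvPolynomial (Fin d) ℝ :=
    Sum.elim Ap (fun s => Wp s.1 s.2)
  let dir0 : Fin d ⊕ ((Fin d × Fin d) × (Fin n × Fin d → Bool)) → Fin d → ℤ :=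
    Sum.elim (fun i => Pi.single i 1) (fun s c => ∑ l, boolSign (s.2 (l, c)))
  set c : ℝ := min (1 / 2) (K ^ 2 / (2 * n ^ 2) * (1 / 4) ^ (n * d)) with hc
  refine ⟨{
    S := (Fin d ⊕ ((Fin d × Fin d) × (Fin n × Fin d → Bool))) × Bool
    neg := fun s => (s.1, !s.2)
    dir := fun s => boolSign s.2 • dir0 s.1
    dir_neg := ?_
    ι := fun i => (Sum.inl i, true)
    dir_ι := ?_
    P := fun s => P0 s.1
    P_neg := fun s => rfl
    neg_neg := fun s => by simp
    c := c
    c_pos := by positivity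
    c_le := ?_
    sum_P := ?_ }⟩
  · rintro ⟨s, b⟩
    cases b <;> simp [boolSign]
  · intro i
    simp [boolSign, dir0]
  · rintro p hp ⟨s | s, b⟩
    · refine (min_le_left _ _).trans ?_
      simp only [P0, Sum.elim_inl, hA]
      have : ∑ q : Fin d × Fin d, (K ^ 2 - MvPolynomial.eval p (rotPoly q s) ^ 2)
          ≤ ∑ q : Fin d × Fin d, K ^ 2 := sum_le_sum fun q _ => by
        linarith [sq_nonneg (MvPolynomial.eval p (rotPoly q s))]
      simp only [Finset.sum_const, Finset.card_univ, Fintype.card_prod, Fintype.card_fin,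
        nsmul_eq_mul, Nat.cast_mul] at this
      have h2 : 1 / (2 * (n : ℝ)) * ∑ q : Fin d × Fin d,
          (K ^ 2 - MvPolynomial.eval p (rotPoly q s) ^ 2) ≤ 1 / (2 * n) * n := by
        apply mul_le_mul_of_nonneg_left _ (by positivity)
        nlinarith
      have h3 : 1 / (2 * (n : ℝ)) * n = 1 / 2 := by field_simp
      linarith
    · refine (min_le_right _ _).trans ?_
      simp only [P0, Sum.elim_inr, hW]
      apply mul_le_mul_of_nonneg_left _ (by positivity)
      unfold signWeight
      have hcard : (1 / 4 : ℝ) ^ (n * d) = ∏ j : Fin n × Fin d, (1 / 4 : ℝ) := by simp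
      rw [hcard]
      refine Finset.prod_le_prod (fun _ _ => by norm_num) fun j _ => ?_
      have h1 := abs_eval_rotPoly_le p hp s.1 j.2
      have h2 : |MvPolynomial.eval p (rotPoly s.1 j.2) / K| ≤ 1 / 2 := by
        rw [abs_div, abs_of_pos hKpos, div_le_iff₀ hKpos]
        linarith
      have h3 := abs_le.1 h2
      cases s.2 j <;> simp [boolSign] <;> linarith [h3.1, h3.2]
  · intro p a b
    rw [Fintype.sum_prod_type]
    simp only [Fintype.sum_bool]
    have h1 : ∀ s, MvPolynomial.eval p (P0 s) * ((boolSign true • dir0 s) a : ℤ)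
          * ((boolSign true • dir0 s) b : ℤ)
        + MvPolynomial.eval p (P0 s) * ((boolSign false • dir0 s) a : ℤ)
          * ((boolSign false • dir0 s) b : ℤ)
        = 2 * (MvPolynomial.eval p (P0 s) * (dir0 s a : ℝ) * (dir0 s b : ℝ)) := by
      intro s
      simp [boolSign]; ring
    simp_rw [h1]
    rw [← mul_sum]
    congr 1
    rw [Fintype.sum_sum_type, Fintype.sum_prod_type]
    simp only [P0, dir0, Sum.elim_inl, Sum.elim_inr, hW]
    have h2 : ∀ q : Fin d × Fin d, ∑ ε : Fin n × Fin d → Bool, K ^ 2 / (2 * (n : ℝ) ^ 2) *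
          signWeight (fun j : Fin n × Fin d => MvPolynomial.eval p (rotPoly q j.2) / K) ε
          * ((∑ l, boolSign (ε (l, a)) : ℤ) : ℝ) * ((∑ l, boolSign (ε (l, b)) : ℤ) : ℝ)
        = (1 / 2) * (MvPolynomial.eval p (rotPoly q a) * MvPolynomial.eval p (rotPoly q b))
          + (if a = b then 1 / (2 * n) * (K ^ 2 - MvPolynomial.eval p (rotPoly q a) ^ 2)
            else 0) := by
      intro q
      have := sum_signWeight_sum_mul_sum (n := n)
        (fun c => MvPolynomial.eval p (rotPoly q c) / K) a b
      simp_rw [mul_assoc (K ^ 2 / (2 * (n : ℝ) ^ 2))]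
      rw [← mul_sum, this]
      split_ifs with hab
      · subst hab; field_simp
      · field_simp; ring
    simp_rw [h2]
    rw [sum_add_distrib, sum_rotPoly_mul]
    have h3 : ∑ i, MvPolynomial.eval p (Ap i) * ((Pi.single i (1:ℤ) : Fin d → ℤ) a : ℝ)
        * ((Pi.single i (1:ℤ) : Fin d → ℤ) b : ℝ)
        = if a = b then MvPolynomial.eval p (Ap a) else 0 := by
      rw [Finset.sum_eq_single a (fun i _ hi => by simp [hi.symm]) (by simp)]
      by_cases hab : a = b
      · simp [hab]
      · have hba : b ≠ a := fun h => hab h.symm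
        simp [hab, hba]
    rw [h3]
    by_cases hab : a = b
    · subst hab
      simp only [if_true, hA, ← mul_sum]
      ring
    · simp [hab]

/-- A common algebraic model for (discrete or continuous) graphical mean curvature flow:
an algebra of functions with difference (or differential) operators `δ s` along the stencil,
the shifts `τ s = 1 + h δ s`, a time operator `dt`, a solution `u` and `ρ = 1 / (1 + |Du|²)`. -/
structure FlowModel {d : ℕ} {Λ : ℝ} (σ : Stencil d Λ) where
  R : Type
  [ring : CommRing R]
  [alg : Algebra ℝ R]
  Z : Type
  ev : Z → R →ₐ[ℝ] ℝ
  sh : σ.S → Z → Z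
  h : R
  δ : σ.S → R →ₗ[ℝ] R
  τ : σ.S → R →ₐ[ℝ] R
  dt : R →ₗ[ℝ] R
  u : R
  ρ : R
  τ_eq : ∀ s f, τ s f = f + h * δ s f
  δ_mul : ∀ s f g, δ s (f * g) = δ s f * g + τ s f * δ s g
  δ_comm : ∀ s s' f, δ s (δ s' f) = δ s' (δ s f)
  δ_h : ∀ s, δ s h = 0
  h_δδ : ∀ s f, h * δ (σ.neg s) (δ s f) = -(δ (σ.neg s) f + δ s f)
  dt_δ : ∀ s f, dt (δ s f) = δ s (dt f)
  ev_τ : ∀ z s f, ev z (τ s f) = ev (sh s z) f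
  ev_h_nonneg : ∀ z, 0 ≤ ev z h
  ev_h_le : ∀ z, ev z h ≤ 1
  ρ_mul : ρ * (1 + ∑ i, δ (σ.ι i) u ^ 2) = 1
  dt_u : dt u = -(1 / 2 : ℝ) • ∑ s, (MvPolynomial.aeval (fun i => δ (σ.ι i) u) (σ.P s) * ρ)
    * δ (σ.neg s) (δ s u)

attribute [instance] FlowModel.ring FlowModel.alg

namespace FlowModel

variable {d : ℕ} {Λ : ℝ} {σ : Stencil d Λ} (M : FlowModel σ)

/-- The first differences of `u` along the coordinate axes. -/
def p (i : Fin d) : M.R := M.δ (σ.ι i) M.u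

/-- Coefficients of the operator. -/
def lam (s : σ.S) : M.R := MvPolynomial.aeval M.p (σ.P s) * M.ρ

/-- The linear operator with frozen coefficients. -/
def L (w : M.R) : M.R := -(1 / 2 : ℝ) • ∑ s, M.lam s * M.δ (σ.neg s) (M.δ s w)

/-- The residual `dt w - L w`. -/
def res (w : M.R) : M.R := M.dt w - M.L w

/-- Iterated differences of the solution. -/
def jet (γ : List σ.S) : M.R := γ.foldr (fun s f => M.δ s f) M.u

@[simp] lemma jet_nil : M.jet [] = M.u := rfl
lemma jet_cons (s : σ.S) (γ : List σ.S) : M.jet (s :: γ) = M.δ s (M.jet γ) := rfl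

lemma res_u : M.res M.u = 0 := by
  unfold res L lam p; rw [M.dt_u, sub_self]

@[simp] lemma δ_one (s : σ.S) : M.δ s 1 = 0 := by
  have := M.δ_mul s 1 1
  simpa using this

@[simp] lemma δ_algebraMap (s : σ.S) (a : ℝ) : M.δ s (algebraMap ℝ M.R a) = 0 := by
  rw [Algebra.algebraMap_eq_smul_one, map_smul, δ_one, smul_zero]

lemma τ_h (s : σ.S) : M.τ s M.h = M.h := by
  rw [M.τ_eq, M.δ_h, mul_zero, add_zero]

lemma δ_τ (s s' : σ.S) (f : M.R) : M.δ s (M.τ s' f) = M.τ s' (M.δ s f) := by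
  rw [M.τ_eq, M.τ_eq, map_add, M.δ_mul, M.δ_h, M.τ_h, M.δ_comm]; ring

lemma δ_ρ (s : σ.S) : M.δ s M.ρ
    = -(M.τ s M.ρ * M.ρ * ∑ i, (M.p i + M.τ s (M.p i)) * M.δ s (M.p i)) := by
  have h1 := congrArg (M.δ s) M.ρ_mul
  rw [M.δ_mul, δ_one, map_add, δ_one, zero_add, map_sum] at h1
  have h2 : ∀ i, M.δ s (M.δ (σ.ι i) M.u ^ 2) = (M.p i + M.τ s (M.p i)) * M.δ s (M.p i) := by
    intro i
    rw [pow_two, M.δ_mul]; unfold p; ring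
  simp_rw [h2] at h1
  have h3 := congrArg (fun f => M.ρ * f) h1
  simp only [mul_zero] at h3
  have h4 := M.ρ_mul
  linear_combination h3 - M.δ s M.ρ * h4

lemma res_δ (β : σ.S) (w : M.R) : M.res (M.δ β w) = M.δ β (M.res w)
    - (1 / 2 : ℝ) • ∑ s, M.δ β (M.lam s) * (M.δ (σ.neg s) (M.δ s w)
      - M.δ (σ.neg s) (M.δ β w) - M.δ s (M.δ β w)) := by
  unfold res L
  rw [map_sub, M.dt_δ, map_smul, map_sum]
  have : ∀ s, M.δ β (M.lam s * M.δ (σ.neg s) (M.δ s w))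
      = M.lam s * M.δ (σ.neg s) (M.δ s (M.δ β w))
        + M.δ β (M.lam s) * (M.δ (σ.neg s) (M.δ s w)
          - M.δ (σ.neg s) (M.δ β w) - M.δ s (M.δ β w)) := by
    intro s
    rw [M.δ_mul, M.τ_eq, M.δ_comm β, M.δ_comm β s]
    linear_combination M.δ β (M.lam s) * M.h_δδ s (M.δ β w)
  simp_rw [this, sum_add_distrib, smul_add]
  simp only [neg_smul]
  abel

/-- The difference-polynomial algebra generated by the jets of order at most `m`. -/
inductive Dp : ℕ → M.R → Prop
  | const (m : ℕ) (a : ℝ) : Dp m (algebraMap ℝ M.R a)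
  | h (m : ℕ) : Dp m M.h
  | jet (m : ℕ) (γ : List σ.S) (hγ : γ.length ≤ m) : Dp m (M.jet γ)
  | rho (m : ℕ) (hm : 1 ≤ m) : Dp m M.ρ
  | add {m : ℕ} {f g : M.R} : Dp m f → Dp m g → Dp m (f + g)
  | mul {m : ℕ} {f g : M.R} : Dp m f → Dp m g → Dp m (f * g)
  | tau {m : ℕ} {f : M.R} (s : σ.S) : Dp m f → Dp m (M.τ s f)

variable {M}

lemma Dp.mono {m m' : ℕ} (hm : m ≤ m') {f : M.R} (hf : M.Dp m f) : M.Dp m' f := by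
  induction hf with
  | const a => exact .const _ a
  | h => exact .h _
  | jet γ hγ => exact .jet _ γ (hγ.trans hm)
  | rho h => exact .rho _ (h.trans hm)
  | add _ _ h1 h2 => exact h1.add h2
  | mul _ _ h1 h2 => exact h1.mul h2
  | tau s _ h1 => exact h1.tau s

lemma Dp.smul {m : ℕ} (a : ℝ) {f : M.R} (hf : M.Dp m f) : M.Dp m (a • f) := by
  rw [Algebra.smul_def]; exact (Dp.const m a).mul hf

lemma Dp.neg {m : ℕ} {f : M.R} (hf : M.Dp m f) : M.Dp m (-f) := by
  simpa using hf.smul (-1)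

lemma Dp.zero (m : ℕ) : M.Dp m 0 := by simpa using Dp.const (M := M) m 0

lemma Dp.one (m : ℕ) : M.Dp m 1 := by simpa using Dp.const (M := M) m 1

lemma Dp.sum {m : ℕ} {J : Type*} (t : Finset J) {f : J → M.R} (hf : ∀ j ∈ t, M.Dp m (f j)) :
    M.Dp m (∑ j ∈ t, f j) :=
  Finset.sum_induction _ _ (fun _ _ => Dp.add) (Dp.zero m) hf

lemma Dp.p (i : Fin d) {m : ℕ} (hm : 1 ≤ m) : M.Dp m (M.p i) := Dp.jet m [σ.ι i] hm

lemma Dp.aeval {m : ℕ} {q : Fin d → M.R} (hq : ∀ i, M.Dp m (q i)) (P : MvPolynomial (Fin d) ℝ) :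
    M.Dp m (MvPolynomial.aeval q P) := by
  induction P using MvPolynomial.induction_on with
  | C a => rw [MvPolynomial.aeval_C]; exact .const m a
  | add P Q hP hQ => rw [map_add]; exact hP.add hQ
  | mul_X P i hP => rw [map_mul, MvPolynomial.aeval_X]; exact hP.mul (hq i)

lemma Dp.δ {m : ℕ} (hm : 1 ≤ m) {f : M.R} (hf : M.Dp m f) (s : σ.S) :
    M.Dp (m + 1) (M.δ s f) := by
  induction hf with
  | const a => rw [δ_algebraMap]; exact .zero _
  | h => rw [M.δ_h]; exact .zero _
  | jet γ hγ => exact .jet _ (s :: γ) (by simpa using hγ)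
  | rho h =>
    rw [M.δ_ρ]
    refine Dp.neg ((((Dp.rho _ (by omega)).tau s).mul (.rho _ (by omega))).mul (.sum _ fun i _ => ?_))
    exact ((Dp.p i (by omega)).add ((Dp.p i (by omega)).tau s)).mul
      (.jet _ [s, σ.ι i] (by simpa using by omega))
  | add _ _ h1 h2 => rw [map_add]; exact h1.add h2
  | mul hf hg h1 h2 =>
    rw [M.δ_mul]
    exact (h1.mul (hg.mono (by omega))).add (((hf.mono (by omega)).tau s).mul h2)
  | tau s' _ h1 => rw [M.δ_τ]; exact h1.tau s'

lemma Dp.lam (s : σ.S) {m : ℕ} (hm : 1 ≤ m) : M.Dp m (M.lam s) :=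
  (Dp.aeval (fun i => Dp.p i hm) _).mul (.rho m hm)

/-- Differences of the coefficients are combinations of second differences of `u`. -/
lemma δ_lam_eq (s β : σ.S) : ∃ c : Fin d → M.R, (∀ i, M.Dp 1 (c i)) ∧
    M.δ β (M.lam s) = ∑ i, c i * M.jet [β, σ.ι i] := by
  have hmul : ∀ f g : M.R, M.Dp 1 f → M.Dp 1 g →
      (∃ c : Fin d → M.R, (∀ i, M.Dp 1 (c i)) ∧ M.δ β f = ∑ i, c i * M.jet [β, σ.ι i]) →
      (∃ c : Fin d → M.R, (∀ i, M.Dp 1 (c i)) ∧ M.δ β g = ∑ i, c i * M.jet [β, σ.ι i]) →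
      ∃ c : Fin d → M.R, (∀ i, M.Dp 1 (c i)) ∧ M.δ β (f * g) = ∑ i, c i * M.jet [β, σ.ι i] := by
    rintro f g hf hg ⟨c, hc, hfc⟩ ⟨c', hc', hgc⟩
    refine ⟨fun i => c i * g + M.τ β f * c' i, fun i => ((hc i).mul hg).add ((hf.tau β).mul (hc' i)),
      ?_⟩
    rw [M.δ_mul, hfc, hgc, sum_mul, mul_sum, ← sum_add_distrib]
    exact sum_congr rfl fun i _ => by ring
  refine hmul _ _ (Dp.aeval (fun i => Dp.p i le_rfl) _) (.rho 1 le_rfl) ?_ ?_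
  · induction σ.P s using MvPolynomial.induction_on with
    | C a =>
      exact ⟨fun _ => 0, fun _ => .zero 1, by rw [MvPolynomial.aeval_C, δ_algebraMap]; simp⟩
    | add P Q hP hQ =>
      obtain ⟨c, hc, h1⟩ := hP
      obtain ⟨c', hc', h2⟩ := hQ
      refine ⟨fun i => c i + c' i, fun i => (hc i).add (hc' i), ?_⟩
      rw [map_add, map_add, h1, h2, ← sum_add_distrib]
      exact sum_congr rfl fun i _ => by ring
    | mul_X P i hP =>
      rw [map_mul, MvPolynomial.aeval_X]
      refine hmul _ _ (Dp.aeval (fun i => Dp.p i le_rfl) _) (.p i le_rfl) hP ?_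
      refine ⟨fun j => if j = i then 1 else 0, fun j => ?_, ?_⟩
      · dsimp only; split_ifs
        · exact .one 1
        · exact .zero 1
      · simp only [ite_mul, one_mul, zero_mul, Finset.sum_ite_eq', Finset.mem_univ, if_true]
        rfl
  · refine ⟨fun i => -(M.τ β M.ρ * M.ρ * (M.p i + M.τ β (M.p i))), fun i => ?_, ?_⟩
    · exact Dp.neg ((((Dp.rho 1 le_rfl).tau β).mul (.rho 1 le_rfl)).mul
        ((Dp.p i le_rfl).add ((Dp.p i le_rfl).tau β)))
    · rw [M.δ_ρ, mul_sum, ← sum_neg_distrib]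
      refine sum_congr rfl fun i _ => ?_
      change _ = _ * M.δ β (M.p i)
      ring

variable (M)

/-- Elements of order `m`, plus order `m + 1` jets with coefficients of order two. -/
inductive T (m : ℕ) : M.R → Prop
  | low {f : M.R} : M.Dp m f → T m f
  | top {B : M.R} (γ : List σ.S) : M.Dp 2 B → γ.length = m + 1 → T m (B * M.jet γ)
  | add {f g : M.R} : T m f → T m g → T m (f + g)

/-- A refinement of `T (m + 1)` recording that lower-order terms are differences. -/
inductive T' (m : ℕ) : M.R → Prop
  | zero : T' m 0
  | low {f : M.R} (β : σ.S) : M.Dp m f → T' m (M.δ β f)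
  | mid {B : M.R} (β : σ.S) (γ : List σ.S) : M.Dp 2 B → γ.length = m + 1 →
      T' m (M.δ β B * M.jet γ)
  | top {B : M.R} (γ : List σ.S) : M.Dp 2 B → γ.length = m + 2 → T' m (B * M.jet γ)
  | add {f g : M.R} : T' m f → T' m g → T' m (f + g)

variable {M}

lemma T.sum {m : ℕ} {J : Type*} (t : Finset J) {f : J → M.R} (hf : ∀ j ∈ t, M.T m (f j)) :
    M.T m (∑ j ∈ t, f j) :=
  Finset.sum_induction _ _ (fun _ _ => T.add) (.low (.zero m)) hf

lemma T'.sum {m : ℕ} {J : Type*} (t : Finset J) {f : J → M.R} (hf : ∀ j ∈ t, M.T' m (f j)) :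
    M.T' m (∑ j ∈ t, f j) :=
  Finset.sum_induction _ _ (fun _ _ => T'.add) .zero hf

lemma T'.toT {m : ℕ} (hm : 2 ≤ m) {f : M.R} (hf : M.T' m f) : M.T (m + 1) f := by
  induction hf with
  | zero => exact .low (.zero _)
  | low β hf => exact .low (hf.δ (by omega) β)
  | mid β γ hB hγ =>
    exact .low (((hB.δ (by omega) β).mono (by omega)).mul (.jet _ γ hγ.le))
  | top γ hB hγ => exact .top γ hB hγ
  | add _ _ h1 h2 => exact h1.add h2

lemma T.δ {m : ℕ} {f : M.R} (hf : M.T m f) (β : σ.S) : M.T' m (M.δ β f) := by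
  induction hf with
  | low hf => exact .low β hf
  | top γ hB hγ =>
    rw [M.δ_mul]
    exact (T'.mid β γ hB hγ).add (.top (β :: γ) (hB.tau β) (by simpa using hγ))
  | add _ _ h1 h2 => rw [map_add]; exact h1.add h2

/-- The commutator of a difference operator with the linear operator. -/
lemma res_δ_jet (β : σ.S) (γ : List σ.S) : ∃ (B : σ.S → M.R), (∀ s, M.Dp 2 (B s)) ∧
    (∀ s, ∃ c : Fin d → M.R, (∀ i, M.Dp 1 (c i)) ∧ B s = ∑ i, c i * M.jet [β, σ.ι i]) ∧
    M.res (M.jet (β :: γ)) = M.δ β (M.res (M.jet γ)) + ∑ s, (B s * M.jet (σ.neg s :: s :: γ)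
      + (-B s) * M.jet (σ.neg s :: β :: γ) + (-B s) * M.jet (s :: β :: γ)) := by
  refine ⟨fun s => -(1 / 2 : ℝ) • M.δ β (M.lam s),
    fun s => ((Dp.lam s le_rfl).δ le_rfl β).smul _, fun s => ?_, ?_⟩
  · obtain ⟨c, hc, h⟩ := δ_lam_eq (M := M) s β
    refine ⟨fun i => -(1 / 2 : ℝ) • c i, fun i => (hc i).smul _, ?_⟩
    simp only [h, Finset.smul_sum]
    exact sum_congr rfl fun i _ => by rw [smul_mul_assoc]
  · rw [jet_cons, res_δ, sub_eq_add_neg, ← neg_smul, Finset.smul_sum]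
    congr 1
    refine sum_congr rfl fun s _ => ?_
    simp only [jet_cons, ← neg_smul, smul_mul_assoc, mul_sub, smul_sub]
    simp only [neg_smul, sub_eq_add_neg, neg_neg]

variable (M) in
/-- Sums of products of two second-order jets with first-order coefficients. -/
inductive Quad : M.R → Prop
  | zero : Quad 0
  | mk {c : M.R} (γ γ' : List σ.S) : M.Dp 1 c → γ.length = 2 → γ'.length = 2 →
      Quad (c * M.jet γ * M.jet γ')
  | add {f g : M.R} : Quad f → Quad g → Quad (f + g)

lemma Quad.sum {J : Type*} (t : Finset J) {f : J → M.R} (hf : ∀ j ∈ t, M.Quad (f j)) :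
    M.Quad (∑ j ∈ t, f j) :=
  Finset.sum_induction _ _ (fun _ _ => Quad.add) .zero hf

lemma Quad.dp {f : M.R} (hf : M.Quad f) : M.Dp 2 f := by
  induction hf with
  | zero => exact .zero 2
  | mk γ γ' hc h1 h2 =>
    exact ((hc.mono (by omega)).mul (.jet _ γ h1.le)).mul (.jet _ γ' h2.le)
  | add _ _ h1 h2 => exact h1.add h2

lemma Quad.δ {f : M.R} (hf : M.Quad f) (β : σ.S) : M.T 2 (M.δ β f) := by
  induction hf with
  | zero => rw [map_zero]; exact .low (.zero 2)
  | @mk c γ γ' hc h1 h2 =>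
    have : M.δ β (c * M.jet γ * M.jet γ') = M.δ β c * M.jet γ * M.jet γ'
        + M.τ β c * M.jet γ' * M.jet (β :: γ)
        + M.τ β c * M.τ β (M.jet γ) * M.jet (β :: γ') := by
      rw [M.δ_mul, M.δ_mul, map_mul, jet_cons, jet_cons]; ring
    rw [this]
    have hc2 := (hc.mono (m' := 2) (by omega)).tau β
    refine ((T.low ?_).add (.top _ ?_ (by simp [h1]))).add (.top _ ?_ (by simp [h2]))
    · exact ((hc.δ le_rfl β).mul (.jet _ γ h1.le)).mul (.jet _ γ' h2.le)
    · exact hc2.mul (.jet _ γ' h2.le)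
    · exact hc2.mul ((Dp.jet _ γ h1.le).tau β)
  | add _ _ h1 h2 => rw [map_add]; exact h1.add h2

lemma res_jet_one (β : σ.S) : M.Quad (M.res (M.jet [β])) := by
  obtain ⟨B, -, hB, h⟩ := M.res_δ_jet β []
  rw [h, jet_nil, res_u, map_zero, zero_add]
  have key : ∀ s, ∀ γ : List σ.S, γ.length = 2 → M.Quad (B s * M.jet γ) ∧
      M.Quad (-B s * M.jet γ) := by
    intro s γ hγ
    obtain ⟨c, hc, h1⟩ := hB s
    rw [h1, sum_mul, ← sum_neg_distrib, sum_mul]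
    refine ⟨.sum _ fun i _ => .mk _ _ (hc i) rfl hγ, .sum _ fun i _ => ?_⟩
    rw [← neg_mul]
    exact .mk _ _ (hc i).neg rfl hγ
  exact .sum _ fun s _ => ((key s _ rfl).1.add (key s _ rfl).2).add (key s _ rfl).2

lemma res_jet_T' {m : ℕ} (β : σ.S) (γ : List σ.S) (hγ : γ.length = m)
    (h : M.T m (M.res (M.jet γ))) : M.T' m (M.res (M.jet (β :: γ))) := by
  obtain ⟨B, hB, -, h'⟩ := M.res_δ_jet β γ
  rw [h']
  exact (h.δ β).add (.sum _ fun s _ => ((T'.top _ (hB s) (by simp [hγ])).add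
    (.top _ (hB s).neg (by simp [hγ]))).add (.top _ (hB s).neg (by simp [hγ])))

lemma res_jet_T (γ : List σ.S) (hγ : 2 ≤ γ.length) : M.T γ.length (M.res (M.jet γ)) := by
  induction γ with
  | nil => simp at hγ
  | cons β γ ih =>
    rcases Nat.lt_or_ge γ.length 2 with h1 | h1
    · obtain ⟨β', rfl⟩ : ∃ β', γ = [β'] := List.length_eq_one_iff.1 (by simp at hγ; omega)
      obtain ⟨B, hB, -, h'⟩ := M.res_δ_jet β [β']
      rw [h']
      exact ((M.res_jet_one β').δ β).add (.sum _ fun s _ => ((T.top _ (hB s) (by simp)).add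
        (.top _ (hB s).neg (by simp))).add (.top _ (hB s).neg (by simp)))
    · exact (M.res_jet_T' β γ rfl (ih h1)).toT h1

lemma res_jet_T'_of_length {m : ℕ} (hm : 2 ≤ m) (γ : List σ.S) (hγ : γ.length = m + 1) :
    M.T' m (M.res (M.jet γ)) := by
  cases γ with
  | nil => simp at hγ
  | cons β γ =>
    have h1 : γ.length = m := by simpa using hγ
    have := M.res_jet_T γ (by omega)
    rw [h1] at this
    exact M.res_jet_T' β γ h1 this

/-! ### Bounds -/

variable (M) in
/-- Sets of evaluation points stable under the shifts. -/
def Sat (D : Set M.Z) : Prop := ∀ s, ∀ z ∈ D, M.sh s z ∈ D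

variable (M) in
/-- All jets of order at most `m` are bounded by `b` on `D`. -/
def JetBd (D : Set M.Z) (m : ℕ) (b : ℝ) : Prop :=
  ∀ z ∈ D, ∀ γ : List σ.S, γ.length ≤ m → |M.ev z (M.jet γ)| ≤ b

lemma JetBd.mono {D : Set M.Z} {m m' : ℕ} {b b' : ℝ} (h : M.JetBd D m b) (hm : m' ≤ m)
    (hb : b ≤ b') : M.JetBd D m' b' :=
  fun z hz γ hγ => (h z hz γ (hγ.trans hm)).trans hb

lemma ev_ρ_eq (z : M.Z) : M.ev z M.ρ * (1 + ∑ i, M.ev z (M.p i) ^ 2) = 1 := by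
  have := congrArg (M.ev z) M.ρ_mul
  simpa [p] using this

lemma ev_ρ_pos (z : M.Z) : 0 < M.ev z M.ρ := by
  have h := M.ev_ρ_eq z
  have h1 : 0 < 1 + ∑ i, M.ev z (M.p i) ^ 2 := by positivity
  by_contra hn
  have := mul_nonpos_of_nonpos_of_nonneg (not_lt.1 hn) h1.le
  linarith

lemma ev_ρ_le (z : M.Z) : M.ev z M.ρ ≤ 1 := by
  have h := M.ev_ρ_eq z
  have h2 : 0 ≤ M.ev z M.ρ * ∑ i, M.ev z (M.p i) ^ 2 :=
    mul_nonneg (M.ev_ρ_pos z).le (sum_nonneg fun _ _ => sq_nonneg _)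
  linarith

lemma abs_ev_ρ_le (z : M.Z) : |M.ev z M.ρ| ≤ 1 := by
  rw [abs_of_pos (M.ev_ρ_pos z)]; exact M.ev_ρ_le z

lemma abs_ev_h_le (z : M.Z) : |M.ev z M.h| ≤ 1 := by
  rw [abs_of_nonneg (M.ev_h_nonneg z)]; exact M.ev_h_le z

lemma Dp.bound {m : ℕ} {f : M.R} (hf : M.Dp m f) (b : ℝ) :
    ∃ K, 0 ≤ K ∧ ∀ D, M.Sat D → M.JetBd D m b → ∀ z ∈ D, |M.ev z f| ≤ K := by
  induction hf with
  | const a => exact ⟨|a|, abs_nonneg _, fun D _ _ z _ => by simp⟩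
  | h => exact ⟨1, zero_le_one, fun D _ _ z _ => M.abs_ev_h_le z⟩
  | jet γ hγ =>
    exact ⟨|b|, abs_nonneg _, fun D _ hb z hz => (hb z hz γ hγ).trans (le_abs_self b)⟩
  | rho _ => exact ⟨1, zero_le_one, fun D _ _ z _ => M.abs_ev_ρ_le z⟩
  | add _ _ h1 h2 =>
    obtain ⟨K1, h10, h1⟩ := h1
    obtain ⟨K2, h20, h2⟩ := h2
    exact ⟨K1 + K2, add_nonneg h10 h20, fun D hD hb z hz => by
      rw [map_add]; exact (abs_add_le _ _).trans (add_le_add (h1 D hD hb z hz) (h2 D hD hb z hz))⟩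
  | mul _ _ h1 h2 =>
    obtain ⟨K1, h10, h1⟩ := h1
    obtain ⟨K2, h20, h2⟩ := h2
    exact ⟨K1 * K2, mul_nonneg h10 h20, fun D hD hb z hz => by
      rw [map_mul, abs_mul]
      exact mul_le_mul (h1 D hD hb z hz) (h2 D hD hb z hz) (abs_nonneg _) h10⟩
  | tau s _ h1 =>
    obtain ⟨K1, h10, h1⟩ := h1
    exact ⟨K1, h10, fun D hD hb z hz => by rw [M.ev_τ]; exact h1 D hD hb _ (hD s z hz)⟩

lemma Dp.bound_δ {m : ℕ} {f : M.R} (hf : M.Dp m f) (hm : 1 ≤ m) (β : σ.S) (b : ℝ) :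
    ∃ K, 0 ≤ K ∧ ∀ D μ, 1 ≤ μ → M.Sat D → M.JetBd D m b → M.JetBd D (m + 1) μ →
      ∀ z ∈ D, |M.ev z (M.δ β f)| ≤ K * μ := by
  induction hf with
  | const a => exact ⟨0, le_rfl, fun D μ _ _ _ _ z _ => by simp⟩
  | h => exact ⟨0, le_rfl, fun D μ _ _ _ _ z _ => by simp [M.δ_h]⟩
  | jet γ hγ =>
    exact ⟨1, zero_le_one, fun D μ _ _ _ hb z hz => by
      rw [one_mul]; exact hb z hz (β :: γ) (by simpa using hγ)⟩
  | rho _ =>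
    refine ⟨d * (2 * |b|), by positivity, fun D μ hμ hD hb hb' z hz => ?_⟩
    rw [M.δ_ρ, map_neg, abs_neg, map_mul, map_mul, abs_mul, abs_mul]
    have h1 : |M.ev z (∑ i, (M.p i + M.τ β (M.p i)) * M.δ β (M.p i))| ≤ d * (2 * |b|) * μ := by
      rw [map_sum]
      refine (Finset.abs_sum_le_sum_abs _ _).trans ?_
      have : ∀ i ∈ (Finset.univ : Finset (Fin d)),
          |M.ev z ((M.p i + M.τ β (M.p i)) * M.δ β (M.p i))| ≤ 2 * |b| * μ := by
        intro i _
        rw [map_mul, map_add, M.ev_τ, abs_mul]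
        have e1 : |M.ev z (M.p i)| ≤ |b| :=
          (hb z hz [σ.ι i] (by simpa using hm)).trans (le_abs_self b)
        have e2 : |M.ev (M.sh β z) (M.p i)| ≤ |b| :=
          (hb _ (hD β z hz) [σ.ι i] (by simpa using hm)).trans (le_abs_self b)
        have e3 : |M.ev z (M.δ β (M.p i))| ≤ μ := hb' z hz [β, σ.ι i] (by simpa using hm)
        refine mul_le_mul ((abs_add_le _ _).trans (by linarith)) e3 (abs_nonneg _) (by positivity)
      refine (sum_le_sum this).trans (le_of_eq ?_)
      simp; ring
    have h2 : |M.ev z (M.τ β M.ρ)| ≤ 1 := by rw [M.ev_τ]; exact M.abs_ev_ρ_le _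
    have h3 : |M.ev z (M.τ β M.ρ)| * |M.ev z M.ρ| ≤ 1 :=
      mul_le_one₀ h2 (abs_nonneg _) (M.abs_ev_ρ_le z)
    calc _ ≤ 1 * |M.ev z (∑ i, (M.p i + M.τ β (M.p i)) * M.δ β (M.p i))| :=
          mul_le_mul_of_nonneg_right h3 (abs_nonneg _)
      _ ≤ _ := by rw [one_mul]; exact h1
  | add _ _ h1 h2 =>
    obtain ⟨K1, h10, h1⟩ := h1
    obtain ⟨K2, h20, h2⟩ := h2
    refine ⟨K1 + K2, add_nonneg h10 h20, fun D μ hμ hD hb hb' z hz => ?_⟩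
    rw [map_add, map_add, add_mul]
    exact (abs_add_le _ _).trans (add_le_add (h1 D μ hμ hD hb hb' z hz) (h2 D μ hμ hD hb hb' z hz))
  | mul hf hg h1 h2 =>
    obtain ⟨K1, h10, h1⟩ := h1
    obtain ⟨K2, h20, h2⟩ := h2
    obtain ⟨K3, h30, h3⟩ := hf.bound b
    obtain ⟨K4, h40, h4⟩ := hg.bound b
    refine ⟨K1 * K4 + K3 * K2, by positivity, fun D μ hμ hD hb hb' z hz => ?_⟩
    rw [M.δ_mul, map_add, map_mul, map_mul, M.ev_τ]
    refine (abs_add_le _ _).trans ?_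
    rw [abs_mul, abs_mul]
    have e1 := mul_le_mul (h1 D μ hμ hD hb hb' z hz) (h4 D hD hb z hz) (abs_nonneg _) (by positivity)
    have e2 := mul_le_mul (h3 D hD hb _ (hD β z hz)) (h2 D μ hμ hD hb hb' z hz) (abs_nonneg _) h30
    linarith
  | tau s _ h1 =>
    obtain ⟨K1, h10, h1⟩ := h1
    exact ⟨K1, h10, fun D μ hμ hD hb hb' z hz => by
      rw [M.δ_τ, M.ev_τ]; exact h1 D μ hμ hD hb hb' _ (hD s z hz)⟩

lemma T.bound {m : ℕ} (hm : 2 ≤ m) {f : M.R} (hf : M.T m f) (b : ℝ) :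
    ∃ K, 0 ≤ K ∧ ∀ D, M.Sat D → M.JetBd D m b → ∀ z ∈ D, ∀ t, 0 ≤ t →
      (∀ γ : List σ.S, γ.length = m + 1 → |M.ev z (M.jet γ)| ≤ t) → |M.ev z f| ≤ K * (1 + t) := by
  induction hf with
  | low hf =>
    obtain ⟨K, hK0, hK⟩ := hf.bound b
    refine ⟨K, hK0, fun D hD hb z hz t ht _ => (hK D hD hb z hz).trans ?_⟩
    nlinarith
  | top γ hB hγ =>
    obtain ⟨K, hK0, hK⟩ := hB.bound b
    refine ⟨K, hK0, fun D hD hb z hz t ht htop => ?_⟩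
    rw [map_mul, abs_mul]
    have := mul_le_mul (hK D hD (hb.mono hm le_rfl) z hz) (htop γ hγ) (abs_nonneg _) hK0
    linarith
  | add _ _ h1 h2 =>
    obtain ⟨K1, h10, h1⟩ := h1
    obtain ⟨K2, h20, h2⟩ := h2
    refine ⟨K1 + K2, add_nonneg h10 h20, fun D hD hb z hz t ht htop => ?_⟩
    rw [map_add, add_mul]
    exact (abs_add_le _ _).trans (add_le_add (h1 D hD hb z hz t ht htop) (h2 D hD hb z hz t ht htop))

lemma T'.bound {m : ℕ} (hm : 2 ≤ m) {f : M.R} (hf : M.T' m f) (b : ℝ) :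
    ∃ K, 0 ≤ K ∧ ∀ D μ, 1 ≤ μ → M.Sat D → M.JetBd D m b → M.JetBd D (m + 1) μ →
      ∀ z ∈ D, ∀ t, 0 ≤ t →
      (∀ γ : List σ.S, γ.length = m + 2 → |M.ev z (M.jet γ)| ≤ t) →
      |M.ev z f| ≤ K * (t + μ * (if m = 2 then μ else 1)) := by
  have hμ2 : ∀ μ : ℝ, 1 ≤ μ → μ ≤ μ * (if m = 2 then μ else 1) := by
    intro μ hμ; split_ifs <;> nlinarith
  induction hf with
  | zero => exact ⟨0, le_rfl, fun D μ _ _ _ _ z _ t _ _ => by simp⟩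
  | low β hf =>
    obtain ⟨K, hK0, hK⟩ := hf.bound_δ (by omega) β b
    refine ⟨K, hK0, fun D μ hμ hD hb hb' z hz t ht htop => (hK D μ hμ hD hb hb' z hz).trans ?_⟩
    exact mul_le_mul_of_nonneg_left (by linarith [hμ2 μ hμ]) hK0
  | @mid B β γ hB hγ =>
    rcases eq_or_ne m 2 with h2 | h2
    · obtain ⟨K, hK0, hK⟩ := hB.bound_δ (by omega) β b
      refine ⟨K, hK0, fun D μ hμ hD hb hb' z hz t ht htop => ?_⟩
      rw [map_mul, abs_mul, if_pos h2]
      have := mul_le_mul (hK D μ hμ hD (hb.mono hm le_rfl) (hb'.mono (by omega) le_rfl) z hz)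
        (hb' z hz γ hγ.le) (abs_nonneg _) (by positivity)
      nlinarith
    · obtain ⟨K, hK0, hK⟩ := (hB.δ (by omega) β).bound b
      refine ⟨K, hK0, fun D μ hμ hD hb hb' z hz t ht htop => ?_⟩
      rw [map_mul, abs_mul, if_neg h2]
      have := mul_le_mul (hK D hD (hb.mono (by omega) le_rfl) z hz)
        (hb' z hz γ hγ.le) (abs_nonneg _) (by positivity)
      nlinarith
  | top γ hB hγ =>
    obtain ⟨K, hK0, hK⟩ := hB.bound b
    refine ⟨K, hK0, fun D μ hμ hD hb hb' z hz t ht htop => ?_⟩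
    rw [map_mul, abs_mul]
    have := mul_le_mul (hK D hD (hb.mono hm le_rfl) z hz) (htop γ hγ) (abs_nonneg _) hK0
    have h3 := hμ2 μ hμ
    nlinarith
  | add _ _ h1 h2 =>
    obtain ⟨K1, h10, h1⟩ := h1
    obtain ⟨K2, h20, h2⟩ := h2
    refine ⟨K1 + K2, add_nonneg h10 h20, fun D μ hμ hD hb hb' z hz t ht htop => ?_⟩
    rw [map_add, add_mul]
    exact (abs_add_le _ _).trans
      (add_le_add (h1 D μ hμ hD hb hb' z hz t ht htop) (h2 D μ hμ hD hb hb' z hz t ht htop))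

end FlowModel

namespace Stencil

variable {d : ℕ} {Λ : ℝ} (σ : Stencil d Λ)

lemma exists_eval_le : ∃ C : ℝ, 0 ≤ C ∧ ∀ p : Fin d → ℝ, (∀ i, |p i| ≤ Λ) → ∀ s,
    MvPolynomial.eval p (σ.P s) ≤ C := by
  have hK : IsCompact (Set.pi Set.univ fun _ : Fin d => Icc (-Λ) Λ) :=
    isCompact_univ_pi fun _ => isCompact_Icc
  have hb : ∀ s, ∃ C : ℝ, ∀ p ∈ (Set.pi Set.univ fun _ : Fin d => Icc (-Λ) Λ),
      MvPolynomial.eval p (σ.P s) ≤ C := by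
    intro s
    obtain ⟨C, hC⟩ := (hK.image (MvPolynomial.continuous_eval (σ.P s))).bddAbove
    exact ⟨C, fun p hp => hC ⟨p, hp, rfl⟩⟩
  choose C hC using hb
  refine ⟨∑ s, |C s|, sum_nonneg fun _ _ => abs_nonneg _, fun p hp s => ?_⟩
  refine (hC s p fun i _ => abs_le.1 (hp i)).trans ((le_abs_self _).trans ?_)
  exact single_le_sum (f := fun s => |C s|) (fun _ _ => abs_nonneg _) (Finset.mem_univ s)

/-- An upper bound for the weights. -/
def wmax : ℝ := σ.exists_eval_le.choose

lemma wmax_nonneg : 0 ≤ σ.wmax := σ.exists_eval_le.choose_spec.1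

lemma eval_le_wmax {p : Fin d → ℝ} (hp : ∀ i, |p i| ≤ Λ) (s : σ.S) :
    MvPolynomial.eval p (σ.P s) ≤ σ.wmax := σ.exists_eval_le.choose_spec.2 p hp s

/-- The CFL number. -/
def κ : ℝ := 1 / (2 * (1 + Fintype.card σ.S * σ.wmax))

lemma κ_pos : 0 < σ.κ := by
  have := σ.wmax_nonneg
  unfold κ; positivity

lemma κ_le : σ.κ ≤ 1 := by
  have := σ.wmax_nonneg
  have h : 0 ≤ Fintype.card σ.S * σ.wmax := by positivity
  unfold κ
  rw [div_le_one (by positivity)]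
  linarith

lemma κ_mul_le : σ.κ * (Fintype.card σ.S * σ.wmax) ≤ 1 / 2 := by
  have := σ.wmax_nonneg
  have h : 0 ≤ Fintype.card σ.S * σ.wmax := by positivity
  unfold κ
  rw [div_mul_eq_mul_div, div_le_iff₀ (by positivity)]
  linarith

/-- Ellipticity constant on the cube. -/
def c0 : ℝ := σ.c / (1 + d * Λ ^ 2)

lemma c0_pos : 0 < σ.c0 := by
  have := σ.c_pos
  unfold c0; positivity

/-- Words of length at most `m`. -/
def words (m : ℕ) : Finset (List σ.S) := (List.finite_length_le σ.S m).toFinset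

@[simp] lemma mem_words {m : ℕ} {γ : List σ.S} : γ ∈ σ.words m ↔ γ.length ≤ m := by
  simp [words]

end Stencil

namespace FlowModel

variable {d : ℕ} {Λ : ℝ} {σ : Stencil d Λ} (M : FlowModel σ)

lemma ev_aeval (z : M.Z) (q : Fin d → M.R) (P : MvPolynomial (Fin d) ℝ) :
    M.ev z (MvPolynomial.aeval q P) = MvPolynomial.eval (fun i => M.ev z (q i)) P := by
  rw [MvPolynomial.comp_aeval_apply, MvPolynomial.aeval_eq_eval]

lemma c0_le_lam {z : M.Z} (hz : ∀ i, |M.ev z (M.p i)| ≤ Λ) (s : σ.S) :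
    σ.c0 ≤ M.ev z (M.lam s) := by
  unfold lam Stencil.c0
  rw [map_mul, ev_aeval, div_eq_mul_inv]
  have h1 := σ.c_le _ hz s
  have h2 : (1 + d * Λ ^ 2)⁻¹ ≤ M.ev z M.ρ := by
    have h := M.ev_ρ_eq z
    have h3 : ∑ i, M.ev z (M.p i) ^ 2 ≤ d * Λ ^ 2 := by
      have : ∀ i ∈ (Finset.univ : Finset (Fin d)), M.ev z (M.p i) ^ 2 ≤ Λ ^ 2 := fun i _ =>
        sq_le_sq' (abs_le.1 (hz i)).1 (abs_le.1 (hz i)).2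
      refine (sum_le_sum this).trans (by simp)
    rw [inv_le_iff_one_le_mul₀ (by positivity)]
    rw [← h]
    exact mul_le_mul_of_nonneg_left (by linarith) (M.ev_ρ_pos z).le
  exact mul_le_mul h1 h2 (by positivity) (σ.c_pos.le.trans h1)

lemma lam_le_wmax {z : M.Z} (hz : ∀ i, |M.ev z (M.p i)| ≤ Λ) (s : σ.S) :
    M.ev z (M.lam s) ≤ σ.wmax := by
  unfold lam
  rw [map_mul, ev_aeval]
  have h1 := σ.eval_le_wmax hz s
  have h2 := σ.c_le _ hz s
  have h3 := σ.c_pos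
  calc _ ≤ σ.wmax * 1 := mul_le_mul h1 (M.ev_ρ_le z) (M.ev_ρ_pos z).le σ.wmax_nonneg
    _ = _ := mul_one _

lemma lam_neg (s : σ.S) : M.lam (σ.neg s) = M.lam s := by
  unfold lam; rw [σ.P_neg]

lemma h_mul_L (w : M.R) : M.h * M.L w = ∑ s, M.lam s * M.δ s w := by
  unfold L
  rw [mul_smul_comm, mul_sum]
  have h1 : ∀ s, M.h * (M.lam s * M.δ (σ.neg s) (M.δ s w))
      = -(M.lam s * M.δ s w + M.lam (σ.neg s) * M.δ (σ.neg s) w) := by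
    intro s
    rw [M.lam_neg]
    linear_combination M.lam s * M.h_δδ s w
  simp_rw [h1]
  have h2 : ∑ s, M.lam (σ.neg s) * M.δ (σ.neg s) w = ∑ s, M.lam s * M.δ s w :=
    Fintype.sum_equiv (Function.Involutive.toPerm σ.neg σ.neg_neg) _ _ (fun _ => rfl)
  rw [sum_neg_distrib, sum_add_distrib, h2, ← two_mul, Algebra.smul_def]
  have : algebraMap ℝ M.R (-(1/2)) * 2 = -1 := by
    rw [show (2 : M.R) = algebraMap ℝ M.R 2 from (map_ofNat _ 2).symm, ← map_mul]; norm_num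
  linear_combination -(∑ s, M.lam s * M.δ s w) * this

end FlowModel

set_option maxHeartbeats 1000000 in
/-- One explicit step for a system of averages with a gain from the variance. -/
lemma one_step_real {S J : Type*} [Fintype S] (t : Finset J) (w : S → ℝ) (hw : ∀ s, 0 ≤ w s)
    (hw1 : ∑ s, w s ≤ 1 / 2) {f : J → ℝ} {fs : S → J → ℝ} {r : J → ℝ} {A k c K G : ℝ}
    (hA : 0 ≤ A) (hf : ∑ j ∈ t, f j ^ 2 ≤ A ^ 2) (hfs : ∀ s, ∑ j ∈ t, fs s j ^ 2 ≤ A ^ 2)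
    (hk : 0 ≤ k) (hk1 : k ≤ 1) (hc : 0 < c) (hG : 0 ≤ G) (hK : 0 ≤ K)
    (hD : k * c * G ^ 2 ≤ ∑ s, w s * ∑ j ∈ t, (fs s j - f j) ^ 2)
    (hr : ∀ j ∈ t, |r j| ≤ K * (1 + A + G)) :
    ∑ j ∈ t, (f j + ∑ s, w s * (fs s j - f j) + k * r j) ^ 2
      ≤ A ^ 2 + k * ((t.card * K * (4 + 4 * t.card * K / c) + t.card * K ^ 2 * (12 + 12 / c))
        * (1 + A ^ 2)) := by
  set D := ∑ s, w s * ∑ j ∈ t, (fs s j - f j) ^ 2 with hDdef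
  have hD0 : 0 ≤ D := sum_nonneg fun s _ => mul_nonneg (hw s)
    (sum_nonneg fun _ _ => sq_nonneg _)
  set a : J → ℝ := fun j => f j + ∑ s, w s * (fs s j - f j) with ha
  -- pointwise convexity with gain
  have h1 : ∀ j, a j ^ 2 ≤ f j ^ 2 + ∑ s, w s * (fs s j ^ 2 - f j ^ 2)
      - (1 / 2) * ∑ s, w s * (fs s j - f j) ^ 2 := by
    intro j
    have cs := Finset.sum_mul_sq_le_sq_mul_sq Finset.univ (fun s => Real.sqrt (w s))
      (fun s => Real.sqrt (w s) * (fs s j - f j))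
    have e1 : ∀ s, Real.sqrt (w s) * (Real.sqrt (w s) * (fs s j - f j)) = w s * (fs s j - f j) := by
      intro s; rw [← mul_assoc, Real.mul_self_sqrt (hw s)]
    have e2 : ∀ s, (Real.sqrt (w s) * (fs s j - f j)) ^ 2 = w s * (fs s j - f j) ^ 2 := by
      intro s; rw [mul_pow, Real.sq_sqrt (hw s)]
    simp only [e1, e2, Real.sq_sqrt (hw _)] at cs
    have h3 : 0 ≤ ∑ s, w s * (fs s j - f j) ^ 2 :=
      sum_nonneg fun s _ => mul_nonneg (hw s) (sq_nonneg _)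
    have h4 : (∑ s, w s * (fs s j - f j)) ^ 2 ≤ (1 / 2) * ∑ s, w s * (fs s j - f j) ^ 2 :=
      cs.trans (mul_le_mul_of_nonneg_right hw1 h3)
    have h5 : ∑ s, w s * (fs s j ^ 2 - f j ^ 2) = ∑ s, w s * (fs s j - f j) ^ 2
        + 2 * f j * ∑ s, w s * (fs s j - f j) := by
      rw [mul_sum, ← sum_add_distrib]
      exact sum_congr rfl fun s _ => by ring
    have h6 : a j ^ 2 = f j ^ 2 + 2 * f j * ∑ s, w s * (fs s j - f j)
        + (∑ s, w s * (fs s j - f j)) ^ 2 := by simp only [ha]; ring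
    rw [h6, h5]; linarith
  have h2 : ∑ j ∈ t, a j ^ 2 ≤ A ^ 2 - (1 / 2) * D := by
    refine (sum_le_sum fun j _ => h1 j).trans ?_
    rw [sum_sub_distrib, sum_add_distrib, ← mul_sum, sum_comm]
    have e3 : ∑ j ∈ t, ∑ s, w s * (fs s j - f j) ^ 2 = D := by
      rw [sum_comm, hDdef]
      exact sum_congr rfl fun s _ => by rw [mul_sum]
    rw [e3]
    have e4 : ∀ s, ∑ j ∈ t, w s * (fs s j ^ 2 - f j ^ 2) ≤ w s * (A ^ 2 - ∑ j ∈ t, f j ^ 2) := by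
      intro s
      rw [← mul_sum, sum_sub_distrib]
      exact mul_le_mul_of_nonneg_left (by linarith [hfs s]) (hw s)
    have e5 := sum_le_sum fun s (_ : s ∈ Finset.univ) => e4 s
    rw [← sum_mul] at e5
    have e6 : (∑ s, w s) * (A ^ 2 - ∑ j ∈ t, f j ^ 2) ≤ 1 * (A ^ 2 - ∑ j ∈ t, f j ^ 2) :=
      mul_le_mul_of_nonneg_right (by linarith) (by linarith)
    linarith
  have hDA : D ≤ 2 * A ^ 2 := by
    have := sum_nonneg fun j (_ : j ∈ t) => sq_nonneg (a j)
    linarith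
  have haj : ∀ j ∈ t, |a j| ≤ A := by
    intro j hj
    refine abs_le_of_sq_le_sq ?_ hA
    have := single_le_sum (f := fun j => a j ^ 2) (fun _ _ => sq_nonneg _) hj
    linarith
  set B := K * (1 + A + G) with hB
  have hB0 : 0 ≤ B := by positivity
  have h3 : ∀ j ∈ t, (a j + k * r j) ^ 2 ≤ a j ^ 2 + (2 * k * A * B + k ^ 2 * B ^ 2) := by
    intro j hj
    have e1 := hr j hj
    have e2 : a j * r j ≤ A * B := (le_abs_self _).trans (by
      rw [abs_mul]; exact mul_le_mul (haj j hj) e1 (abs_nonneg _) hA)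
    have e3 : r j ^ 2 ≤ B ^ 2 := sq_le_sq' (abs_le.1 e1).1 (abs_le.1 e1).2
    have e4 := mul_le_mul_of_nonneg_left e2 hk
    have e5 := mul_le_mul_of_nonneg_left e3 (sq_nonneg k)
    nlinarith
  have h4 := sum_le_sum h3
  rw [sum_add_distrib, Finset.sum_const, nsmul_eq_mul] at h4
  refine h4.trans ?_
  set T : ℝ := (t.card : ℝ) with hT
  have hT0 : 0 ≤ T := by positivity
  -- absorb
  have h5 : k * (k * G ^ 2) ≤ k * (2 * A ^ 2 / c) := by
    apply mul_le_mul_of_nonneg_left _ hk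
    rw [le_div_iff₀ hc]; linarith
  have h6 : T * (k ^ 2 * B ^ 2) ≤ k * (T * K ^ 2 * (12 + 12 / c) * (1 + A ^ 2)) := by
    have e1 : (1 + A + G) ^ 2 ≤ 3 * (1 + A ^ 2 + G ^ 2) := by
      nlinarith [sq_nonneg (1 - A), sq_nonneg (A - G), sq_nonneg (1 - G)]
    have e2 : k ^ 2 * (1 + A + G) ^ 2 ≤ k * (12 + 12 / c) * (1 + A ^ 2) := by
      have e3 : k ^ 2 * (1 + A ^ 2) ≤ k * (1 + A ^ 2) := by
        apply mul_le_mul_of_nonneg_right _ (by positivity)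
        nlinarith
      have e4 : k * (2 * A ^ 2 / c) = 2 * (k * (1 / c) * A ^ 2) := by ring
      have e5 : 0 ≤ k * (1 / c) * A ^ 2 := by positivity
      have e6 : 0 ≤ k * (1 / c) := by positivity
      have e7 : 0 ≤ k * (1 + A ^ 2) := by positivity
      have e8 : k * (12 + 12 / c) * (1 + A ^ 2) = 12 * (k * (1 + A ^ 2)) + 12 * (k * (1 / c))
        + 12 * (k * (1 / c) * A ^ 2) := by ring
      nlinarith [mul_le_mul_of_nonneg_left e1 (sq_nonneg k)]
    have e9 : T * (k ^ 2 * B ^ 2) = T * K ^ 2 * (k ^ 2 * (1 + A + G) ^ 2) := by rw [hB]; ring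
    rw [e9]
    calc _ ≤ T * K ^ 2 * (k * (12 + 12 / c) * (1 + A ^ 2)) :=
          mul_le_mul_of_nonneg_left e2 (by positivity)
      _ = _ := by ring
  have h7 : T * (2 * k * A * B) ≤ (1 / 2) * (k * c * G ^ 2)
      + k * (T * K * (4 + 4 * T * K / c) * (1 + A ^ 2)) := by
    have e1 : T * (2 * A * B) = 2 * T * K * (A * (1 + A)) + 2 * (T * K * A) * G := by rw [hB]; ring
    have e2 : 2 * (T * K * A) * G ≤ (1 / 2) * (c * G ^ 2) + 2 * (T * K * A) ^ 2 / c := by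
      have : 0 ≤ (c * G - 2 * (T * K * A)) ^ 2 / (2 * c) := by positivity
      have e3 : (c * G - 2 * (T * K * A)) ^ 2 / (2 * c) = (1 / 2) * (c * G ^ 2)
        + 2 * (T * K * A) ^ 2 / c - 2 * (T * K * A) * G := by field_simp; ring
      linarith
    have e3 : A * (1 + A) ≤ 2 * (1 + A ^ 2) := by nlinarith [sq_nonneg (A - 1)]
    have e4 : 2 * (T * K * A) ^ 2 / c ≤ T * K * (4 * T * K / c) * (1 + A ^ 2) := by
      have : T * K * (4 * T * K / c) * (1 + A ^ 2) - 2 * (T * K * A) ^ 2 / c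
        = (4 * (T * K) ^ 2 + 2 * (T * K * A) ^ 2) / c := by ring
      have h0 : 0 ≤ (4 * (T * K) ^ 2 + 2 * (T * K * A) ^ 2) / c := by positivity
      linarith
    have e5 : T * (2 * A * B) ≤ (1 / 2) * (c * G ^ 2)
        + T * K * (4 + 4 * T * K / c) * (1 + A ^ 2) := by
      have := mul_le_mul_of_nonneg_left e3 (show 0 ≤ 2 * (T * K) by positivity)
      rw [e1]
      linarith [show T * K * (4 + 4 * T * K / c) * (1 + A ^ 2) = 4 * (T * K) * (1 + A ^ 2)
        + T * K * (4 * T * K / c) * (1 + A ^ 2) by ring,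
        show 2 * T * K * (A * (1 + A)) = 2 * (T * K) * (A * (1 + A)) by ring]
    calc T * (2 * k * A * B) = k * (T * (2 * A * B)) := by ring
      _ ≤ k * ((1 / 2) * (c * G ^ 2) + T * K * (4 + 4 * T * K / c) * (1 + A ^ 2)) :=
        mul_le_mul_of_nonneg_left e5 hk
      _ = _ := by ring
  have h8 : T * (2 * k * A * B + k ^ 2 * B ^ 2)
      = T * (2 * k * A * B) + T * (k ^ 2 * B ^ 2) := by ring
  rw [h8]
  have h9 : k * ((T * K * (4 + 4 * T * K / c) + T * K ^ 2 * (12 + 12 / c)) * (1 + A ^ 2))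
    = k * (T * K * (4 + 4 * T * K / c) * (1 + A ^ 2))
      + k * (T * K ^ 2 * (12 + 12 / c) * (1 + A ^ 2)) := by ring
  rw [h9]
  linarith

namespace FlowModel

variable {d : ℕ} {Λ : ℝ} {σ : Stencil d Λ} (M : FlowModel σ)

/-- Sum of squares of all jets of order at most `m`. -/
def energy (m : ℕ) (z : M.Z) : ℝ := ∑ γ ∈ σ.words m, M.ev z (M.jet γ) ^ 2

/-- Sum of squares of the first differences of all jets of order at most `m`. -/
def gain (m : ℕ) (z : M.Z) : ℝ := ∑ s, ∑ γ ∈ σ.words m, M.ev z (M.jet (s :: γ)) ^ 2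

lemma energy_nonneg (m : ℕ) (z : M.Z) : 0 ≤ M.energy m z :=
  sum_nonneg fun _ _ => sq_nonneg _

lemma gain_nonneg (m : ℕ) (z : M.Z) : 0 ≤ M.gain m z :=
  sum_nonneg fun _ _ => sum_nonneg fun _ _ => sq_nonneg _

lemma abs_jet_le_of_energy {m : ℕ} {z : M.Z} {A : ℝ} (hA : 0 ≤ A) (h : M.energy m z ≤ A ^ 2)
    {γ : List σ.S} (hγ : γ.length ≤ m) : |M.ev z (M.jet γ)| ≤ A := by
  refine abs_le_of_sq_le_sq ?_ hA
  exact (single_le_sum (f := fun γ => M.ev z (M.jet γ) ^ 2) (fun _ _ => sq_nonneg _)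
    (σ.mem_words.2 hγ)).trans h

lemma energy_le_of_abs {m : ℕ} {z : M.Z} {b : ℝ}
    (h : ∀ γ : List σ.S, γ.length ≤ m → |M.ev z (M.jet γ)| ≤ b) :
    M.energy m z ≤ (σ.words m).card * b ^ 2 := by
  unfold energy
  refine (Finset.sum_le_card_nsmul _ _ (b ^ 2) fun γ hγ => ?_).trans (by simp)
  have := h γ (σ.mem_words.1 hγ)
  exact sq_le_sq' (abs_le.1 this).1 (abs_le.1 this).2

lemma abs_jet_le_gain {m : ℕ} {z : M.Z} {γ : List σ.S} (hγ : γ.length ≤ m + 1) (h0 : γ ≠ []) :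
    |M.ev z (M.jet γ)| ≤ Real.sqrt (M.gain m z) := by
  cases γ with
  | nil => exact (h0 rfl).elim
  | cons s γ =>
    apply Real.abs_le_sqrt
    refine le_trans ?_ (single_le_sum (f := fun s => ∑ γ ∈ σ.words m,
      M.ev z (M.jet (s :: γ)) ^ 2) (fun _ _ => sum_nonneg fun _ _ => sq_nonneg _)
      (Finset.mem_univ s))
    exact single_le_sum (f := fun γ => M.ev z (M.jet (s :: γ)) ^ 2)
      (fun _ _ => sq_nonneg _) (σ.mem_words.2 (by simpa using hγ))

/-- Residuals of low-order jets. -/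
lemma exists_res_bound (m : ℕ) (b : ℝ) : ∃ K, 0 ≤ K ∧ ∀ D, M.Sat D → M.JetBd D m b →
    (2 ≤ m) → ∀ z ∈ D, ∀ γ : List σ.S, γ.length ≤ m →
      |M.ev z (M.res (M.jet γ))| ≤ K * (1 + Real.sqrt (M.gain m z)) := by
  have key : ∀ γ : List σ.S, ∃ K, 0 ≤ K ∧ (γ.length ≤ m → 2 ≤ m → ∀ D, M.Sat D → M.JetBd D m b →
      ∀ z ∈ D, |M.ev z (M.res (M.jet γ))| ≤ K * (1 + Real.sqrt (M.gain m z))) := by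
    intro γ
    rcases Nat.lt_or_ge γ.length 2 with h1 | h1
    · have h2 : M.Dp 2 (M.res (M.jet γ)) := by
        match γ, h1 with
        | [], _ => rw [jet_nil, res_u]; exact .zero 2
        | [β], _ => exact (res_jet_one β).dp
      obtain ⟨K, hK0, hK⟩ := h2.bound b
      refine ⟨K, hK0, fun hγ hm D hD hb z hz => (hK D hD (hb.mono hm le_rfl) z hz).trans ?_⟩
      nlinarith [Real.sqrt_nonneg (M.gain m z)]
    · obtain ⟨K, hK0, hK⟩ := (res_jet_T γ h1).bound h1 b
      refine ⟨K, hK0, fun hγ hm D hD hb z hz => ?_⟩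
      refine hK D hD (hb.mono hγ le_rfl) z hz _ (Real.sqrt_nonneg _) fun γ' hγ' => ?_
      exact M.abs_jet_le_gain (by omega) (by rintro rfl; simp at hγ')
  choose K hK0 hK using key
  refine ⟨∑ γ ∈ σ.words m, K γ, sum_nonneg fun γ _ => hK0 γ,
    fun D hD hb hm z hz γ hγ => (hK γ hγ hm D hD hb z hz).trans ?_⟩
  exact mul_le_mul_of_nonneg_right (single_le_sum (f := K) (fun γ _ => hK0 γ)
    (σ.mem_words.2 hγ)) (by positivity)

/-- Residuals of jets of order `m + 1` are at most quadratic, and linear for `m ≥ 3`, in the jets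
of order `m + 1`. -/
lemma exists_res_bound_succ {m : ℕ} (hm : 2 ≤ m) (b : ℝ) : ∃ K, 0 ≤ K ∧ ∀ D μ, 1 ≤ μ → M.Sat D →
    M.JetBd D m b → M.JetBd D (m + 1) μ → ∀ z ∈ D, ∀ γ : List σ.S, γ.length ≤ m + 1 →
      |M.ev z (M.res (M.jet γ))| ≤ K * (μ * (if m = 2 then μ else 1) + Real.sqrt (M.gain (m + 1) z)) := by
  obtain ⟨K0, hK00, hK0⟩ := M.exists_res_bound m b
  have key : ∀ γ : List σ.S, ∃ K, 0 ≤ K ∧ (γ.length = m + 1 → ∀ D μ, 1 ≤ μ → M.Sat D →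
      M.JetBd D m b → M.JetBd D (m + 1) μ →
      ∀ z ∈ D, |M.ev z (M.res (M.jet γ))| ≤ K * (μ * (if m = 2 then μ else 1) + Real.sqrt (M.gain (m + 1) z))) := by
    intro γ
    by_cases hγ : γ.length = m + 1
    · obtain ⟨K, hK0, hK⟩ := (res_jet_T'_of_length (by omega) γ hγ).bound (by omega) b
      refine ⟨K, hK0, fun _ D μ hμ hD hb hb' z hz => ?_⟩
      have := hK D μ hμ hD hb hb' z hz (Real.sqrt (M.gain (m + 1) z)) (Real.sqrt_nonneg _)
        fun γ' hγ' => M.abs_jet_le_gain (by omega) (by rintro rfl; simp at hγ')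
      rwa [add_comm] at this
    · exact ⟨0, le_rfl, fun h => (hγ h).elim⟩
  choose K hK0' hK using key
  have hgain : ∀ z, M.gain m z ≤ M.gain (m + 1) z := fun z =>
    sum_le_sum fun s _ => Finset.sum_le_sum_of_subset_of_nonneg
      (fun γ hγ => σ.mem_words.2 ((σ.mem_words.1 hγ).trans (by omega))) fun _ _ _ => sq_nonneg _
  have hS : 0 ≤ ∑ γ ∈ σ.words (m + 1), K γ := sum_nonneg fun γ _ => hK0' γ
  refine ⟨K0 + ∑ γ ∈ σ.words (m + 1), K γ, add_nonneg hK00 hS,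
    fun D μ hμ hD hb hb' z hz γ hγ => ?_⟩
  have hμ2 : 1 ≤ μ * (if m = 2 then μ else 1) := by split_ifs <;> nlinarith
  have hp : 0 ≤ μ * (if m = 2 then μ else 1) + Real.sqrt (M.gain (m + 1) z) := by positivity
  rw [add_mul]
  rcases Nat.lt_or_ge m γ.length with h1 | h1
  · have := hK γ (by omega) D μ hμ hD hb hb' z hz
    have h2 := mul_le_mul_of_nonneg_right (single_le_sum (f := K) (fun γ _ => hK0' γ)
      (σ.mem_words.2 hγ)) hp
    have h3 := mul_nonneg hK00 hp
    linarith
  · have h2 := hK0 D hD hb (by omega) z hz γ h1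
    have h3 := Real.sqrt_le_sqrt (hgain z)
    have h4 := mul_le_mul_of_nonneg_left (add_le_add hμ2 h3) hK00
    have h5 := mul_nonneg hS hp
    linarith

/-- Residuals of jets of order `m + 1` are at most linear in the jets of order `m + 1`. -/
lemma exists_res_bound_tame {m : ℕ} (hm : 3 ≤ m) (b : ℝ) : ∃ K, 0 ≤ K ∧ ∀ D μ, 1 ≤ μ → M.Sat D →
    M.JetBd D m b → M.JetBd D (m + 1) μ → ∀ z ∈ D, ∀ γ : List σ.S, γ.length ≤ m + 1 →
      |M.ev z (M.res (M.jet γ))| ≤ K * (μ + Real.sqrt (M.gain (m + 1) z)) := by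
  have := M.exists_res_bound_succ (m := m) (by omega) b
  simpa only [if_neg (show m ≠ 2 by omega), mul_one] using this

end FlowModel

/-! ### The explicit scheme -/

namespace Stencil

variable {d : ℕ} {Λ : ℝ} (σ : Stencil d Λ)

/-- Difference quotient on the lattice with mesh `1 / (N + 1)`. -/
def diff (N : ℕ) (s : σ.S) (w : (Fin d → ℤ) → ℝ) (x : Fin d → ℤ) : ℝ :=
  (N + 1) * (w (x + σ.dir s) - w x)

/-- Time step. -/
def kk (N : ℕ) : ℝ := σ.κ / (N + 1) ^ 2

lemma kk_pos (N : ℕ) : 0 < σ.kk N := div_pos σ.κ_pos (by positivity)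

lemma kk_le_one (N : ℕ) : σ.kk N ≤ 1 := by
  unfold kk
  rw [div_le_one (by positivity)]
  have := σ.κ_le
  nlinarith [show (0 : ℝ) ≤ N from N.cast_nonneg]

/-- The explicit Euler step. -/
def step (N : ℕ) (w : (Fin d → ℤ) → ℝ) (x : Fin d → ℤ) : ℝ :=
  w x + σ.kk N * (-(1 / 2) * ∑ s, (MvPolynomial.eval (fun i => σ.diff N (σ.ι i) w x) (σ.P s)
    * (1 + ∑ i, σ.diff N (σ.ι i) w x ^ 2)⁻¹) * σ.diff N (σ.neg s) (σ.diff N s w) x)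

/-- The lattice point. -/
def pt {d : ℕ} (N : ℕ) (x : Fin d → ℤ) : 𝔼 d :=
  WithLp.toLp 2 fun i => (x i : ℝ) / (N + 1)

/-- The discrete solution. -/
def sol (g : 𝔼 d → ℝ) (N : ℕ) : ℕ → (Fin d → ℤ) → ℝ
  | 0 => fun x => g (pt N x)
  | n + 1 => σ.step N (sol g N n)

/-- The discrete model. -/
def model (g : 𝔼 d → ℝ) : FlowModel σ where
  R := ℕ × ℕ × (Fin d → ℤ) → ℝ
  Z := ℕ × ℕ × (Fin d → ℤ)
  ev := fun z => Pi.evalAlgHom ℝ _ z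
  sh := fun s z => (z.1, z.2.1, z.2.2 + σ.dir s)
  h := fun z => 1 / (z.1 + 1)
  δ := fun s =>
    { toFun := fun f z => (z.1 + 1) * (f (z.1, z.2.1, z.2.2 + σ.dir s) - f z)
      map_add' := fun f g => by ext z; simp; ring
      map_smul' := fun a f => by ext z; simp; ring }
  τ := fun s =>
    { toFun := fun f z => f (z.1, z.2.1, z.2.2 + σ.dir s)
      map_one' := rfl
      map_mul' := fun _ _ => rfl
      map_zero' := rfl
      map_add' := fun _ _ => rfl
      commutes' := fun _ => rfl }
  dt :=
    { toFun := fun f z => (σ.kk z.1)⁻¹ * (f (z.1, z.2.1 + 1, z.2.2) - f z)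
      map_add' := fun f g => by ext z; simp; ring
      map_smul' := fun a f => by ext z; simp; ring }
  u := fun z => σ.sol g z.1 z.2.1 z.2.2
  ρ := fun z => (1 + ∑ i, ((z.1 + 1) * (σ.sol g z.1 z.2.1 (z.2.2 + σ.dir (σ.ι i))
    - σ.sol g z.1 z.2.1 z.2.2)) ^ 2)⁻¹
  τ_eq := fun s f => by
    ext z
    have : (z.1 + 1 : ℝ) ≠ 0 := by positivity
    change f _ = f z + 1 / (z.1 + 1) * ((z.1 + 1) * (f _ - f z))
    field_simp; ring
  δ_mul := fun s f g => by
    ext z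
    change (z.1 + 1 : ℝ) * (f _ * g _ - f z * g z)
      = (z.1 + 1) * (f _ - f z) * g z + f _ * ((z.1 + 1) * (g _ - g z))
    ring
  δ_comm := fun s s' f => by
    ext z
    simp only [LinearMap.coe_mk, AddHom.coe_mk]
    rw [add_right_comm]; ring
  δ_h := fun s => by ext z; simp
  h_δδ := fun s f => by
    ext z
    have : (z.1 + 1 : ℝ) ≠ 0 := by positivity
    simp [σ.dir_neg]; field_simp; ring
  dt_δ := fun s f => by ext z; simp; ring
  ev_τ := fun z s f => rfl
  ev_h_nonneg := fun z => by simp; positivity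
  ev_h_le := fun z => by
    simp only [Pi.evalAlgHom_apply]
    rw [div_le_one (by positivity)]; linarith [show (0 : ℝ) ≤ z.1 from z.1.cast_nonneg]
  ρ_mul := by
    ext z
    simp only [Pi.mul_apply, Pi.add_apply, Pi.one_apply, Finset.sum_apply, Pi.pow_apply,
      LinearMap.coe_mk, AddHom.coe_mk]
    exact inv_mul_cancel₀ (by positivity)
  dt_u := by
    ext z
    have hk := (σ.kk_pos z.1).ne'
    have hae : ∀ (q : Fin d → ℕ × ℕ × (Fin d → ℤ) → ℝ) (P : MvPolynomial (Fin d) ℝ),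
        MvPolynomial.aeval q P z = MvPolynomial.eval (fun i => q i z) P := by
      intro q P
      have := MvPolynomial.comp_aeval_apply q (Pi.evalAlgHom ℝ (fun _ => ℝ) z) P
      simpa [MvPolynomial.aeval_eq_eval] using this
    simp only [Pi.smul_apply, Finset.sum_apply, Pi.mul_apply, hae, smul_eq_mul]
    simp only [LinearMap.coe_mk, AddHom.coe_mk, sol, step, diff]
    rw [add_sub_cancel_left, inv_mul_cancel_left₀ hk]

variable (g : 𝔼 d → ℝ)

lemma model_next (f : (σ.model g).R) (N n : ℕ) (x : Fin d → ℤ) :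
    f (N, n + 1, x) = f (N, n, x)
      + ∑ s, σ.κ * (σ.model g).lam s (N, n, x) * (f (N, n, x + σ.dir s) - f (N, n, x))
      + σ.kk N * (σ.model g).res f (N, n, x) := by
  have h1 : (σ.model g).res f (N, n, x) = (σ.kk N)⁻¹ * (f (N, n + 1, x) - f (N, n, x))
      - (σ.model g).L f (N, n, x) := rfl
  have h2 := congrArg ((σ.model g).ev (N, n, x)) ((σ.model g).h_mul_L f)
  rw [map_sum] at h2
  have h3 : ∀ s, (σ.model g).ev (N, n, x) ((σ.model g).lam s * (σ.model g).δ s f)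
      = (σ.model g).lam s (N, n, x) * ((N + 1) * (f (N, n, x + σ.dir s) - f (N, n, x))) :=
    fun s => rfl
  have h4 : (σ.model g).ev (N, n, x) ((σ.model g).h * (σ.model g).L f)
      = 1 / (N + 1) * (σ.model g).L f (N, n, x) := rfl
  simp only [h3, h4] at h2
  have hk := (σ.kk_pos N).ne'
  have hN : (N + 1 : ℝ) ≠ 0 := by positivity
  have h5 : σ.kk N * (σ.model g).L f (N, n, x)
      = ∑ s, σ.κ * (σ.model g).lam s (N, n, x) * (f (N, n, x + σ.dir s) - f (N, n, x)) := by
    have : σ.kk N * (σ.model g).L f (N, n, x)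
        = σ.κ / (N + 1) * (1 / (N + 1) * (σ.model g).L f (N, n, x)) := by
      unfold kk; field_simp
    rw [this, h2, mul_sum]
    refine sum_congr rfl fun s _ => ?_
    field_simp
  rw [h1, ← h5, mul_sub, mul_inv_cancel_left₀ hk]; ring

/-- The slice of all lattice points at a given mesh and time. -/
def slice (N n : ℕ) : Set (σ.model g).Z := {z | z.1 = N ∧ z.2.1 = n}

lemma sat_slice (N n : ℕ) : (σ.model g).Sat (σ.slice g N n) := fun _ _ hz => hz

lemma forall_slice {N n : ℕ} {q : (σ.model g).Z → Prop} :
    (∀ z ∈ σ.slice g N n, q z) ↔ ∀ x, q (N, n, x) :=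
  ⟨fun h x => h _ ⟨rfl, rfl⟩, by rintro h ⟨a, b, x⟩ ⟨rfl, rfl⟩; exact h x⟩

/-- The slopes on a slice are bounded by `a`. -/
def SlopeLe (N n : ℕ) (a : ℝ) : Prop := ∀ x i, |(σ.model g).p i (N, n, x)| ≤ a

variable {σ g}

lemma SlopeLe.lam_nonneg {N n : ℕ} (h : σ.SlopeLe g N n Λ) (s : σ.S) (x : Fin d → ℤ) :
    0 ≤ σ.κ * (σ.model g).lam s (N, n, x) :=
  mul_nonneg σ.κ_pos.le (σ.c0_pos.le.trans
    ((σ.model g).c0_le_lam (z := (N, n, x)) (fun i => h x i) s))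

lemma SlopeLe.sum_lam_le {N n : ℕ} (h : σ.SlopeLe g N n Λ) (x : Fin d → ℤ) :
    ∑ s, σ.κ * (σ.model g).lam s (N, n, x) ≤ 1 / 2 := by
  refine le_trans ?_ σ.κ_mul_le
  rw [← mul_sum]
  refine mul_le_mul_of_nonneg_left ?_ σ.κ_pos.le
  refine (Finset.sum_le_card_nsmul _ _ σ.wmax fun s _ =>
    (σ.model g).lam_le_wmax (z := (N, n, x)) (fun i => h x i) s).trans ?_
  simp

lemma SlopeLe.le_next {N n : ℕ} (h : σ.SlopeLe g N n Λ) (f : (σ.model g).R) {a K : ℝ}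
    (hf : ∀ x, f (N, n, x) ≤ a) (hK : ∀ x, (σ.model g).res f (N, n, x) ≤ K) (x : Fin d → ℤ) :
    f (N, n + 1, x) ≤ a + σ.kk N * K := by
  refine (model_next σ g f N n x).le.trans ?_
  have h1 : ∑ s, σ.κ * (σ.model g).lam s (N, n, x) * (f (N, n, x + σ.dir s) - f (N, n, x))
      ≤ ∑ s, σ.κ * (σ.model g).lam s (N, n, x) * (a - f (N, n, x)) :=
    sum_le_sum fun s _ => mul_le_mul_of_nonneg_left
      (by linarith [hf (x + σ.dir s)]) (h.lam_nonneg s x)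
  rw [← sum_mul] at h1
  have h2 := mul_le_mul_of_nonneg_right (h.sum_lam_le x) (sub_nonneg.2 (hf x))
  have h3 := mul_le_mul_of_nonneg_left (hK x) (σ.kk_pos N).le
  have h4 := hf x
  linarith

lemma SlopeLe.abs_le_next {N n : ℕ} (h : σ.SlopeLe g N n Λ) (f : (σ.model g).R) {a K : ℝ}
    (hf : ∀ x, |f (N, n, x)| ≤ a) (hK : ∀ x, |(σ.model g).res f (N, n, x)| ≤ K) (x : Fin d → ℤ) :
    |f (N, n + 1, x)| ≤ a + σ.kk N * K := by
  have h1 := h.le_next f (fun x => (abs_le.1 (hf x)).2) (fun x => (abs_le.1 (hK x)).2) x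
  have hneg : (σ.model g).res (-f) = -(σ.model g).res f := by
    unfold FlowModel.res FlowModel.L
    simp only [map_neg, mul_neg, sum_neg_distrib, smul_neg]; abel
  have h2 := h.le_next (-f) (a := a) (K := K)
    (fun x => by have := (abs_le.1 (hf x)).1; change -f (N, n, x) ≤ a; linarith)
    (fun x => by
      rw [hneg]; have := (abs_le.1 (hK x)).1
      change -(σ.model g).res f (N, n, x) ≤ K; linarith) x
  change -f (N, n + 1, x) ≤ _ at h2
  exact abs_le.2 ⟨by linarith, h1⟩

/-- The constant in the one-step estimate. -/
def stepC (σ : Stencil d Λ) (m : ℕ) (K : ℝ) : ℝ :=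
  (σ.words m).card * K * (4 + 4 * (σ.words m).card * K / σ.c0)
    + (σ.words m).card * K ^ 2 * (12 + 12 / σ.c0)

lemma stepC_nonneg (m : ℕ) {K : ℝ} (hK : 0 ≤ K) : 0 ≤ σ.stepC m K := by
  have := σ.c0_pos
  unfold stepC; positivity

lemma SlopeLe.energy_next {N n m : ℕ} (h : σ.SlopeLe g N n Λ) {A K : ℝ} (hA : 0 ≤ A) (hK : 0 ≤ K)
    (hE : ∀ x, (σ.model g).energy m (N, n, x) ≤ A ^ 2)
    (hR : ∀ x, ∀ γ : List σ.S, γ.length ≤ m → |(σ.model g).res ((σ.model g).jet γ) (N, n, x)|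
      ≤ K * (1 + A + Real.sqrt ((σ.model g).gain m (N, n, x)))) (x : Fin d → ℤ) :
    (σ.model g).energy m (N, n + 1, x) ≤ A ^ 2 + σ.kk N * (σ.stepC m K * (1 + A ^ 2)) := by
  have key := one_step_real (σ.words m) (fun s => σ.κ * (σ.model g).lam s (N, n, x))
    (fun s => h.lam_nonneg s x) (h.sum_lam_le x)
    (f := fun γ => (σ.model g).jet γ (N, n, x))
    (fs := fun s γ => (σ.model g).jet γ (N, n, x + σ.dir s))
    (r := fun γ => (σ.model g).res ((σ.model g).jet γ) (N, n, x)) hA (hE x)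
    (fun s => hE (x + σ.dir s)) (σ.kk_pos N).le (σ.kk_le_one N) σ.c0_pos
    (Real.sqrt_nonneg ((σ.model g).gain m (N, n, x))) hK ?_
    (fun γ hγ => hR x γ (σ.mem_words.1 hγ))
  · refine le_trans (le_of_eq ?_) key
    refine sum_congr rfl fun γ _ => ?_
    exact congrArg (fun y : ℝ => y ^ 2) (model_next σ g ((σ.model g).jet γ) N n x)
  · have e0 : Real.sqrt ((σ.model g).gain m (N, n, x)) ^ 2 = ∑ s, ∑ γ ∈ σ.words m,
        (σ.model g).ev (N, n, x) ((σ.model g).jet (s :: γ)) ^ 2 :=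
      Real.sq_sqrt ((σ.model g).gain_nonneg _ _)
    refine (congrArg (fun y => σ.kk N * σ.c0 * y) e0).le.trans ?_
    rw [mul_sum]
    refine sum_le_sum fun s _ => ?_
    rw [mul_sum, mul_sum]
    refine sum_le_sum fun γ _ => ?_
    have e1 : (σ.model g).ev (N, n, x) ((σ.model g).jet (s :: γ)) = (N + 1) *
        ((σ.model g).jet γ (N, n, x + σ.dir s) - (σ.model g).jet γ (N, n, x)) := rfl
    have e2 := (σ.model g).c0_le_lam (z := (N, n, x)) (fun i => h x i) s
    have hN : (N + 1 : ℝ) ≠ 0 := by positivity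
    rw [e1, kk]
    have e3 : σ.κ / (N + 1) ^ 2 * σ.c0 * ((N + 1) *
        ((σ.model g).jet γ (N, n, x + σ.dir s) - (σ.model g).jet γ (N, n, x))) ^ 2
        = σ.κ * σ.c0 * ((σ.model g).jet γ (N, n, x + σ.dir s)
          - (σ.model g).jet γ (N, n, x)) ^ 2 := by
      field_simp
    rw [e3]
    exact mul_le_mul_of_nonneg_right (mul_le_mul_of_nonneg_left e2 σ.κ_pos.le) (sq_nonneg _)

end Stencil

namespace Stencil

variable {d : ℕ} {Λ : ℝ} {σ : Stencil d Λ} {g : 𝔼 d → ℝ}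

lemma jetBd_slice_of_energy {N n m : ℕ} {A : ℝ} (hA : 0 ≤ A)
    (h : ∀ x, (σ.model g).energy m (N, n, x) ≤ A ^ 2) :
    (σ.model g).JetBd (σ.slice g N n) m A := by
  rintro ⟨a, b, x⟩ ⟨rfl, rfl⟩ γ hγ
  exact (σ.model g).abs_jet_le_of_energy hA (h x) hγ

lemma energy_le_of_jetBd {N n m : ℕ} {b : ℝ} (h : (σ.model g).JetBd (σ.slice g N n) m b)
    (x : Fin d → ℤ) : (σ.model g).energy m (N, n, x) ≤ (σ.words m).card * b ^ 2 :=
  (σ.model g).energy_le_of_abs fun γ hγ => h (N, n, x) ⟨rfl, rfl⟩ γ hγ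

/-- Short-time control of jets of order three and of the slopes. -/
lemma exists_short_time (σ : Stencil d Λ) (g : 𝔼 d → ℝ) (b : ℝ) :
    ∃ T0 : ℝ, 0 < T0 ∧ ∃ B : ℝ, ∀ N n₀, (σ.model g).JetBd (σ.slice g N n₀) 3 b →
      σ.SlopeLe g N n₀ (Λ - 1) → ∀ j : ℕ, j * σ.kk N ≤ T0 →
        (σ.model g).JetBd (σ.slice g N (n₀ + j)) 3 B ∧ σ.SlopeLe g N (n₀ + j) Λ := by
  set m0 : ℝ := (σ.words 3).card * b ^ 2 with hm0
  have hm0' : 0 ≤ m0 := by positivity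
  set A1 := Real.sqrt (m0 + 1) with hA1
  have hA1' : A1 ^ 2 = m0 + 1 := Real.sq_sqrt (by positivity)
  obtain ⟨K, hK0, hK⟩ := (σ.model g).exists_res_bound 3 A1
  have hp : ∀ i, ∃ K, 0 ≤ K ∧ ∀ D, (σ.model g).Sat D → (σ.model g).JetBd D 2 A1 → ∀ z ∈ D,
      |(σ.model g).ev z ((σ.model g).res ((σ.model g).jet [σ.ι i]))| ≤ K := fun i =>
    (FlowModel.res_jet_one (M := σ.model g) (σ.ι i)).dp.bound A1
  choose Kp hKp0 hKp using hp
  set C := σ.stepC 3 K * (1 + A1 ^ 2) with hC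
  have hC0 : 0 ≤ C := mul_nonneg (stepC_nonneg 3 hK0) (by positivity)
  set Kq := ∑ i, Kp i with hKq
  have hKq0 : 0 ≤ Kq := sum_nonneg fun i _ => hKp0 i
  have hden : 0 < C + Kq + 1 := by positivity
  refine ⟨1 / (C + Kq + 1), by positivity, A1, fun N n₀ hJ hS => ?_⟩
  have claim : ∀ j : ℕ, j * σ.kk N ≤ 1 / (C + Kq + 1) →
      (∀ x, (σ.model g).energy 3 (N, n₀ + j, x) ≤ m0 + j * σ.kk N * C) ∧
      σ.SlopeLe g N (n₀ + j) (Λ - 1 + j * σ.kk N * Kq) := by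
    intro j
    induction j with
    | zero =>
      intro _
      refine ⟨fun x => ?_, fun x i => ?_⟩
      · simpa using energy_le_of_jetBd hJ x
      · simpa using hS x i
    | succ j ih =>
      intro hj
      have hk := σ.kk_pos N
      have hj' : (j : ℝ) * σ.kk N ≤ 1 / (C + Kq + 1) := by
        push_cast at hj; linarith
      obtain ⟨hE, hs⟩ := ih hj'
      have hj0 : 0 ≤ (j : ℝ) * σ.kk N := by positivity
      rw [le_div_iff₀ hden] at hj'
      have hjC : (j : ℝ) * σ.kk N * C ≤ 1 := by nlinarith
      have hjK : (j : ℝ) * σ.kk N * Kq ≤ 1 := by nlinarith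
      have hΛ : σ.SlopeLe g N (n₀ + j) Λ := fun x i => (hs x i).trans (by linarith)
      set A := Real.sqrt (m0 + j * σ.kk N * C) with hA
      have hA2 : A ^ 2 = m0 + j * σ.kk N * C := Real.sq_sqrt (by positivity)
      have hJA : (σ.model g).JetBd (σ.slice g N (n₀ + j)) 3 A1 :=
        jetBd_slice_of_energy (Real.sqrt_nonneg _) fun x => by rw [hA1']; linarith [hE x]
      constructor
      · intro x
        have := hΛ.energy_next (m := 3) (A := A) (K := K) (Real.sqrt_nonneg _) hK0
          (fun x => by rw [hA2]; exact hE x) (fun x γ hγ => (hK _ (σ.sat_slice g N (n₀ + j)) hJA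
            (by norm_num) (N, n₀ + j, x) ⟨rfl, rfl⟩ γ hγ).trans
            (mul_le_mul_of_nonneg_left (by linarith [Real.sqrt_nonneg (m0 + j * σ.kk N * C)])
              hK0)) x
        refine this.trans ?_
        rw [hA2]
        have h1 : σ.stepC 3 K * (1 + (m0 + j * σ.kk N * C)) ≤ C := by
          have hCe : C = σ.stepC 3 K * (1 + (m0 + 1)) := by rw [hC, hA1']
          refine le_of_le_of_eq ?_ hCe.symm
          exact mul_le_mul_of_nonneg_left (by linarith) (stepC_nonneg 3 hK0)
        have h2 := mul_le_mul_of_nonneg_left h1 hk.le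
        push_cast; linarith
      · intro x i
        have := hΛ.abs_le_next ((σ.model g).p i) (fun x => hs x i) (K := Kq) (fun x =>
          (hKp i _ (σ.sat_slice g N (n₀ + j)) (hJA.mono (by norm_num) le_rfl) (N, n₀ + j, x)
            ⟨rfl, rfl⟩).trans (single_le_sum (f := Kp) (fun i _ => hKp0 i)
              (Finset.mem_univ i))) x
        refine this.trans (le_of_eq ?_)
        push_cast; ring
  intro j hj
  obtain ⟨hE, hs⟩ := claim j hj
  have hj0 : 0 ≤ (j : ℝ) * σ.kk N := mul_nonneg (Nat.cast_nonneg _) (σ.kk_pos N).le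
  rw [le_div_iff₀ hden] at hj
  have hjC : (j : ℝ) * σ.kk N * C ≤ 1 := by nlinarith
  have hjK : (j : ℝ) * σ.kk N * Kq ≤ 1 := by nlinarith
  exact ⟨jetBd_slice_of_energy (Real.sqrt_nonneg _) fun x => by rw [hA1']; linarith [hE x],
    fun x i => (hs x i).trans (by linarith)⟩

/-- Bounds of order three on a time window propagate to all orders. -/
lemma exists_jet_bound (σ : Stencil d Λ) (g : 𝔼 d → ℝ) (b T : ℝ)
    (h0 : ∀ m, ∃ b0, ∀ N, (σ.model g).JetBd (σ.slice g N 0) m b0) (m : ℕ) :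
    ∃ B, ∀ N, (∀ n : ℕ, n * σ.kk N ≤ T →
      (σ.model g).JetBd (σ.slice g N n) 3 b ∧ σ.SlopeLe g N n Λ) →
      ∀ n : ℕ, n * σ.kk N ≤ T → (σ.model g).JetBd (σ.slice g N n) m B := by
  suffices H : ∀ m, 3 ≤ m → ∃ B, ∀ N, (∀ n : ℕ, n * σ.kk N ≤ T →
      (σ.model g).JetBd (σ.slice g N n) 3 b ∧ σ.SlopeLe g N n Λ) →
      ∀ n : ℕ, n * σ.kk N ≤ T → (σ.model g).JetBd (σ.slice g N n) m B by
    obtain ⟨B, hB⟩ := H (m + 3) (by omega)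
    exact ⟨B, fun N h n hn => (hB N h n hn).mono (by omega) le_rfl⟩
  intro m hm
  induction m, hm using Nat.le_induction with
  | base => exact ⟨b, fun N h n hn => (h n hn).1⟩
  | succ m hm ih =>
    obtain ⟨B, hB⟩ := ih
    obtain ⟨b0, hb0⟩ := h0 (m + 1)
    obtain ⟨K, hK0, hK⟩ := (σ.model g).exists_res_bound_tame hm B
    set C := σ.stepC (m + 1) K with hC
    have hC0 : 0 ≤ C := stepC_nonneg _ hK0
    set E0 : ℝ := (σ.words (m + 1)).card * b0 ^ 2 with hE0
    have hE0' : 0 ≤ E0 := by positivity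
    refine ⟨Real.sqrt ((1 + E0) * Real.exp (C * T)), fun N h => ?_⟩
    have hk := σ.kk_pos N
    have claim : ∀ n : ℕ, n * σ.kk N ≤ T →
        ∀ x, (σ.model g).energy (m + 1) (N, n, x) ≤ (1 + E0) * (1 + σ.kk N * C) ^ n - 1 := by
      intro n
      induction n with
      | zero =>
        intro _ x
        have := energy_le_of_jetBd (hb0 N) x
        simp only [pow_zero]; linarith
      | succ n ihn =>
        intro hn x
        have hn' : (n : ℝ) * σ.kk N ≤ T := by push_cast at hn; linarith
        have hE := ihn hn'
        have h1 : 1 ≤ (1 + σ.kk N * C) ^ n := one_le_pow₀ (by nlinarith)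
        have hpos : 0 ≤ (1 + E0) * (1 + σ.kk N * C) ^ n - 1 := by nlinarith
        set A := Real.sqrt ((1 + E0) * (1 + σ.kk N * C) ^ n - 1) with hA
        have hA2 : A ^ 2 = (1 + E0) * (1 + σ.kk N * C) ^ n - 1 := Real.sq_sqrt hpos
        have hA0 : 0 ≤ A := Real.sqrt_nonneg _
        have hJA : (σ.model g).JetBd (σ.slice g N n) (m + 1) (1 + A) :=
          (jetBd_slice_of_energy hA0 fun x => by rw [hA2]; exact hE x).mono le_rfl
            (by linarith)
        have := (h n hn').2.energy_next (m := m + 1) (A := A) (K := K) hA0 hK0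
          (fun x => by rw [hA2]; exact hE x) (fun x γ hγ => hK _ (1 + A) (by linarith)
            (σ.sat_slice g N n) (hB N h n hn') hJA (N, n, x) ⟨rfl, rfl⟩ γ hγ) x
        refine this.trans (le_of_eq ?_)
        rw [hA2, pow_succ]; ring
    intro n hn
    refine jetBd_slice_of_energy (Real.sqrt_nonneg _) fun x => ?_
    rw [Real.sq_sqrt (by positivity)]
    refine (claim n hn x).trans ?_
    have h1 : (1 + σ.kk N * C) ^ n ≤ Real.exp (C * T) := by
      calc (1 + σ.kk N * C) ^ n ≤ Real.exp (σ.kk N * C) ^ n :=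
            pow_le_pow_left₀ (by positivity) (by linarith [Real.add_one_le_exp (σ.kk N * C)]) n
        _ = Real.exp (C * (n * σ.kk N)) := by rw [← Real.exp_nat_mul]; ring_nf
        _ ≤ _ := Real.exp_le_exp.2 (mul_le_mul_of_nonneg_left hn hC0)
    nlinarith

/-- Upper and lower bounds are preserved. -/
lemma sol_mem_Icc {N : ℕ} {T a b : ℝ} (h : ∀ n : ℕ, n * σ.kk N ≤ T → σ.SlopeLe g N n Λ)
    (hg : ∀ y, g y ∈ Icc a b) (n : ℕ) (hn : n * σ.kk N ≤ T) (x : Fin d → ℤ) :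
    σ.sol g N n x ∈ Icc a b := by
  induction n generalizing x with
  | zero => exact hg _
  | succ n ih =>
    have hk := σ.kk_pos N
    have hn' : (n : ℝ) * σ.kk N ≤ T := by push_cast at hn; linarith
    have hr : (σ.model g).res (σ.model g).u = 0 := FlowModel.res_u _
    have h1 := (h n hn').le_next (σ.model g).u (a := b) (K := 0) (fun x => (ih hn' x).2)
      (fun x => by rw [hr]; exact le_rfl) x
    have h2 := (h n hn').le_next (-(σ.model g).u) (a := -a) (K := 0)
      (fun x => neg_le_neg (ih hn' x).1)
      (fun x => by
        have : (σ.model g).res (-(σ.model g).u) = 0 := by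
          have : (σ.model g).res (-(σ.model g).u) = -(σ.model g).res (σ.model g).u := by
            unfold FlowModel.res FlowModel.L
            simp only [map_neg, mul_neg, sum_neg_distrib, smul_neg]; abel
          rw [this, hr, neg_zero]
        rw [this]; exact le_rfl) x
    change σ.sol g N (n + 1) x ≤ _ at h1
    change -σ.sol g N (n + 1) x ≤ _ at h2
    exact ⟨by linarith, by linarith⟩

/-- Periodicity is preserved. -/
lemma sol_periodic {R : ℕ} (hg : ∀ y (e : Fin d → ℤ),
      g (y + WithLp.toLp 2 fun i => (R : ℝ) * e i) = g y)
    (N n : ℕ) (x e : Fin d → ℤ) :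
    σ.sol g N n (x + fun i => (R * (N + 1) : ℤ) * e i) = σ.sol g N n x := by
  induction n generalizing x with
  | zero =>
    change g (pt N _) = g (pt N x)
    rw [← hg (pt N x) e]
    congr 1
    ext i
    have : (N + 1 : ℝ) ≠ 0 := by positivity
    simp [pt]; field_simp
  | succ n ih =>
    have hd : ∀ s x, σ.diff N s (σ.sol g N n) (x + fun i => (R * (N + 1) : ℤ) * e i)
        = σ.diff N s (σ.sol g N n) x := fun s x => by
      unfold diff; rw [add_right_comm, ih, ih]
    have hdd : ∀ s x, σ.diff N (σ.neg s) (σ.diff N s (σ.sol g N n))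
        (x + fun i => (R * (N + 1) : ℤ) * e i)
        = σ.diff N (σ.neg s) (σ.diff N s (σ.sol g N n)) x := fun s x => by
      conv_lhs => rw [diff]
      rw [add_right_comm, hd, hd]; rfl
    change σ.step N _ _ = σ.step N _ _
    unfold step
    simp only [hd, hdd, ih]

end Stencil

/-! ### Lattice paths -/

/-- The `ℓ¹` length of a lattice vector. -/
def latNorm {d : ℕ} (y : Fin d → ℤ) : ℕ := ∑ i, (y i).natAbs

lemma exists_latNorm_pred {d : ℕ} (y : Fin d → ℤ) (hy : latNorm y ≠ 0) : ∃ i y',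
    latNorm y' + 1 = latNorm y ∧ (y = y' + Pi.single i 1 ∨ y' = y + Pi.single i 1) := by
  obtain ⟨i, -, hi⟩ := Finset.exists_ne_zero_of_sum_ne_zero hy
  have key : ∀ z : Fin d → ℤ, (∀ j, j ≠ i → z j = y j) → (z i).natAbs + 1 = (y i).natAbs →
      latNorm z + 1 = latNorm y := by
    intro z hz h
    unfold latNorm
    rw [← Finset.add_sum_erase _ _ (Finset.mem_univ i),
      ← Finset.add_sum_erase Finset.univ (fun j => (y j).natAbs) (Finset.mem_univ i),
      sum_congr rfl fun j hj => by rw [hz j (Finset.ne_of_mem_erase hj)]]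
    omega
  rcases lt_or_ge (y i) 0 with h | h
  · refine ⟨i, y + Pi.single i 1, key _ (fun j hj => by simp [hj]) ?_, Or.inr rfl⟩
    simp; omega
  · refine ⟨i, y - Pi.single i 1, key _ (fun j hj => by simp [hj]) ?_, Or.inl (by simp)⟩
    simp; omega

lemma lattice_path {d : ℕ} {F : (Fin d → ℤ) → ℝ} {c : ℝ} {r : ℕ}
    (h : ∀ y i, latNorm y ≤ r → |F (y + Pi.single i 1) - F y| ≤ c) (y : Fin d → ℤ)
    (hy : latNorm y ≤ r) : |F y - F 0| ≤ c * latNorm y := by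
  induction hk : latNorm y generalizing y with
  | zero =>
    have : y = 0 := by
      ext i
      have := (Finset.sum_eq_zero_iff.1 hk) i (Finset.mem_univ i)
      simpa using this
    simp [this]
  | succ k ih =>
    obtain ⟨i, y', h1, h2⟩ := exists_latNorm_pred y (by omega)
    have h3 := ih y' (by omega) (by omega)
    have h4 : |F y - F y'| ≤ c := by
      rcases h2 with rfl | rfl
      · exact h y' i (by omega)
      · rw [abs_sub_comm]; exact h y i hy
    calc |F y - F 0| ≤ |F y - F y'| + |F y' - F 0| := abs_sub_le _ _ _
      _ ≤ c + c * k := add_le_add h4 h3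
      _ = _ := by push_cast; ring

lemma nat_path {F : ℕ → ℝ} {c : ℝ} {j : ℕ} (h : ∀ l < j, |F (l + 1) - F l| ≤ c) :
    |F j - F 0| ≤ c * j := by
  induction j with
  | zero => simp
  | succ j ih =>
    calc |F (j + 1) - F 0| ≤ |F (j + 1) - F j| + |F j - F 0| := abs_sub_le _ _ _
      _ ≤ c + c * j := add_le_add (h j (by omega)) (ih fun l hl => h l (by omega))
      _ = _ := by push_cast; ring

/-! ### Limits along an ultrafilter -/

/-- Limit of a bounded sequence along a fixed nonprincipal ultrafilter. -/
def ulim (a : ℕ → ℝ) : ℝ := limUnder 𝔲 a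

lemma tendsto_ulim {a : ℕ → ℝ} {B : ℝ} (h : ∀ᶠ N in 𝔲, |a N| ≤ B) :
    Tendsto a 𝔲 (𝓝 (ulim a)) := by
  obtain ⟨y, -, hy⟩ := (isCompact_Icc (a := -B) (b := B)).ultrafilter_le_nhds
    ((hyperfilter ℕ).map a) (by
      rw [le_principal_iff]
      exact h.mono fun N hN => abs_le.1 hN)
  exact tendsto_nhds_limUnder ⟨y, hy⟩

lemma tendsto_one_div_hyper :
    Tendsto (fun N : ℕ => 1 / ((N : ℝ) + 1)) 𝔲 (𝓝 0) :=
  tendsto_one_div_add_atTop_nhds_zero_nat.mono_left Nat.hyperfilter_le_atTop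

namespace Stencil

variable {d : ℕ} {Λ : ℝ} (σ : Stencil d Λ) (g : 𝔼 d → ℝ)

/-- Bounds of order `m` on the time window `[0, T]`. -/
def Win (T : ℝ) (m : ℕ) (B : ℝ) (N : ℕ) : Prop := ∀ n : ℕ, n * σ.kk N ≤ T →
  (σ.model g).JetBd (σ.slice g N n) m B ∧ σ.SlopeLe g N n Λ

/-- The scheme is under control up to time `T`. -/
def Good (T : ℝ) : Prop := ∃ B, ∀ᶠ N in 𝔲, σ.Win g T 3 B N

/-- `Good` with all orders. -/
def AllGood (T : ℝ) : Prop := ∀ m, ∃ B, ∀ᶠ N in 𝔲, σ.Win g T m B N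

/-- Uniform boundedness on the window. -/
def Bdd (T : ℝ) (f : (σ.model g).R) : Prop :=
  ∃ B, ∀ᶠ N in 𝔲, ∀ n : ℕ, n * σ.kk N ≤ T → ∀ x, |f (N, n, x)| ≤ B

/-- Uniform Lipschitz continuity on the window. -/
def Lip (T : ℝ) (f : (σ.model g).R) : Prop :=
  ∃ C, 0 ≤ C ∧ ∀ᶠ N in 𝔲, ∀ n : ℕ, n * σ.kk N ≤ T → ∀ x,
    (∀ s, |f (N, n, x + σ.dir s) - f (N, n, x)| ≤ C * (1 / (N + 1))) ∧
    ((n + 1 : ℕ) * σ.kk N ≤ T → |f (N, n + 1, x) - f (N, n, x)| ≤ C * σ.kk N)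

variable {σ g}

lemma Dp_bdd {T : ℝ} (hT : σ.AllGood g T) {m : ℕ} {f : (σ.model g).R}
    (hf : (σ.model g).Dp m f) : σ.Bdd g T f := by
  obtain ⟨b, hb⟩ := hT m
  obtain ⟨K, -, hK⟩ := hf.bound b
  exact ⟨K, hb.mono fun N h n hn x => hK _ (σ.sat_slice g N n) (h n hn).1 (N, n, x) ⟨rfl, rfl⟩⟩

lemma Dp_space_lip {T : ℝ} (hT : σ.AllGood g T) {m : ℕ} {f : (σ.model g).R}
    (hf : (σ.model g).Dp m f) : ∃ C, 0 ≤ C ∧ ∀ᶠ N in 𝔲,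
      ∀ n : ℕ, n * σ.kk N ≤ T → ∀ x s,
        |f (N, n, x + σ.dir s) - f (N, n, x)| ≤ C * (1 / (N + 1)) := by
  have h1 : ∀ s, σ.Bdd g T ((σ.model g).δ s f) := fun s =>
    Dp_bdd hT ((hf.mono (Nat.le_succ m)).δ (by omega) s)
  choose B hB using h1
  refine ⟨∑ s, |B s|, sum_nonneg fun _ _ => abs_nonneg _, ?_⟩
  filter_upwards [(eventually_all.2 hB)] with N h n hn x s
  have h2 : |(N + 1 : ℝ) * (f (N, n, x + σ.dir s) - f (N, n, x))| ≤ B s := h s n hn x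
  have hN : (0 : ℝ) < N + 1 := by positivity
  rw [abs_mul, abs_of_pos hN] at h2
  have h3 : B s ≤ ∑ s, |B s| := (le_abs_self _).trans
    (single_le_sum (f := fun s => |B s|) (fun _ _ => abs_nonneg _) (Finset.mem_univ s))
  rw [mul_one_div, le_div_iff₀ hN]; linarith

lemma Dp_dt_jet (γ : List σ.S) : ∃ m, (σ.model g).Dp m ((σ.model g).dt ((σ.model g).jet γ)) := by
  induction γ with
  | nil =>
    refine ⟨2, ?_⟩
    have h := (σ.model g).dt_u
    rw [FlowModel.jet_nil, h]
    exact .smul _ (.sum _ fun s _ => .mul (.lam s (by norm_num)) (.jet 2 [σ.neg s, s] (by simp)))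
  | cons s γ ih =>
    obtain ⟨m, hm⟩ := ih
    exact ⟨m + 1 + 1, by
      rw [FlowModel.jet_cons, (σ.model g).dt_δ]; exact (hm.mono (Nat.le_succ m)).δ (by omega) s⟩

lemma jet_time_lip {T : ℝ} (hT : σ.AllGood g T) (γ : List σ.S) :
    ∃ C, 0 ≤ C ∧ ∀ᶠ N in 𝔲, ∀ n : ℕ, (n + 1 : ℕ) * σ.kk N ≤ T → ∀ x,
      |(σ.model g).jet γ (N, n + 1, x) - (σ.model g).jet γ (N, n, x)| ≤ C * σ.kk N := by
  obtain ⟨m, hm⟩ := Dp_dt_jet (σ := σ) (g := g) γ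
  obtain ⟨B, hB⟩ := Dp_bdd hT hm
  refine ⟨|B|, abs_nonneg _, hB.mono fun N h n hn x => ?_⟩
  have hk := σ.kk_pos N
  have h2 : |(σ.kk N)⁻¹ * ((σ.model g).jet γ (N, n + 1, x) - (σ.model g).jet γ (N, n, x))| ≤ B :=
    h n (le_trans (by push_cast; nlinarith) hn) x
  rw [abs_mul, abs_of_pos (inv_pos.2 hk), inv_mul_le_iff₀ hk] at h2
  nlinarith [le_abs_self B]

lemma Dp_time_lip {T : ℝ} (hT : σ.AllGood g T) {m : ℕ} {f : (σ.model g).R}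
    (hf : (σ.model g).Dp m f) : ∃ C, 0 ≤ C ∧ ∀ᶠ N in 𝔲,
      ∀ n : ℕ, (n + 1 : ℕ) * σ.kk N ≤ T → ∀ x,
        |f (N, n + 1, x) - f (N, n, x)| ≤ C * σ.kk N := by
  have hwin : ∀ {N n : ℕ}, (n + 1 : ℕ) * σ.kk N ≤ T → (n : ℕ) * σ.kk N ≤ T := fun {N n} hn =>
    le_trans (by push_cast; nlinarith [σ.kk_pos N]) hn
  induction hf with
  | const a =>
    refine ⟨0, le_rfl, .of_forall fun N n _ x => ?_⟩
    change |a - a| ≤ _; simp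
  | h =>
    refine ⟨0, le_rfl, .of_forall fun N n _ x => ?_⟩
    change |1 / ((N : ℝ) + 1) - 1 / ((N : ℝ) + 1)| ≤ _; simp
  | jet γ hγ => exact jet_time_lip hT γ
  | rho hm =>
    have h1 := fun i : Fin d => jet_time_lip hT [σ.ι i]
    choose C hC0 hC using h1
    have h2 := fun i : Fin d => Dp_bdd hT (FlowModel.Dp.jet (M := σ.model g) 1 [σ.ι i] le_rfl)
    choose B hB using h2
    refine ⟨∑ i, 2 * |B i| * C i, sum_nonneg fun i _ => by have := hC0 i; positivity, ?_⟩
    filter_upwards [eventually_all.2 hC, eventually_all.2 hB] with N hC hB n hn x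
    set r := (σ.model g).ev (N, n, x) (σ.model g).ρ with hr
    set r' := (σ.model g).ev (N, n + 1, x) (σ.model g).ρ with hr'
    set q := fun i => (σ.model g).ev (N, n, x) ((σ.model g).p i) with hq
    set q' := fun i => (σ.model g).ev (N, n + 1, x) ((σ.model g).p i) with hq'
    have e1 : r * (1 + ∑ i, q i ^ 2) = 1 := (σ.model g).ev_ρ_eq (N, n, x)
    have e2 : r' * (1 + ∑ i, q' i ^ 2) = 1 := (σ.model g).ev_ρ_eq (N, n + 1, x)
    have e3 : |r| ≤ 1 := (σ.model g).abs_ev_ρ_le _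
    have e4 : |r'| ≤ 1 := (σ.model g).abs_ev_ρ_le _
    have e5 : r' - r = -(r * r') * ∑ i, (q' i + q i) * (q' i - q i) := by
      have : ∑ i, (q' i + q i) * (q' i - q i) = (1 + ∑ i, q' i ^ 2) - (1 + ∑ i, q i ^ 2) := by
        rw [add_sub_add_left_eq_sub, ← sum_sub_distrib]
        exact sum_congr rfl fun i _ => by ring
      rw [this]; linear_combination (-r') * e1 + r * e2
    change |r' - r| ≤ _
    rw [e5, abs_mul, abs_neg, abs_mul]
    have e6 : |r| * |r'| ≤ 1 := mul_le_one₀ e3 (abs_nonneg _) e4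
    refine (mul_le_of_le_one_left (abs_nonneg _) e6).trans ?_
    refine (Finset.abs_sum_le_sum_abs _ _).trans ?_
    rw [sum_mul]
    refine sum_le_sum fun i _ => ?_
    rw [abs_mul, mul_assoc]
    have h3 : |q' i| ≤ B i := hB i (n + 1) hn x
    have h4 : |q i| ≤ B i := hB i n (hwin hn) x
    refine mul_le_mul ?_ (hC i n hn x) (abs_nonneg _) (by positivity)
    refine (abs_add_le _ _).trans ?_
    linarith [le_abs_self (B i)]
  | @add f f' _ _ h1 h2 =>
    obtain ⟨C, h0, hC⟩ := h1
    obtain ⟨C', h0', hC'⟩ := h2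
    refine ⟨C + C', by positivity, ?_⟩
    filter_upwards [hC, hC'] with N hC hC' n hn x
    have h3 := hC n hn x
    have h4 := hC' n hn x
    rw [add_mul]
    refine le_trans (le_of_eq ?_) ((abs_add_le _ _).trans (add_le_add h3 h4))
    refine congrArg abs ?_
    change (f (N, n + 1, x) + f' (N, n + 1, x)) - (f (N, n, x) + f' (N, n, x)) = _
    ring
  | @mul f g' hf hg h1 h2 =>
    obtain ⟨C, h0, hC⟩ := h1
    obtain ⟨C', h0', hC'⟩ := h2
    obtain ⟨B, hB⟩ := Dp_bdd hT hf
    obtain ⟨B', hB'⟩ := Dp_bdd hT hg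
    refine ⟨C * |B'| + |B| * C', by positivity, ?_⟩
    filter_upwards [hC, hC', hB, hB'] with N hC hC' hB hB' n hn x
    have h3 := hC n hn x
    have h4 := hC' n hn x
    have h5 := (hB (n + 1) hn x).trans (le_abs_self B)
    have h6 := (hB' n (hwin hn) x).trans (le_abs_self B')
    have e : f (N, n + 1, x) * g' (N, n + 1, x) - f (N, n, x) * g' (N, n, x)
        = (f (N, n + 1, x) - f (N, n, x)) * g' (N, n, x)
          + f (N, n + 1, x) * (g' (N, n + 1, x) - g' (N, n, x)) := by ring
    change |f (N, n + 1, x) * g' (N, n + 1, x) - f (N, n, x) * g' (N, n, x)| ≤ _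
    rw [e]
    refine (abs_add_le _ _).trans ?_
    rw [abs_mul, abs_mul]
    have hk := (σ.kk_pos N).le
    have h7 := mul_le_mul h3 h6 (abs_nonneg _) (by positivity)
    have h8 := mul_le_mul h5 h4 (abs_nonneg _) (by positivity)
    linarith
  | @tau f s _ h1 =>
    obtain ⟨C, h0, hC⟩ := h1
    exact ⟨C, h0, hC.mono fun N hC n hn x => hC n hn (x + σ.dir s)⟩

lemma Dp_lip {T : ℝ} (hT : σ.AllGood g T) {m : ℕ} {f : (σ.model g).R}
    (hf : (σ.model g).Dp m f) : σ.Lip g T f := by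
  obtain ⟨C, hC0, hC⟩ := Dp_space_lip hT hf
  obtain ⟨C', hC0', hC'⟩ := Dp_time_lip hT hf
  refine ⟨C + C', add_nonneg hC0 hC0', ?_⟩
  filter_upwards [hC, hC'] with N h h' n hn x
  have hN : (0 : ℝ) < 1 / (N + 1) := by positivity
  have hk := σ.kk_pos N
  exact ⟨fun s => (h n hn x s).trans (by nlinarith), fun hn' => (h' n hn' x).trans (by nlinarith)⟩

end Stencil

namespace Stencil

variable {d : ℕ} {Λ : ℝ} {σ : Stencil d Λ} {g : 𝔼 d → ℝ}

lemma space_path {f : (σ.model g).R} {N n : ℕ} {C : ℝ}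
    (h : ∀ x s, |f (N, n, x + σ.dir s) - f (N, n, x)| ≤ C * (1 / (N + 1))) (x y : Fin d → ℤ) :
    |f (N, n, x + y) - f (N, n, x)| ≤ C * (latNorm y / (N + 1)) := by
  have := lattice_path (F := fun y => f (N, n, x + y)) (c := C * (1 / (N + 1))) (r := latNorm y)
    (fun y i _ => by
      have := h (x + y) (σ.ι i)
      rw [σ.dir_ι, add_assoc] at this
      exact this) y le_rfl
  simp only [add_zero] at this
  refine this.trans (le_of_eq ?_)
  ring

lemma time_path {f : (σ.model g).R} {N n j : ℕ} {C T : ℝ} {x : Fin d → ℤ}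
    (h : ∀ n : ℕ, (n + 1 : ℕ) * σ.kk N ≤ T → |f (N, n + 1, x) - f (N, n, x)| ≤ C * σ.kk N)
    (hj : (n + j : ℕ) * σ.kk N ≤ T) :
    |f (N, n + j, x) - f (N, n, x)| ≤ C * (j * σ.kk N) := by
  have := nat_path (F := fun l => f (N, n + l, x)) (c := C * σ.kk N) (j := j) (fun l hl =>
    h (n + l) (le_trans (mul_le_mul_of_nonneg_right (by exact_mod_cast (by omega))
      (σ.kk_pos N).le) hj))
  refine this.trans (le_of_eq ?_)
  ring

lemma Lip.two_point {T : ℝ} {f : (σ.model g).R} (hf : σ.Lip g T f) :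
    ∃ C, 0 ≤ C ∧ ∀ᶠ N in 𝔲, ∀ (n j : ℕ) (x y : Fin d → ℤ),
      (n + j : ℕ) * σ.kk N ≤ T →
      |f (N, n + j, x + y) - f (N, n, x)| ≤ C * (latNorm y / (N + 1) + j * σ.kk N) := by
  obtain ⟨C, hC0, hC⟩ := hf
  refine ⟨C, hC0, hC.mono fun N h n j x y hj => ?_⟩
  have hwin : ∀ {n : ℕ}, (n + 1 : ℕ) * σ.kk N ≤ T → (n : ℕ) * σ.kk N ≤ T := fun {n} hn =>
    le_trans (by push_cast; nlinarith [σ.kk_pos N]) hn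
  have h1 := space_path (fun x s => (h (n + j) hj x).1 s) x y
  have h2 := time_path (f := f) (x := x) (fun n hn => (h n (hwin hn) x).2 hn) hj
  have := abs_sub_le (f (N, n + j, x + y)) (f (N, n + j, x)) (f (N, n, x))
  linarith

lemma discrete_taylor {T : ℝ} {f : (σ.model g).R}
    (hi : ∀ i, σ.Lip g T ((σ.model g).δ (σ.ι i) f)) (ht : σ.Lip g T ((σ.model g).dt f)) :
    ∃ C, 0 ≤ C ∧ ∀ᶠ N in 𝔲, ∀ (n j : ℕ) (x y : Fin d → ℤ),
      (n + j : ℕ) * σ.kk N ≤ T →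
      |f (N, n + j, x + y) - f (N, n, x)
        - ∑ i, (σ.model g).δ (σ.ι i) f (N, n, x) * (y i / (N + 1))
        - (σ.model g).dt f (N, n, x) * (j * σ.kk N)|
        ≤ C * (latNorm y / (N + 1) + j * σ.kk N) ^ 2 := by
  have hi' := fun i => (hi i).two_point
  choose Ci hCi0 hCi using hi'
  obtain ⟨Ct, hCt0, hCt⟩ := ht.two_point
  have hS : 0 ≤ ∑ i, Ci i := sum_nonneg fun i _ => hCi0 i
  have hle : ∀ i, Ci i ≤ ∑ i, Ci i + Ct := fun i =>
    (single_le_sum (f := Ci) (fun i _ => hCi0 i) (Finset.mem_univ i)).trans (by linarith)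
  refine ⟨∑ i, Ci i + Ct, by positivity, ?_⟩
  filter_upwards [eventually_all.2 hCi, hCt] with N hCi hCt n j x y hj
  set C := ∑ i, Ci i + Ct with hC
  have hC0 : 0 ≤ C := by positivity
  have hN : (0 : ℝ) < N + 1 := by positivity
  have hk := σ.kk_pos N
  set a : Fin d → ℕ → (Fin d → ℤ) → ℝ := fun i n x => (σ.model g).δ (σ.ι i) f (N, n, x) with ha
  set b : ℕ → ℝ := fun n => (σ.model g).dt f (N, n, x) with hb
  set r : ℝ := latNorm y / (N + 1) with hr
  have hr0 : 0 ≤ r := by positivity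
  -- spatial part
  have hsp : |f (N, n + j, x + y) - f (N, n + j, x) - ∑ i, a i (n + j) x * (y i / (N + 1))|
      ≤ C * r ^ 2 := by
    have := lattice_path (F := fun y => f (N, n + j, x + y)
        - ∑ i, a i (n + j) x * (y i / (N + 1))) (c := 1 / (N + 1) * (C * r)) (r := latNorm y)
      (fun z i hz => by
        have e1 : a i (n + j) (x + z) = (N + 1) *
            (f (N, n + j, x + z + σ.dir (σ.ι i)) - f (N, n + j, x + z)) := rfl
        rw [σ.dir_ι, add_assoc] at e1
        have e2 : ∑ l, a l (n + j) x * (((z + Pi.single i 1 : Fin d → ℤ) l : ℝ) / (N + 1))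
            = ∑ l, a l (n + j) x * (z l / (N + 1)) + a i (n + j) x * (1 / (N + 1)) := by
          have : ∀ l, a l (n + j) x * (((z + Pi.single i 1 : Fin d → ℤ) l : ℝ) / (N + 1))
              = a l (n + j) x * (z l / (N + 1))
                + if l = i then a i (n + j) x * (1 / (N + 1)) else 0 := by
            intro l
            by_cases hl : l = i
            · subst hl; simp; ring
            · simp [hl]
          simp_rw [this, sum_add_distrib]
          simp
        have e3 : f (N, n + j, x + (z + Pi.single i 1))
              - ∑ l, a l (n + j) x * (((z + Pi.single i 1 : Fin d → ℤ) l : ℝ) / (N + 1))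
              - (f (N, n + j, x + z) - ∑ l, a l (n + j) x * (z l / (N + 1)))
            = 1 / (N + 1) * (a i (n + j) (x + z) - a i (n + j) x) := by
          rw [e2, e1]; field_simp; ring
        rw [e3, abs_mul, abs_of_pos (by positivity : (0 : ℝ) < 1 / (N + 1))]
        refine mul_le_mul_of_nonneg_left ?_ (by positivity)
        have := hCi i (n + j) 0 x z hj
        simp only [add_zero, Nat.cast_zero, zero_mul] at this
        refine this.trans ?_
        refine mul_le_mul (hle i) ?_ (by positivity) hC0
        rw [hr]; gcongr) y le_rfl
    simp only [add_zero, Pi.zero_apply, Int.cast_zero, zero_div, mul_zero,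
      Finset.sum_const_zero, sub_zero] at this
    have e : f (N, n + j, x + y) - f (N, n + j, x) - ∑ i, a i (n + j) x * (y i / (N + 1))
        = f (N, n + j, x + y) - ∑ i, a i (n + j) x * (y i / (N + 1)) - f (N, n + j, x) := by ring
    rw [e]
    refine this.trans (le_of_eq ?_)
    rw [hr]; ring
  have hmid : |∑ i, a i (n + j) x * (y i / (N + 1)) - ∑ i, a i n x * (y i / (N + 1))|
      ≤ C * (j * σ.kk N) * r := by
    rw [← sum_sub_distrib]
    refine (Finset.abs_sum_le_sum_abs _ _).trans ?_
    have e : C * (j * σ.kk N) * r = ∑ i, C * (j * σ.kk N) * ((y i).natAbs / (N + 1)) := by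
      rw [← mul_sum, hr, latNorm, ← Finset.sum_div]; push_cast; rfl
    rw [e]
    refine sum_le_sum fun i _ => ?_
    rw [← sub_mul, abs_mul]
    have h1 := hCi i n j x 0 hj
    simp only [add_zero] at h1
    have h0 : (latNorm (0 : Fin d → ℤ) : ℝ) = 0 := by simp [latNorm]
    rw [h0, zero_div, zero_add] at h1
    refine mul_le_mul (h1.trans (mul_le_mul_of_nonneg_right (hle i) (by positivity))) ?_
      (abs_nonneg _) (by positivity)
    rw [abs_div, abs_of_pos hN, Nat.cast_natAbs, Int.cast_abs]
  have htm : |f (N, n + j, x) - f (N, n, x) - b n * (j * σ.kk N)| ≤ C * (j * σ.kk N) ^ 2 := by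
    have := nat_path (F := fun l => f (N, n + l, x) - b n * (l * σ.kk N))
      (c := σ.kk N * (C * (j * σ.kk N))) (j := j) (fun l hl => by
        have e1 : b (n + l) = (σ.kk N)⁻¹ * (f (N, n + l + 1, x) - f (N, n + l, x)) := rfl
        have e2 : f (N, n + (l + 1), x) - b n * ((l + 1 : ℕ) * σ.kk N)
            - (f (N, n + l, x) - b n * (l * σ.kk N)) = σ.kk N * (b (n + l) - b n) := by
          rw [e1, mul_sub, mul_inv_cancel_left₀ hk.ne']; push_cast; rw [add_assoc]; ring
        rw [e2, abs_mul, abs_of_pos hk]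
        refine mul_le_mul_of_nonneg_left ?_ hk.le
        have h1 := hCt n l x 0 (le_trans (mul_le_mul_of_nonneg_right
          (by exact_mod_cast (by omega)) hk.le) hj)
        simp only [add_zero] at h1
        have h0 : (latNorm (0 : Fin d → ℤ) : ℝ) = 0 := by simp [latNorm]
        rw [h0, zero_div, zero_add] at h1
        refine h1.trans (mul_le_mul (by rw [hC]; linarith) ?_ (by positivity) hC0)
        exact mul_le_mul_of_nonneg_right (by exact_mod_cast hl.le) hk.le)
    simp only [add_zero, Nat.cast_zero, zero_mul, mul_zero, sub_zero] at this
    have e : f (N, n + j, x) - f (N, n, x) - b n * (j * σ.kk N)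
        = f (N, n + j, x) - b n * (j * σ.kk N) - f (N, n, x) := by ring
    rw [e]
    refine this.trans (le_of_eq ?_)
    ring
  have hfin : f (N, n + j, x + y) - f (N, n, x) - ∑ i, a i n x * (y i / (N + 1))
        - b n * (j * σ.kk N)
      = (f (N, n + j, x + y) - f (N, n + j, x) - ∑ i, a i (n + j) x * (y i / (N + 1)))
        + (∑ i, a i (n + j) x * (y i / (N + 1)) - ∑ i, a i n x * (y i / (N + 1)))
        + (f (N, n + j, x) - f (N, n, x) - b n * (j * σ.kk N)) := by ring
  rw [hfin]
  refine (abs_add_three _ _ _).trans ((add_le_add_three hsp hmid htm).trans ?_)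
  have hj0 : 0 ≤ (j : ℝ) * σ.kk N := by positivity
  nlinarith [mul_nonneg hC0 (mul_nonneg hj0 hr0)]

/-! ### Limits of grid functions -/

variable (σ g)

/-- The grid point below a space-time point. -/
def node (N : ℕ) (q : 𝔼 d × ℝ) : ℕ × ℕ × (Fin d → ℤ) :=
  (N, ⌊q.2 / σ.kk N⌋₊, fun i => ⌊(N + 1) * q.1 i⌋)

/-- The limit of a grid function. -/
def lim (f : (σ.model g).R) (q : 𝔼 d × ℝ) : ℝ :=
  ulim fun N => f (σ.node N q)

variable {σ g}

lemma node_time {N : ℕ} {t T : ℝ} (h0 : 0 ≤ t) (hT : t ≤ T) :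
    ((⌊t / σ.kk N⌋₊ : ℕ) : ℝ) * σ.kk N ≤ T := by
  have hk := σ.kk_pos N
  refine le_trans ?_ hT
  rw [← le_div_iff₀ hk]
  exact Nat.floor_le (by positivity)

lemma tendsto_lim {T : ℝ} {f : (σ.model g).R} (hf : σ.Bdd g T f)
    {q : 𝔼 d × ℝ} (h0 : 0 ≤ q.2) (hq : q.2 ≤ T) :
    Tendsto (fun N => f (σ.node N q)) 𝔲 (𝓝 (σ.lim g f q)) := by
  obtain ⟨B, hB⟩ := hf
  exact tendsto_ulim (hB.mono fun N h => h _ (node_time h0 hq) _)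

lemma tendsto_kk : Tendsto (fun N => σ.kk N) 𝔲 (𝓝 0) := by
  have h := (tendsto_one_div_hyper.mul tendsto_one_div_hyper).const_mul σ.κ
  simp only [mul_zero] at h
  refine h.congr fun N => ?_
  unfold kk; field_simp

lemma tendsto_floor_time {t : ℝ} (h0 : 0 ≤ t) :
    Tendsto (fun N => ((⌊t / σ.kk N⌋₊ : ℕ) : ℝ) * σ.kk N) 𝔲 (𝓝 t) := by
  have h1 : Tendsto (fun N => t - σ.kk N) 𝔲 (𝓝 t) := by
    simpa using tendsto_const_nhds.sub (tendsto_kk (σ := σ))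
  refine tendsto_of_tendsto_of_tendsto_of_le_of_le h1 tendsto_const_nhds (fun N => ?_) fun N =>
    node_time h0 le_rfl
  have hk := σ.kk_pos N
  have := Nat.lt_floor_add_one (t / σ.kk N)
  rw [div_lt_iff₀ hk] at this
  change t - σ.kk N ≤ _
  linarith

lemma tendsto_floor_space (a : ℝ) :
    Tendsto (fun N : ℕ => ((⌊(N + 1) * a⌋ : ℤ) : ℝ) / (N + 1)) 𝔲 (𝓝 a) := by
  have h1 : Tendsto (fun N : ℕ => a - 1 / ((N : ℝ) + 1)) 𝔲 (𝓝 a) := by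
    simpa using tendsto_const_nhds.sub tendsto_one_div_hyper
  refine tendsto_of_tendsto_of_tendsto_of_le_of_le h1 tendsto_const_nhds (fun N => ?_) fun N => ?_
  · have hN : (0 : ℝ) < N + 1 := by positivity
    have := Int.lt_floor_add_one ((N + 1) * a)
    change a - 1 / ((N : ℝ) + 1) ≤ _
    rw [le_div_iff₀ hN, sub_mul, one_div_mul_cancel hN.ne']
    linarith
  · have hN : (0 : ℝ) < N + 1 := by positivity
    change _ / _ ≤ a
    rw [div_le_iff₀ hN]
    have := Int.floor_le ((N + 1) * a)
    linarith

end Stencil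

/-- The `ℓ¹` distance in space-time. -/
def stDist {d : ℕ} (q q' : 𝔼 d × ℝ) : ℝ :=
  ∑ i, |q'.1 i - q.1 i| + |q'.2 - q.2|

lemma stDist_nonneg {d : ℕ} (q q' : 𝔼 d × ℝ) : 0 ≤ stDist q q' := by
  unfold stDist; positivity

lemma stDist_comm {d : ℕ} (q q' : 𝔼 d × ℝ) : stDist q q' = stDist q' q := by
  unfold stDist; simp only [abs_sub_comm]

lemma stDist_le {d : ℕ} (q q' : 𝔼 d × ℝ) :
    stDist q q' ≤ (d + 1) * ‖q' - q‖ := by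
  unfold stDist
  have h1 : ∀ i, |q'.1 i - q.1 i| ≤ ‖q' - q‖ := fun i =>
    (PiLp.norm_apply_le (q'.1 - q.1) i).trans (norm_fst_le (q' - q))
  have h2 : |q'.2 - q.2| ≤ ‖q' - q‖ := norm_snd_le (q' - q)
  have h3 : ∑ i, |q'.1 i - q.1 i| ≤ ∑ _i : Fin d, ‖q' - q‖ := sum_le_sum fun i _ => h1 i
  simp only [Finset.sum_const, Finset.card_univ, Fintype.card_fin, nsmul_eq_mul] at h3
  linarith

/-- The linear form with given coefficients. -/
def stForm {d : ℕ} (a : Fin d → ℝ) (b : ℝ) : 𝔼 d × ℝ →L[ℝ] ℝ :=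
  ∑ i, a i • (EuclideanSpace.proj i : 𝔼 d →L[ℝ] ℝ).comp
    (ContinuousLinearMap.fst ℝ _ _) + b • ContinuousLinearMap.snd ℝ _ _

lemma stForm_apply {d : ℕ} (a : Fin d → ℝ) (b : ℝ) (w : 𝔼 d × ℝ) :
    stForm a b w = ∑ i, a i * w.1 i + b * w.2 := by
  simp [stForm]

lemma hasFDerivAt_of_quadratic {V : Type*} [NormedAddCommGroup V] [NormedSpace ℝ V] {f : V → ℝ}
    {A : V →L[ℝ] ℝ} {x : V} {C : ℝ}
    (h : ∀ᶠ y in 𝓝 x, |f y - f x - A (y - x)| ≤ C * ‖y - x‖ ^ 2) : HasFDerivAt f A x := by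
  rw [hasFDerivAt_iff_isLittleO]
  have h1 : (fun y => f y - f x - A (y - x)) =O[𝓝 x] fun y => ‖y - x‖ ^ 2 := by
    refine Asymptotics.IsBigO.of_bound C (h.mono fun y hy => ?_)
    rw [Real.norm_of_nonneg (sq_nonneg ‖y - x‖)]; exact hy
  exact h1.trans_isLittleO (Asymptotics.isLittleO_norm_pow_id one_lt_two |>.comp_tendsto
    (tendsto_sub_nhds_zero_iff.2 tendsto_id))

namespace Stencil

variable {d : ℕ} {Λ : ℝ} {σ : Stencil d Λ} {g : 𝔼 d → ℝ}

section Increments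

variable (q q' : 𝔼 d × ℝ)

lemma tendsto_incr_space (i : Fin d) :
    Tendsto (fun N => (((σ.node N q').2.2 i - (σ.node N q).2.2 i : ℤ) : ℝ) / (N + 1))
      𝔲 (𝓝 (q'.1 i - q.1 i)) := by
  refine ((tendsto_floor_space (q'.1 i)).sub (tendsto_floor_space (q.1 i))).congr fun N => ?_
  simp only [node]; push_cast; ring

lemma tendsto_latNorm :
    Tendsto (fun N => (latNorm ((σ.node N q').2.2 - (σ.node N q).2.2) : ℝ) / (N + 1))
      𝔲 (𝓝 (∑ i, |q'.1 i - q.1 i|)) := by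
  refine (tendsto_finsetSum Finset.univ fun i _ =>
    (tendsto_incr_space (σ := σ) q q' i).abs).congr fun N => ?_
  rw [latNorm]; push_cast
  rw [Finset.sum_div]
  refine sum_congr rfl fun i _ => ?_
  rw [abs_div, abs_of_pos (by positivity : (0 : ℝ) < N + 1), Pi.sub_apply,
    Nat.cast_natAbs, Int.cast_abs]; push_cast; rfl

variable {q q'}

lemma tendsto_incr_time (h0 : 0 ≤ q.2) (h : q.2 ≤ q'.2) :
    Tendsto (fun N => (((σ.node N q').2.1 - (σ.node N q).2.1 : ℕ) : ℝ) * σ.kk N)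
      𝔲 (𝓝 (|q'.2 - q.2|)) := by
  rw [abs_of_nonneg (by linarith)]
  refine ((tendsto_floor_time (σ := σ) (h0.trans h)).sub (tendsto_floor_time (σ := σ) h0)).congr fun N => ?_
  have : (σ.node N q).2.1 ≤ (σ.node N q').2.1 :=
    Nat.floor_mono (div_le_div_of_nonneg_right h (σ.kk_pos N).le)
  rw [Nat.cast_sub this]; simp only [node]; ring

lemma node_eq (N : ℕ) (h : q.2 ≤ q'.2) :
    σ.node N q' = (N, (σ.node N q).2.1 + ((σ.node N q').2.1 - (σ.node N q).2.1),
      (σ.node N q).2.2 + ((σ.node N q').2.2 - (σ.node N q).2.2)) := by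
  have : (σ.node N q).2.1 ≤ (σ.node N q').2.1 :=
    Nat.floor_mono (div_le_div_of_nonneg_right h (σ.kk_pos N).le)
  rw [add_sub_cancel, Nat.add_sub_cancel' this]; rfl

end Increments

lemma lim_lip {T : ℝ} {f : (σ.model g).R} (hb : σ.Bdd g T f) (hf : σ.Lip g T f) :
    ∃ C, 0 ≤ C ∧ ∀ q q' : 𝔼 d × ℝ, 0 ≤ q.2 → q.2 ≤ T → 0 ≤ q'.2 → q'.2 ≤ T →
      |σ.lim g f q' - σ.lim g f q| ≤ C * stDist q q' := by
  obtain ⟨C, hC0, hC⟩ := hf.two_point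
  refine ⟨C, hC0, ?_⟩
  have key : ∀ q q' : 𝔼 d × ℝ, 0 ≤ q.2 → q'.2 ≤ T → q.2 ≤ q'.2 →
      |σ.lim g f q' - σ.lim g f q| ≤ C * stDist q q' := by
    intro q q' h0 hT h
    have h1 := ((tendsto_lim hb (h0.trans h) hT).sub (tendsto_lim hb h0 (h.trans hT))).abs
    have h2 := ((tendsto_latNorm (σ := σ) q q').add (tendsto_incr_time (σ := σ) h0 h)).const_mul C
    refine le_of_tendsto_of_tendsto h1 h2 (hC.mono fun N hN => ?_)
    have := hN (σ.node N q).2.1 ((σ.node N q').2.1 - (σ.node N q).2.1) (σ.node N q).2.2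
      ((σ.node N q').2.2 - (σ.node N q).2.2) (by
        have hle : (σ.node N q).2.1 ≤ (σ.node N q').2.1 :=
          Nat.floor_mono (div_le_div_of_nonneg_right h (σ.kk_pos N).le)
        rw [Nat.add_sub_cancel' hle]
        exact node_time (h0.trans h) hT)
    rw [← node_eq N h] at this
    exact this
  intro q q' h0 hT h0' hT'
  rcases le_total q.2 q'.2 with h | h
  · exact key q q' h0 hT' h
  · rw [abs_sub_comm, stDist_comm]; exact key q' q h0' hT h

lemma lim_taylor {T : ℝ} {f : (σ.model g).R} (hb : σ.Bdd g T f)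
    (hbi : ∀ i, σ.Bdd g T ((σ.model g).δ (σ.ι i) f)) (hbt : σ.Bdd g T ((σ.model g).dt f))
    (hi : ∀ i, σ.Lip g T ((σ.model g).δ (σ.ι i) f)) (ht : σ.Lip g T ((σ.model g).dt f)) :
    ∃ C, 0 ≤ C ∧ ∀ q q' : 𝔼 d × ℝ, 0 ≤ q.2 → q.2 ≤ T → 0 ≤ q'.2 → q'.2 ≤ T →
      |σ.lim g f q' - σ.lim g f q
        - ∑ i, σ.lim g ((σ.model g).δ (σ.ι i) f) q * (q'.1 i - q.1 i)
        - σ.lim g ((σ.model g).dt f) q * (q'.2 - q.2)| ≤ C * stDist q q' ^ 2 := by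
  obtain ⟨C, hC0, hC⟩ := discrete_taylor hi ht
  have hLi := fun i => lim_lip (hbi i) (hi i)
  choose Ci hCi0 hCi using hLi
  obtain ⟨Ct, hCt0, hCt⟩ := lim_lip hbt ht
  have hS : 0 ≤ ∑ i, Ci i := sum_nonneg fun i _ => hCi0 i
  have key : ∀ q q' : 𝔼 d × ℝ, 0 ≤ q.2 → q'.2 ≤ T → q.2 ≤ q'.2 →
      |σ.lim g f q' - σ.lim g f q
        - ∑ i, σ.lim g ((σ.model g).δ (σ.ι i) f) q * (q'.1 i - q.1 i)
        - σ.lim g ((σ.model g).dt f) q * (q'.2 - q.2)| ≤ C * stDist q q' ^ 2 := by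
    intro q q' h0 hT h
    have ht' := tendsto_incr_time (σ := σ) h0 h
    have h1 := ((((tendsto_lim hb (h0.trans h) hT).sub (tendsto_lim hb h0 (h.trans hT))).sub
      (tendsto_finsetSum Finset.univ fun i _ => (tendsto_lim (hbi i) h0 (h.trans hT)).mul
        (tendsto_incr_space (σ := σ) q q' i))).sub
      ((tendsto_lim hbt h0 (h.trans hT)).mul ht')).abs
    rw [abs_of_nonneg (sub_nonneg.2 h)] at h1
    have h2 := (((tendsto_latNorm (σ := σ) q q').add ht').pow 2).const_mul C
    refine le_of_tendsto_of_tendsto h1 h2 (hC.mono fun N hN => ?_)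
    have := hN (σ.node N q).2.1 ((σ.node N q').2.1 - (σ.node N q).2.1) (σ.node N q).2.2
      ((σ.node N q').2.2 - (σ.node N q).2.2) (by
        have hle : (σ.node N q).2.1 ≤ (σ.node N q').2.1 :=
          Nat.floor_mono (div_le_div_of_nonneg_right h (σ.kk_pos N).le)
        rw [Nat.add_sub_cancel' hle]
        exact node_time (h0.trans h) hT)
    rw [← node_eq N h] at this
    exact this
  refine ⟨C + ∑ i, Ci i + Ct, by positivity, fun q q' h0 hT h0' hT' => ?_⟩
  have hD := stDist_nonneg q q'
  rcases le_total q.2 q'.2 with h | h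
  · exact (key q q' h0 hT' h).trans (mul_le_mul_of_nonneg_right (by linarith) (by positivity))
  · have h1 := key q' q h0' hT h
    rw [stDist_comm] at h1
    set a := fun i => σ.lim g ((σ.model g).δ (σ.ι i) f) with ha
    set b := σ.lim g ((σ.model g).dt f) with hbdef
    have hs : ∑ i, |q'.1 i - q.1 i| ≤ stDist q q' := by
      unfold stDist; linarith [abs_nonneg (q'.2 - q.2)]
    have hsi : ∀ i, |q'.1 i - q.1 i| ≤ stDist q q' := fun i =>
      (single_le_sum (f := fun i => |q'.1 i - q.1 i|) (fun i _ => abs_nonneg _)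
        (Finset.mem_univ i)).trans hs
    have hst : |q'.2 - q.2| ≤ stDist q q' := by
      unfold stDist; linarith [sum_nonneg fun i (_ : i ∈ Finset.univ) =>
        abs_nonneg (q'.1 i - q.1 i)]
    have h2 : |∑ i, (a i q' - a i q) * (q'.1 i - q.1 i)| ≤ (∑ i, Ci i) * stDist q q' ^ 2 := by
      refine (Finset.abs_sum_le_sum_abs _ _).trans ?_
      rw [sum_mul]
      refine sum_le_sum fun i _ => ?_
      rw [abs_mul, pow_two, ← mul_assoc]
      exact mul_le_mul (hCi i q q' h0 hT h0' hT') (hsi i) (abs_nonneg _)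
        (mul_nonneg (hCi0 i) hD)
    have h3 : |(b q' - b q) * (q'.2 - q.2)| ≤ Ct * stDist q q' ^ 2 := by
      rw [abs_mul, pow_two, ← mul_assoc]
      exact mul_le_mul (hCt q q' h0 hT h0' hT') hst (abs_nonneg _) (mul_nonneg hCt0 hD)
    have e : σ.lim g f q' - σ.lim g f q - ∑ i, a i q * (q'.1 i - q.1 i) - b q * (q'.2 - q.2)
        = -(σ.lim g f q - σ.lim g f q' - ∑ i, a i q' * (q.1 i - q'.1 i) - b q' * (q.2 - q'.2))
          + ∑ i, (a i q' - a i q) * (q'.1 i - q.1 i) + (b q' - b q) * (q'.2 - q.2) := by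
      have e1 : ∑ i, (a i q' - a i q) * (q'.1 i - q.1 i)
          = -∑ i, a i q' * (q.1 i - q'.1 i) - ∑ i, a i q * (q'.1 i - q.1 i) := by
        rw [← sum_neg_distrib, ← sum_sub_distrib]
        exact sum_congr rfl fun i _ => by ring
      rw [e1]; ring
    rw [e]
    refine (abs_add_three _ _ _).trans ?_
    rw [abs_neg]
    linarith

end Stencil

/-- Open space-time slabs. -/
def slab (d : ℕ) (T : ℝ) : Set (𝔼 d × ℝ) := {q | 0 < q.2 ∧ q.2 < T}

lemma isOpen_slab (d : ℕ) (T : ℝ) : IsOpen (slab d T) :=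
  (isOpen_lt continuous_const continuous_snd).inter (isOpen_lt continuous_snd continuous_const)

lemma contDiff_stForm {d : ℕ} {n : WithTop ℕ∞} {s : Set (𝔼 d × ℝ)}
    {a : Fin d → 𝔼 d × ℝ → ℝ} {b : 𝔼 d × ℝ → ℝ}
    (ha : ∀ i, ContDiffOn ℝ n (a i) s) (hb : ContDiffOn ℝ n b s) :
    ContDiffOn ℝ n (fun q => stForm (fun i => a i q) (b q)) s := by
  unfold stForm
  exact (ContDiffOn.sum fun i _ => (ha i).smul contDiffOn_const).add (hb.smul contDiffOn_const)

namespace Stencil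

variable {d : ℕ} {Λ : ℝ} {σ : Stencil d Λ} {g : 𝔼 d → ℝ} {T : ℝ}

lemma lim_eq {f : (σ.model g).R} {q : 𝔼 d × ℝ} {a : ℝ}
    (h : Tendsto (fun N => f (σ.node N q)) 𝔲 (𝓝 a)) :
    σ.lim g f q = a := h.limUnder_eq

section

variable (hT : σ.AllGood g T) {q : 𝔼 d × ℝ} (h0 : 0 ≤ q.2) (hq : q.2 ≤ T)

include hT h0 hq

lemma Dp_tendsto {m : ℕ} {f : (σ.model g).R} (hf : (σ.model g).Dp m f) :
    Tendsto (fun N => f (σ.node N q)) 𝔲 (𝓝 (σ.lim g f q)) :=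
  tendsto_lim (Dp_bdd hT hf) h0 hq

lemma lim_tau {m : ℕ} {f : (σ.model g).R} (hf : (σ.model g).Dp m f) (s : σ.S) :
    σ.lim g ((σ.model g).τ s f) q = σ.lim g f q := by
  refine lim_eq ?_
  obtain ⟨C, -, hC⟩ := Dp_space_lip hT hf
  have h1 := Dp_tendsto hT h0 hq hf
  have h2 : Tendsto (fun N => (σ.model g).τ s f (σ.node N q) - f (σ.node N q))
      𝔲 (𝓝 0) := by
    refine squeeze_zero_norm' (hC.mono fun N h => ?_)
      (by simpa only [mul_zero] using tendsto_one_div_hyper.const_mul C)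
    exact h (σ.node N q).2.1 (node_time h0 hq) (σ.node N q).2.2 s
  simpa using h1.add h2

lemma lim_rho : σ.lim g (σ.model g).ρ q
    = (1 + ∑ i, σ.lim g ((σ.model g).jet [σ.ι i]) q ^ 2)⁻¹ := by
  have h1 := Dp_tendsto hT h0 hq (.rho 1 le_rfl)
  have h2 := tendsto_finsetSum Finset.univ fun i (_ : i ∈ Finset.univ) =>
    (Dp_tendsto hT h0 hq (.jet 1 [σ.ι i] le_rfl)).pow 2
  have h3 := h1.mul (tendsto_const_nhds (x := (1 : ℝ)) |>.add h2)
  have h4 : ∀ N, (σ.model g).ρ (σ.node N q)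
      * (1 + ∑ i, (σ.model g).jet [σ.ι i] (σ.node N q) ^ 2) = 1 := fun N => by
    have := congrArg ((σ.model g).ev (σ.node N q)) (σ.model g).ρ_mul
    rw [map_mul, map_add, map_one, map_sum] at this
    simp only [map_pow] at this
    exact this
  have h5 := tendsto_nhds_unique h3 (tendsto_const_nhds.congr fun N => (h4 N).symm)
  exact eq_inv_of_mul_eq_one_left h5

lemma lim_dir {f : (σ.model g).R} {m : ℕ} (hf : (σ.model g).Dp m f)
    (ht : ∃ m, (σ.model g).Dp m ((σ.model g).dt f)) (s : σ.S) :
    σ.lim g ((σ.model g).δ s f) q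
      = ∑ i, (σ.dir s i : ℝ) * σ.lim g ((σ.model g).δ (σ.ι i) f) q := by
  have hf' := hf.mono (Nat.le_succ m)
  have hi := fun s => hf'.δ (by omega) s
  obtain ⟨m', ht⟩ := ht
  obtain ⟨C, hC0, hC⟩ := discrete_taylor (fun i => Dp_lip hT (hi (σ.ι i))) (Dp_lip hT ht)
  refine lim_eq ?_
  have h1 := tendsto_finsetSum Finset.univ fun i (_ : i ∈ Finset.univ) =>
    (Dp_tendsto hT h0 hq (hi (σ.ι i))).const_mul (σ.dir s i : ℝ)
  have h2 : Tendsto (fun N => (σ.model g).δ s f (σ.node N q)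
      - ∑ i, (σ.dir s i : ℝ) * (σ.model g).δ (σ.ι i) f (σ.node N q))
      𝔲 (𝓝 0) := by
    refine squeeze_zero_norm' (hC.mono fun N h => ?_)
      (by simpa using tendsto_one_div_hyper.const_mul (C * latNorm (σ.dir s) ^ 2))
    have := h (σ.node N q).2.1 0 (σ.node N q).2.2 (σ.dir s) (node_time h0 hq)
    have hN : (0 : ℝ) < N + 1 := by positivity
    set F := f (N, (σ.node N q).2.1, (σ.node N q).2.2 + σ.dir s) - f (σ.node N q) with hF
    set G : Fin d → ℝ := fun i => (σ.model g).δ (σ.ι i) f (σ.node N q) with hG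
    have h3 : |F - ∑ i, G i * (σ.dir s i / (N + 1))|
        ≤ C * (latNorm (σ.dir s) / (N + 1)) ^ 2 := by
      refine le_trans (le_of_eq ?_) (this.trans (le_of_eq ?_))
      · congr 1
        change F - _ = F - _ - _
        simp only [Nat.cast_zero, zero_mul, mul_zero, sub_zero]
        rfl
      · simp
    change |(N + 1 : ℝ) * F - ∑ i, (σ.dir s i : ℝ) * G i| ≤ _
    have e : (N + 1 : ℝ) * F - ∑ i, (σ.dir s i : ℝ) * G i
        = (N + 1) * (F - ∑ i, G i * (σ.dir s i / (N + 1))) := by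
      have e' : ∑ i, (σ.dir s i : ℝ) * G i = (N + 1) * ∑ i, G i * (σ.dir s i / (N + 1)) := by
        rw [mul_sum]
        exact sum_congr rfl fun i _ => by field_simp
      rw [e']
      exact (mul_sub _ _ _).symm
    rw [e, abs_mul, abs_of_pos hN]
    refine (mul_le_mul_of_nonneg_left h3 hN.le).trans (le_of_eq ?_)
    field_simp
  simpa using h2.add h1

lemma lim_jet_cons (s : σ.S) (γ : List σ.S) : σ.lim g ((σ.model g).jet (s :: γ)) q
      = ∑ i, (σ.dir s i : ℝ) * σ.lim g ((σ.model g).jet (σ.ι i :: γ)) q :=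
  lim_dir hT h0 hq (.jet _ γ le_rfl) (Dp_dt_jet γ) s

lemma lim_dt_u : σ.lim g ((σ.model g).dt (σ.model g).u) q = -(1 / 2 : ℝ) * ∑ s,
    MvPolynomial.eval (fun i => σ.lim g ((σ.model g).jet [σ.ι i]) q) (σ.P s)
      * (1 + ∑ i, σ.lim g ((σ.model g).jet [σ.ι i]) q ^ 2)⁻¹
      * σ.lim g ((σ.model g).jet [σ.neg s, s]) q := by
  rw [← lim_rho hT h0 hq]
  refine lim_eq ?_
  have hp := tendsto_pi_nhds.2 fun i => Dp_tendsto hT h0 hq (.jet 1 [σ.ι i] le_rfl)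
  have h1 := (tendsto_finsetSum Finset.univ fun s (_ : s ∈ Finset.univ) =>
    ((((MvPolynomial.continuous_eval (σ.P s)).tendsto _).comp hp).mul
      (Dp_tendsto hT h0 hq (.rho 1 le_rfl))).mul
      (Dp_tendsto hT h0 hq (.jet 2 [σ.neg s, s] le_rfl))).const_mul (-(1 / 2 : ℝ))
  refine h1.congr fun N => ?_
  have h2 := congrArg ((σ.model g).ev (σ.node N q)) (σ.model g).dt_u
  rw [map_smul, map_sum] at h2
  refine Eq.trans ?_ h2.symm
  rw [smul_eq_mul]
  congr 1
  refine sum_congr rfl fun s _ => ?_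
  rw [map_mul, map_mul]
  have h3 := FlowModel.ev_aeval (M := σ.model g) (z := σ.node N q)
    (fun i => (σ.model g).δ (σ.ι i) (σ.model g).u) (σ.P s)
  rw [h3]
  rfl

end

lemma hasFDerivAt_lim_jet (hT : σ.AllGood g T) {q : 𝔼 d × ℝ}
    (hq : q ∈ slab d T) (γ : List σ.S) :
    HasFDerivAt (σ.lim g ((σ.model g).jet γ))
      (stForm (fun i => σ.lim g ((σ.model g).jet (σ.ι i :: γ)) q)
        (σ.lim g ((σ.model g).dt ((σ.model g).jet γ)) q)) q := by
  have hγ := fun γ : List σ.S => FlowModel.Dp.jet (M := σ.model g) γ.length γ le_rfl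
  obtain ⟨m, hm⟩ := Dp_dt_jet (σ := σ) (g := g) γ
  obtain ⟨C, hC0, hC⟩ := lim_taylor (Dp_bdd hT (hγ γ)) (fun i => Dp_bdd hT (hγ (σ.ι i :: γ)))
    (Dp_bdd hT hm) (fun i => Dp_lip hT (hγ (σ.ι i :: γ))) (Dp_lip hT hm)
  refine hasFDerivAt_of_quadratic (C := C * (d + 1) ^ 2) ?_
  filter_upwards [(isOpen_slab d T).mem_nhds hq] with q' hq'
  have h := hC q q' hq.1.le hq.2.le hq'.1.le hq'.2.le
  rw [stForm_apply]
  have h2 := pow_le_pow_left₀ (stDist_nonneg q q') (stDist_le q q') 2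
  calc _ = _ := by rw [← sub_sub]; rfl
    _ ≤ _ := h
    _ ≤ C * ((d + 1) * ‖q' - q‖) ^ 2 := mul_le_mul_of_nonneg_left h2 hC0
    _ = _ := by ring

lemma contDiffOn_lim_Dp (hT : σ.AllGood g T) {n : ℕ∞}
    (h : ∀ γ, ContDiffOn ℝ n (σ.lim g ((σ.model g).jet γ)) (slab d T)) {m : ℕ}
    {f : (σ.model g).R} (hf : (σ.model g).Dp m f) : ContDiffOn ℝ n (σ.lim g f) (slab d T) := by
  induction hf with
  | const a =>
    exact (contDiffOn_const (c := a)).congr fun q hq => lim_eq tendsto_const_nhds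
  | h =>
    exact (contDiffOn_const (c := (0 : ℝ))).congr fun q hq => lim_eq tendsto_one_div_hyper
  | jet γ hγ => exact h γ
  | rho hm =>
    have h1 : ContDiffOn ℝ n (fun q => 1 + ∑ i, σ.lim g ((σ.model g).jet [σ.ι i]) q ^ 2)
      (slab d T) := contDiffOn_const.add (ContDiffOn.sum fun i _ => (h _).pow 2)
    refine (h1.inv fun q _ => ?_).congr fun q hq => lim_rho hT hq.1.le hq.2.le
    have : 0 ≤ ∑ i, σ.lim g ((σ.model g).jet [σ.ι i]) q ^ 2 :=
      sum_nonneg fun i _ => sq_nonneg _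
    positivity
  | add hf hg ihf ihg =>
    exact (ihf.add ihg).congr fun q hq => lim_eq
      ((Dp_tendsto hT hq.1.le hq.2.le hf).add (Dp_tendsto hT hq.1.le hq.2.le hg))
  | mul hf hg ihf ihg =>
    exact (ihf.mul ihg).congr fun q hq => lim_eq
      ((Dp_tendsto hT hq.1.le hq.2.le hf).mul (Dp_tendsto hT hq.1.le hq.2.le hg))
  | tau s hf ih => exact ih.congr fun q hq => lim_tau hT hq.1.le hq.2.le hf s

lemma contDiffOn_lim_jet (hT : σ.AllGood g T) (n : ℕ) (γ : List σ.S) :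
    ContDiffOn ℝ n (σ.lim g ((σ.model g).jet γ)) (slab d T) := by
  induction n generalizing γ with
  | zero =>
    rw [Nat.cast_zero, contDiffOn_zero]
    exact fun q hq => (hasFDerivAt_lim_jet hT hq γ).continuousAt.continuousWithinAt
  | succ n ih =>
    rw [Nat.cast_succ, contDiffOn_succ_iff_fderiv_of_isOpen (isOpen_slab d T)]
    refine ⟨fun q hq => (hasFDerivAt_lim_jet hT hq γ).differentiableAt.differentiableWithinAt,
      by simp, ?_⟩
    obtain ⟨m, hm⟩ := Dp_dt_jet (σ := σ) (g := g) γ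
    exact (contDiff_stForm (fun i => ih (σ.ι i :: γ))
      (contDiffOn_lim_Dp (n := (n : ℕ∞)) hT ih hm)).congr fun q hq =>
        (hasFDerivAt_lim_jet hT hq γ).fderiv

/-- The limit of the discrete solutions. -/
def flow (σ : Stencil d Λ) (g : 𝔼 d → ℝ) :
    𝔼 d × ℝ → ℝ := σ.lim g (σ.model g).u

lemma contDiffOn_flow (hT : σ.AllGood g T) : ContDiffOn ℝ (⊤ : ℕ∞) (σ.flow g) (slab d T) :=
  contDiffOn_infty.2 fun n => contDiffOn_lim_jet hT n []

lemma flow_initial (hg : Continuous g) (x : 𝔼 d) :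
    σ.flow g (x, 0) = g x := by
  refine lim_eq ?_
  have h1 : Tendsto (fun N : ℕ => pt N fun i => ⌊((N : ℝ) + 1) * x i⌋)
      𝔲 (𝓝 x) := by
    have h2 := tendsto_pi_nhds.2 fun i => tendsto_floor_space (x i)
    exact ((PiLp.continuous_toLp 2 _).tendsto _).comp h2
  refine ((hg.tendsto x).comp h1).congr fun N => ?_
  change _ = σ.sol g N ⌊(0 : ℝ) / σ.kk N⌋₊ _
  rw [zero_div, Nat.floor_zero]; rfl

/-- Continuity up to the initial time. -/
lemma lim_jet_lip (hT : σ.AllGood g T) (γ : List σ.S) : ∃ C, 0 ≤ C ∧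
    ∀ q q' : 𝔼 d × ℝ, 0 ≤ q.2 → q.2 ≤ T → 0 ≤ q'.2 → q'.2 ≤ T →
      |σ.lim g ((σ.model g).jet γ) q' - σ.lim g ((σ.model g).jet γ) q| ≤ C * stDist q q' :=
  have h := FlowModel.Dp.jet (M := σ.model g) γ.length γ le_rfl
  lim_lip (Dp_bdd hT h) (Dp_lip hT h)

lemma lim_slope_initial (hT : σ.AllGood g T) (hT0 : 0 ≤ T) (hg : Differentiable ℝ g)
    (x : 𝔼 d) (i : Fin d) :
    σ.lim g ((σ.model g).jet [σ.ι i]) (x, 0) = fderiv ℝ g x (EuclideanSpace.single i 1) := by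
  have hγ := fun γ : List σ.S => FlowModel.Dp.jet (M := σ.model g) γ.length γ le_rfl
  obtain ⟨m, hm⟩ := Dp_dt_jet (σ := σ) (g := g) []
  obtain ⟨C, hC0, hC⟩ := lim_taylor (Dp_bdd hT (hγ [])) (fun i => Dp_bdd hT (hγ [σ.ι i]))
    (Dp_bdd hT hm) (fun i => Dp_lip hT (hγ [σ.ι i])) (Dp_lip hT hm)
  set A := ∑ i, σ.lim g ((σ.model g).jet [σ.ι i]) (x, 0) •
    (EuclideanSpace.proj i : 𝔼 d →L[ℝ] ℝ) with hA
  have h1 : HasFDerivAt g A x := by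
    refine hasFDerivAt_of_quadratic (C := C * (d + 1) ^ 2) (Eventually.of_forall fun y => ?_)
    have h := hC (x, 0) (y, 0) le_rfl hT0 le_rfl hT0
    have h2 := pow_le_pow_left₀ (stDist_nonneg (x, 0) (y, 0)) (stDist_le (x, (0:ℝ)) (y, 0)) 2
    have h3 : ‖((y, 0) : 𝔼 d × ℝ) - (x, 0)‖ = ‖y - x‖ := by
      rw [Prod.mk_sub_mk, Prod.norm_def]; simp
    rw [h3] at h2
    have e : ∀ z, σ.lim g ((σ.model g).jet []) (z, 0) = g z := fun z =>
      flow_initial hg.continuous z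
    rw [← e y, ← e x]
    calc _ = _ := by
          simp only [hA, ContinuousLinearMap.sum_apply, ContinuousLinearMap.smul_apply,
            PiLp.proj_apply, smul_eq_mul, PiLp.sub_apply, sub_self, mul_zero, sub_zero]
          rfl
      _ ≤ _ := h
      _ ≤ C * ((d + 1) * ‖y - x‖) ^ 2 := mul_le_mul_of_nonneg_left h2 hC0
      _ = _ := by ring
  rw [h1.fderiv, hA]
  simp [ContinuousLinearMap.sum_apply, EuclideanSpace.single_apply]

end Stencil

/-- Periodicity with respect to the lattice `R ℤ^d`. -/
def IsPer {d : ℕ} (R : ℕ) (F : 𝔼 d → ℝ) : Prop :=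
  ∀ (y : 𝔼 d) (e : Fin d → ℤ),
    F (y + WithLp.toLp 2 fun i => (R : ℝ) * e i) = F y

/-- The period cell. -/
def cell (d R : ℕ) : Set (𝔼 d) :=
  WithLp.toLp 2 '' Set.pi univ fun _ => Icc (0 : ℝ) R

lemma isCompact_cell (d R : ℕ) : IsCompact (cell d R) :=
  (isCompact_univ_pi fun _ => isCompact_Icc).image (PiLp.continuous_toLp 2 _)

lemma exists_mem_cell {d R : ℕ} (hR : 0 < R) (y : 𝔼 d) :
    ∃ e : Fin d → ℤ, (y + WithLp.toLp 2 fun i => (R : ℝ) * e i) ∈ cell d R := by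
  have hR' : (0 : ℝ) < R := by exact_mod_cast hR
  refine ⟨fun i => -⌊y i / R⌋, fun i => y i + R * ((-⌊y i / R⌋ : ℤ) : ℝ), fun i _ => ?_, rfl⟩
  have h1 := Int.floor_le (y i / R)
  have h2 := Int.lt_floor_add_one (y i / R)
  rw [le_div_iff₀ hR'] at h1
  rw [div_lt_iff₀ hR'] at h2
  push_cast
  constructor <;> nlinarith

lemma IsPer.bounded {d R : ℕ} (hR : 0 < R) {F : 𝔼 d → ℝ} (hF : IsPer R F)
    (hc : Continuous F) : ∃ C, ∀ y, |F y| ≤ C := by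
  obtain ⟨C, hC⟩ := (isCompact_cell d R).exists_bound_of_continuousOn hc.continuousOn
  refine ⟨C, fun y => ?_⟩
  obtain ⟨e, he⟩ := exists_mem_cell hR y
  rw [← hF y e]; exact hC _ he

lemma IsPer.fderiv {d R : ℕ} {F : 𝔼 d → ℝ} (hF : IsPer R F)
    (v : 𝔼 d) : IsPer R fun y => fderiv ℝ F y v := by
  intro y e
  have h : (fun z => F (z + WithLp.toLp 2 fun i => (R : ℝ) * e i)) = F := funext fun z => hF z e
  have := fderiv_comp_add_right (𝕜 := ℝ) (f := F) (x := y) (WithLp.toLp 2 fun i => (R : ℝ) * e i)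
  change _root_.fderiv ℝ F _ v = _root_.fderiv ℝ F y v
  rw [← this, h]

namespace Stencil

variable {d : ℕ} {Λ : ℝ} {σ : Stencil d Λ} {g : 𝔼 d → ℝ} {T : ℝ}

section InitialJets

/-- The direction of a stencil element as a vector. -/
def vec (σ : Stencil d Λ) (s : σ.S) : 𝔼 d :=
  WithLp.toLp 2 fun i => (σ.dir s i : ℝ)

/-- Iterated difference quotients of a function. -/
def dq (σ : Stencil d Λ) (N : ℕ) (F : 𝔼 d → ℝ) :
    List σ.S → 𝔼 d → ℝ
  | [] => F
  | s :: γ => fun y => (N + 1) * (dq σ N F γ (y + (1 / (N + 1) : ℝ) • σ.vec s) - dq σ N F γ y)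

lemma hasDerivAt_dq {F : 𝔼 d → ℝ} (hF : Differentiable ℝ F)
    (v : 𝔼 d) (N : ℕ) (γ : List σ.S) (y : 𝔼 d) (t : ℝ) :
    HasDerivAt (fun t : ℝ => σ.dq N F γ (y + t • v))
      (σ.dq N (fun z => fderiv ℝ F z v) γ (y + t • v)) t := by
  induction γ generalizing y with
  | nil =>
    have h1 : HasDerivAt (fun t : ℝ => y + t • v) v t := by
      simpa using ((hasDerivAt_id t).smul_const v).const_add y
    exact (hF _).hasFDerivAt.comp_hasDerivAt t h1
  | cons s γ ih =>
    have := ((ih (y + (1 / (N + 1) : ℝ) • σ.vec s)).sub (ih y)).const_mul ((N : ℝ) + 1)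
    simp only [add_right_comm y] at this
    exact this

lemma dq_bounded {R : ℕ} (hR : 0 < R) (γ : List σ.S) {F : 𝔼 d → ℝ}
    (hF : ContDiff ℝ (⊤ : ℕ∞) F) (hp : IsPer R F) : ∃ C, ∀ N y, |σ.dq N F γ y| ≤ C := by
  induction γ generalizing F with
  | nil =>
    obtain ⟨C, hC⟩ := hp.bounded hR hF.continuous
    exact ⟨C, fun _ => hC⟩
  | cons s γ ih =>
    obtain ⟨C, hC⟩ := ih (F := fun z => fderiv ℝ F z (σ.vec s))
      ((hF.fderiv_right (m := (⊤ : ℕ∞)) le_rfl).clm_apply contDiff_const) (hp.fderiv _)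
    refine ⟨C, fun N y => ?_⟩
    have hN : (0 : ℝ) < N + 1 := by positivity
    have hd := hasDerivAt_dq (hF.differentiable (by simp)) (σ.vec s) N γ y
    have h1 := Convex.norm_image_sub_le_of_norm_hasDerivWithin_le (s := univ)
      (f := fun t : ℝ => σ.dq N F γ (y + t • σ.vec s)) (x := 0) (y := 1 / (N + 1)) (C := C)
      (fun t _ => (hd t).hasDerivWithinAt) (fun t _ => hC N _) convex_univ (mem_univ _) (mem_univ _)
    simp only [zero_smul, add_zero, sub_zero] at h1
    rw [Real.norm_eq_abs, Real.norm_eq_abs, abs_of_pos (by positivity : (0 : ℝ) < 1 / (N + 1))]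
      at h1
    change |((N : ℝ) + 1) * _| ≤ C
    rw [abs_mul, abs_of_pos hN]
    refine (mul_le_mul_of_nonneg_left h1 hN.le).trans (le_of_eq ?_)
    field_simp

lemma pt_add (N : ℕ) (x y : Fin d → ℤ) :
    pt N (x + y) = pt N x + (1 / (N + 1) : ℝ) • WithLp.toLp 2 fun i => (y i : ℝ) := by
  ext i
  simp only [pt, Pi.add_apply, PiLp.add_apply, PiLp.smul_apply, smul_eq_mul]
  push_cast; ring

lemma jet_zero_eq (N : ℕ) (γ : List σ.S) (x : Fin d → ℤ) :
    (σ.model g).jet γ (N, 0, x) = σ.dq N g γ (pt N x) := by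
  induction γ generalizing x with
  | nil => rfl
  | cons s γ ih =>
    change ((N : ℝ) + 1) * ((σ.model g).jet γ (N, 0, x + σ.dir s) - (σ.model g).jet γ (N, 0, x)) = _
    rw [ih, ih, pt_add]
    rfl

lemma initial_jetBd {R : ℕ} (hR : 0 < R) (hg : ContDiff ℝ (⊤ : ℕ∞) g) (hp : IsPer R g) (m : ℕ) :
    ∃ b, ∀ N, (σ.model g).JetBd (σ.slice g N 0) m b := by
  choose C hC using fun γ : List σ.S => dq_bounded (σ := σ) hR γ hg hp
  have hfin : {γ : List σ.S | γ.length ≤ m}.Finite := List.finite_length_le _ m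
  obtain ⟨b, hb⟩ := (hfin.image C).bddAbove
  refine ⟨b, fun N z hz γ hγ => ?_⟩
  obtain ⟨N', n, x⟩ := z
  obtain ⟨rfl, rfl⟩ := hz
  change |(σ.model g).jet γ (N', 0, x)| ≤ b
  rw [jet_zero_eq]
  exact (hC γ N' _).trans (hb ⟨γ, hγ, rfl⟩)

lemma initial_slope (hg : Differentiable ℝ g) {K : ℝ}
    (hK : ∀ y i, |fderiv ℝ g y (EuclideanSpace.single i 1)| ≤ K) (N : ℕ) : σ.SlopeLe g N 0 K := by
  intro x i
  have h0 : (σ.model g).p i (N, 0, x) = (N + 1) * (g (pt N x + (1 / (N + 1) : ℝ) •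
      EuclideanSpace.single i 1) - g (pt N x)) := by
    change (σ.model g).jet [σ.ι i] (N, 0, x) = _
    rw [jet_zero_eq]
    have : σ.vec (σ.ι i) = EuclideanSpace.single i 1 := by
      ext j
      simp [vec, σ.dir_ι, Pi.single_apply]
    change ((N : ℝ) + 1) * (g (pt N x + (1 / (N + 1) : ℝ) • σ.vec (σ.ι i)) - g (pt N x)) = _
    rw [this]
  have hN : (0 : ℝ) < N + 1 := by positivity
  have hd : ∀ t : ℝ, HasDerivAt (fun t : ℝ => g (pt N x + t • EuclideanSpace.single i 1))
      (fderiv ℝ g (pt N x + t • EuclideanSpace.single i 1) (EuclideanSpace.single i 1)) t := by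
    intro t
    have h1 : HasDerivAt (fun t : ℝ => pt N x + t • EuclideanSpace.single i (1 : ℝ))
        (EuclideanSpace.single i 1) t := by
      simpa using ((hasDerivAt_id t).smul_const (EuclideanSpace.single i (1 : ℝ))).const_add (pt N x)
    exact (hg _).hasFDerivAt.comp_hasDerivAt t h1
  have h1 := Convex.norm_image_sub_le_of_norm_hasDerivWithin_le (s := univ)
    (f := fun t : ℝ => g (pt N x + t • EuclideanSpace.single i 1)) (x := 0) (y := 1 / (N + 1))
    (C := K) (fun t _ => (hd t).hasDerivWithinAt) (fun t _ => hK _ i) convex_univ (mem_univ _)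
    (mem_univ _)
  simp only [zero_smul, add_zero, sub_zero] at h1
  rw [Real.norm_eq_abs, Real.norm_eq_abs, abs_of_pos (by positivity : (0 : ℝ) < 1 / (N + 1))]
    at h1
  rw [h0, abs_mul, abs_of_pos hN]
  refine (mul_le_mul_of_nonneg_left h1 hN.le).trans (le_of_eq ?_)
  field_simp

end InitialJets

lemma Good.mono {T' : ℝ} (h : σ.Good g T) (hT : T' ≤ T) : σ.Good g T' := by
  obtain ⟨B, hB⟩ := h
  exact ⟨B, hB.mono fun N hN n hn => hN n (hn.trans hT)⟩

lemma Good.all {R : ℕ} (hR : 0 < R) (hg : ContDiff ℝ (⊤ : ℕ∞) g) (hp : IsPer R g)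
    (h : σ.Good g T) : σ.AllGood g T := by
  intro m
  obtain ⟨b, hb⟩ := h
  obtain ⟨B, hB⟩ := exists_jet_bound σ g b T (initial_jetBd hR hg hp) m
  exact ⟨B, hb.mono fun N hN n hn => ⟨hB N hN n hn, (hN n hn).2⟩⟩

lemma good_zero {R : ℕ} (hR : 0 < R) (hg : ContDiff ℝ (⊤ : ℕ∞) g) (hp : IsPer R g)
    (hK : ∀ y i, |fderiv ℝ g y (EuclideanSpace.single i 1)| ≤ Λ - 1) :
    ∃ T, 0 < T ∧ σ.Good g T := by
  obtain ⟨b, hb⟩ := initial_jetBd (σ := σ) hR hg hp 3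
  obtain ⟨T, hT, B, hB⟩ := exists_short_time σ g b
  refine ⟨T, hT, B, Eventually.of_forall fun N n hn => ?_⟩
  have := hB N 0 (hb N) (initial_slope (hg.differentiable (by simp)) hK N) n hn
  rwa [zero_add] at this

lemma jet_periodic {R : ℕ} (hp : IsPer R g) (γ : List σ.S) (N n : ℕ) (x e : Fin d → ℤ) :
    (σ.model g).jet γ (N, n, x + fun i => (R * (N + 1) : ℤ) * e i)
      = (σ.model g).jet γ (N, n, x) := by
  induction γ generalizing x with
  | nil => exact sol_periodic hp N n x e
  | cons s γ ih =>
    change ((N : ℝ) + 1) * ((σ.model g).jet γ (N, n, _ + σ.dir s) - (σ.model g).jet γ (N, n, _))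
      = (N + 1) * ((σ.model g).jet γ (N, n, x + σ.dir s) - (σ.model g).jet γ (N, n, x))
    rw [add_right_comm, ih, ih]

lemma lim_jet_periodic {R : ℕ} (hp : IsPer R g) (γ : List σ.S) (t : ℝ) :
    IsPer R fun x => σ.lim g ((σ.model g).jet γ) (x, t) := by
  intro y e
  refine congrArg ulim (funext fun N => ?_)
  have h := jet_periodic (σ := σ) hp γ N ⌊t / σ.kk N⌋₊ (fun i => ⌊((N : ℝ) + 1) * y i⌋) e
  refine Eq.trans ?_ h
  have : (fun i => ⌊((N : ℝ) + 1) * (y + WithLp.toLp 2 fun i => (R : ℝ) * e i) i⌋)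
      = (fun i => ⌊((N : ℝ) + 1) * y i⌋) + fun i => (R * (N + 1) : ℤ) * e i := by
    funext i
    rw [Pi.add_apply, ← Int.floor_add_intCast]
    congr 1
    simp only [PiLp.add_apply]
    push_cast; ring
  unfold node
  dsimp only
  rw [this]

lemma eventually_jet_le {R : ℕ} (hR : 0 < R) (hp : IsPer R g) (hT : σ.AllGood g T) {t : ℝ}
    (h0 : 0 ≤ t) (ht : t ≤ T) (γ : List σ.S) {C ε : ℝ} (hε : 0 < ε)
    (h : ∀ x, |σ.lim g ((σ.model g).jet γ) (x, t)| ≤ C) :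
    ∀ᶠ N in 𝔲, ∀ x,
      |(σ.model g).jet γ (N, ⌊t / σ.kk N⌋₊, x)| ≤ C + ε := by
  by_contra hcon
  rw [← Ultrafilter.eventually_not] at hcon
  have hx : ∀ N, ∃ x : Fin d → ℤ, pt N x ∈ cell d R ∧
      ((¬ ∀ x, |(σ.model g).jet γ (N, ⌊t / σ.kk N⌋₊, x)| ≤ C + ε) →
        C + ε < |(σ.model g).jet γ (N, ⌊t / σ.kk N⌋₊, x)|) := by
    intro N
    obtain ⟨x, hx⟩ : ∃ x : Fin d → ℤ,
        ((¬ ∀ x, |(σ.model g).jet γ (N, ⌊t / σ.kk N⌋₊, x)| ≤ C + ε) →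
        C + ε < |(σ.model g).jet γ (N, ⌊t / σ.kk N⌋₊, x)|) := by
      by_cases hh : ∀ x, |(σ.model g).jet γ (N, ⌊t / σ.kk N⌋₊, x)| ≤ C + ε
      · exact ⟨0, fun h => absurd hh h⟩
      · push Not at hh
        obtain ⟨x, hx⟩ := hh
        exact ⟨x, fun _ => hx⟩
    obtain ⟨e, he⟩ := exists_mem_cell hR (pt N x)
    refine ⟨x + fun i => (R * (N + 1) : ℤ) * e i, ?_, fun hh => by
      rw [jet_periodic hp]; exact hx hh⟩
    have : pt N (x + fun i => (R * (N + 1) : ℤ) * e i)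
        = pt N x + WithLp.toLp 2 fun i => (R : ℝ) * e i := by
      rw [pt_add]
      congr 1
      ext i
      have hN : ((N : ℝ) + 1) ≠ 0 := by positivity
      simp only [PiLp.smul_apply, smul_eq_mul]
      push_cast; field_simp
    rw [this]; exact he
  choose x hxc hx using hx
  obtain ⟨y, -, hy⟩ := (isCompact_cell d R).ultrafilter_le_nhds
    ((hyperfilter ℕ).map fun N => pt N (x N)) (by
      rw [le_principal_iff]
      exact Filter.mem_map.2 (Eventually.of_forall hxc))
  have hy' : Tendsto (fun N => pt N (x N)) 𝔲 (𝓝 y) := hy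
  have hγ := FlowModel.Dp.jet (M := σ.model g) γ.length γ le_rfl
  obtain ⟨C', hC0, hC⟩ := (Dp_lip hT hγ).two_point
  have h1 : Tendsto (fun N => (latNorm (x N - (σ.node N (y, t)).2.2) : ℝ) / (N + 1))
      𝔲 (𝓝 0) := by
    have hi : ∀ i, Tendsto (fun N => |((x N - (σ.node N (y, t)).2.2) i : ℝ) / (N + 1)|)
        𝔲 (𝓝 0) := by
      intro i
      have h2 : Tendsto (fun N => pt N (x N) i) 𝔲 (𝓝 (y i)) :=
        (((PiLp.continuous_ofLp 2 _).tendsto y).comp hy').apply_nhds i |>.congr fun _ => rfl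
      have h3 := (h2.sub (tendsto_floor_space (y i))).abs
      rw [sub_self, abs_zero] at h3
      refine h3.congr fun N => ?_
      congr 1
      change (x N i : ℝ) / (N + 1) - _ = ((x N i - ⌊((N : ℝ) + 1) * y i⌋ : ℤ) : ℝ) / (N + 1)
      push_cast; ring
    have h4 := tendsto_finsetSum Finset.univ fun i (_ : i ∈ Finset.univ) => hi i
    rw [Finset.sum_const_zero] at h4
    refine h4.congr fun N => ?_
    rw [latNorm]; push_cast
    rw [Finset.sum_div]
    refine sum_congr rfl fun i _ => ?_
    rw [abs_div, abs_of_pos (by positivity : (0 : ℝ) < N + 1), Nat.cast_natAbs, Int.cast_abs]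
  have h2 : Tendsto (fun N => (σ.model g).jet γ (N, ⌊t / σ.kk N⌋₊, x N)
      - (σ.model g).jet γ (σ.node N (y, t))) 𝔲 (𝓝 0) := by
    refine squeeze_zero_norm' (hC.mono fun N hN => ?_) (by simpa using h1.const_mul C')
    have := hN (σ.node N (y, t)).2.1 0 (σ.node N (y, t)).2.2 (x N - (σ.node N (y, t)).2.2)
      (node_time h0 ht)
    rw [add_sub_cancel, Nat.cast_zero, zero_mul, add_zero] at this
    refine this.trans (le_of_eq ?_)
    rw [add_zero]
  have h3 := (h2.add (Dp_tendsto hT (q := (y, t)) h0 ht hγ)).abs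
  simp only [sub_add_cancel, zero_add] at h3
  have h4 := h3.eventually_lt_const (lt_of_le_of_lt (h y) (lt_add_of_pos_right C hε))
  obtain ⟨N, hN1, hN2⟩ := (h4.and hcon).exists
  exact absurd (hx N hN2) (not_lt.2 hN1.le)

/-- Extension of the control window from bounds on the limit. -/
lemma good_extend {R : ℕ} (hR : 0 < R) (hp : IsPer R g) (b : ℝ) : ∃ T0, 0 < T0 ∧
    ∀ T t, σ.AllGood g T → 0 ≤ t → t ≤ T →
      (∀ γ : List σ.S, γ.length ≤ 3 → ∀ x, |σ.lim g ((σ.model g).jet γ) (x, t)| ≤ b) →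
      (∀ i x, |σ.lim g ((σ.model g).jet [σ.ι i]) (x, t)| ≤ Λ - 2) → σ.Good g (t + T0) := by
  obtain ⟨T0, hT0, B, hB⟩ := exists_short_time σ g (b + 1)
  refine ⟨T0 / 2, by positivity, fun T t hT h0 ht hj hs => ?_⟩
  obtain ⟨B', hB'⟩ := hT 3
  refine ⟨max B B', ?_⟩
  have hfin : {γ : List σ.S | γ.length ≤ 3}.Finite := List.finite_length_le _ 3
  have e1 := (hfin.eventually_all (l := 𝔲)).2 fun γ hγ =>
    eventually_jet_le hR hp hT h0 ht γ one_pos (hj γ hγ)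
  have e2 := eventually_all.2 fun i => eventually_jet_le hR hp hT h0 ht [σ.ι i] one_pos (hs i)
  have e3 := (tendsto_kk (σ := σ)).eventually_lt_const (half_pos hT0)
  filter_upwards [hB', e1, e2, e3] with N w1 w2 w3 w4 n hn
  set n₀ := ⌊t / σ.kk N⌋₊ with hn₀
  have hk := σ.kk_pos N
  rcases le_total n n₀ with hle | hle
  · have h1 : (n : ℝ) * σ.kk N ≤ T :=
      (mul_le_mul_of_nonneg_right (by exact_mod_cast hle) hk.le).trans (node_time h0 ht)
    exact ⟨(w1 n h1).1.mono le_rfl (le_max_right _ _), (w1 n h1).2⟩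
  · obtain ⟨j, rfl⟩ := Nat.exists_eq_add_of_le hle
    have h1 := Nat.lt_floor_add_one (t / σ.kk N)
    rw [div_lt_iff₀ hk, ← hn₀] at h1
    have h2 : (j : ℝ) * σ.kk N ≤ T0 := by push_cast at hn; nlinarith
    have h3 := hB N n₀ ((forall_slice σ g).2 fun x γ hγ => w2 γ hγ x)
      (fun x i => (w3 i x).trans (by linarith)) j h2
    exact ⟨h3.1.mono le_rfl (le_max_left _ _), h3.2⟩

end Stencil

section SmoothRing

variable {V : Type} [NormedAddCommGroup V] [NormedSpace ℝ V] {O : Set V}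

/-- Extension by zero. -/
def extZ (f : O → ℝ) : V → ℝ := Function.extend Subtype.val f 0

lemma extZ_apply (f : O → ℝ) (q : O) : extZ f q = f q :=
  Subtype.val_injective.extend_apply f 0 q

lemma extZ_of_mem (f : O → ℝ) {q : V} (hq : q ∈ O) : extZ f q = f ⟨q, hq⟩ :=
  extZ_apply f ⟨q, hq⟩

/-- Families of smooth functions on an open set. -/
def smSub (I : Type) (O : Set V) : Subalgebra ℝ (I → O → ℝ) where
  carrier := {f | ∀ i, ContDiffOn ℝ (⊤ : ℕ∞) (extZ (f i)) O}
  mul_mem' {f g} hf hg i := ((hf i).mul (hg i)).congr fun q hq => by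
    simp [extZ_of_mem _ hq]
  add_mem' {f g} hf hg i := ((hf i).add (hg i)).congr fun q hq => by
    simp [extZ_of_mem _ hq]
  algebraMap_mem' a i := (contDiffOn_const (c := a)).congr fun q hq => by
    rw [extZ_of_mem _ hq]; rfl

/-- The ring of families of smooth functions on an open set. -/
abbrev Sm (I : Type) (O : Set V) : Type := smSub I O

namespace Sm

variable {I : Type}

/-- The value of a member of the family, extended by zero. -/
def fn (f : Sm I O) (i : I) : V → ℝ := extZ (f.1 i)

lemma smooth (f : Sm I O) (i : I) : ContDiffOn ℝ (⊤ : ℕ∞) (f.fn i) O := f.2 i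

/-- Evaluation. -/
def ev (z : I × O) : Sm I O →ₐ[ℝ] ℝ :=
  ((Pi.evalAlgHom ℝ (fun _ : O => ℝ) z.2).comp (Pi.evalAlgHom ℝ (fun _ : I => O → ℝ) z.1)).comp
    (smSub I O).val

lemma fn_apply (f : Sm I O) (i : I) (q : O) : f.fn i q = ev (i, q) f := extZ_apply _ q

lemma ext_ev {f g : Sm I O} (h : ∀ z, ev z f = ev z g) : f = g :=
  Subtype.ext (funext fun i => funext fun q => h (i, q))

/-- Restriction of a family of smooth functions. -/
def ofFn (F : I → V → ℝ) (hF : ∀ i, ContDiffOn ℝ (⊤ : ℕ∞) (F i) O) : Sm I O :=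
  ⟨fun i q => F i q, fun i => (hF i).congr fun q hq => extZ_of_mem _ hq⟩

lemma ev_ofFn (F : I → V → ℝ) (hF : ∀ i, ContDiffOn ℝ (⊤ : ℕ∞) (F i) O) (z : I × O) :
    ev z (ofFn F hF) = F z.1 z.2 := rfl

lemma fn_ofFn (F : I → V → ℝ) (hF : ∀ i, ContDiffOn ℝ (⊤ : ℕ∞) (F i) O) (i : I) {q : V}
    (hq : q ∈ O) : (ofFn F hF).fn i q = F i q := extZ_of_mem _ hq

section Derivations

variable (hO : IsOpen O)

include hO

lemma differentiableAt (f : Sm I O) (i : I) {q : V} (hq : q ∈ O) :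
    DifferentiableAt ℝ (f.fn i) q :=
  ((f.smooth i).contDiffAt (hO.mem_nhds hq)).differentiableAt (by simp)

/-- The derivative in direction `w`. -/
def der (w : V) (f : Sm I O) : Sm I O := ofFn (fun i q => fderiv ℝ (f.fn i) q w) fun i =>
  ((f.smooth i).fderiv_of_isOpen (m := (⊤ : ℕ∞)) hO (by simp)).clm_apply contDiffOn_const

lemma ev_der (w : V) (f : Sm I O) (z : I × O) :
    ev z (der hO w f) = fderiv ℝ (f.fn z.1) z.2 w := rfl

lemma fderiv_fn_eq {f : Sm I O} {i : I} {F : V → ℝ} (h : ∀ q ∈ O, f.fn i q = F q) {q : V}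
    (hq : q ∈ O) : fderiv ℝ (f.fn i) q = fderiv ℝ F q :=
  (Filter.eventuallyEq_of_mem (hO.mem_nhds hq) h).fderiv_eq

/-- The derivative in direction `w` as a derivation. -/
def D (w : V) : Derivation ℝ (Sm I O) (Sm I O) := Derivation.mk'
  { toFun := der hO w
    map_add' := fun f g => ext_ev fun z => by
      rw [map_add]; simp only [ev_der]
      rw [fderiv_fn_eq hO (F := f.fn z.1 + g.fn z.1) (fun q hq => by
        simp [fn, extZ_of_mem _ hq]) z.2.2,
        fderiv_add (f.differentiableAt hO z.1 z.2.2) (g.differentiableAt hO z.1 z.2.2)]; rfl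
    map_smul' := fun a f => ext_ev fun z => by
      rw [map_smul]; simp only [ev_der]
      rw [fderiv_fn_eq hO (F := a • f.fn z.1) (fun q hq => by
        simp [fn, extZ_of_mem _ hq]) z.2.2,
        fderiv_const_smul (f.differentiableAt hO z.1 z.2.2)]; rfl }
  fun f g => ext_ev fun z => by
    simp only [LinearMap.coe_mk, AddHom.coe_mk, smul_eq_mul, map_add, map_mul, ev_der]
    rw [fderiv_fn_eq hO (F := f.fn z.1 * g.fn z.1) (fun q hq => by
        simp [fn, extZ_of_mem _ hq]) z.2.2,
        fderiv_mul (f.differentiableAt hO z.1 z.2.2) (g.differentiableAt hO z.1 z.2.2)]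
    simp [fn_apply f z.1 z.2, fn_apply g z.1 z.2]

lemma ev_D (w : V) (f : Sm I O) (z : I × O) :
    ev z (D hO w f) = fderiv ℝ (f.fn z.1) z.2 w := rfl

lemma fn_D (w : V) (f : Sm I O) (i : I) {q : V} (hq : q ∈ O) :
    (D hO w f).fn i q = fderiv ℝ (f.fn i) q w := extZ_of_mem _ hq

lemma hasFDerivAt (f : Sm I O) (i : I) {q : V} (hq : q ∈ O) :
    HasFDerivAt (f.fn i) (fderiv ℝ (f.fn i) q) q := (f.differentiableAt hO i hq).hasFDerivAt

lemma D_comm (w w' : V) (f : Sm I O) : D hO w (D hO w' f) = D hO w' (D hO w f) := by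
  refine ext_ev fun z => ?_
  have hq := z.2.2
  have hd : DifferentiableAt ℝ (fun q => fderiv ℝ (f.fn z.1) q) z.2 :=
    (((f.smooth z.1).fderiv_of_isOpen (m := (⊤ : ℕ∞)) hO (by simp)).contDiffAt
      (hO.mem_nhds hq)).differentiableAt (by simp)
  have h : ∀ w w', ev z (D hO w (D hO w' f)) = fderiv ℝ (fderiv ℝ (f.fn z.1)) z.2 w w' := by
    intro w w'
    rw [ev_D, fderiv_fn_eq hO (fun q hq => fn_D hO w' f z.1 hq) hq]
    rw [fderiv_clm_apply hd (differentiableAt_const w')]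
    simp
  rw [h, h]
  exact (((f.smooth z.1).contDiffAt (hO.mem_nhds hq)).isSymmSndFDerivAt
    (by simp only [minSmoothness_of_isRCLikeNormedField]; exact WithTop.coe_le_coe.2 (le_top : (2 : ℕ∞) ≤ ⊤))) w w'

lemma D_smul (a : ℝ) (w : V) (f : Sm I O) : D hO (a • w) f = a • D hO w f :=
  ext_ev fun z => by rw [map_smul]; simp only [ev_D, map_smul]

lemma D_sum {ι : Type*} (s : Finset ι) (w : ι → V) (f : Sm I O) :
    D hO (∑ j ∈ s, w j) f = ∑ j ∈ s, D hO (w j) f :=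
  ext_ev fun z => by rw [map_sum]; simp only [ev_D, map_sum]

/-- The derivative along a line. -/
lemma hasDerivAt_line (f : Sm I O) (i : I) (q w : V) {r : ℝ} (h : q + r • w ∈ O) :
    HasDerivAt (fun r : ℝ => f.fn i (q + r • w)) ((D hO w f).fn i (q + r • w)) r := by
  have h1 : HasDerivAt (fun r : ℝ => q + r • w) w r := by
    simpa using ((hasDerivAt_id r).smul_const w).const_add q
  rw [fn_D hO w f i h]
  exact (f.hasFDerivAt hO i h).comp_hasDerivAt r h1

/-- First and second derivative tests at a minimum along a line. -/
lemma min_line {f : Sm I O} {z : I × O} {w : V}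
    (h : ∀ᶠ r : ℝ in 𝓝 0, f.fn z.1 z.2 ≤ f.fn z.1 (z.2 + r • w)) :
    ev z (D hO w f) = 0 ∧ 0 ≤ ev z (D hO w (D hO w f)) := by
  have hmem : ∀ᶠ r : ℝ in 𝓝 0, (z.2 : V) + r • w ∈ O := by
    have hc : Continuous fun r : ℝ => (z.2 : V) + r • w := by fun_prop
    exact hc.continuousAt.eventually_mem (hO.mem_nhds (by simp))
  set φ : ℝ → ℝ := fun r => f.fn z.1 (z.2 + r • w) with hφ
  have hmin : IsLocalMin φ 0 := h.mono fun r hr => by simpa [hφ] using hr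
  have hd : ∀ᶠ r : ℝ in 𝓝 0, deriv φ r = (D hO w f).fn z.1 (z.2 + r • w) :=
    hmem.mono fun r hr => (hasDerivAt_line hO f z.1 z.2 w hr).deriv
  have h0 : (z.2 : V) + (0 : ℝ) • w = z.2 := by simp
  have h1 : deriv φ 0 = ev z (D hO w f) := by rw [hd.self_of_nhds, h0, fn_apply]
  have h2 : deriv (deriv φ) 0 = ev z (D hO w (D hO w f)) := by
    rw [Filter.EventuallyEq.deriv_eq hd, (hasDerivAt_line hO (D hO w f) z.1 z.2 w (hmem.self_of_nhds)).deriv, h0,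
      fn_apply]
  have hz : deriv φ 0 = 0 := hmin.deriv_eq_zero
  refine ⟨h1 ▸ hz, ?_⟩
  by_contra hneg
  rw [← h2, not_le] at hneg
  have hmax : IsLocalMax φ 0 := isLocalMax_of_deriv_deriv_neg hneg hz
    (hasDerivAt_line hO f z.1 z.2 w (hmem.self_of_nhds)).continuousAt
  have hconst : φ =ᶠ[𝓝 0] fun _ => φ 0 := (hmin.and hmax).mono fun r hr => le_antisymm hr.2 hr.1
  have hconst' : deriv φ =ᶠ[𝓝 0] fun _ => (0 : ℝ) := by
    have := hconst.deriv
    simpa using this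
  rw [hconst'.deriv_eq] at hneg
  simp at hneg

/-- One-sided derivative test at a minimum. -/
lemma min_past {f : Sm I O} {z : I × O} {w : V}
    (h : ∀ᶠ r : ℝ in 𝓝[≤] 0, f.fn z.1 z.2 ≤ f.fn z.1 (z.2 + r • w)) : ev z (D hO w f) ≤ 0 := by
  have h0 : (z.2 : V) + (0 : ℝ) • w = z.2 := by simp
  have hd := hasDerivAt_line hO f z.1 z.2 w (r := 0) (by rw [h0]; exact z.2.2)
  rw [h0, fn_apply] at hd
  have ht := hd.hasDerivWithinAt (s := Iio 0)
  rw [hasDerivWithinAt_iff_tendsto_slope' (by simp)] at ht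
  refine le_of_tendsto ht ?_
  filter_upwards [h.filter_mono (nhdsWithin_mono 0 Iio_subset_Iic_self), self_mem_nhdsWithin]
    with r hr hr0
  rw [slope_def_field]
  have hr0 : r < 0 := hr0
  refine div_nonpos_of_nonneg_of_nonpos ?_ (by linarith)
  rw [h0]; linarith

end Derivations

end Sm

end SmoothRing

/-- A commutative ring with commuting derivations, together with a solution of the graphical mean
curvature flow equation. -/
structure GraphData (d : ℕ) (R : Type) [CommRing R] [Algebra ℝ R] where
  D : Fin d → Derivation ℝ R R
  Dt : Derivation ℝ R R
  D_comm : ∀ i j f, D i (D j f) = D j (D i f)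
  Dt_D : ∀ i f, Dt (D i f) = D i (Dt f)
  u : R
  ρ : R
  v : R
  v_mul_v : v * v = 1 + ∑ i, D i u * D i u
  ρ_mul : ρ * (1 + ∑ i, D i u * D i u) = 1
  dt_u : 2 * Dt u = 2 * ∑ i, D i (D i u) - ρ * ∑ i, D i u * D i (∑ j, D j u * D j u)

namespace GraphData

variable {d : ℕ} {R : Type} [CommRing R] [Algebra ℝ R] (G : GraphData d R)

/-- The carré du champ. -/
def Γ (f g : R) : R := ∑ i, G.D i f * G.D i g

/-- The Laplacian. -/
def Lap (f : R) : R := ∑ i, G.D i (G.D i f)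

/-- The squared slope. -/
def X : R := G.Γ G.u G.u

/-- Twice the linearised operator. -/
def P (f : R) : R :=
  2 * G.Dt f - 2 * G.Lap f + 2 * G.ρ * G.Γ G.u (G.Γ G.u f) - G.ρ * G.Γ G.X f

/-- The carré du champ of the linearised operator. -/
def GG (f g : R) : R := G.Γ f g - G.ρ * G.Γ G.u f * G.Γ G.u g

lemma Γ_comm (f g : R) : G.Γ f g = G.Γ g f := sum_congr rfl fun _ _ => mul_comm _ _

lemma Γ_add_right (f g k : R) : G.Γ f (g + k) = G.Γ f g + G.Γ f k := by
  simp only [Γ, map_add, mul_add, sum_add_distrib]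

lemma Γ_sub_right (f g k : R) : G.Γ f (g - k) = G.Γ f g - G.Γ f k := by
  simp only [Γ, map_sub, mul_sub, sum_sub_distrib]

lemma Γ_mul_right (f g k : R) : G.Γ f (g * k) = g * G.Γ f k + k * G.Γ f g := by
  simp only [Γ, Derivation.leibniz, smul_eq_mul, mul_sum, ← sum_add_distrib]
  exact sum_congr rfl fun _ _ => by ring

lemma Γ_const_right (f : R) {g : R} (hg : ∀ i, G.D i g = 0) : G.Γ f g = 0 := by
  simp [Γ, hg]

lemma Γ_add_left (f g k : R) : G.Γ (g + k) f = G.Γ g f + G.Γ k f := by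
  simp only [G.Γ_comm _ f, Γ_add_right]

lemma Γ_sub_left (f g k : R) : G.Γ (g - k) f = G.Γ g f - G.Γ k f := by
  simp only [G.Γ_comm _ f, Γ_sub_right]

lemma Γ_mul_left (f g k : R) : G.Γ (g * k) f = g * G.Γ k f + k * G.Γ g f := by
  simp only [G.Γ_comm _ f, Γ_mul_right]

lemma Γ_two_mul_right (f g : R) : G.Γ f (2 * g) = 2 * G.Γ f g := by
  rw [two_mul, Γ_add_right, two_mul]

lemma Γ_two_mul_left (f g : R) : G.Γ (2 * f) g = 2 * G.Γ f g := by
  rw [two_mul, Γ_add_left, two_mul]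

/-- Derivations commuting with the coordinate derivations. -/
def Comm (δ : Derivation ℝ R R) : Prop := ∀ i f, δ (G.D i f) = G.D i (δ f)

lemma comm_D (i : Fin d) : G.Comm (G.D i) := fun j f => G.D_comm i j f

lemma comm_Dt : G.Comm G.Dt := G.Dt_D

variable {G} in
lemma Comm.Γ {δ : Derivation ℝ R R} (h : G.Comm δ) (f g : R) :
    δ (G.Γ f g) = G.Γ (δ f) g + G.Γ f (δ g) := by
  simp only [GraphData.Γ, map_sum, Derivation.leibniz, smul_eq_mul, h _ _,
    ← sum_add_distrib]
  exact sum_congr rfl fun _ _ => by ring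

variable {G} in
lemma Comm.Lap {δ : Derivation ℝ R R} (h : G.Comm δ) (f : R) : δ (G.Lap f) = G.Lap (δ f) := by
  simp only [GraphData.Lap, map_sum, h _ _]

lemma Lap_mul (f g : R) : G.Lap (f * g) = f * G.Lap g + g * G.Lap f + 2 * G.Γ f g := by
  simp only [Lap, Γ, Derivation.leibniz, map_add, smul_eq_mul, mul_sum,
    ← sum_add_distrib]
  exact sum_congr rfl fun _ _ => by ring

lemma Lap_add (f g : R) : G.Lap (f + g) = G.Lap f + G.Lap g := by
  simp only [Lap, map_add, sum_add_distrib]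

lemma Lap_Γ (f g : R) :
    G.Lap (G.Γ f g) = G.Γ (G.Lap f) g + G.Γ f (G.Lap g) + 2 * ∑ i, G.Γ (G.D i f) (G.D i g) := by
  have h : ∀ i, G.D i (G.D i (G.Γ f g)) = G.Γ (G.D i (G.D i f)) g + G.Γ f (G.D i (G.D i g))
      + 2 * G.Γ (G.D i f) (G.D i g) := fun i => by
    rw [(G.comm_D i).Γ, map_add, (G.comm_D i).Γ, (G.comm_D i).Γ]; ring
  rw [Lap, sum_congr rfl fun i _ => h i, sum_add_distrib, sum_add_distrib,
    mul_sum]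
  congr 2
  · simp only [Γ, Lap, map_sum, sum_mul]; exact sum_comm
  · simp only [Γ, Lap, map_sum, mul_sum]; exact sum_comm

lemma dt_u' : 2 * G.Dt G.u = 2 * G.Lap G.u - G.ρ * G.Γ G.u G.X := G.dt_u

lemma ρ_mul' : G.ρ * (1 + G.X) = 1 := G.ρ_mul

lemma v_mul_v' : G.v * G.v = 1 + G.X := G.v_mul_v

/-- The squared norm of the Hessian. -/
def HH : R := ∑ i, G.Γ (G.D i G.u) (G.D i G.u)

lemma δ_ρ (δ : Derivation ℝ R R) : δ G.ρ = -(G.ρ * G.ρ) * δ G.X := by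
  have h := congrArg δ G.ρ_mul'
  simp only [Derivation.leibniz, map_add, smul_eq_mul, Derivation.map_one_eq_zero, zero_add] at h
  linear_combination G.ρ * h - δ G.ρ * G.ρ_mul'

lemma Γ_ρ (f : R) : G.Γ f G.ρ = -(G.ρ * G.ρ) * G.Γ f G.X := by
  simp only [Γ, δ_ρ, mul_sum]
  exact sum_congr rfl fun _ _ => by ring

lemma P_mul (f g : R) : G.P (f * g) = f * G.P g + g * G.P f - 4 * G.GG f g := by
  simp only [P, GG, Lap_mul, Γ_mul_right, Γ_add_right, Derivation.leibniz, smul_eq_mul]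
  ring

lemma P_add (f g : R) : G.P (f + g) = G.P f + G.P g := by
  simp only [P, Lap_add, Γ_add_right, map_add]
  ring

lemma P_neg (f : R) : G.P (-f) = -G.P f := by
  have h := G.P_add f (-f)
  have h0 : G.P 0 = 0 := by simpa using G.P_add 0 0
  rw [add_neg_cancel, h0] at h
  linear_combination -h

lemma P_sub (f g : R) : G.P (f - g) = G.P f - G.P g := by
  rw [sub_eq_add_neg, P_add, P_neg, sub_eq_add_neg]

lemma P_const {c : R} (hc : ∀ i, G.D i c = 0) (hc' : G.Dt c = 0) : G.P c = 0 := by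
  simp [P, Lap, Γ, hc, hc']

lemma P_u : G.P G.u = 0 := by
  rw [P, dt_u', ← X, G.Γ_comm G.X]; ring

lemma two_Dt_X : 2 * G.Dt G.X = 2 * G.Γ G.u (2 * G.Dt G.u) := by
  rw [X, G.comm_Dt.Γ, G.Γ_comm (G.Dt G.u), Γ_two_mul_right]; ring

lemma P_X : G.P G.X = -4 * G.HH + 2 * (G.ρ * G.Γ G.u G.X) ^ 2 - G.ρ * G.Γ G.X G.X := by
  have hL : G.Lap G.X = 2 * G.Γ G.u (G.Lap G.u) + 2 * G.HH := by
    rw [X, Lap_Γ, G.Γ_comm (G.Lap G.u), HH]; ring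
  rw [P, two_Dt_X, dt_u', hL, Γ_sub_right, Γ_two_mul_right, Γ_mul_right, Γ_ρ]
  ring

lemma GG_u_left (f : R) : G.GG G.u f = G.ρ * G.Γ G.u f := by
  rw [GG]; change _ - G.ρ * G.X * _ = _
  linear_combination -G.Γ G.u f * G.ρ_mul'

/-- The evolution of `(1 + |Du|²) s²` for `s = c - u`. -/
lemma P_slope_mul {c : R} (hc : ∀ i, G.D i c = 0) (hc' : G.Dt c = 0) :
    G.P ((1 + G.X) * ((c - G.u) * (c - G.u))) = -4 * G.X
      + (c - G.u) ^ 2 * (-4 * G.HH + 2 * (G.ρ * G.Γ G.u G.X) ^ 2 - G.ρ * G.Γ G.X G.X)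
      + 8 * (c - G.u) * G.ρ * G.Γ G.u G.X := by
  have h1 : ∀ i, G.D i (1 : R) = 0 := fun i => (G.D i).map_one_eq_zero
  have hs : G.P (c - G.u) = 0 := by rw [P_sub, G.P_const hc hc', P_u, sub_zero]
  have hΓ : ∀ f, G.Γ f c = 0 := fun f => G.Γ_const_right f hc
  have hΓ1 : ∀ f, G.Γ f 1 = 0 := fun f => G.Γ_const_right f h1
  rw [P_mul, P_mul, hs, P_add, G.P_const h1 (Derivation.map_one_eq_zero _), P_X]
  simp only [GG, Γ_mul_right, Γ_sub_right, Γ_sub_left, Γ_add_left, Γ_add_right, hΓ, hΓ1,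
    G.Γ_comm c, G.Γ_comm 1, G.Γ_comm G.X G.u]
  change _ = _
  rw [← X]
  linear_combination (4 * G.X + 4*G.X^2 - 4 * G.X -8 * (c - G.u) * G.Γ G.u G.X) * G.ρ_mul'

end GraphData

namespace GraphData

variable {d : ℕ} {R : Type} [CommRing R] [Algebra ℝ R] (G : GraphData d R)

section Second

variable {δ : Derivation ℝ R R} (hδ : G.Comm δ) (ht : ∀ f, δ (G.Dt f) = G.Dt (δ f))

include hδ

lemma δ_X : δ G.X = 2 * G.Γ G.u (δ G.u) := by
  rw [X, hδ.Γ, G.Γ_comm (δ G.u)]; ring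

lemma δ_ρ' : δ G.ρ = -2 * (G.ρ * G.ρ) * G.Γ G.u (δ G.u) := by
  rw [δ_ρ, G.δ_X hδ]; ring

include ht

lemma P_δu : G.P (δ G.u) = 2 * G.ρ ^ 2 * G.Γ G.u (δ G.u) * G.Γ G.u G.X
    - 2 * G.ρ * G.Γ (δ G.u) G.X := by
  have h := congrArg δ G.dt_u'
  rw [map_sub, Derivation.leibniz, Derivation.leibniz, Derivation.leibniz, hδ.Γ, hδ.Lap, ht,
    G.δ_ρ' hδ, G.δ_X hδ, Γ_two_mul_right] at h
  have h2 : δ (2 : R) = 0 := by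
    simpa using Derivation.map_natCast δ 2
  simp only [h2, smul_eq_mul] at h
  rw [P, G.Γ_comm G.X]
  linear_combination h

/-- The cubic expression in second derivatives. -/
def cub (e : R) : R := ∑ i, G.D i e * G.Γ (G.D i G.u) e

omit hδ ht in
lemma Γ_u_Γ (e : R) : G.Γ G.u (G.Γ e e) = 2 * G.Γ e (G.Γ G.u e) - 2 * G.cub e := by
  have h1 : G.Γ G.u (G.Γ e e) = 2 * ∑ i, ∑ j, G.D i G.u * (G.D i (G.D j e) * G.D j e) := by
    rw [Γ, mul_sum]
    refine sum_congr rfl fun i _ => ?_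
    rw [(G.comm_D i).Γ, G.Γ_comm e, ← two_mul, Γ, ← mul_sum]
    simp only [G.D_comm i]; ring
  have h2 : G.Γ e (G.Γ G.u e) = G.cub e
      + ∑ i, ∑ j, G.D i e * (G.D j G.u * G.D j (G.D i e)) := by
    rw [Γ, cub, ← sum_add_distrib]
    refine sum_congr rfl fun i _ => ?_
    rw [(G.comm_D i).Γ, mul_add, ← mul_sum]
    simp only [Γ]
  have h3 : ∑ i, ∑ j, G.D i e * (G.D j G.u * G.D j (G.D i e))
      = ∑ i, ∑ j, G.D i G.u * (G.D i (G.D j e) * G.D j e) := by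
    rw [sum_comm]
    exact sum_congr rfl fun i _ => sum_congr rfl fun j _ => by ring
  rw [h1, h2, h3]; ring

lemma P_δδu : G.P (δ (δ G.u)) =
    -(-2 * G.ρ ^ 2 * (G.Γ (δ G.u) (δ G.u) + G.Γ G.u (δ (δ G.u)))
      + 8 * G.ρ ^ 3 * G.Γ G.u (δ G.u) ^ 2) * G.Γ G.u G.X
    + 8 * G.ρ ^ 2 * G.Γ G.u (δ G.u) * G.Γ G.u (G.Γ G.u (δ G.u))
    + 4 * G.ρ ^ 2 * G.Γ G.u (δ G.u) * G.Γ (δ G.u) G.X - 2 * G.ρ * G.Γ (δ (δ G.u)) G.X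
    - 4 * G.ρ * G.Γ (δ G.u) (G.Γ G.u (δ G.u)) - 2 * G.ρ * G.Γ G.u (G.Γ (δ G.u) (δ G.u)) := by
  have h := congrArg δ (G.P_δu hδ ht)
  have h2 : δ (2 : R) = 0 := by
    simpa using Derivation.map_natCast δ 2
  simp only [P, map_sub, map_add, Derivation.leibniz, smul_eq_mul, hδ.Γ, hδ.Lap, ht, h2,
    G.δ_ρ' hδ, G.δ_X hδ, Γ_two_mul_right, Γ_two_mul_left, pow_two, Γ_add_right] at h
  rw [P]
  rw [G.Γ_comm (G.Γ G.u (δ G.u)) (δ G.u)] at h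
  simp only [G.Γ_comm G.X] at h ⊢
  linear_combination h

/-- The evolution of the second derivative in the moving direction `ξ + ρ σ Du`, at a point at
which `σ` vanishes. -/
lemma P_second {c : R} (hc : ∀ i, G.D i c = 0) (hc' : G.Dt c = 0) (φ : R →ₐ[ℝ] ℝ)
    (hσ : φ (c - δ G.u) = 0) :
    φ (G.P (2 * δ (δ G.u) + (c - δ G.u) * (4 * G.ρ * G.Γ G.u (δ G.u))
      + (c - δ G.u) * (c - δ G.u) * (G.ρ * G.ρ * G.Γ G.u G.X))) =
    φ (-2 * G.ρ * (2 * G.Γ (δ (δ G.u)) G.X - 4 * G.ρ * G.Γ G.u (δ G.u) * G.Γ (δ G.u) G.X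
        - G.ρ * G.Γ G.u G.X * (2 * G.Γ G.u (δ (δ G.u))
          - 4 * G.ρ * G.Γ G.u (δ G.u) * G.Γ G.u (δ G.u)))
      + 8 * G.ρ * (G.cub (δ G.u) - G.ρ * G.Γ G.u (δ G.u) * G.Γ (δ G.u) G.X)
      + 4 * G.ρ ^ 3 * G.Γ G.u (δ G.u) ^ 2 * G.Γ G.u G.X) := by
  have h1 : ∀ i, G.D i (4 : R) = 0 := fun i => by
    simpa using Derivation.map_natCast (G.D i) 4
  have h1' : ∀ i, G.D i (2 : R) = 0 := fun i => by
    simpa using Derivation.map_natCast (G.D i) 2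
  have h1t : G.Dt (2 : R) = 0 := by
    simpa using Derivation.map_natCast G.Dt 2
  have hs : G.P (c - δ G.u) = -(2 * G.ρ ^ 2 * G.Γ G.u (δ G.u) * G.Γ G.u G.X
    - 2 * G.ρ * G.Γ (δ G.u) G.X) := by
    rw [P_sub, G.P_const hc hc', G.P_δu hδ ht]; ring
  have hΓ : ∀ f, G.Γ f c = 0 := fun f => G.Γ_const_right f hc
  have hΓ4 : ∀ f, G.Γ f 4 = 0 := fun f => G.Γ_const_right f h1
  have hΓ2 : ∀ f, G.Γ f 2 = 0 := fun f => G.Γ_const_right f h1'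
  rw [P_add, P_add, P_mul, G.P_mul (c - δ G.u) (4 * G.ρ * G.Γ G.u (δ G.u)),
    G.P_mul ((c - δ G.u) * (c - δ G.u)), G.P_mul (c - δ G.u) (c - δ G.u),
    G.P_const h1' h1t, G.P_δδu hδ ht, hs, Γ_u_Γ]
  simp only [GG, Γ_mul_right, Γ_sub_right, Γ_sub_left, Γ_mul_left, Γ_add_left, Γ_add_right, hΓ,
    hΓ4, hΓ2, G.Γ_comm c, G.Γ_comm 4, G.Γ_comm 2, Γ_ρ, G.Γ_comm G.ρ, G.Γ_comm G.X,
    G.Γ_comm (G.Γ G.u (δ G.u)), map_add, map_sub, map_mul, map_neg, map_pow, map_ofNat, map_zero]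
  have hσ' : φ c = φ (δ G.u) := by rw [map_sub] at hσ; linarith
  rw [hσ']
  ring

end Second

end GraphData

section QuadraticForms

variable {d : ℕ}

lemma sq_form_le (w : Fin d → ℝ) (M : Fin d → Fin d → ℝ) :
    (∑ i, ∑ j, w i * w j * M i j) ^ 2 ≤ (∑ i, w i * w i) ^ 2 * ∑ i, ∑ j, M i j ^ 2 := by
  have h := Finset.sum_mul_sq_le_sq_mul_sq (Finset.univ : Finset (Fin d × Fin d))
    (fun ij => w ij.1 * w ij.2) (fun ij => M ij.1 ij.2)
  simp only [Fintype.sum_prod_type] at h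
  refine h.trans (le_of_eq ?_)
  congr 1
  rw [pow_two, Finset.sum_mul_sum]
  exact sum_congr rfl fun i _ => sum_congr rfl fun j _ => by ring

lemma sum_mul_mul_symm {U : Fin d → Fin d → ℝ} (hU : ∀ i j, U i j = U j i) (x y : Fin d → ℝ) :
    ∑ i, x i * ∑ j, U i j * y j = ∑ i, y i * ∑ j, U i j * x j := by
  simp only [mul_sum]
  rw [sum_comm]
  exact sum_congr rfl fun i _ => sum_congr rfl fun j _ => by rw [hU i j]; ring

lemma sum_sum_rank_one (F : Fin d → Fin d → ℝ) (x y : Fin d → ℝ) :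
    ∑ i, ∑ j, x i * y j * F i j = ∑ i, x i * ∑ j, F i j * y j := by
  simp only [mul_sum]
  exact sum_congr rfl fun i _ => sum_congr rfl fun j _ => by ring

/-- The norm of a symmetric matrix in the metric of the graph, and its compression. -/
lemma exists_compression {p a : Fin d → ℝ} {U : Fin d → Fin d → ℝ} {ν ρ N : ℝ}
    (hU : ∀ i j, U i j = U j i) (ha : ∀ i, a i = ∑ j, U i j * p j) (hN : N = ∑ i, p i * a i)
    (hν : 0 < ν) (hν2 : ν * ν = 1 + ∑ i, p i * p i) (hρ : ρ * (1 + ∑ i, p i * p i) = 1) :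
    ∃ M : Fin d → Fin d → ℝ,
      ∑ i, ∑ j, M i j ^ 2
        = (∑ i, ∑ j, U i j ^ 2) - 2 * ρ * (∑ i, a i * a i) + ρ ^ 2 * N ^ 2 ∧
      (∑ i, ∑ j, p i * p j * M i j = ρ * N) ∧
      ∀ (ξ : Fin d → ℝ) (e : ℝ), e = ∑ i, p i * ξ i → ∃ ω : Fin d → ℝ, (∑ i, ω i * ω i = (∑ i, ξ i * ξ i) + e * e) ∧
        ∑ i, ∑ j, ω i * ω j * M i j = ∑ i, ξ i * ∑ j, U i j * ξ j := by
  set X := ∑ i, p i * p i with hX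
  set β : ℝ := 1 / (ν * (ν + 1)) with hβ
  have hβ1 : β * (ν * (ν + 1)) = 1 := by rw [hβ]; field_simp
  have hXν : X = ν * ν - 1 := by linarith
  have hρν : ρ * (ν * ν) = 1 := by rw [hν2]; exact hρ
  have hρβ : ρ = 2 * β - β ^ 2 * X := by
    have h1 : β * ν * (ν + 1) = 1 := by linarith
    have : (2 * β - β ^ 2 * X) * (ν * ν) = 1 := by
      rw [hXν]
      have h2 : β ^ 2 * (ν * ν - 1) * (ν * ν) = (β * ν * (ν + 1)) * (β * ν * (ν - 1)) := by ring
      rw [sub_mul, h2, h1]; linear_combination h1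
    have hne : ν * ν ≠ 0 := by positivity
    exact mul_right_cancel₀ hne (hρν.trans this.symm)
  have hβX : 1 - β * X = β * ν * (1 + ν) - β * X := by linear_combination -hβ1
  have hsq : (1 - β * X) ^ 2 = ρ := by
    have h3 : 1 - β * X = β * (ν + 1) := by rw [hβX, hXν]; ring
    have h4 : (β * (ν + 1)) ^ 2 * (ν * ν) = 1 := by
      have : (β * (ν + 1)) ^ 2 * (ν * ν) = (β * (ν * (ν + 1))) ^ 2 := by ring
      rw [this, hβ1]; norm_num
    have hne : ν * ν ≠ 0 := by positivity
    rw [h3]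
    exact mul_right_cancel₀ hne (h4.trans hρν.symm)
  have hpU : ∑ i, p i * ∑ j, U i j * a j = ∑ i, a i * a i := by
    rw [sum_mul_mul_symm hU]; exact sum_congr rfl fun i _ => by rw [ha i]
  have haU : ∑ i, a i * ∑ j, U i j * p j = ∑ i, a i * a i :=
    sum_congr rfl fun i _ => by rw [ha i]
  have hpp : ∑ i, p i * ∑ j, U i j * p j = N := by
    rw [hN]; exact sum_congr rfl fun i _ => by rw [ha i]
  have hN' : ∑ i, a i * p i = N := by rw [hN]; exact sum_congr rfl fun i _ => mul_comm _ _
  refine ⟨fun i j => U i j - β * (p i * a j) - β * (a i * p j) + β ^ 2 * N * (p i * p j),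
    ?_, ?_, ?_⟩
  · have hexp : ∀ i j, (U i j - β * (p i * a j) - β * (a i * p j)
          + β ^ 2 * N * (p i * p j)) ^ 2
        = U i j ^ 2 + β ^ 2 * ((p i * p i) * (a j * a j)) + β ^ 2 * ((a i * a i) * (p j * p j))
          + β ^ 4 * N ^ 2 * ((p i * p i) * (p j * p j)) - 2 * β * (p i * a j * U i j)
          - 2 * β * (a i * p j * U i j) + 2 * β ^ 2 * N * (p i * p j * U i j)
          + 2 * β ^ 2 * ((p i * a i) * (p j * a j)) - 2 * β ^ 3 * N * ((p i * p i) * (p j * a j))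
          - 2 * β ^ 3 * N * ((p i * a i) * (p j * p j)) := fun i j => by ring
    simp only [hexp, sum_add_distrib, sum_sub_distrib, ← mul_sum]
    simp only [sum_sum_rank_one, hpU, haU, hpp, ← sum_mul, ← hX, ← hN]
    rw [hρβ]; ring
  · have hexp : ∀ i j, p i * p j * (U i j - β * (p i * a j) - β * (a i * p j)
          + β ^ 2 * N * (p i * p j))
        = p i * p j * U i j - β * ((p i * p i) * (p j * a j)) - β * ((p i * a i) * (p j * p j))
          + β ^ 2 * N * ((p i * p i) * (p j * p j)) := fun i j => by ring
    simp only [hexp, sum_add_distrib, sum_sub_distrib, ← mul_sum]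
    simp only [sum_sum_rank_one, hpp, ← sum_mul, ← hX, ← hN]
    rw [← hsq]; ring
  · intro ξ e he
    set γ : ℝ := 1 - β * (1 + X) with hγ
    have he' : ∑ i, ξ i * p i = e := by
      rw [he]; exact sum_congr rfl fun i _ => mul_comm _ _
    have hξa : ∑ i, ξ i * a i = ∑ i, p i * ∑ j, U i j * ξ j := by
      rw [← sum_mul_mul_symm hU]; exact sum_congr rfl fun i _ => by rw [ha i]
    have hξa' : ∑ i, ξ i * ∑ j, U i j * p j = ∑ i, ξ i * a i :=
      sum_congr rfl fun i _ => by rw [ha i]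
    -- `ω = ξ + γ e p` satisfies `ω - β (p·ω) p = ξ`
    have hγ1 : γ - β * (1 + γ * X) = 0 := by
      have h1 : (1 + X) = ν * ν := hν2.symm
      have h2 : β * ν * ν = 1 - β * ν := by linear_combination hβ1
      have h3 : γ = β * ν := by rw [hγ, h1]; linear_combination -h2
      rw [h3, hXν]
      have : β * (1 + β * ν * (ν * ν - 1)) = β * ν := by
        have : β * ν * (ν * ν - 1) = (β * (ν * (ν + 1))) * (ν - 1) := by ring
        rw [this, hβ1]; ring
      linarith
    have hγ2 : 2 * γ + γ ^ 2 * X = 1 := by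
      have h1 : (1 + X) = ν * ν := hν2.symm
      have h2 : β * ν * ν = 1 - β * ν := by linear_combination hβ1
      have h3 : γ = β * ν := by rw [hγ, h1]; linear_combination -h2
      rw [h3, hXν]
      linear_combination (1 + β * ν * ν - β * ν) * hβ1
    refine ⟨fun i => ξ i + γ * e * p i, ?_, ?_⟩
    · have hexp : ∀ i, (ξ i + γ * e * p i) * (ξ i + γ * e * p i)
          = ξ i * ξ i + 2 * γ * e * (p i * ξ i) + γ ^ 2 * e ^ 2 * (p i * p i) := fun i => by ring
      simp only [hexp, sum_add_distrib, ← mul_sum, ← he, ← hX]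
      linear_combination e ^ 2 * hγ2
    · have hexp : ∀ i j, (ξ i + γ * e * p i) * (ξ j + γ * e * p j) * (U i j - β * (p i * a j)
            - β * (a i * p j) + β ^ 2 * N * (p i * p j))
          = ξ i * ξ j * U i j + γ * e * (ξ i * p j * U i j) + γ * e * (p i * ξ j * U i j)
            + γ ^ 2 * e ^ 2 * (p i * p j * U i j)
            - β * ((p i * ξ i + γ * e * (p i * p i)) * (ξ j * a j + γ * e * (p j * a j)))
            - β * ((ξ i * a i + γ * e * (p i * a i)) * (p j * ξ j + γ * e * (p j * p j)))
            + β ^ 2 * N * ((p i * ξ i + γ * e * (p i * p i)) *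
              (p j * ξ j + γ * e * (p j * p j))) := fun i j => by ring
      simp only [hexp, sum_add_distrib, sum_sub_distrib, ← mul_sum]
      simp only [sum_sum_rank_one, hpp, ← sum_mul, sum_add_distrib,
        ← mul_sum, ← hX, ← hN, ← he, hξa', hξa]
      linear_combination (2 * e * (∑ i, p i * ∑ j, U i j * ξ j)
        + (γ - β * (1 + γ * X)) * e ^ 2 * N) * hγ1

end QuadraticForms

/-- The differential inequality at a maximum of the weighted second derivative. -/
lemma second_derivative_key {m k b ν ρ θ s ε q N X Ha aa pg ag M2 : ℝ}
    (hν0 : 0 < ν) (hθ : 0 < θ) (hs : 0 < s) (hρ : ρ * (1 + X) = 1)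
    (hH : 2 * m * b = ε * θ * s * (2 * q))
    (hpg : ε * θ * s * pg = ε * θ * (2 * q) * X - 2 * m * k * N / ν)
    (hag : ε * θ * s * ag = ε * θ * (2 * q) * N - 2 * m * k * aa / ν)
    (hP : 2 * m * (-(k * ((-2 * Ha + 2 * ρ ^ 2 * N ^ 2) / ν)) + b * (4 * ρ * q ^ 2))
      - ε * (2 * (s * (2 * q)) + θ * (s * (-2 * ρ * (2 * ag - 2 * ρ * N * pg) + 8 * ρ * q ^ 3)
        + 4 * ρ * pg)) ≤ 0)
    (hM2 : M2 = Ha - 2 * ρ * aa + ρ ^ 2 * N ^ 2) :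
    m * k / ν * M2 ≤ m * b / θ - 2 * m * b * N * ρ ^ 2 / s + 2 * ρ * m * b * X / s ^ 2
      - 2 * ρ * m * k * N / (ν * s) := by
  obtain ⟨y, hy⟩ : ∃ y, y * ν = 1 := ⟨ν⁻¹, inv_mul_cancel₀ hν0.ne'⟩
  obtain ⟨x, hx⟩ : ∃ x, x * s = 1 := ⟨s⁻¹, inv_mul_cancel₀ hs.ne'⟩
  obtain ⟨w, hw⟩ : ∃ w, w * θ = 1 := ⟨θ⁻¹, inv_mul_cancel₀ hθ.ne'⟩
  have hx' : s⁻¹ = x := by rw [← mul_left_inj' hs.ne', hx, inv_mul_cancel₀ hs.ne']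
  have hy' : ν⁻¹ = y := by rw [← mul_left_inj' hν0.ne', hy, inv_mul_cancel₀ hν0.ne']
  have hw' : θ⁻¹ = w := by rw [← mul_left_inj' hθ.ne', hw, inv_mul_cancel₀ hθ.ne']
  simp only [div_eq_mul_inv, mul_inv, hx', hy', hw', ← inv_pow] at hpg hag hP ⊢
  have h1 : ε * θ * q = m * b * x := by linear_combination -(ε * θ * q) * hx - x / 2 * hH
  have h2 : ε * s * q = m * b * w := by linear_combination -(ε * s * q) * hw - w / 2 * hH
  have e2 : ε * θ * pg = (2 * (m * b * x) * X - 2 * m * k * N * y) * x := by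
    linear_combination x * hpg - ε * θ * pg * hx + 2 * X * x * h1
  have h5 : ρ ^ 2 * X = ρ - ρ ^ 2 := by linear_combination ρ * hρ
  have e3 : ε * θ * s * ag = 2 * (m * b * x) * N - 2 * m * k * aa * y := by
    linear_combination hag + 2 * N * h1
  have e4 : ε * θ * s * pg = 2 * (m * b * x) * X - 2 * m * k * N * y := by
    linear_combination hpg + 2 * X * h1
  have e5 : 2 * m * (-(k * ((-2 * Ha + 2 * ρ ^ 2 * N ^ 2) * y)) + b * (4 * ρ * q ^ 2))
      - ε * (2 * (s * (2 * q)) + θ * (s * (-2 * ρ * (2 * ag - 2 * ρ * N * pg) + 8 * ρ * q ^ 3)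
        + 4 * ρ * pg)) = 4 * (m * k * y * M2 - (m * b * w - 2 * m * b * N * ρ ^ 2 * x
          + 2 * ρ * m * b * X * x ^ 2 - 2 * ρ * m * k * N * (y * x))) := by
    rw [hM2]
    linear_combination 4 * ρ * q ^ 2 * hH - 4 * h2 + 4 * ρ * e3 - 4 * ρ ^ 2 * N * e4
      - 4 * ρ * e2 - 8 * (m * b * x) * N * h5
  rw [e5] at hP
  linarith

lemma barrier_bounds {k b ν V : ℝ} (hν1 : 1 ≤ ν) (hνV : ν ≤ V) (hk : k = 1 / (2 * V))
    (hb : b = 1 - k * ν) : 0 < k ∧ 1 / 2 ≤ b ∧ b ≤ 1 ∧ 1 / (2 * V ^ 2) ≤ k / (ν * b) ∧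
      k / (ν * b) ≤ 1 := by
  have hV1 : 1 ≤ V := hν1.trans hνV
  have hν0 : 0 < ν := by linarith
  have hk0 : 0 < k := by rw [hk]; positivity
  have hkν : k * ν ≤ 1 / 2 := by
    rw [hk, div_mul_eq_mul_div, div_le_div_iff₀ (by positivity) (by norm_num)]; linarith
  have hb1 : 1 / 2 ≤ b := by linarith
  have hb2 : b ≤ 1 := by rw [hb]; linarith [mul_pos hk0 hν0]
  have hb0 : 0 < b := by linarith
  have h1 : ν * b ≤ V * 1 := mul_le_mul hνV hb2 hb0.le (by linarith)
  refine ⟨hk0, hb1, hb2, ?_, ?_⟩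
  · rw [hk, div_div, div_le_div_iff₀ (by positivity) (by positivity)]
    have h2 : 2 * V * (ν * b) ≤ 2 * V * (V * 1) := by gcongr
    linarith
  · rw [div_le_one (by positivity)]
    have h2 : 1 * (1 / 2) ≤ ν * b := mul_le_mul hν1 hb1 (by norm_num) hν0.le
    have h3 : k ≤ 1 / 2 := by
      rw [hk]; gcongr; linarith
    linarith

lemma second_derivative_absorb {ρ θ s N X V M2 κ : ℝ} (hV1 : 1 ≤ V) (hθ : 0 < θ) (hs : 0 < s)
    (hκ1 : 1 / (2 * V ^ 2) ≤ κ) (hκ2 : κ ≤ 1) (hρ0 : 0 ≤ ρ) (hρ1 : ρ ≤ 1) (hρX : ρ * X ≤ 1)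
    (hX : 0 ≤ X) (hXV : X ≤ V ^ 2) (hM20 : 0 ≤ M2) (hN : (ρ * N) ^ 2 ≤ X ^ 2 * M2)
    (key : κ * M2 ≤ 1 / θ - 2 * (ρ * N) * ρ / s + 2 * (ρ * X) / s ^ 2
      - 2 * (ρ * N) * κ / s) :
    M2 * (θ * s ^ 2) ≤ 4 * V ^ 2 * s ^ 2 + 72 * V ^ 8 * θ := by
  obtain ⟨A, hA0, hA2⟩ : ∃ A, 0 ≤ A ∧ A * A = M2 :=
    ⟨_, Real.sqrt_nonneg _, Real.mul_self_sqrt hM20⟩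
  have hB0 : 0 ≤ V ^ 2 * A := by positivity
  have hρN : |ρ * N| ≤ V ^ 2 * A := by
    refine abs_le_of_sq_le_sq ?_ hB0
    calc (ρ * N) ^ 2 ≤ X ^ 2 * M2 := hN
      _ ≤ (V ^ 2) ^ 2 * M2 := by gcongr
      _ = (V ^ 2 * A) ^ 2 := by rw [← hA2]; ring
  have hlow := (abs_le.1 hρN).1
  have hκ0 : 0 ≤ κ := le_trans (by positivity) hκ1
  have aux : ∀ y, 0 ≤ y → y ≤ 1 → -(2 * (ρ * N) * y / s) ≤ 2 * (V ^ 2 * A) / s := by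
    intro y hy0 hy1
    rw [← neg_div]; gcongr
    have h1 : -(ρ * N) * y ≤ (V ^ 2 * A) * y := by gcongr; linarith
    have h2 : (V ^ 2 * A) * y ≤ (V ^ 2 * A) * 1 := by gcongr
    linarith
  have h1 := aux ρ hρ0 hρ1
  have h2 := aux κ hκ0 hκ2
  have h3 : 2 * (ρ * X) / s ^ 2 ≤ 2 / s ^ 2 := by gcongr; linarith
  have h4 : 4 * (V ^ 2 * A) / s ≤ M2 / (4 * V ^ 2) + 16 * V ^ 6 / s ^ 2 := by
    have : 0 ≤ (A / (2 * V) - 4 * V ^ 3 / s) ^ 2 := sq_nonneg _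
    have e : (A / (2 * V) - 4 * V ^ 3 / s) ^ 2
        = M2 / (4 * V ^ 2) + 16 * V ^ 6 / s ^ 2 - 4 * (V ^ 2 * A) / s := by
      rw [← hA2]; field_simp; ring
    linarith
  have h5 : M2 / (4 * V ^ 2) ≤ 1 / θ + (2 + 16 * V ^ 6) / s ^ 2 := by
    have e1 : 1 / (2 * V ^ 2) * M2 = 2 * (M2 / (4 * V ^ 2)) := by field_simp; ring
    have e2 : 1 / (2 * V ^ 2) * M2 ≤ κ * M2 := by gcongr
    have e3 : (2 + 16 * V ^ 6) / s ^ 2 = 2 / s ^ 2 + 16 * V ^ 6 / s ^ 2 := by ring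
    have e4 : 4 * (V ^ 2 * A) / s = 2 * (V ^ 2 * A) / s + 2 * (V ^ 2 * A) / s := by ring
    linarith
  rw [div_le_iff₀ (by positivity)] at h5
  have e : (1 / θ + (2 + 16 * V ^ 6) / s ^ 2) * (4 * V ^ 2) * (θ * s ^ 2)
      = 4 * V ^ 2 * s ^ 2 + (8 * V ^ 2 + 64 * V ^ 8) * θ := by field_simp; ring
  have h7 := mul_le_mul_of_nonneg_right h5 (show 0 ≤ θ * s ^ 2 by positivity)
  rw [e] at h7
  have h8 : V ^ 2 * θ ≤ V ^ 8 * θ := by gcongr; norm_num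
  linarith

/-- The real inequality behind the interior estimate for second derivatives. -/
lemma second_derivative_arith {m k b ν ρ θ s ε q N X Ha aa pg ag V M2 : ℝ}
    (hm : 0 < m) (hν1 : 1 ≤ ν) (hνV : ν ≤ V) (hk : k = 1 / (2 * V)) (hb : b = 1 - k * ν)
    (hθ : 0 < θ) (hs : 0 < s) (hε : ε * ε = 1) (hν : ν * ν = 1 + X) (hρ : ρ * (1 + X) = 1)
    (hX : 0 ≤ X)
    (hH : 2 * m * b = ε * θ * s * (2 * q))
    (hpg : ε * θ * s * pg = ε * θ * (2 * q) * X - 2 * m * k * N / ν)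
    (hag : ε * θ * s * ag = ε * θ * (2 * q) * N - 2 * m * k * aa / ν)
    (hP : 2 * m * (-(k * ((-2 * Ha + 2 * ρ ^ 2 * N ^ 2) / ν)) + b * (4 * ρ * q ^ 2))
      - ε * (2 * (s * (2 * q)) + θ * (s * (-2 * ρ * (2 * ag - 2 * ρ * N * pg) + 8 * ρ * q ^ 3)
        + 4 * ρ * pg)) ≤ 0)
    (hM2 : M2 = Ha - 2 * ρ * aa + ρ ^ 2 * N ^ 2) (hq : q ^ 2 ≤ M2)
    (hN : (ρ * N) ^ 2 ≤ X ^ 2 * M2) :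
    m ^ 2 ≤ 4 * (4 * V ^ 2 * (θ * s ^ 2) + 72 * V ^ 8 * θ ^ 2) := by
  have hν0 : 0 < ν := by linarith
  have key := second_derivative_key hν0 hθ hs hρ hH hpg hag hP hM2
  clear hP hpg hag
  obtain ⟨hk0, hb1, hb2, hκ1, hκ2⟩ := barrier_bounds hν1 hνV hk hb
  have hρ' : ρ = 1 / (1 + X) := by rw [eq_div_iff (by positivity)]; exact hρ
  have hρ0 : 0 < ρ := by rw [hρ']; positivity
  have hρX0 : 0 ≤ ρ * X := by positivity
  have hM20 : 0 ≤ M2 := (sq_nonneg q).trans hq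
  have hb0 : 0 < b := by linarith
  have hXV : X ≤ V ^ 2 := by
    have : ν * ν ≤ V * V := mul_le_mul hνV hνV hν0.le (by linarith)
    rw [pow_two]; linarith
  have hmb : 0 < m * b := by positivity
  have h6 := second_derivative_absorb (hν1.trans hνV) hθ hs hκ1 hκ2 hρ0.le (by linarith)
    (by linarith) hX hXV hM20 hN (by
      refine le_of_mul_le_mul_left ?_ hmb
      refine (le_of_eq ?_).trans (key.trans (le_of_eq ?_))
      · field_simp
      · field_simp)
  have h7 : (m * b) ^ 2 = θ ^ 2 * s ^ 2 * q ^ 2 := by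
    have : m * b = ε * θ * s * q := by linarith
    rw [this]
    linear_combination (θ ^ 2 * s ^ 2 * q ^ 2) * hε
  have h8 : m ^ 2 ≤ 4 * (m * b) ^ 2 := by
    have h1 : (1 / 2) ^ 2 ≤ b ^ 2 := by gcongr
    have h2 := mul_le_mul_of_nonneg_left h1 (sq_nonneg m)
    rw [mul_pow]; linarith
  have h9 : θ ^ 2 * s ^ 2 * q ^ 2 ≤ θ * (M2 * (θ * s ^ 2)) := by
    have : θ * (M2 * (θ * s ^ 2)) = θ ^ 2 * s ^ 2 * M2 := by ring
    rw [this]; gcongr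
  have h10 := mul_le_mul_of_nonneg_left h6 hθ.le
  calc m ^ 2 ≤ 4 * (m * b) ^ 2 := h8
    _ ≤ 4 * (θ * (4 * V ^ 2 * s ^ 2 + 72 * V ^ 8 * θ)) := by rw [h7]; linarith
    _ = _ := by ring

namespace GraphData

variable {d : ℕ} {R : Type} [CommRing R] [Algebra ℝ R] (G : GraphData d R)

/-- Elements annihilated by all derivations. -/
def Cst (f : R) : Prop := (∀ i, G.D i f = 0) ∧ G.Dt f = 0

lemma Cst.algebraMap (a : ℝ) : G.Cst (algebraMap ℝ R a) :=
  ⟨fun i => (G.D i).map_algebraMap a, G.Dt.map_algebraMap a⟩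

variable {G} in
lemma Cst.P_mul {c : R} (hc : G.Cst c) (f : R) : G.P (c * f) = c * G.P f := by
  have h : G.Γ c f = 0 := by rw [Γ_comm, G.Γ_const_right f hc.1]
  rw [GraphData.P_mul, G.P_const hc.1 hc.2, GG, h, G.Γ_const_right _ hc.1]; ring

variable {G} in
lemma Cst.P {c : R} (hc : G.Cst c) : G.P c = 0 := G.P_const hc.1 hc.2

lemma cst_one : G.Cst 1 := ⟨fun i => (G.D i).map_one_eq_zero, G.Dt.map_one_eq_zero⟩

lemma v_mul_δ (δ : Derivation ℝ R R) : 2 * (G.v * δ G.v) = δ G.X := by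
  have h := congrArg δ G.v_mul_v'
  simp only [Derivation.leibniz, map_add, smul_eq_mul, Derivation.map_one_eq_zero, zero_add] at h
  linear_combination h

lemma Γ_v (f : R) : 2 * (G.v * G.Γ f G.v) = G.Γ f G.X := by
  simp only [Γ, mul_sum]
  refine sum_congr rfl fun i _ => ?_
  rw [← v_mul_δ]; ring

lemma P_v : 2 * (G.v * G.P G.v) = -4 * G.HH + (G.ρ * G.Γ G.u G.X) ^ 2 := by
  have h := G.P_mul G.v G.v
  have h1 : 4 * (G.v * G.v * G.GG G.v G.v) = G.Γ G.X G.X - G.ρ * G.Γ G.u G.X ^ 2 := by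
    have e1 := G.Γ_v G.v
    have e2 := G.Γ_v G.X
    have e3 := G.Γ_v G.u
    rw [G.Γ_comm G.v G.X] at e1
    rw [GG]
    linear_combination 2 * G.v * e1 + e2
      - G.ρ * (2 * G.v * G.Γ G.u G.v + G.Γ G.u G.X) * e3
  have hρv : G.ρ * (G.v * G.v) = 1 := by rw [v_mul_v', ρ_mul']
  rw [v_mul_v', P_add, G.cst_one.P, P_X] at h
  linear_combination -h + G.ρ * h1 - 4 * G.GG G.v G.v * hρv

section Eval

variable (φ : R →ₐ[ℝ] ℝ)

lemma ev_Γ (f g : R) : φ (G.Γ f g) = ∑ i, φ (G.D i f) * φ (G.D i g) := by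
  simp only [Γ, map_sum, map_mul]

lemma ev_D_X (i : Fin d) :
    φ (G.D i G.X) = 2 * ∑ j, φ (G.D i (G.D j G.u)) * φ (G.D j G.u) := by
  rw [G.δ_X (G.comm_D i), map_mul, ev_Γ, map_ofNat]
  congr 1
  exact sum_congr rfl fun j _ => by rw [G.D_comm i j]; ring

set_option maxHeartbeats 2000000 in
/-- Second derivative bound at a critical point of the auxiliary function. -/
lemma second_critical {δ : Derivation ℝ R R} (hδ : G.Comm δ) (ht : ∀ f, δ (G.Dt f) = G.Dt (δ f))
    {ξ : Fin d → ℝ} (hξ : ∀ f, φ (δ f) = ∑ i, ξ i * φ (G.D i f)) {c M mm kk εε θθ : R}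
    (hc : G.Cst c) (hM : G.Cst M) (hm : G.Cst mm) (hk : G.Cst kk) (hε : G.Cst εε)
    (hθ : ∀ i, G.D i θθ = 0) (hθ1 : G.Dt θθ = 1) {q e V : ℝ} (he : e = φ (δ G.u))
    (hσ : φ (c - δ G.u) = 0) (heig : ∀ i, φ (G.D i (δ G.u)) = q * (ξ i + e * φ (G.D i G.u)))
    (hnorm : (∑ i, ξ i * ξ i) + e * e = 1) (hm0 : 0 < φ mm) (hv : 0 < φ G.v) (hvV : φ G.v ≤ V)
    (hkV : φ kk = 1 / (2 * V)) (hθ0 : 0 < φ θθ) (hs0 : 0 < φ (M - G.u)) (hε1 : φ εε * φ εε = 1)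
    {H : R} (hHdef : H = 2 * (mm * ((1 - kk * G.v) * (1 - G.ρ * ((c - δ G.u) * (c - δ G.u)))))
      - εε * (θθ * ((M - G.u) * (2 * δ (δ G.u)
        + (c - δ G.u) * (4 * G.ρ * G.Γ G.u (δ G.u))
        + (c - δ G.u) * (c - δ G.u) * (G.ρ * G.ρ * G.Γ G.u G.X)))))
    (hH0 : φ H = 0) (hH1 : ∀ i, φ (G.D i H) = 0) (hHP : φ (G.P H) ≤ 0) :
    φ mm ^ 2 ≤ 4 * (4 * V ^ 2 * (φ θθ * φ (M - G.u) ^ 2) + 72 * V ^ 8 * φ θθ ^ 2) := by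
  obtain ⟨Q, hQ⟩ : ∃ Q, Q = 2 * δ (δ G.u) + (c - δ G.u) * (4 * G.ρ * G.Γ G.u (δ G.u))
      + (c - δ G.u) * (c - δ G.u) * (G.ρ * G.ρ * G.Γ G.u G.X) := ⟨_, rfl⟩
  obtain ⟨σ, hσd⟩ : ∃ σ, σ = c - δ G.u := ⟨_, rfl⟩
  have hPQ := G.P_second hδ ht hc.1 hc.2 φ hσ
  rw [← hQ] at hPQ hHdef
  rw [← hσd] at hQ hHdef hσ
  obtain ⟨K, hK⟩ : ∃ K, K = 1 - G.ρ * (σ * σ) := ⟨_, rfl⟩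
  obtain ⟨B, hB⟩ : ∃ B, B = 1 - kk * G.v := ⟨_, rfl⟩
  rw [← hK, ← hB] at hHdef
  obtain ⟨s, hs⟩ : ∃ s, s = M - G.u := ⟨_, rfl⟩
  rw [← hs] at hHdef hs0 ⊢
  have c2 : G.Cst 2 := by
    have h := Cst.algebraMap G 2; rwa [map_ofNat] at h
  -- derivatives
  have d1 : ∀ i, G.D i (1 : R) = 0 := G.cst_one.1
  have dσ : ∀ i, G.D i σ = -G.D i (δ G.u) := fun i => by rw [hσd, map_sub, hc.1]; ring
  have ds : ∀ i, G.D i s = -G.D i G.u := fun i => by rw [hs, map_sub, hM.1]; ring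
  have dB : ∀ i, G.D i B = -(kk * G.D i G.v) := fun i => by
    rw [hB, map_sub, d1, Derivation.leibniz, hk.1]; simp
  have φK : φ K = 1 := by rw [hK]; simp [hσ]
  have dK : ∀ i, φ (G.D i K) = 0 := fun i => by
    rw [hK, map_sub, d1]; simp [Derivation.leibniz, hσ]
  have dQ : ∀ i, φ (G.D i Q) = 2 * φ (G.D i (δ (δ G.u)))
      - 4 * φ G.ρ * φ (G.Γ G.u (δ G.u)) * φ (G.D i (δ G.u)) := fun i => by
    rw [hQ]
    simp only [map_add, Derivation.leibniz, dσ, c2.1, smul_eq_mul, map_mul, hσ, map_neg, map_zero,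
      map_ofNat]
    ring
  -- values
  obtain ⟨p, hp⟩ : ∃ p : Fin d → ℝ, ∀ i, p i = φ (G.D i G.u) := ⟨_, fun _ => rfl⟩
  obtain ⟨U, hU⟩ : ∃ U : Fin d → Fin d → ℝ, ∀ i j, U i j = φ (G.D i (G.D j G.u)) :=
    ⟨_, fun _ _ => rfl⟩
  obtain ⟨a, ha⟩ : ∃ a : Fin d → ℝ, ∀ i, a i = ∑ j, U i j * p j := ⟨_, fun _ => rfl⟩
  obtain ⟨g, hg⟩ : ∃ g : Fin d → ℝ, ∀ i, g i = φ (G.D i Q) := ⟨_, fun _ => rfl⟩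
  obtain ⟨N, hN⟩ : ∃ N : ℝ, N = ∑ i, p i * a i := ⟨_, rfl⟩
  obtain ⟨x, hx⟩ : ∃ x : ℝ, x = ∑ i, p i * p i := ⟨_, rfl⟩
  have hUs : ∀ i j, U i j = U j i := fun i j => by rw [hU, hU, G.D_comm]
  have φX : φ G.X = x := by rw [X, ev_Γ, hx]; simp only [hp]
  have φDX : ∀ i, φ (G.D i G.X) = 2 * a i := fun i => by
    rw [ev_D_X, ha]; simp only [hU, hp]
  have φY : φ (G.Γ G.u G.X) = 2 * N := by
    rw [ev_Γ, hN, mul_sum]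
    exact sum_congr rfl fun i _ => by rw [φDX, hp]; ring
  have φXX : φ (G.Γ G.X G.X) = 4 * ∑ i, a i * a i := by
    rw [ev_Γ, mul_sum]
    exact sum_congr rfl fun i _ => by rw [φDX]; ring
  have φH : φ G.HH = ∑ i, ∑ j, U i j ^ 2 := by
    rw [HH, map_sum]
    refine sum_congr rfl fun i _ => ?_
    rw [ev_Γ]
    exact sum_congr rfl fun j _ => by rw [hUs, hU]; ring
  have hρ : φ G.ρ * (1 + x) = 1 := by
    have := congrArg φ G.ρ_mul'
    simpa [φX] using this
  have hν : φ G.v * φ G.v = 1 + x := by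
    have := congrArg φ G.v_mul_v'
    simpa [φX] using this
  have he' : e = ∑ i, p i * ξ i := by
    rw [he, hξ]; exact sum_congr rfl fun i _ => by rw [hp]; ring
  have hx0 : 0 ≤ x := by rw [hx]; exact sum_nonneg fun i _ => mul_self_nonneg _
  have heig' : ∀ i, φ (G.D i (δ G.u)) = q * (ξ i + e * p i) := fun i => by rw [heig, hp]
  have hUξ : ∀ i, ∑ j, U i j * ξ j = q * (ξ i + e * p i) := fun i => by
    rw [← heig', ← hδ, hξ]
    exact sum_congr rfl fun j _ => by rw [hUs, hU]; ring
  have φA : φ (G.Γ G.u (δ G.u)) = q * e * (1 + x) := by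
    have : ∀ i, φ (G.D i G.u) * φ (G.D i (δ G.u)) = q * (p i * ξ i) + q * e * (p i * p i) :=
      fun i => by rw [heig', ← hp]; ring
    rw [ev_Γ, sum_congr rfl fun i _ => this i, sum_add_distrib, ← mul_sum,
      ← mul_sum, ← he', ← hx]; ring
  have hξa : ∑ i, ξ i * a i = q * e * (1 + x) := by
    have h1 : ∑ i, ξ i * a i = ∑ i, p i * ∑ j, U i j * ξ j := by
      rw [← sum_mul_mul_symm hUs]; exact sum_congr rfl fun i _ => by rw [ha i]
    have h2 : ∀ i, p i * ∑ j, U i j * ξ j = q * (p i * ξ i) + q * e * (p i * p i) :=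
      fun i => by rw [hUξ]; ring
    rw [h1, sum_congr rfl fun i _ => h2 i, sum_add_distrib, ← mul_sum,
      ← mul_sum, ← he', ← hx]; ring
  have φee : φ (G.Γ (δ G.u) (δ G.u)) = q ^ 2 * (1 + e ^ 2 * (1 + x)) := by
    have : ∀ i, φ (G.D i (δ G.u)) * φ (G.D i (δ G.u)) = q ^ 2 * (ξ i * ξ i)
        + 2 * q ^ 2 * e * (p i * ξ i) + q ^ 2 * e ^ 2 * (p i * p i) :=
      fun i => by rw [heig']; ring
    rw [ev_Γ, sum_congr rfl fun i _ => this i, sum_add_distrib,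
      sum_add_distrib, ← mul_sum, ← mul_sum, ← mul_sum, ← he', ← hx]
    linear_combination q ^ 2 * hnorm
  have φeX : φ (G.Γ (δ G.u) G.X) = 2 * q * (q * e * (1 + x) + e * N) := by
    have : ∀ i, φ (G.D i (δ G.u)) * φ (G.D i G.X) = 2 * q * (ξ i * a i)
        + 2 * q * e * (p i * a i) := fun i => by rw [heig', φDX]; ring
    rw [ev_Γ, sum_congr rfl fun i _ => this i, sum_add_distrib, ← mul_sum,
      ← mul_sum, hξa, ← hN]; ring
  have hUη : ∀ i, φ (G.Γ (G.D i G.u) (δ G.u)) = q ^ 2 * (ξ i + e * p i) + q * e * a i :=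
    fun i => by
      have : ∀ j, φ (G.D j (G.D i G.u)) * φ (G.D j (δ G.u)) = q * (U i j * ξ j)
          + q * e * (U i j * p j) := fun j => by rw [heig', ← hU, hUs]; ring
      rw [ev_Γ, sum_congr rfl fun i _ => this i, sum_add_distrib, ← mul_sum,
        ← mul_sum, hUξ, ← ha]; ring
  have φcub : φ (G.cub (δ G.u)) = q ^ 3 * (1 + e ^ 2 * (1 + x))
      + q ^ 2 * e * (q * e * (1 + x) + e * N) := by
    have : ∀ i, φ (G.D i (δ G.u)) * φ (G.Γ (G.D i G.u) (δ G.u)) = q ^ 3 * (ξ i * ξ i)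
        + 2 * q ^ 3 * e * (p i * ξ i) + q ^ 3 * e ^ 2 * (p i * p i)
        + q ^ 2 * e * (ξ i * a i) + q ^ 2 * e ^ 2 * (p i * a i) :=
      fun i => by rw [heig', hUη]; ring
    rw [cub, map_sum]
    simp only [map_mul, this]
    simp only [sum_add_distrib, ← mul_sum]
    rw [hξa, ← hN, ← he', ← hx]
    linear_combination q ^ 3 * hnorm
  have φδδ : φ (δ (δ G.u)) = q := by
    have : ∀ i, ξ i * φ (G.D i (δ G.u)) = q * (ξ i * ξ i) + q * e * (p i * ξ i) :=
      fun i => by rw [heig']; ring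
    rw [hξ, sum_congr rfl fun i _ => this i, sum_add_distrib, ← mul_sum,
      ← mul_sum, ← he']
    linear_combination q * hnorm
  have φQ : φ Q = 2 * q := by
    rw [hQ]; simp only [map_add, map_mul, map_ofNat, hσ, φδδ]; ring
  have φQX : 2 * φ (G.Γ (δ (δ G.u)) G.X) - 4 * φ G.ρ * φ (G.Γ G.u (δ G.u)) *
      φ (G.Γ (δ G.u) G.X) = 2 * ∑ i, g i * a i := by
    simp only [ev_Γ (f := δ (δ G.u)), ev_Γ (f := δ G.u) (g := G.X), mul_sum,
      ← sum_sub_distrib]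
    exact sum_congr rfl fun i _ => by rw [hg, dQ, φDX]; ring
  have φuQ : φ (G.Γ G.u Q) = ∑ i, p i * g i := by
    rw [ev_Γ]; simp only [hp, hg]
  have φuQ' : 2 * φ (G.Γ G.u (δ (δ G.u))) - 4 * φ G.ρ * φ (G.Γ G.u (δ G.u)) *
      φ (G.Γ G.u (δ G.u)) = ∑ i, p i * g i := by
    nth_rewrite 3 [ev_Γ]
    rw [ev_Γ, mul_sum, mul_sum, ← sum_sub_distrib]
    exact sum_congr rfl fun i _ => by rw [hg, dQ, hp]; ring
  have φPQ : φ (G.P Q) = -2 * φ G.ρ * (2 * (∑ i, g i * a i) - 2 * φ G.ρ * N * ∑ i, p i * g i)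
      + 8 * φ G.ρ * q ^ 3 := by
    rw [hPQ]
    simp only [map_add, map_sub, map_mul, map_neg, map_ofNat, map_pow]
    rw [φQX, φuQ', φY, φcub, φeX, φA]
    linear_combination (8 * φ G.ρ * q ^ 3 * e ^ 2 * (1 + x) * (-2)
      + 8 * φ G.ρ * q ^ 2 * e ^ 2 * N * (-1 + φ G.ρ * (1 + x))) * hρ
  have φPv : φ (G.P G.v) = (-2 * (∑ i, ∑ j, U i j ^ 2) + 2 * φ G.ρ ^ 2 * N ^ 2) / φ G.v := by
    have h := congrArg φ G.P_v
    simp only [map_add, map_mul, map_neg, map_pow, map_ofNat, φH, φY] at h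
    rw [eq_div_iff hv.ne']
    linear_combination h / 2
  have dv : ∀ i, φ (G.D i G.v) = a i / φ G.v := fun i => by
    have h := congrArg φ (G.v_mul_δ (G.D i))
    simp only [map_mul, map_ofNat, φDX] at h
    rw [eq_div_iff hv.ne']
    linear_combination h / 2
  -- the critical point equations
  have φB : φ B = 1 - φ kk * φ G.v := by rw [hB]; simp
  have hH0' : 2 * φ mm * φ B = φ εε * φ θθ * φ s * (2 * q) := by
    rw [hHdef] at hH0
    simp only [map_sub, map_mul, map_ofNat, φK, φQ] at hH0
    linarith
  have hcrit : ∀ i, φ εε * φ θθ * φ s * g i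
      = φ εε * φ θθ * (2 * q) * p i - 2 * φ mm * φ kk * a i / φ G.v := fun i => by
    have h := hH1 i
    rw [hHdef] at h
    simp only [map_sub, Derivation.leibniz, c2.1, hm.1, hε.1, hθ, dB, ds, smul_eq_mul, map_add,
      map_mul, map_neg, map_zero, map_ofNat, φK, dK, φQ, dv, ← hg, ← hp] at h
    linear_combination -h
  have hPs : G.P s = 0 := by rw [hs, P_sub, hM.P, P_u, sub_zero]
  have hΓs : ∀ f, G.Γ s f = -G.Γ G.u f := fun f => by
    simp only [Γ, ds, neg_mul, sum_neg_distrib]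
  have hΓσ : ∀ f, G.Γ σ f = -G.Γ (δ G.u) f := fun f => by
    simp only [Γ, dσ, neg_mul, sum_neg_distrib]
  have hPB : φ (G.P B) = -(φ kk * φ (G.P G.v)) := by
    rw [hB, P_sub, G.cst_one.P, hk.P_mul]; simp
  have hGσ : φ (G.GG σ σ) = q ^ 2 := by
    rw [GG, G.Γ_comm G.u, hΓσ, hΓσ, G.Γ_comm (δ G.u) σ, hΓσ, G.Γ_comm (δ G.u) G.u]
    simp only [map_sub, map_mul, map_neg, φee, φA]
    linear_combination -(q ^ 2 * e ^ 2 * (1 + x)) * hρ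
  have hPK : φ (G.P K) = 4 * φ G.ρ * q ^ 2 := by
    have h0 : φ (G.GG G.ρ (σ * σ)) = 0 := by simp [GG, Γ_mul_right, hσ]
    rw [hK, P_sub, G.cst_one.P, P_mul, P_mul]
    simp only [map_sub, map_add, map_mul, hσ, hGσ, h0, map_zero, map_ofNat]
    ring
  have hBK : φ (G.GG B K) = 0 := by
    simp only [GG, map_sub, map_mul, ev_Γ, dK]; simp
  have hPθ : G.P θθ = 2 := by
    simp [P, Lap, Γ, hθ, hθ1]
  have hGθ : ∀ f, G.GG θθ f = 0 := fun f => by simp [GG, Γ, hθ]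
  have hGs : φ (G.GG s Q) = -(φ G.ρ * ∑ i, p i * g i) := by
    have : G.GG s Q = -G.GG G.u Q := by
      rw [GG, GG, hΓs, G.Γ_comm G.u s, hΓs]; ring
    rw [this, GG_u_left, map_neg, map_mul, φuQ]
  rw [hHdef, P_sub, c2.P_mul, hm.P_mul, P_mul, hε.P_mul, P_mul, P_mul, hPθ, hGθ, hPs] at hHP
  simp only [map_sub, map_add, map_mul, map_ofNat, map_zero, hBK, hGs, hPK, hPB, φPQ, φPv, φK,
    φQ] at hHP
  obtain ⟨Mt, hM1, hM2, hM3⟩ := exists_compression hUs ha hN hv (hx ▸ hν) (hx ▸ hρ)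
  obtain ⟨ω, hω1, hω2⟩ := hM3 ξ e he'
  refine second_derivative_arith (ν := φ G.v) (ρ := φ G.ρ) (q := q) (N := N) (X := x)
    (Ha := ∑ i, ∑ j, U i j ^ 2) (aa := ∑ i, a i * a i) (pg := ∑ i, p i * g i)
    (ag := ∑ i, g i * a i) (b := φ B) (ε := φ εε) hm0 ?_ hvV hkV φB hθ0 hs0 hε1 hν hρ hx0 hH0'
    ?_ ?_ ?_ hM1 ?_ ?_
  · nlinarith
  · rw [hx, hN, mul_sum, mul_sum, mul_sum, Finset.sum_div,
      ← sum_sub_distrib]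
    exact sum_congr rfl fun i _ => by linear_combination p i * hcrit i
  · rw [hN, mul_sum, mul_sum, mul_sum, Finset.sum_div,
      ← sum_sub_distrib]
    exact sum_congr rfl fun i _ => by linear_combination a i * hcrit i
  · refine le_trans (le_of_eq ?_) hHP
    ring
  · have h := sq_form_le ω Mt
    rw [hω1, hω2, hnorm] at h
    have h1 : ∑ i, ξ i * ∑ j, U i j * ξ j = q := by
      have : ∀ i, ξ i * ∑ j, U i j * ξ j = q * (ξ i * ξ i) + q * e * (p i * ξ i) :=
        fun i => by rw [hUξ]; ring
      rw [sum_congr rfl fun i _ => this i, sum_add_distrib, ← mul_sum,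
        ← mul_sum, ← he']
      linear_combination q * hnorm
    rw [h1] at h
    linarith
  · have h := sq_form_le p Mt
    rw [hM2, ← hx] at h
    exact h

end Eval

end GraphData

/-- Spatial coordinate direction in space-time. -/
def eX {d : ℕ} (i : Fin d) : 𝔼 d × ℝ := (EuclideanSpace.single i 1, 0)

/-- Time direction in space-time. -/
def eT {d : ℕ} : 𝔼 d × ℝ := (0, 1)

/-- Spatial partial derivative. -/
def dX {d : ℕ} (i : Fin d) (f : 𝔼 d × ℝ → ℝ) :
    𝔼 d × ℝ → ℝ := fun q => fderiv ℝ f q (eX i)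

/-- Time derivative. -/
def dT {d : ℕ} (f : 𝔼 d × ℝ → ℝ) :
    𝔼 d × ℝ → ℝ := fun q => fderiv ℝ f q eT

/-- Smooth solutions of graphical mean curvature flow on a space-time set, the equation being in
non-divergence form. -/
structure GrSol {d : ℕ} (O : Set (𝔼 d × ℝ))
    (U : 𝔼 d × ℝ → ℝ) : Prop where
  smooth : ContDiffOn ℝ (⊤ : ℕ∞) U O
  eq : ∀ q ∈ O, dT U q = ∑ a, dX a (dX a U) q
    - (1 + ∑ i, dX i U q ^ 2)⁻¹ * ∑ a, ∑ b, dX a U q * dX b U q * dX a (dX b U) q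

section

variable {d : ℕ} {O : Set (𝔼 d × ℝ)} {I : Type}

lemma contDiffOn_dX (hO : IsOpen O) {f : 𝔼 d × ℝ → ℝ}
    (hf : ContDiffOn ℝ (⊤ : ℕ∞) f O) (i : Fin d) : ContDiffOn ℝ (⊤ : ℕ∞) (dX i f) O :=
  (hf.fderiv_of_isOpen (m := (⊤ : ℕ∞)) hO (by simp)).clm_apply contDiffOn_const

lemma contDiffOn_dT (hO : IsOpen O) {f : 𝔼 d × ℝ → ℝ}
    (hf : ContDiffOn ℝ (⊤ : ℕ∞) f O) : ContDiffOn ℝ (⊤ : ℕ∞) (dT f) O :=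
  (hf.fderiv_of_isOpen (m := (⊤ : ℕ∞)) hO (by simp)).clm_apply contDiffOn_const

lemma one_add_sum_sq_pos (p : Fin d → ℝ) : 0 < 1 + ∑ i, p i ^ 2 :=
  add_pos_of_pos_of_nonneg one_pos (sum_nonneg fun i _ => sq_nonneg (p i))

namespace Sm

variable (hO : IsOpen O)

lemma ev_D_ofFn (F : I → 𝔼 d × ℝ → ℝ)
    (hF : ∀ i, ContDiffOn ℝ (⊤ : ℕ∞) (F i) O) (w) (z : I × O) :
    ev z (D hO w (ofFn F hF)) = fderiv ℝ (F z.1) z.2 w := by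
  rw [ev_D, fderiv_fn_eq hO (fun q hq => fn_ofFn F hF z.1 hq) z.2.2]

lemma D_ofFn_eX (F : I → 𝔼 d × ℝ → ℝ)
    (hF : ∀ i, ContDiffOn ℝ (⊤ : ℕ∞) (F i) O) (i : Fin d) :
    D hO (eX i) (ofFn F hF) = ofFn (fun j => dX i (F j)) fun j => contDiffOn_dX hO (hF j) i :=
  ext_ev fun z => ev_D_ofFn hO F hF _ z

lemma D_ofFn_eT (F : I → 𝔼 d × ℝ → ℝ)
    (hF : ∀ i, ContDiffOn ℝ (⊤ : ℕ∞) (F i) O) :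
    D hO eT (ofFn F hF) = ofFn (fun j => dT (F j)) fun j => contDiffOn_dT hO (hF j) :=
  ext_ev fun z => ev_D_ofFn hO F hF _ z

end Sm

/-- The differential ring of a family of solutions. -/
def graphData (hO : IsOpen O) (U : I → 𝔼 d × ℝ → ℝ)
    (hU : ∀ i, GrSol O (U i)) : GraphData d (Sm I O) where
  D i := Sm.D hO (eX i)
  Dt := Sm.D hO eT
  D_comm i j f := Sm.D_comm hO _ _ f
  Dt_D i f := Sm.D_comm hO _ _ f
  u := Sm.ofFn U fun i => (hU i).smooth
  ρ := Sm.ofFn (fun j q => (1 + ∑ i, dX i (U j) q ^ 2)⁻¹) fun j =>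
    (contDiffOn_const.add (ContDiffOn.sum fun i _ =>
      (contDiffOn_dX hO (hU j).smooth i).pow 2)).inv fun q _ => (one_add_sum_sq_pos _).ne'
  v := Sm.ofFn (fun j q => Real.sqrt (1 + ∑ i, dX i (U j) q ^ 2)) fun j =>
    (contDiffOn_const.add (ContDiffOn.sum fun i _ =>
      (contDiffOn_dX hO (hU j).smooth i).pow 2)).sqrt fun q _ => (one_add_sum_sq_pos _).ne'
  v_mul_v := Sm.ext_ev fun z => by
    simp only [map_mul, map_add, map_one, map_sum, Sm.ev_ofFn, Sm.D_ofFn_eX]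
    rw [Real.mul_self_sqrt (one_add_sum_sq_pos _).le]
    simp only [pow_two]
  ρ_mul := Sm.ext_ev fun z => by
    simp only [map_mul, map_add, map_one, map_sum, Sm.ev_ofFn, Sm.D_ofFn_eX, ← pow_two]
    exact inv_mul_cancel₀ (one_add_sum_sq_pos _).ne'
  dt_u := Sm.ext_ev fun z => by
    simp only [map_mul, map_sub, map_sum, Derivation.leibniz, smul_eq_mul, map_add, Sm.ev_ofFn,
      Sm.D_ofFn_eX, Sm.D_ofFn_eT, (hU z.1).eq z.2 z.2.2, map_ofNat, mul_sum, mul_sub]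
    refine congrArg _ (sum_congr rfl fun a _ => sum_congr rfl fun b _ => ?_)
    ring

variable {U : I → 𝔼 d × ℝ → ℝ} (hO : IsOpen O) (hU : ∀ i, GrSol O (U i))

lemma ev_graphData_ρ (z : I × O) : Sm.ev z (graphData hO U hU).ρ
    = (1 + ∑ i, dX i (U z.1) z.2 ^ 2)⁻¹ := rfl

lemma ev_graphData_X (z : I × O) : Sm.ev z (graphData hO U hU).X
    = ∑ i, dX i (U z.1) z.2 ^ 2 := by
  simp only [GraphData.X, GraphData.Γ, map_sum, map_mul, graphData, Sm.D_ofFn_eX, Sm.ev_ofFn,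
    pow_two]

lemma Stencil.sum_form {d : ℕ} {Λ : ℝ} (σ : Stencil d Λ) (p : Fin d → ℝ) (a : Fin d → Fin d → ℝ) :
    ∑ s, MvPolynomial.eval p (σ.P s) * ∑ i, ∑ j, (σ.dir s i : ℝ) * σ.dir s j * a i j
      = 2 * ((1 + ∑ i, p i ^ 2) * ∑ i, a i i - ∑ i, ∑ j, p i * p j * a i j) := by
  simp only [mul_sum]
  rw [sum_comm]
  have : ∀ i j, ∑ s, MvPolynomial.eval p (σ.P s) * ((σ.dir s i : ℝ) * σ.dir s j * a i j)
      = 2 * ((1 + ∑ i, p i ^ 2) * (if i = j then 1 else 0) - p i * p j) * a i j := fun i j => by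
    rw [← σ.sum_P p i j, sum_mul]; exact sum_congr rfl fun s _ => by ring
  simp_rw [sum_comm (s := (Finset.univ : Finset σ.S)), this]
  simp only [mul_sub, sub_mul, sum_sub_distrib, mul_ite, ite_mul, mul_one, mul_zero,
    zero_mul, Finset.sum_ite_eq, Finset.mem_univ, if_true, mul_sum]
  congr 1
  · exact sum_congr rfl fun i _ => by ring
  · exact sum_congr rfl fun i _ => sum_congr rfl fun j _ => by ring

/-- The parabolic maximum principle at a point. -/
lemma parabolic_min {f : Sm I O} {z : I × O}
    (h : ∀ᶠ q in 𝓝 (z.2 : 𝔼 d × ℝ), q.2 ≤ (z.2 : 𝔼 d × ℝ).2 →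
      f.fn z.1 z.2 ≤ f.fn z.1 q) :
    (∀ i, Sm.ev z ((graphData hO U hU).D i f) = 0) ∧
      Sm.ev z ((graphData hO U hU).P f) ≤ 0 := by
  obtain ⟨G, hG⟩ : ∃ G, G = graphData hO U hU := ⟨_, rfl⟩
  rw [← hG]
  have hline : ∀ w : 𝔼 d × ℝ,
      Tendsto (fun r : ℝ => (z.2 : 𝔼 d × ℝ) + r • w) (𝓝 0) (𝓝 z.2) := fun w => by
    have hc : Continuous fun r : ℝ => (z.2 : 𝔼 d × ℝ) + r • w := by fun_prop
    simpa using hc.tendsto 0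
  have hsp : ∀ w : 𝔼 d × ℝ, w.2 = 0 →
      Sm.ev z (Sm.D hO w f) = 0 ∧ 0 ≤ Sm.ev z (Sm.D hO w (Sm.D hO w f)) := fun w hw =>
    Sm.min_line hO (((hline w).eventually h).mono fun r hr => hr (by simp [hw]))
  have hD : ∀ i, Sm.ev z (G.D i f) = 0 := fun i => by
    rw [hG]; exact (hsp (eX i) rfl).1
  have ht : Sm.ev z (G.Dt f) ≤ 0 := by
    rw [hG]
    refine Sm.min_past hO ?_
    filter_upwards [((hline eT).eventually h).filter_mono nhdsWithin_le_nhds,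
      self_mem_nhdsWithin] with r hr hr0
    exact hr (by simpa [eT] using hr0)
  refine ⟨hD, ?_⟩
  obtain ⟨p, hp⟩ : ∃ p : Fin d → ℝ, p = fun i => Sm.ev z (G.D i G.u) := ⟨_, rfl⟩
  obtain ⟨a, ha⟩ : ∃ a : Fin d → Fin d → ℝ, a = fun i j => Sm.ev z (G.D i (G.D j f)) := ⟨_, rfl⟩
  have hΛ : ∀ i, |p i| ≤ ∑ j, |p j| := fun i =>
    single_le_sum (f := fun j => |p j|) (fun j _ => abs_nonneg _) (Finset.mem_univ i)
  obtain ⟨σ⟩ := nonempty_stencil d (sum_nonneg fun j _ => abs_nonneg (p j) :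
    0 ≤ ∑ j, |p j|)
  have hpos : ∀ s, 0 ≤ ∑ i, ∑ j, (σ.dir s i : ℝ) * σ.dir s j * a i j := fun s => by
    have h1 := (hsp (∑ i, (σ.dir s i : ℝ) • eX i) (by simp [Prod.snd_sum, eX])).2
    have h2 : ∀ g : Sm I O, Sm.D hO (∑ i, (σ.dir s i : ℝ) • eX i) g
        = ∑ i, (σ.dir s i : ℝ) • G.D i g := fun g => by
      rw [Sm.D_sum, hG]; exact sum_congr rfl fun i _ => Sm.D_smul hO _ _ _
    rw [h2, h2] at h1
    simp only [map_sum, Derivation.map_smul, map_smul, smul_eq_mul, mul_sum] at h1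
    refine h1.trans_eq (sum_congr rfl fun i _ => sum_congr rfl fun j _ => ?_)
    rw [ha]; ring
  have hsum : 0 ≤ ∑ s, MvPolynomial.eval p (σ.P s)
      * ∑ i, ∑ j, (σ.dir s i : ℝ) * σ.dir s j * a i j :=
    sum_nonneg fun s _ => mul_nonneg (σ.c_pos.le.trans (σ.c_le p hΛ s)) (hpos s)
  rw [σ.sum_form] at hsum
  have hρ : Sm.ev z G.ρ * (1 + ∑ i, p i ^ 2) = 1 := by
    have := congrArg (Sm.ev z) G.ρ_mul
    simpa only [map_mul, map_add, map_one, map_sum, hp, pow_two] using this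
  have hρ0 : 0 < Sm.ev z G.ρ := by
    rw [hG, ev_graphData_ρ]; exact inv_pos.2 (one_add_sum_sq_pos _)
  have hP : Sm.ev z (G.P f) = 2 * Sm.ev z (G.Dt f) - 2 * ∑ i, a i i
      + 2 * Sm.ev z G.ρ * ∑ i, ∑ j, p i * p j * a i j := by
    simp only [GraphData.P, GraphData.Lap, GraphData.Γ, map_sub, map_add, map_mul, map_sum,
      map_ofNat, Derivation.leibniz, smul_eq_mul, hD, mul_zero, zero_mul, add_zero,
      Finset.sum_const_zero, sub_zero, ha, hp]
    refine congrArg _ (congrArg _ (sum_congr rfl fun i _ => ?_))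
    rw [mul_sum]; exact sum_congr rfl fun j _ => by ring
  rw [hP]
  have := mul_nonneg hρ0.le hsum
  have h3 : Sm.ev z G.ρ * (2 * ((1 + ∑ i, p i ^ 2) * ∑ i, a i i - ∑ i, ∑ j, p i * p j * a i j))
      = 2 * ∑ i, a i i - 2 * Sm.ev z G.ρ * ∑ i, ∑ j, p i * p j * a i j := by
    linear_combination (2 * ∑ i, a i i) * hρ
  rw [h3] at this
  linarith

end

/-- The slab including the initial time. -/
def slab0 (d : ℕ) (T : ℝ) : Set (𝔼 d × ℝ) := {q | 0 ≤ q.2 ∧ q.2 < T}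

lemma slab_subset_slab0 (d : ℕ) (T : ℝ) : slab d T ⊆ slab0 d T := fun _ hq => ⟨hq.1.le, hq.2⟩

/-- Periodic solutions of graphical mean curvature flow with initial datum `g`. -/
structure PerSol {d : ℕ} (R : ℕ) (T : ℝ) (g : 𝔼 d → ℝ)
    (U : 𝔼 d × ℝ → ℝ) : Prop where
  sol : GrSol (slab d T) U
  per : ∀ t, IsPer R fun x => U (x, t)
  cont : ContinuousOn U (slab0 d T)
  init : ∀ x, U (x, 0) = g x
  slope : ∃ p : Fin d → 𝔼 d × ℝ → ℝ, (∀ i, ContinuousOn (p i) (slab0 d T)) ∧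
    (∀ i, ∀ q ∈ slab d T, p i q = dX i U q) ∧
    ∀ i x, p i (x, 0) = fderiv ℝ g x (EuclideanSpace.single i 1)
  range : ∀ a b, (∀ y, g y ∈ Icc a b) → ∀ q ∈ slab0 d T, U q ∈ Icc a b

namespace Stencil

variable {d : ℕ} {Λ : ℝ} {σ : Stencil d Λ} {g : 𝔼 d → ℝ} {T : ℝ}

lemma dX_lim_jet (hT : σ.AllGood g T) {q : 𝔼 d × ℝ} (hq : q ∈ slab d T)
    (γ : List σ.S) (i : Fin d) : dX i (σ.lim g ((σ.model g).jet γ)) q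
      = σ.lim g ((σ.model g).jet (σ.ι i :: γ)) q := by
  rw [dX, (hasFDerivAt_lim_jet hT hq γ).fderiv, stForm_apply, eX]
  simp

lemma dT_lim_jet (hT : σ.AllGood g T) {q : 𝔼 d × ℝ} (hq : q ∈ slab d T)
    (γ : List σ.S) : dT (σ.lim g ((σ.model g).jet γ)) q
      = σ.lim g ((σ.model g).dt ((σ.model g).jet γ)) q := by
  rw [dT, (hasFDerivAt_lim_jet hT hq γ).fderiv, stForm_apply, eT]
  simp

lemma dX_congr {O : Set (𝔼 d × ℝ)} (hO : IsOpen O)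
    {f f' : 𝔼 d × ℝ → ℝ} (h : ∀ q ∈ O, f q = f' q) (i : Fin d) {q}
    (hq : q ∈ O) : dX i f q = dX i f' q := by
  rw [dX, dX, (Filter.eventuallyEq_of_mem (hO.mem_nhds hq) h).fderiv_eq]

lemma flow_grSol (hT : σ.AllGood g T) : GrSol (slab d T) (σ.flow g) := by
  refine ⟨contDiffOn_flow hT, fun q hq => ?_⟩
  obtain ⟨h0, h1⟩ : 0 ≤ q.2 ∧ q.2 ≤ T := ⟨hq.1.le, hq.2.le⟩
  have e1 : ∀ q ∈ slab d T, ∀ i, dX i (σ.flow g) q = σ.lim g ((σ.model g).jet [σ.ι i]) q :=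
    fun q hq i => dX_lim_jet hT hq [] i
  have e2 : ∀ i j, dX i (dX j (σ.flow g)) q = σ.lim g ((σ.model g).jet [σ.ι i, σ.ι j]) q :=
    fun i j => by
      rw [dX_congr (isOpen_slab d T) (fun q hq => e1 q hq j) i hq, dX_lim_jet hT hq]
  have e3 : dT (σ.flow g) q = σ.lim g ((σ.model g).dt (σ.model g).u) q := dT_lim_jet hT hq []
  have e4 : ∀ s, σ.lim g ((σ.model g).jet [σ.neg s, s]) q = -∑ a, ∑ b,
      (σ.dir s a : ℝ) * σ.dir s b * dX a (dX b (σ.flow g)) q := fun s => by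
    rw [lim_jet_cons hT h0 h1, ← sum_neg_distrib]
    refine sum_congr rfl fun a _ => ?_
    have : (σ.model g).jet [σ.ι a, s] = (σ.model g).jet [s, σ.ι a] := by
      simp only [FlowModel.jet_cons]; exact (σ.model g).δ_comm _ _ _
    rw [this, lim_jet_cons hT h0 h1, mul_sum, ← sum_neg_distrib]
    refine sum_congr rfl fun b _ => ?_
    have : (σ.model g).jet [σ.ι b, σ.ι a] = (σ.model g).jet [σ.ι a, σ.ι b] := by
      simp only [FlowModel.jet_cons]; exact (σ.model g).δ_comm _ _ _
    rw [e2, this, σ.dir_neg]; push_cast [Pi.neg_apply]; ring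
  rw [e3, lim_dt_u hT h0 h1]
  simp only [e4, ← e1 q hq]
  obtain ⟨p, hp⟩ : ∃ p : Fin d → ℝ, p = fun i => dX i (σ.flow g) q := ⟨_, rfl⟩
  obtain ⟨H, hH⟩ : ∃ H : Fin d → Fin d → ℝ, H = fun i j => dX i (dX j (σ.flow g)) q := ⟨_, rfl⟩
  obtain ⟨ρ, hρ⟩ : ∃ ρ : ℝ, ρ = (1 + ∑ i, p i ^ 2)⁻¹ := ⟨_, rfl⟩
  have hρ1 : ρ * (1 + ∑ i, p i ^ 2) = 1 := by
    rw [hρ]; exact inv_mul_cancel₀ (one_add_sum_sq_pos p).ne'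
  have e5 : ∀ i, dX i (σ.flow g) q = p i := fun i => by rw [hp]
  have e6 : ∀ i j, dX i (dX j (σ.flow g)) q = H i j := fun i j => by rw [hH]
  simp only [e5, e6, ← hρ]
  have e7 : ∑ s, MvPolynomial.eval (fun i => p i) (σ.P s) * ρ
      * -∑ a, ∑ b, (σ.dir s a : ℝ) * σ.dir s b * H a b
      = -ρ * ∑ s, MvPolynomial.eval p (σ.P s) * ∑ i, ∑ j, (σ.dir s i : ℝ) * σ.dir s j * H i j := by
    rw [mul_sum]; exact sum_congr rfl fun s _ => by ring
  rw [e7, σ.sum_form]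
  linear_combination (∑ i, H i i) * hρ1

lemma lim_mem_Icc {f : (σ.model g).R} {q : 𝔼 d × ℝ} {a b : ℝ}
    (h : ∀ᶠ N in 𝔲, f (σ.node N q) ∈ Icc a b) :
    σ.lim g f q ∈ Icc a b := by
  have hb : ∀ᶠ N in 𝔲, |f (σ.node N q)| ≤ max |a| |b| :=
    h.mono fun N hN => abs_le_max_abs_abs hN.1 hN.2
  exact isClosed_Icc.mem_of_tendsto (tendsto_ulim hb) h

lemma continuousOn_of_stDist {f : 𝔼 d × ℝ → ℝ} {C : ℝ} (hC : 0 ≤ C)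
    (h : ∀ q q' : 𝔼 d × ℝ, 0 ≤ q.2 → q.2 ≤ T → 0 ≤ q'.2 → q'.2 ≤ T →
      |f q' - f q| ≤ C * stDist q q') : ContinuousOn f {q | 0 ≤ q.2 ∧ q.2 ≤ T} := by
  refine LipschitzOnWith.continuousOn (K := ⟨C * (d + 1), by positivity⟩)
    (LipschitzOnWith.of_dist_le_mul fun x hx y hy => ?_)
  rw [Real.dist_eq, dist_eq_norm]
  refine (h y x hy.1 hy.2 hx.1 hx.2).trans ?_
  change _ ≤ C * (d + 1) * _
  rw [mul_assoc]
  exact mul_le_mul_of_nonneg_left (stDist_le y x) hC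

lemma continuousOn_lim_jet (hT : ∀ T' < T, σ.AllGood g T') (γ : List σ.S) :
    ContinuousOn (σ.lim g ((σ.model g).jet γ)) (slab0 d T) := by
  intro q hq
  obtain ⟨T', h1, h2⟩ := exists_between hq.2
  obtain ⟨C, hC, h⟩ := lim_jet_lip (hT T' h2) γ
  have := continuousOn_of_stDist hC h q ⟨hq.1, h1.le⟩
  refine this.mono_of_mem_nhdsWithin ?_
  filter_upwards [self_mem_nhdsWithin, nhdsWithin_le_nhds
    ((isOpen_lt continuous_snd continuous_const).mem_nhds (x := q) (s := {q | q.2 < T'}) h1)]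
    with q' h3 h4
  exact ⟨h3.1, le_of_lt h4⟩

lemma flow_perSol {R : ℕ} (hT : ∀ T' < T, σ.AllGood g T') (hT0 : 0 < T)
    (hg : Differentiable ℝ g) (hp : IsPer R g) : PerSol R T g (σ.flow g) where
  sol := by
    have h := fun T' h => flow_grSol (hT T' h)
    constructor
    · intro q hq
      obtain ⟨T', h1, h2⟩ := exists_between hq.2
      exact ((h T' h2).smooth.contDiffAt ((isOpen_slab d T').mem_nhds ⟨hq.1, h1⟩)).contDiffWithinAt
    · intro q hq
      obtain ⟨T', h1, h2⟩ := exists_between hq.2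
      exact (h T' h2).eq q ⟨hq.1, h1⟩
  per := lim_jet_periodic hp []
  cont := continuousOn_lim_jet hT []
  init := flow_initial hg.continuous
  slope := ⟨fun i => σ.lim g ((σ.model g).jet [σ.ι i]), fun i => continuousOn_lim_jet hT _,
    fun i q hq => by
      obtain ⟨T', h1, h2⟩ := exists_between hq.2
      exact (dX_lim_jet (hT T' h2) ⟨hq.1, h1⟩ [] i).symm,
    fun i x => lim_slope_initial (hT 0 hT0) le_rfl hg x i⟩
  range a b hab q hq := by
    obtain ⟨B, hB⟩ := hT q.2 hq.2 0
    refine lim_mem_Icc (hB.mono fun N hN => ?_)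
    exact sol_mem_Icc (fun n hn => (hN n hn).2) hab _ (node_time hq.1 le_rfl) _

end Stencil

section

variable {d : ℕ}

lemma dX_add_right (f : 𝔼 d × ℝ → ℝ) (w : 𝔼 d × ℝ)
    (h : ∀ q, f (q + w) = f q) (i : Fin d) (q) : dX i f (q + w) = dX i f q := by
  have h' : (fun q => f (q + w)) = f := funext h
  have := fderiv_comp_add_right (𝕜 := ℝ) (f := f) (x := q) w
  rw [dX, dX, ← this, h']

/-- A lattice translation of space-time. -/
def perShift (R : ℕ) (e : Fin d → ℤ) : 𝔼 d × ℝ :=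
  (WithLp.toLp 2 fun i => (R : ℝ) * e i, 0)

lemma add_perShift_snd (R : ℕ) (e : Fin d → ℤ) (q : 𝔼 d × ℝ) :
    (q + perShift R e).2 = q.2 := by simp [perShift]

lemma PerSol.shift {R : ℕ} {T : ℝ} {g : 𝔼 d → ℝ}
    {U : 𝔼 d × ℝ → ℝ} (h : PerSol R T g U) (e : Fin d → ℤ) (q) :
    U (q + perShift R e) = U q := by
  have := h.per q.2 q.1 e
  simpa [perShift, Prod.add_def] using this

/-- The pointwise computation behind the interior gradient estimate. -/
lemma slope_critical {I : Type} {O : Set (𝔼 d × ℝ)}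
    {U : I → 𝔼 d × ℝ → ℝ} (hO : IsOpen O) (hU : ∀ i, GrSol O (U i))
    (z : I × O) (M : ℝ) (hs : U z.1 z.2 < M) (hp : 0 < ∑ i, dX i (U z.1) z.2 ^ 2)
    (h : ∀ᶠ q in 𝓝 (z.2 : 𝔼 d × ℝ),
      q.2 ≤ (z.2 : 𝔼 d × ℝ).2 →
      (1 + ∑ i, dX i (U z.1) q ^ 2) * (M - U z.1 q) ^ 2
        ≤ (1 + ∑ i, dX i (U z.1) z.2 ^ 2) * (M - U z.1 z.2) ^ 2) : False := by
  obtain ⟨G, hG⟩ : ∃ G, G = graphData hO U hU := ⟨_, rfl⟩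
  obtain ⟨c, hc⟩ : ∃ c : Sm I O, c = algebraMap ℝ _ M := ⟨_, rfl⟩
  obtain ⟨F, hF⟩ : ∃ F, F = (1 + G.X) * ((c - G.u) * (c - G.u)) := ⟨_, rfl⟩
  have hGu : ∀ z, Sm.ev z G.u = U z.1 z.2 := fun z => by rw [hG]; rfl
  have hcz : ∀ z, Sm.ev z c = M := fun z => by rw [hc]; exact AlgHom.commutes _ M
  have hFz : ∀ z : I × O, Sm.ev z F
      = (1 + ∑ i, dX i (U z.1) z.2 ^ 2) * (M - U z.1 z.2) ^ 2 := fun z => by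
    rw [hF]
    simp only [map_mul, map_add, map_sub, map_one, hGu, hcz]
    rw [hG, ev_graphData_X, pow_two (M - _)]
  have hmin := parabolic_min hO hU (f := -F) (z := z) (by
    filter_upwards [h, hO.mem_nhds z.2.2] with q hq hqO hqt
    have e1 := Sm.fn_apply (-F) z.1 z.2
    have e2 := Sm.fn_apply (-F) z.1 ⟨q, hqO⟩
    simp only at e2
    rw [e1, e2, map_neg, map_neg, hFz, hFz]
    exact neg_le_neg (hq hqt))
  rw [← hG, G.P_neg, map_neg] at hmin
  obtain ⟨hD, hP⟩ := hmin
  obtain ⟨φ, hφ⟩ : ∃ φ, φ = Sm.ev z := ⟨_, rfl⟩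
  rw [← hφ] at hP hD
  have hcD : ∀ i, G.D i c = 0 := fun i => by rw [hc]; exact (G.D i).map_algebraMap M
  have hcT : G.Dt c = 0 := by rw [hc]; exact G.Dt.map_algebraMap M
  rw [hF, G.P_slope_mul hcD hcT] at hP
  obtain ⟨s, hsd⟩ : ∃ s, s = φ (c - G.u) := ⟨_, rfl⟩
  have hs0 : 0 < s := by rw [hsd, hφ, map_sub, hcz, hGu]; linarith
  obtain ⟨x, hx⟩ : ∃ x, x = φ G.X := ⟨_, rfl⟩
  have hx0 : 0 < x := by rw [hx, hφ, hG, ev_graphData_X]; exact hp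
  obtain ⟨p, hpd⟩ : ∃ p : Fin d → ℝ, p = fun i => φ (G.D i G.u) := ⟨_, rfl⟩
  have hxp : x = ∑ i, p i * p i := by
    rw [hx, GraphData.X, GraphData.Γ, map_sum, hpd]; simp only [map_mul]
  have hρ : φ G.ρ * (1 + x) = 1 := by
    have := congrArg φ G.ρ_mul
    rw [hx, GraphData.X, GraphData.Γ]
    simpa only [map_mul, map_add, map_one] using this
  have h1 : ∀ i, s * φ (G.D i G.X) = 2 * (1 + x) * p i := fun i => by
    have h := hD i
    have e1 : G.D i (1 + G.X) = G.D i G.X := by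
      rw [map_add, Derivation.map_one_eq_zero, zero_add]
    rw [hF, map_neg, map_neg, Derivation.leibniz, Derivation.leibniz, e1, map_sub, hcD] at h
    simp only [smul_eq_mul, map_add, map_mul, ← hsd, ← hx, map_neg, map_one, zero_sub,
      zero_add] at h
    have h' : s * (s * φ (G.D i G.X)) = s * (2 * (1 + x) * p i) := by
      rw [hpd]; linear_combination -h
    exact mul_left_cancel₀ hs0.ne' h'
  have hΓuX : s * φ (G.Γ G.u G.X) = 2 * (1 + x) * x := by
    rw [GraphData.Γ, map_sum, hxp, mul_sum, mul_sum, ← hxp]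
    refine sum_congr rfl fun i _ => ?_
    rw [map_mul]
    have := h1 i
    have e : φ (G.D i G.u) = p i := by rw [hpd]
    rw [e]; linear_combination p i * this
  have hΓXX : s ^ 2 * φ (G.Γ G.X G.X) = 4 * (1 + x) ^ 2 * x := by
    rw [GraphData.Γ, map_sum, mul_sum]
    have : ∀ i, s ^ 2 * φ (G.D i G.X * G.D i G.X) = 4 * (1 + x) ^ 2 * (p i * p i) := fun i => by
      rw [map_mul]
      linear_combination (s * φ (G.D i G.X) + 2 * (1 + x) * p i) * h1 i
    rw [sum_congr rfl fun i _ => this i, ← mul_sum, ← hxp]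
  have hHH : φ G.HH = ∑ i, ∑ j, φ (G.D j (G.D i G.u)) ^ 2 := by
    simp only [GraphData.HH, GraphData.Γ, map_sum, map_mul, pow_two]
  have hXi : ∀ i, φ (G.D i G.X) = 2 * ∑ j, p j * φ (G.D j (G.D i G.u)) := fun i => by
    simp only [GraphData.X, GraphData.Γ, map_sum, Derivation.leibniz, smul_eq_mul, map_add,
      map_mul, mul_sum, G.D_comm i, hpd]
    exact sum_congr rfl fun j _ => by ring
  have hcs : φ (G.Γ G.X G.X) ≤ 4 * x * φ G.HH := by
    rw [GraphData.Γ, map_sum, hHH, mul_sum]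
    refine sum_le_sum fun i _ => ?_
    have := Finset.sum_mul_sq_le_sq_mul_sq Finset.univ p fun j => φ (G.D j (G.D i G.u))
    rw [map_mul, hXi, hxp, sum_congr rfl fun i _ => (pow_two (p i)).symm]
    nlinarith
  have hlow : (1 + x) ^ 2 ≤ s ^ 2 * φ G.HH := by
    have := mul_le_mul_of_nonneg_left hcs (sq_nonneg s)
    rw [hΓXX] at this
    have h4 : x * (1 + x) ^ 2 ≤ x * (s ^ 2 * φ G.HH) := by linarith
    exact le_of_mul_le_mul_left h4 hx0
  simp only [map_add, map_sub, map_mul, map_neg, map_pow, map_ofNat] at hP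
  have hsd' : φ c - φ G.u = s := by rw [hsd, map_sub]
  rw [hsd', ← hx] at hP
  have e1 : φ G.ρ * (s * φ (G.Γ G.u G.X)) = 2 * x := by
    rw [hΓuX]; linear_combination 2 * x * hρ
  have e2 : φ G.ρ * (s ^ 2 * φ (G.Γ G.X G.X)) = 4 * (1 + x) * x := by
    rw [hΓXX]; linear_combination 4 * (1 + x) * x * hρ
  have e3 : s ^ 2 * (φ G.ρ * φ (G.Γ G.u G.X)) ^ 2 = 4 * x ^ 2 := by
    linear_combination (φ G.ρ * (s * φ (G.Γ G.u G.X)) + 2 * x) * e1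
  have hval : -4 * x + s ^ 2 * (-4 * φ G.HH + 2 * (φ G.ρ * φ (G.Γ G.u G.X)) ^ 2
      - φ G.ρ * φ (G.Γ G.X G.X)) + 8 * s * φ G.ρ * φ (G.Γ G.u G.X)
      = -4 * (s ^ 2 * φ G.HH) + 4 * x ^ 2 + 8 * x := by
    linear_combination 8 * e1 - e2 + 2 * e3
  rw [hval] at hP
  nlinarith

/-- Interior gradient estimate. -/
lemma PerSol.gradient_bound {R : ℕ} {T : ℝ} {g : 𝔼 d → ℝ}
    {U : 𝔼 d × ℝ → ℝ} (h : PerSol R T g U) (hR : 0 < R) {M m0 b K : ℝ}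
    (hg : ∀ y, g y ∈ Icc m0 b)
    (hK : ∀ y, g y < M →
      (1 + ∑ i, fderiv ℝ g y (EuclideanSpace.single i 1) ^ 2) * (M - g y) ^ 2 ≤ K)
    (hK' : (M - m0) ^ 2 ≤ K) (q : 𝔼 d × ℝ) (hq : q ∈ slab d T)
    (hqM : U q < M) : (1 + ∑ i, dX i U q ^ 2) * (M - U q) ^ 2 ≤ K := by
  obtain ⟨p, hpc, hp1, hp2⟩ := h.slope
  by_contra! hcon
  obtain ⟨F, hF⟩ : ∃ F : 𝔼 d × ℝ → ℝ,
    F = fun q => (1 + ∑ i, p i q ^ 2) * (max (M - U q) 0) ^ 2 := ⟨_, rfl⟩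
  have hFc : ContinuousOn F (slab0 d T) := by
    rw [hF]
    exact (continuousOn_const.add (continuousOn_finsetSum _ fun i _ => (hpc i).pow 2)).mul
      (((continuousOn_const.sub h.cont).sup continuousOn_const).pow 2)
  have hp_per : ∀ e, ∀ q ∈ slab0 d T, ∀ i, p i (q + perShift R e) = p i q := by
    intro e q hq i
    have h2 := add_perShift_snd R e q
    rcases hq.1.eq_or_lt with h0 | h0
    · have e1 : q = (q.1, 0) := Prod.ext rfl h0.symm
      have e2 : q + perShift R e = (q.1 + WithLp.toLp 2 fun i => (R : ℝ) * e i, 0) :=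
        Prod.ext rfl (h2.trans h0.symm)
      have hgper : IsPer R g := by
        have := h.per 0; simpa only [h.init] using this
      rw [e2, e1, hp2, hp2]
      exact hgper.fderiv _ q.1 e
    · rw [hp1 i _ ⟨by rw [h2]; exact h0, by rw [h2]; exact hq.2⟩, hp1 i q ⟨h0, hq.2⟩]
      exact dX_add_right U _ (h.shift e) i q
  have hF_per : ∀ e, ∀ q ∈ slab0 d T, F (q + perShift R e) = F q := fun e q hq => by
    rw [hF]; simp only [hp_per e q hq, h.shift]
  have hcpt : IsCompact (cell d R ×ˢ Icc (0 : ℝ) q.2) := (isCompact_cell d R).prod isCompact_Icc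
  have hsub : cell d R ×ˢ Icc (0 : ℝ) q.2 ⊆ slab0 d T := fun y hy =>
    ⟨hy.2.1, hy.2.2.trans_lt hq.2⟩
  have hne : (cell d R ×ˢ Icc (0 : ℝ) q.2).Nonempty := by
    obtain ⟨e, he⟩ := exists_mem_cell hR q.1
    exact ⟨(_, 0), he, le_rfl, hq.1.le⟩
  obtain ⟨z, hz, hzmax⟩ := hcpt.exists_isMaxOn hne (hFc.mono hsub)
  have hmax : ∀ y : 𝔼 d × ℝ, 0 ≤ y.2 → y.2 ≤ q.2 → F y ≤ F z := by
    intro y h0 h1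
    obtain ⟨e, he⟩ := exists_mem_cell hR y.1
    rw [← hF_per e y ⟨h0, h1.trans_lt hq.2⟩]
    exact hzmax ⟨he, by rw [add_perShift_snd]; exact ⟨h0, h1⟩⟩
  have hFq : F q = (1 + ∑ i, dX i U q ^ 2) * (M - U q) ^ 2 := by
    rw [hF]; simp only [hp1 _ q hq]; rw [max_eq_left (by linarith)]
  have hz0 : K < F z := hcon.trans_le (hFq ▸ hmax q hq.1.le le_rfl)
  have hK0 : 0 ≤ K := (sq_nonneg _).trans hK'
  have hzM : U z < M := by
    by_contra! hge
    rw [hF] at hz0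
    simp only [max_eq_right (sub_nonpos.2 hge)] at hz0
    simp at hz0; linarith
  have hFz : F z = (1 + ∑ i, p i z ^ 2) * (M - U z) ^ 2 := by
    rw [hF]; simp only; rw [max_eq_left (by linarith)]
  rcases hz.2.1.eq_or_lt with h0 | h0
  · have e1 : z = (z.1, 0) := Prod.ext rfl h0.symm
    rw [e1, h.init] at hzM
    have := hK z.1 hzM
    rw [hFz, e1, h.init] at hz0
    simp only [hp2] at hz0
    linarith
  · have hzs : z ∈ slab d T := ⟨h0, (hsub hz).2⟩
    rw [hFz] at hz0
    simp only [hp1 _ z hzs] at hz0 hFz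
    have hx : 0 < ∑ i, dX i U z ^ 2 := by
      by_contra! hle
      have : U z ∈ Icc m0 b := h.range m0 b hg z (hsub hz)
      have h3 : (M - U z) ^ 2 ≤ (M - m0) ^ 2 := by
        have := this.1
        nlinarith
      nlinarith [sq_nonneg (M - U z)]
    refine slope_critical (I := Unit) (U := fun _ => U) (isOpen_slab d T) (fun _ => h.sol)
      ((), ⟨z, hzs⟩) M hzM hx ?_
    have hUc : ContinuousAt U z := (h.sol.smooth.contDiffAt
      ((isOpen_slab d T).mem_nhds hzs)).continuousAt
    filter_upwards [hUc.eventually_lt continuousAt_const hzM,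
      (isOpen_slab d T).mem_nhds hzs] with y hy hys hyt
    have := hmax y hys.1.le (le_trans hyt hz.2.2)
    rw [hFz, hF] at this
    simp only [hp1 _ y hys] at this
    rwa [max_eq_left (by linarith)] at this

end

section

variable {d : ℕ}

/-- The second spatial derivative as a quadratic form. -/
def grQ (U : 𝔼 d × ℝ → ℝ) (q : 𝔼 d × ℝ)
    (ξ : Fin d → ℝ) : ℝ := ∑ i, ∑ j, ξ i * ξ j * dX i (dX j U) q

/-- The induced metric of the graph. -/
def grG (U : 𝔼 d × ℝ → ℝ) (q : 𝔼 d × ℝ)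
    (ξ : Fin d → ℝ) : ℝ := ∑ i, ξ i * ξ i + (∑ i, dX i U q * ξ i) ^ 2

/-- The gradient function. -/
def grV (U : 𝔼 d × ℝ → ℝ) (q : 𝔼 d × ℝ) : ℝ :=
  Real.sqrt (1 + ∑ i, dX i U q ^ 2)

lemma metric_shift (p ξ : Fin d → ℝ) {ρ e σ : ℝ} (hρ : ρ * (1 + ∑ i, p i * p i) = 1)
    (hσ : σ = e - ∑ i, p i * ξ i) (hn : ∑ i, ξ i * ξ i + e * e = 1) :
    ∑ i, (ξ i + ρ * σ * p i) * (ξ i + ρ * σ * p i) + (∑ i, p i * (ξ i + ρ * σ * p i)) ^ 2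
      = 1 - ρ * (σ * σ) := by
  have h1 : ∑ i, (ξ i + ρ * σ * p i) * (ξ i + ρ * σ * p i)
      = ∑ i, ξ i * ξ i + 2 * ρ * σ * ∑ i, p i * ξ i + (ρ * σ) ^ 2 * ∑ i, p i * p i := by
    simp only [mul_sum, ← sum_add_distrib]
    exact sum_congr rfl fun i _ => by ring
  have h2 : ∑ i, p i * (ξ i + ρ * σ * p i) = ∑ i, p i * ξ i + ρ * σ * ∑ i, p i * p i := by
    simp only [mul_sum, ← sum_add_distrib]
    exact sum_congr rfl fun i _ => by ring
  rw [h1, h2]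
  generalize ∑ i, p i * ξ i = a at *
  generalize ∑ i, p i * p i = x at *
  have he : e = σ + a := by rw [hσ]; ring
  subst he
  linear_combination hn + (2 * a * σ + ρ * σ ^ 2 * x + σ ^ 2) * hρ

lemma form_shift (p ξ : Fin d → ℝ) {h : Fin d → Fin d → ℝ} (hs : ∀ i j, h i j = h j i) (r : ℝ) :
    ∑ i, ∑ j, (ξ i + r * p i) * (ξ j + r * p j) * h i j
      = ∑ i, ∑ j, ξ i * ξ j * h i j + 2 * r * ∑ i, p i * ∑ j, ξ j * h i j
        + r ^ 2 * ∑ i, ∑ j, p i * p j * h i j := by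
  have h1 : ∑ i, ∑ j, ξ i * p j * h i j = ∑ i, p i * ∑ j, ξ j * h i j := by
    rw [sum_comm]
    refine sum_congr rfl fun i _ => ?_
    rw [mul_sum]
    exact sum_congr rfl fun j _ => by rw [hs i j]; ring
  have h2 : ∑ i, ∑ j, p i * ξ j * h i j = ∑ i, p i * ∑ j, ξ j * h i j := by
    refine sum_congr rfl fun i _ => ?_
    rw [mul_sum]
    exact sum_congr rfl fun j _ => by ring
  have h3 : ∑ i, ∑ j, (ξ i + r * p i) * (ξ j + r * p j) * h i j
      = ∑ i, ∑ j, ξ i * ξ j * h i j + r * ∑ i, ∑ j, ξ i * p j * h i j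
        + r * ∑ i, ∑ j, p i * ξ j * h i j + r ^ 2 * ∑ i, ∑ j, p i * p j * h i j := by
    simp only [mul_sum, ← sum_add_distrib]
    exact sum_congr rfl fun i _ => sum_congr rfl fun j _ => by ring
  rw [h3, h1, h2]; ring

/-- A nonnegative quadratic form vanishing at a vector has that vector in its kernel. -/
lemma kernel_of_nonneg {h : Fin d → Fin d → ℝ} (hs : ∀ i j, h i j = h j i)
    (h0 : ∀ ξ : Fin d → ℝ, 0 ≤ ∑ i, ∑ j, ξ i * ξ j * h i j) {ξ : Fin d → ℝ}
    (hξ : ∑ i, ∑ j, ξ i * ξ j * h i j = 0) (i : Fin d) : ∑ j, ξ j * h i j = 0 := by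
  have key : ∀ r : ℝ, 0 ≤ 2 * r * ∑ j, ξ j * h i j + r ^ 2 * h i i := fun r => by
    have := h0 fun j => ξ j + r * (if j = i then 1 else 0)
    rw [form_shift (fun j => if j = i then (1 : ℝ) else 0) ξ hs r, hξ] at this
    simpa [Finset.sum_ite_eq'] using this
  by_contra hne
  obtain ⟨a, ha⟩ : ∃ a, a = ∑ j, ξ j * h i j := ⟨_, rfl⟩
  rw [← ha] at key hne
  have hpos : 0 < 1 + |h i i| := by positivity
  have := key (-a / (1 + |h i i|))
  have e : 2 * (-a / (1 + |h i i|)) * a + (-a / (1 + |h i i|)) ^ 2 * h i i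
      = a ^ 2 / (1 + |h i i|) ^ 2 * (h i i - 2 * (1 + |h i i|)) := by
    field_simp; ring
  rw [e] at this
  have h1 : h i i - 2 * (1 + |h i i|) < 0 := by have := le_abs_self (h i i); linarith [abs_nonneg (h i i)]
  have h2 : 0 < a ^ 2 / (1 + |h i i|) ^ 2 := by positivity
  nlinarith

lemma dX_comm {O : Set (𝔼 d × ℝ)} (hO : IsOpen O)
    {f : 𝔼 d × ℝ → ℝ} (hf : ContDiffOn ℝ (⊤ : ℕ∞) f O) (i j : Fin d) {q}
    (hq : q ∈ O) : dX i (dX j f) q = dX j (dX i f) q := by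
  have := congrArg (Sm.ev ((), (⟨q, hq⟩ : O)))
    (Sm.D_comm hO (eX i) (eX j) (Sm.ofFn (fun _ : Unit => f) fun _ => hf))
  simpa only [Sm.D_ofFn_eX, Sm.ev_ofFn] using this

/-- The pointwise computation behind the second derivative estimate. -/
lemma hessian_critical {O : Set (𝔼 d × ℝ)}
    {U : 𝔼 d × ℝ → ℝ} (hO : IsOpen O) (hU : GrSol O U)
    {z : 𝔼 d × ℝ} (hz : z ∈ O) {M m V τ ε : ℝ} {ξ : Fin d → ℝ}
    (hs : U z < M) (hτ : τ < z.2) (hm : 0 < m) (hV : grV U z ≤ V) (hε : ε * ε = 1)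
    (hξ : grG U z ξ = 1)
    (hle : ∀ᶠ q in 𝓝 z, q.2 ≤ z.2 → ∀ ξ' : Fin d → ℝ,
      ε * ((q.2 - τ) * ((M - U q) * grQ U q ξ')) ≤ m * ((1 - 1 / (2 * V) * grV U q) * grG U q ξ'))
    (heq : ε * ((z.2 - τ) * ((M - U z) * grQ U z ξ)) = m * (1 - 1 / (2 * V) * grV U z)) :
    m ^ 2 ≤ 4 * (4 * V ^ 2 * ((z.2 - τ) * (M - U z) ^ 2) + 72 * V ^ 8 * (z.2 - τ) ^ 2) := by
  obtain ⟨G, hG⟩ : ∃ G, G = graphData (I := Unit) (U := fun _ => U) hO fun _ => hU := ⟨_, rfl⟩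
  obtain ⟨w, hw⟩ : ∃ w : 𝔼 d × ℝ, w = ∑ i, ξ i • eX i := ⟨_, rfl⟩
  obtain ⟨δ, hδ⟩ : ∃ δ, δ = Sm.D (I := Unit) hO w := ⟨_, rfl⟩
  have hδf : ∀ f, δ f = ∑ i, ξ i • G.D i f := fun f => by
    rw [hδ, hw, Sm.D_sum, hG]; exact sum_congr rfl fun i _ => Sm.D_smul hO _ _ _
  have hδφ : ∀ (φ : Sm Unit O →ₐ[ℝ] ℝ) f, φ (δ f) = ∑ i, ξ i * φ (G.D i f) := fun φ f => by
    rw [hδf, map_sum]; simp only [map_smul, smul_eq_mul]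
  have hcomm : G.Comm δ := fun i f => by rw [hδ, hG]; exact Sm.D_comm hO _ _ f
  have hδt : ∀ f, δ (G.Dt f) = G.Dt (δ f) := fun f => by rw [hδ, hG]; exact Sm.D_comm hO _ _ f
  obtain ⟨θθ, hθθ⟩ : ∃ θθ : Sm Unit O, θθ = Sm.ofFn (fun _ q => q.2 - τ)
    fun _ => (contDiff_snd.sub contDiff_const).contDiffOn := ⟨_, rfl⟩
  have hfd : ∀ q : 𝔼 d × ℝ, ∀ w,
      fderiv ℝ (fun q : 𝔼 d × ℝ => q.2 - τ) q w = w.2 := fun q w => by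
    rw [fderiv_sub_const, fderiv_snd]; rfl
  have hθD : ∀ i, G.D i θθ = 0 := fun i => Sm.ext_ev fun y => by
    rw [hG, hθθ]; refine (Sm.ev_D_ofFn hO _ _ _ y).trans ?_
    rw [hfd, map_zero]; rfl
  have hθT : G.Dt θθ = 1 := Sm.ext_ev fun y => by
    rw [hG, hθθ]; refine (Sm.ev_D_ofFn hO _ _ _ y).trans ?_
    rw [hfd, map_one]; rfl
  obtain ⟨al, hal⟩ : ∃ al : ℝ → Sm Unit O, al = fun a => algebraMap ℝ _ a := ⟨_, rfl⟩
  have halC : ∀ a, G.Cst (al a) := fun a => by rw [hal]; exact GraphData.Cst.algebraMap G a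
  have hale : ∀ (φ : Sm Unit O →ₐ[ℝ] ℝ) a, φ (al a) = a := fun φ a => by
    rw [hal]; exact AlgHom.commutes _ a
  -- evaluation at a point
  obtain ⟨E, hE⟩ : ∃ E : O → (Sm Unit O →ₐ[ℝ] ℝ), E = fun q => Sm.ev ((), q) := ⟨_, rfl⟩
  have eu : ∀ q : O, E q G.u = U q := fun q => by rw [hE, hG]; rfl
  have ev : ∀ q : O, E q G.v = grV U q := fun q => by rw [hE, hG]; rfl
  have eθ : ∀ q : O, E q θθ = (q : 𝔼 d × ℝ).2 - τ := fun q => by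
    rw [hE, hθθ]; rfl
  have hUs : ∀ _ : Unit, ContDiffOn ℝ (⊤ : ℕ∞) U O := fun _ => hU.smooth
  have ep : ∀ (q : O) i, E q (G.D i G.u) = dX i U q := fun q i => by
    rw [hE, hG]; exact Sm.ev_D_ofFn hO (fun _ : Unit => U) hUs _ ((), q)
  have eh : ∀ (q : O) i j, E q (G.D i (G.D j G.u)) = dX i (dX j U) q := fun q i j => by
    rw [hE, hG]
    change Sm.ev ((), q) (Sm.D hO (eX i) (Sm.D hO (eX j) (Sm.ofFn (fun _ : Unit => U) hUs))) = _
    rw [Sm.D_ofFn_eX, Sm.D_ofFn_eX]; rfl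
  have eρ : ∀ q : O, E q G.ρ * (1 + ∑ i, dX i U q * dX i U q) = 1 := fun q => by
    have := congrArg (E q) G.ρ_mul
    simpa only [map_mul, map_add, map_one, map_sum, ep] using this
  have eδ : ∀ q : O, E q (δ G.u) = ∑ i, dX i U q * ξ i := fun q => by
    rw [hδφ]; exact sum_congr rfl fun i _ => by rw [ep]; ring
  have eDδ : ∀ (q : O) i, E q (G.D i (δ G.u)) = ∑ j, ξ j * dX i (dX j U) q := fun q i => by
    rw [← hcomm, hδφ]
    exact sum_congr rfl fun j _ => by rw [G.D_comm, eh]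
  have eδδ : ∀ q : O, E q (δ (δ G.u)) = grQ U q ξ := fun q => by
    rw [hδφ, grQ]
    refine sum_congr rfl fun i _ => ?_
    rw [eDδ, mul_sum]; exact sum_congr rfl fun j _ => by ring
  have eΓ : ∀ q : O, E q (G.Γ G.u (δ G.u)) = ∑ i, dX i U q * ∑ j, ξ j * dX i (dX j U) q :=
    fun q => by rw [GraphData.Γ, map_sum]; simp only [map_mul, ep, eDδ]
  have eX : ∀ q : O, E q (G.Γ G.u G.X) = 2 * grQ U q fun i => dX i U q := fun q => by
    simp only [GraphData.Γ, GraphData.X, map_sum, map_mul, Derivation.leibniz, smul_eq_mul,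
      map_add, ep, eh, grQ, mul_sum]
    exact sum_congr rfl fun i _ => sum_congr rfl fun j _ => by ring
  obtain ⟨e, he⟩ : ∃ e, e = ∑ i, dX i U z * ξ i := ⟨_, rfl⟩
  have hn : ∑ i, ξ i * ξ i + e * e = 1 := by rw [he, ← hξ, grG, pow_two]
  have hsymm : ∀ q ∈ O, ∀ i j, dX i (dX j U) q = dX j (dX i U) q := fun q hq i j =>
    dX_comm hO hU.smooth i j hq
  have hs0 : 0 < M - U z := sub_pos.2 hs
  have hτ0 : 0 < z.2 - τ := sub_pos.2 hτ
  -- first order condition in `ξ`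
  have heig : ∀ i, ∑ j, ξ j * dX i (dX j U) z = grQ U z ξ * (ξ i + e * dX i U z) := fun i => by
    obtain ⟨B, hB⟩ : ∃ B, B = m * (1 - 1 / (2 * V) * grV U z) := ⟨_, rfl⟩
    obtain ⟨A, hA⟩ : ∃ A, A = ε * ((z.2 - τ) * (M - U z)) := ⟨_, rfl⟩
    have hA0 : A ≠ 0 := by
      rw [hA]; exact mul_ne_zero (fun h => by simp [h] at hε) (mul_pos hτ0 hs0).ne'
    have hAQ : A * grQ U z ξ = B := by rw [hA, hB, ← heq]; ring
    obtain ⟨k, hk⟩ : ∃ k : Fin d → Fin d → ℝ, k = fun i j =>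
      B * ((if i = j then 1 else 0) + dX i U z * dX j U z) - A * dX i (dX j U) z := ⟨_, rfl⟩
    have hks : ∀ i j, k i j = k j i := fun i j => by
      rw [hk]; simp only [hsymm z hz i j, eq_comm (a := i)]; ring
    have hform : ∀ η : Fin d → ℝ, ∑ i, ∑ j, η i * η j * k i j
        = B * grG U z η - A * grQ U z η := fun η => by
      have h1 : ∀ i j, η i * η j * k i j = B * (η i * η j * (if i = j then 1 else 0))
          + B * ((dX i U z * η i) * (dX j U z * η j))
          - A * (η i * η j * dX i (dX j U) z) := fun i j => by rw [hk]; ring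
      simp only [h1, sum_sub_distrib, sum_add_distrib, ← mul_sum]
      rw [← sum_mul, grG, grQ, pow_two]
      simp only [mul_ite, mul_one, mul_zero, Finset.sum_ite_eq, Finset.mem_univ, if_true]
      ring
    have h0 : ∀ η : Fin d → ℝ, 0 ≤ ∑ i, ∑ j, η i * η j * k i j := fun η => by
      have := hle.self_of_nhds le_rfl η
      rw [hform, hA, hB]; linarith
    have := kernel_of_nonneg hks h0 (ξ := ξ) (by rw [hform, hξ, hAQ]; ring) i
    have h1 : ∑ j, ξ j * k i j = B * (ξ i + e * dX i U z)
        - A * ∑ j, ξ j * dX i (dX j U) z := by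
      have h1 : ∀ j, ξ j * k i j = B * (ξ j * (if i = j then 1 else 0))
          + B * dX i U z * (dX j U z * ξ j) - A * (ξ j * dX i (dX j U) z) := fun j => by
        rw [hk]; ring
      simp only [h1, sum_sub_distrib, sum_add_distrib, ← mul_sum, ← he]
      simp only [mul_ite, mul_one, mul_zero, Finset.sum_ite_eq, Finset.mem_univ, if_true]
      ring
    rw [h1, ← hAQ] at this
    exact mul_left_cancel₀ hA0 (by linarith)
  obtain ⟨H, hH⟩ : ∃ H, H = 2 * (al m * ((1 - al (1 / (2 * V)) * G.v)
      * (1 - G.ρ * ((al e - δ G.u) * (al e - δ G.u)))))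
      - al ε * (θθ * ((al M - G.u) * (2 * δ (δ G.u)
        + (al e - δ G.u) * (4 * G.ρ * G.Γ G.u (δ G.u))
        + (al e - δ G.u) * (al e - δ G.u) * (G.ρ * G.ρ * G.Γ G.u G.X)))) := ⟨_, rfl⟩
  have hHq : ∀ q : O, ∃ η : Fin d → ℝ, E q H
      = 2 * (m * ((1 - 1 / (2 * V) * grV U q) * grG U q η)
        - ε * ((q.1.2 - τ) * ((M - U q) * grQ U q η))) := fun q => by
    obtain ⟨s, hs⟩ : ∃ s, s = e - ∑ i, dX i U q * ξ i := ⟨_, rfl⟩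
    refine ⟨fun i => ξ i + E q G.ρ * s * dX i U q, ?_⟩
    rw [grG, metric_shift (fun i => dX i U q) ξ (eρ q) hs hn, grQ,
      form_shift (fun i => dX i U q) ξ (hsymm q q.2), hH]
    simp only [map_sub, map_mul, map_add, map_one, map_ofNat, hale, eu, ev, eθ, eδ, eδδ, eΓ, eX,
      ← hs, grQ]
    ring
  have hHz : E ⟨z, hz⟩ H = 0 := by
    rw [hH]
    simp only [map_sub, map_mul, map_add, map_one, map_ofNat, hale, eu, ev, eθ, eδ, eδδ, ← he]
    linear_combination (-2) * heq
  have hfn : ∀ q : O, H.fn () q = E q H := fun q => by rw [hE]; exact Sm.fn_apply H () q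
  have hmin := parabolic_min (I := Unit) (U := fun _ => U) hO (fun _ => hU) (f := H)
    (z := ((), ⟨z, hz⟩)) (by
      filter_upwards [hle, hO.mem_nhds hz] with q hq hqO hqt
      have h1 := hfn ⟨z, hz⟩
      have h2 := hfn ⟨q, hqO⟩
      simp only at h1 h2 hqt ⊢
      rw [h1, h2, hHz]
      obtain ⟨η, hη⟩ := hHq ⟨q, hqO⟩
      rw [hη]
      have := hq hqt η
      simp only
      linarith)
  rw [← hG] at hmin
  have hEz : E ⟨z, hz⟩ = Sm.ev ((), ⟨z, hz⟩) := by rw [hE]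
  rw [← hEz] at hmin
  have hv1 : 0 < E ⟨z, hz⟩ G.v := by
    rw [ev]; exact Real.sqrt_pos.2 (one_add_sum_sq_pos _)
  have := G.second_critical (φ := E ⟨z, hz⟩) hcomm hδt (hδφ _) (halC e) (halC M) (halC m)
    (halC (1 / (2 * V))) (halC ε) hθD hθT (q := grQ U z ξ) (e := e) (V := V) (by rw [eδ, he])
    (by rw [map_sub, hale, eδ, he, sub_self]) (fun i => by rw [eDδ, ep]; exact heig i) hn
    (by rwa [hale]) hv1 (by rwa [ev]) (hale _ _) (by rwa [eθ]) (by rw [map_sub, hale, eu]; exact hs0)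
    (by rw [hale]; exact hε) hH hHz hmin.1 hmin.2
  simpa only [hale, eθ, map_sub, eu] using this

end

section

variable {d : ℕ}

lemma grQ_smul (U : 𝔼 d × ℝ → ℝ) (q) (r : ℝ) (ξ : Fin d → ℝ) :
    grQ U q (fun i => r * ξ i) = r ^ 2 * grQ U q ξ := by
  simp only [grQ, mul_sum]
  exact sum_congr rfl fun i _ => sum_congr rfl fun j _ => by ring

lemma grG_smul (U : 𝔼 d × ℝ → ℝ) (q) (r : ℝ) (ξ : Fin d → ℝ) :
    grG U q (fun i => r * ξ i) = r ^ 2 * grG U q ξ := by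
  have : ∑ i, dX i U q * (r * ξ i) = r * ∑ i, dX i U q * ξ i := by
    rw [mul_sum]; exact sum_congr rfl fun i _ => by ring
  have h2 : ∑ i, r * ξ i * (r * ξ i) = r ^ 2 * ∑ i, ξ i * ξ i := by
    rw [mul_sum]; exact sum_congr rfl fun i _ => by ring
  rw [grG, grG, this, h2]; ring

lemma le_grG (U : 𝔼 d × ℝ → ℝ) (q) (ξ : Fin d → ℝ) :
    ∑ i, ξ i * ξ i ≤ grG U q ξ := le_add_of_nonneg_right (sq_nonneg _)

lemma grV_sq (U : 𝔼 d × ℝ → ℝ) (q) :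
    grV U q ^ 2 = 1 + ∑ i, dX i U q ^ 2 := Real.sq_sqrt (one_add_sum_sq_pos _).le

lemma grV_nonneg (U : 𝔼 d × ℝ → ℝ) (q) : 0 ≤ grV U q := Real.sqrt_nonneg _

lemma grG_le (U : 𝔼 d × ℝ → ℝ) (q) (ξ : Fin d → ℝ) :
    grG U q ξ ≤ grV U q ^ 2 * ∑ i, ξ i * ξ i := by
  have := Finset.sum_mul_sq_le_sq_mul_sq Finset.univ (fun i => dX i U q) ξ
  rw [grV_sq, grG]
  simp only [← pow_two] at *
  linarith

lemma isCompact_unitSphere (d : ℕ) : IsCompact {ξ : Fin d → ℝ | ∑ i, ξ i * ξ i = 1} := by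
  refine (isCompact_closedBall (0 : Fin d → ℝ) 1).of_isClosed_subset
    (isClosed_eq (by fun_prop) continuous_const) fun ξ hξ => ?_
  rw [mem_closedBall, dist_zero_right, pi_norm_le_iff_of_nonneg zero_le_one]
  intro i
  have h1 : ξ i * ξ i ≤ ∑ i, ξ i * ξ i :=
    single_le_sum (f := fun i => ξ i * ξ i) (fun i _ => mul_self_nonneg _)
      (Finset.mem_univ i)
  rw [mem_setOf_eq] at hξ
  rw [Real.norm_eq_abs]
  exact abs_le_of_sq_le_sq (by nlinarith) zero_le_one

/-- One-sided interior second derivative estimate. -/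
lemma PerSol.hessian_bound_aux {R : ℕ} {T : ℝ} {g : 𝔼 d → ℝ}
    {U : 𝔼 d × ℝ → ℝ} (h : PerSol R T g U) (hR : 0 < R) {M V S : ℝ}
    (hV1 : 1 ≤ V) (hV : ∀ q ∈ slab d T, U q < M → grV U q ≤ V)
    (hS : ∀ q ∈ slab d T, M - U q ≤ S) (q : 𝔼 d × ℝ) (hq : q ∈ slab d T)
    (hqM : U q < M) (ξ : Fin d → ℝ) {ε : ℝ} (hε : ε * ε = 1) :
    ε * (q.2 / 2 * ((M - U q) * grQ U q ξ)) ≤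
      Real.sqrt (8 * V ^ 2 * S ^ 2 * q.2 + 72 * V ^ 8 * q.2 ^ 2) * (V ^ 2 * ∑ i, ξ i * ξ i) := by
  have hV0 : 0 < V := by linarith
  have hnn : ∀ ξ : Fin d → ℝ, 0 ≤ ∑ i, ξ i * ξ i := fun ξ =>
    sum_nonneg fun i _ => mul_self_nonneg _
  have hrhs : 0 ≤ Real.sqrt (8 * V ^ 2 * S ^ 2 * q.2 + 72 * V ^ 8 * q.2 ^ 2)
      * (V ^ 2 * ∑ i, ξ i * ξ i) := by have := hnn ξ; positivity
  obtain ⟨τ, hτ⟩ : ∃ τ, τ = q.2 / 2 := ⟨_, rfl⟩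
  have hq0 : 0 < q.2 := hq.1
  have hτ0 : 0 < τ := by rw [hτ]; linarith
  obtain ⟨ω, hω⟩ : ∃ ω : 𝔼 d × ℝ → ℝ,
    ω = fun y => max (1 - 1 / (2 * V) * grV U y) (1 / 2) := ⟨_, rfl⟩
  have hω2 : ∀ y, 1 / 2 ≤ ω y := fun y => by rw [hω]; exact le_max_right _ _
  have hω1 : ∀ y, ω y ≤ 1 := fun y => by
    rw [hω]
    have := grV_nonneg U y
    exact max_le (by have : 0 ≤ 1 / (2 * V) * grV U y := by positivity
                     linarith) (by norm_num)
  obtain ⟨N, hN⟩ : ∃ N : 𝔼 d × ℝ → (Fin d → ℝ) → ℝ,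
    N = fun y η => ε * ((y.2 - τ) * (max (M - U y) 0 * grQ U y η)) := ⟨_, rfl⟩
  obtain ⟨B, hB⟩ : ∃ B : 𝔼 d × ℝ → (Fin d → ℝ) → ℝ,
    B = fun y η => ω y * grG U y η := ⟨_, rfl⟩
  have hNs : ∀ y r η, N y (fun i => r * η i) = r ^ 2 * N y η := fun y r η => by
    rw [hN]; simp only [grQ_smul]; ring
  have hBs : ∀ y r η, B y (fun i => r * η i) = r ^ 2 * B y η := fun y r η => by
    rw [hB]; simp only [grG_smul]; ring
  have hBpos : ∀ y η, ∑ i, η i * η i = 1 → 0 < B y η := fun y η hη => by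
    rw [hB]
    have h1 := le_grG U y η
    exact mul_pos (by linarith [hω2 y]) (by linarith)
  have hO := isOpen_slab d T
  obtain ⟨K, hK⟩ : ∃ K : Set (𝔼 d × ℝ), K = cell d R ×ˢ Icc τ q.2 := ⟨_, rfl⟩
  have hKs : K ⊆ slab d T := fun y hy => by
    rw [hK] at hy; exact ⟨hτ0.trans_le hy.2.1, hy.2.2.trans_lt hq.2⟩
  -- normalisation of vectors
  have hnorm : ∀ η : Fin d → ℝ, (∀ i, η i = 0) ∨ ∃ (r : ℝ) (η' : Fin d → ℝ), ∑ i, η' i * η' i = 1 ∧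
      η = fun i => r * η' i := fun η => by
    rcases (hnn η).eq_or_lt with h0 | h0
    · left
      intro i
      have := (Finset.sum_eq_zero_iff_of_nonneg fun i _ => mul_self_nonneg (η i)).1 h0.symm i
        (Finset.mem_univ i)
      exact mul_self_eq_zero.1 this
    · right
      obtain ⟨r, hr⟩ : ∃ r, r = Real.sqrt (∑ i, η i * η i) := ⟨_, rfl⟩
      have hr0 : 0 < r := by rw [hr]; exact Real.sqrt_pos.2 h0
      have hr2 : r * r = ∑ i, η i * η i := by rw [hr]; exact Real.mul_self_sqrt h0.le
      refine ⟨r, fun i => r⁻¹ * η i, ?_, ?_⟩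
      · have : ∀ i, r⁻¹ * η i * (r⁻¹ * η i) = r⁻¹ * r⁻¹ * (η i * η i) := fun i => by ring
        simp only [this, ← mul_sum, ← hr2]
        field_simp
      · funext i; field_simp
  rcases hnorm ξ with hξ0 | ⟨r0, ξ1, hξ1, -⟩
  · have : grQ U q ξ = 0 := by simp [grQ, hξ0]
    rw [this]; simpa using hrhs
  have hdX : ∀ i, ContinuousOn (dX i U) (slab d T) := fun i =>
    (contDiffOn_dX hO h.sol.smooth i).continuousOn
  have hddX : ∀ i j, ContinuousOn (dX i (dX j U)) (slab d T) := fun i j =>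
    (contDiffOn_dX hO (contDiffOn_dX hO h.sol.smooth j) i).continuousOn
  have hUc : ContinuousOn U (slab d T) := h.sol.smooth.continuousOn
  have hVc : ContinuousOn (grV U) (slab d T) := by
    unfold grV
    exact (continuousOn_const.add (continuousOn_finsetSum _ fun i _ => (hdX i).pow 2)).sqrt
  have hfst : ∀ {f : 𝔼 d × ℝ → ℝ}, ContinuousOn f (slab d T) →
      ContinuousOn (fun y : (𝔼 d × ℝ) × (Fin d → ℝ) => f y.1)
        (K ×ˢ {ξ : Fin d → ℝ | ∑ i, ξ i * ξ i = 1}) := fun hf =>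
    hf.comp continuousOn_fst fun y hy => hKs hy.1
  have hsnd : ∀ i, ContinuousOn (fun y : (𝔼 d × ℝ) × (Fin d → ℝ) => y.2 i)
        (K ×ˢ {ξ : Fin d → ℝ | ∑ i, ξ i * ξ i = 1}) := fun i =>
    Continuous.continuousOn (by fun_prop)
  have hNc : ContinuousOn (fun y : (𝔼 d × ℝ) × (Fin d → ℝ) => N y.1 y.2)
      (K ×ˢ {ξ : Fin d → ℝ | ∑ i, ξ i * ξ i = 1}) := by
    rw [hN]
    refine continuousOn_const.mul (ContinuousOn.mul (Continuous.continuousOn (by fun_prop))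
      (((continuousOn_const.sub (hfst hUc)).sup continuousOn_const).mul ?_))
    unfold grQ
    exact continuousOn_finsetSum _ fun i _ => continuousOn_finsetSum _ fun j _ =>
      ((hsnd i).mul (hsnd j)).mul (hfst (hddX i j))
  have hBc : ContinuousOn (fun y : (𝔼 d × ℝ) × (Fin d → ℝ) => B y.1 y.2)
      (K ×ˢ {ξ : Fin d → ℝ | ∑ i, ξ i * ξ i = 1}) := by
    rw [hB, hω]
    refine ContinuousOn.mul ((continuousOn_const.sub
      (continuousOn_const.mul (hfst hVc))).sup continuousOn_const) ?_
    unfold grG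
    exact (continuousOn_finsetSum _ fun i _ => (hsnd i).mul (hsnd i)).add
      ((continuousOn_finsetSum _ fun i _ => (hfst (hdX i)).mul (hsnd i)).pow 2)
  obtain ⟨⟨z, ξ0⟩, ⟨hz, hξ0⟩, hzmax⟩ := IsCompact.exists_isMaxOn
    (s := K ×ˢ {ξ : Fin d → ℝ | ∑ i, ξ i * ξ i = 1})
    ((hK ▸ (isCompact_cell d R).prod isCompact_Icc).prod (isCompact_unitSphere d))
    (by
      obtain ⟨e, he⟩ := exists_mem_cell hR q.1
      refine ⟨((q.1 + WithLp.toLp 2 fun i => (R : ℝ) * e i, q.2), ξ1), ?_, hξ1⟩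
      rw [hK]; exact ⟨he, by rw [hτ]; linarith, le_rfl⟩)
    (hNc.div hBc fun y hy => (hBpos _ _ hy.2).ne')
  obtain ⟨m, hm⟩ : ∃ m, m = N z ξ0 / B z ξ0 := ⟨_, rfl⟩
  have hmax : ∀ y : 𝔼 d × ℝ, τ ≤ y.2 → y.2 ≤ q.2 → ∀ η, N y η ≤ m * B y η := by
    intro y h0 h1 η
    obtain ⟨e, he⟩ := exists_mem_cell hR y.1
    have hsh : ∀ y, U (y + perShift R e) = U y := h.shift e
    have hdsh : ∀ i y, dX i U (y + perShift R e) = dX i U y := fun i y =>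
      dX_add_right U _ hsh i y
    have hddsh : ∀ i j y, dX i (dX j U) (y + perShift R e) = dX i (dX j U) y := fun i j y =>
      dX_add_right _ _ (fun y => hdsh j y) i y
    have hshN : ∀ η, N (y + perShift R e) η = N y η := fun η => by
      rw [hN]; simp only [add_perShift_snd, hsh, grQ, hddsh]
    have hshB : ∀ η, B (y + perShift R e) η = B y η := fun η => by
      rw [hB, hω]; simp only [grG, grV, hdsh]
    rcases hnorm η with hη | ⟨r, η', hη', rfl⟩
    · have e1 : N y η = 0 := by rw [hN]; simp [grQ, hη]
      have e2 : B y η = 0 := by rw [hB]; simp [grG, hη]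
      rw [e1, e2]; simp
    · rw [hNs, hBs]
      have h3 : N (y + perShift R e) η' / B (y + perShift R e) η' ≤ m := by
        rw [hm]
        exact hzmax (show (y + perShift R e, η') ∈ _ from
          ⟨hK ▸ ⟨he, by rw [add_perShift_snd]; exact ⟨h0, h1⟩⟩, hη'⟩)
      rw [div_le_iff₀ (hBpos _ _ hη'), hshN, hshB] at h3
      nlinarith [sq_nonneg r]
  have hNq : N q ξ = ε * (q.2 / 2 * ((M - U q) * grQ U q ξ)) := by
    rw [hN]; simp only [max_eq_left (sub_pos.2 hqM).le, hτ]; ring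
  have hq1 := hmax q (by rw [hτ]; linarith) le_rfl ξ
  rw [hNq] at hq1
  have hBq : B q ξ ≤ V ^ 2 * ∑ i, ξ i * ξ i := by
    have h1 := grG_le U q ξ
    have h2 := hV q hq hqM
    have h3 := (hnn ξ).trans (le_grG U q ξ)
    rw [hB]
    calc ω q * grG U q ξ ≤ 1 * grG U q ξ := mul_le_mul_of_nonneg_right (hω1 q) h3
      _ ≤ grV U q ^ 2 * ∑ i, ξ i * ξ i := by rw [one_mul]; exact h1
      _ ≤ _ := mul_le_mul_of_nonneg_right (pow_le_pow_left₀ (grV_nonneg U q) h2 2) (hnn ξ)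
  have hBq0 : 0 ≤ B q ξ := by
    rw [hB]; exact mul_nonneg (by linarith [hω2 q]) ((hnn ξ).trans (le_grG U q ξ))
  rcases le_or_gt m 0 with hm0 | hm0
  · exact (hq1.trans (mul_nonpos_of_nonpos_of_nonneg hm0 hBq0)).trans hrhs
  suffices hm2 : m ≤ Real.sqrt (8 * V ^ 2 * S ^ 2 * q.2 + 72 * V ^ 8 * q.2 ^ 2) from
    hq1.trans (mul_le_mul hm2 hBq hBq0 (Real.sqrt_nonneg _))
  have hzS := hKs hz
  have hNz : N z ξ0 = m * B z ξ0 := by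
    rw [hm, div_mul_cancel₀ _ (hBpos z ξ0 hξ0).ne']
  have hNz0 : 0 < N z ξ0 := by rw [hNz]; exact mul_pos hm0 (hBpos z ξ0 hξ0)
  rw [hK] at hz
  have hzM : U z < M := by
    by_contra! hge
    rw [hN] at hNz0
    simp only [max_eq_right (sub_nonpos.2 hge)] at hNz0
    simp at hNz0
  have hzτ : τ < z.2 := by
    rcases hz.2.1.eq_or_lt with h0 | h0
    · have : N z ξ0 = 0 := by
        have e : z.2 - τ = 0 := sub_eq_zero.2 h0.symm
        rw [hN]; simp only [e, zero_mul, mul_zero]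
      linarith
    · exact h0
  have hωV : ∀ y ∈ slab d T, U y < M → ω y = 1 - 1 / (2 * V) * grV U y := fun y hy hyM => by
    rw [hω]
    refine max_eq_left ?_
    have h1 := hV y hy hyM
    have h2 : 1 / (2 * V) * grV U y ≤ 1 / (2 * V) * V :=
      mul_le_mul_of_nonneg_left h1 (by positivity)
    have h3 : 1 / (2 * V) * V = 1 / 2 := by field_simp
    linarith
  have hG0 : 0 < grG U z ξ0 := by have := le_grG U z ξ0; rw [mem_setOf_eq] at hξ0; linarith
  obtain ⟨r, hr⟩ : ∃ r, r = (Real.sqrt (grG U z ξ0))⁻¹ := ⟨_, rfl⟩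
  have hr2 : r ^ 2 * grG U z ξ0 = 1 := by
    rw [hr, inv_pow, Real.sq_sqrt hG0.le, inv_mul_cancel₀ hG0.ne']
  have hUz : ContinuousAt U z := (h.sol.smooth.contDiffAt (hO.mem_nhds hzS)).continuousAt
  have key := hessian_critical hO h.sol hzS (ξ := fun i => r * ξ0 i) hzM hzτ hm0
    (hV z hzS hzM) hε (by rw [grG_smul, hr2])
    (by
      filter_upwards [hUz.eventually_lt continuousAt_const hzM, hO.mem_nhds hzS,
        (isOpen_lt continuous_const continuous_snd).mem_nhds
          (s := {y : 𝔼 d × ℝ | τ < y.2}) hzτ] with y hy hyS hyτ hyt η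
      have := hmax y (le_of_lt hyτ) (hyt.trans hz.2.2) η
      rw [hN, hB] at this
      simp only [max_eq_left (sub_pos.2 hy).le, hωV y hyS hy] at this
      exact this)
    (by
      have := hNs z r ξ0
      have h1 := hBs z r ξ0
      rw [hNz] at this
      rw [hN, hB] at this
      simp only [max_eq_left (sub_pos.2 hzM).le, hωV z hzS hzM] at this
      rw [this]
      linear_combination (m * (1 - 1 / (2 * V) * grV U z)) * hr2)
  refine Real.le_sqrt_of_sq_le (key.trans ?_)
  have h1 : 0 < z.2 - τ := sub_pos.2 hzτ
  have h2 : z.2 - τ ≤ q.2 / 2 := by have := hz.2.2; rw [hτ]; linarith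
  have h3 : (M - U z) ^ 2 ≤ S ^ 2 := by
    have := hS z hzS
    exact pow_le_pow_left₀ (sub_pos.2 hzM).le this 2
  have h4 : (z.2 - τ) * (M - U z) ^ 2 ≤ q.2 / 2 * S ^ 2 :=
    mul_le_mul h2 h3 (sq_nonneg _) (by linarith)
  have h5 : (z.2 - τ) ^ 2 ≤ (q.2 / 2) ^ 2 := pow_le_pow_left₀ h1.le h2 2
  have h6 := mul_le_mul_of_nonneg_left h4 (by positivity : 0 ≤ 16 * V ^ 2)
  have h7 := mul_le_mul_of_nonneg_left h5 (by positivity : 0 ≤ 288 * V ^ 8)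
  nlinarith

/-- Interior second derivative estimate. -/
lemma PerSol.hessian_bound {R : ℕ} {T : ℝ} {g : 𝔼 d → ℝ}
    {U : 𝔼 d × ℝ → ℝ} (h : PerSol R T g U) (hR : 0 < R) {M V S : ℝ}
    (hV1 : 1 ≤ V) (hV : ∀ q ∈ slab d T, U q < M → grV U q ≤ V)
    (hS : ∀ q ∈ slab d T, M - U q ≤ S) (q : 𝔼 d × ℝ) (hq : q ∈ slab d T)
    (hqM : U q < M) (ξ : Fin d → ℝ) :
    q.2 * (M - U q) ^ 2 * grQ U q ξ ^ 2 ≤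
      (32 * V ^ 2 * S ^ 2 + 288 * V ^ 8 * q.2) * V ^ 4 * (∑ i, ξ i * ξ i) ^ 2 := by
  have h1 := h.hessian_bound_aux hR hV1 hV hS q hq hqM ξ (ε := 1) (by norm_num)
  have h2 := h.hessian_bound_aux hR hV1 hV hS q hq hqM ξ (ε := -1) (by norm_num)
  have hq0 : 0 < q.2 := hq.1
  have h3 := sq_le_sq' (by linarith) (h1.trans_eq' (one_mul _).symm)
  rw [one_mul, mul_pow (Real.sqrt _), Real.sq_sqrt (by positivity)] at h3
  have : q.2 * (q.2 * (M - U q) ^ 2 * grQ U q ξ ^ 2) ≤ q.2 *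
      ((32 * V ^ 2 * S ^ 2 + 288 * V ^ 8 * q.2) * V ^ 4 * (∑ i, ξ i * ξ i) ^ 2) := by
    linarith
  exact le_of_mul_le_mul_left this hq0

end

namespace FlowModel

variable {d : ℕ} {Λ : ℝ} {σ : Stencil d Λ} (M : FlowModel σ)

/-- Models without a mesh: differences are derivations. -/
structure Cts : Prop where
  h : M.h = 0
  dt_mul : ∀ f g, M.dt (f * g) = f * M.dt g + g * M.dt f
  sh : ∀ s z, M.sh s z = z

variable {M} (hM : M.Cts)
include hM

lemma Cts.τ (s : σ.S) (f : M.R) : M.τ s f = f := by rw [M.τ_eq, hM.h, zero_mul, add_zero]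

lemma Cts.δ_mul (s : σ.S) (f g : M.R) : M.δ s (f * g) = f * M.δ s g + g * M.δ s f := by
  rw [M.δ_mul, hM.τ]; ring

lemma Cts.δ_neg (s : σ.S) (f : M.R) : M.δ (σ.neg s) f = -M.δ s f := by
  have := M.h_δδ s f
  rw [hM.h, zero_mul] at this
  linear_combination this

lemma Cts.ev_res (z : M.Z) (f : M.R) : M.ev z (M.res f)
    = M.ev z (M.dt f) - 1 / 2 * ∑ s, M.ev z (M.lam s) * M.ev z (M.δ s (M.δ s f)) := by
  simp only [FlowModel.res, FlowModel.L, hM.δ_neg, map_sub, map_smul, map_sum, map_mul, map_neg,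
    smul_eq_mul, mul_neg, sum_neg_distrib, neg_mul, neg_neg]

lemma Cts.ev_res_add (z : M.Z) (f g : M.R) :
    M.ev z (M.res (f + g)) = M.ev z (M.res f) + M.ev z (M.res g) := by
  simp only [hM.ev_res, map_add, mul_add, sum_add_distrib]; ring

lemma Cts.ev_res_sum (z : M.Z) {J : Type*} (t : Finset J) (f : J → M.R) :
    M.ev z (M.res (∑ j ∈ t, f j)) = ∑ j ∈ t, M.ev z (M.res (f j)) := by
  classical
  induction t using Finset.induction_on with
  | empty => simp [hM.ev_res]
  | insert j t hj ih => rw [Finset.sum_insert hj, Finset.sum_insert hj, hM.ev_res_add, ih]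

lemma Cts.ev_res_mul (z : M.Z) (f g : M.R) : M.ev z (M.res (f * g))
    = M.ev z f * M.ev z (M.res g) + M.ev z g * M.ev z (M.res f)
      - ∑ s, M.ev z (M.lam s) * (M.ev z (M.δ s f) * M.ev z (M.δ s g)) := by
  have : ∀ s, M.ev z (M.lam s) * M.ev z (M.δ s (M.δ s (f * g)))
      = M.ev z f * (M.ev z (M.lam s) * M.ev z (M.δ s (M.δ s g)))
        + M.ev z g * (M.ev z (M.lam s) * M.ev z (M.δ s (M.δ s f)))
        + 2 * (M.ev z (M.lam s) * (M.ev z (M.δ s f) * M.ev z (M.δ s g))) := fun s => by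
    simp only [hM.δ_mul, map_add, map_mul]; ring
  rw [hM.ev_res, hM.ev_res, hM.ev_res]
  simp only [this, hM.dt_mul, sum_add_distrib, ← mul_sum, map_add, map_mul]
  ring

lemma Cts.dt_one : M.dt 1 = 0 := by
  have := hM.dt_mul 1 1
  simp only [one_mul] at this
  exact left_eq_add.1 this

lemma Cts.dt_algebraMap (a : ℝ) : M.dt (algebraMap ℝ M.R a) = 0 := by
  rw [Algebra.algebraMap_eq_smul_one, map_smul, hM.dt_one, smul_zero]

lemma Cts.ev_res_algebraMap (z : M.Z) (a : ℝ) : M.ev z (M.res (algebraMap ℝ M.R a)) = 0 := by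
  rw [hM.ev_res, hM.dt_algebraMap]; simp

lemma Cts.sat (D : Set M.Z) : M.Sat D := fun s z hz => by rwa [hM.sh]

omit hM in
variable (M) in
/-- The energy as a ring element. -/
def en (m : ℕ) : M.R := ∑ γ ∈ σ.words m, M.jet γ * M.jet γ

omit hM in
lemma ev_en (m : ℕ) (z : M.Z) : M.ev z (M.en m) = M.energy m z := by
  simp only [en, energy, map_sum, map_mul, pow_two]

omit hM in
lemma sum_lam_gain {z : M.Z} (hz : ∀ i, |M.ev z (M.p i)| ≤ Λ) (m : ℕ) :
    σ.c0 * M.gain m z ≤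
      ∑ s, M.ev z (M.lam s) * ∑ γ ∈ σ.words m, M.ev z (M.jet (s :: γ)) ^ 2 := by
  rw [gain, mul_sum]
  exact sum_le_sum fun s _ => mul_le_mul_of_nonneg_right (M.c0_le_lam hz s)
    (sum_nonneg fun _ _ => sq_nonneg _)

lemma Cts.ev_res_en {z : M.Z} (hz : ∀ i, |M.ev z (M.p i)| ≤ Λ) {m : ℕ} {K : ℝ}
    (hK : ∀ γ : List σ.S, γ.length ≤ m → |M.ev z (M.res (M.jet γ))| ≤ K) :
    M.ev z (M.res (M.en m)) ≤ 2 * (σ.words m).card * Real.sqrt (M.energy m z) * K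
      - σ.c0 * M.gain m z := by
  have h1 : M.ev z (M.res (M.en m)) = ∑ γ ∈ σ.words m, 2 * M.ev z (M.jet γ) * M.ev z (M.res (M.jet γ))
      - ∑ s, M.ev z (M.lam s) * ∑ γ ∈ σ.words m, M.ev z (M.jet (s :: γ)) ^ 2 := by
    rw [en, hM.ev_res_sum]
    simp only [hM.ev_res_mul, mul_sum]
    rw [sum_comm, ← sum_sub_distrib]
    refine sum_congr rfl fun γ _ => ?_
    rw [show M.ev z (M.jet γ) * M.ev z (M.res (M.jet γ))
      + M.ev z (M.jet γ) * M.ev z (M.res (M.jet γ))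
      = 2 * M.ev z (M.jet γ) * M.ev z (M.res (M.jet γ)) by ring]
    simp only [jet_cons, pow_two]
  have h2 : ∑ γ ∈ σ.words m, 2 * M.ev z (M.jet γ) * M.ev z (M.res (M.jet γ))
      ≤ 2 * (σ.words m).card * Real.sqrt (M.energy m z) * K := by
    refine (Finset.sum_le_card_nsmul _ _ (2 * Real.sqrt (M.energy m z) * K) fun γ hγ => ?_).trans
      (by rw [nsmul_eq_mul]; exact le_of_eq (by ring))
    have hγ' := σ.mem_words.1 hγ
    have e1 := abs_jet_le_of_energy (M := M) (z := z) (Real.sqrt_nonneg (M.energy m z))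
      (Real.sq_sqrt (M.energy_nonneg m z)).ge hγ'
    calc _ ≤ |2 * M.ev z (M.jet γ) * M.ev z (M.res (M.jet γ))| := le_abs_self _
      _ = 2 * |M.ev z (M.jet γ)| * |M.ev z (M.res (M.jet γ))| := by
        rw [abs_mul, abs_mul, abs_two]
      _ ≤ _ := mul_le_mul (by linarith) (hK γ hγ') (abs_nonneg _) (by positivity)
  rw [h1]
  linarith [sum_lam_gain hz m]

omit hM in
lemma energy_succ_le (m : ℕ) (z : M.Z) : M.energy (m + 1) z ≤ M.energy m z + M.gain m z := by
  classical
  have h : σ.words (m + 1) ⊆ σ.words m ∪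
      (Finset.univ ×ˢ σ.words m).image fun x : σ.S × List σ.S => x.1 :: x.2 := by
    intro γ hγ
    rw [Finset.mem_union]
    cases γ with
    | nil => left; simp
    | cons s γ =>
      right
      refine Finset.mem_image.2 ⟨(s, γ), Finset.mem_product.2 ⟨Finset.mem_univ _, ?_⟩, rfl⟩
      have := σ.mem_words.1 hγ
      exact σ.mem_words.2 (by simpa using this)
  refine (Finset.sum_le_sum_of_subset_of_nonneg h fun _ _ _ => sq_nonneg _).trans ?_
  have h1 := Finset.sum_union_inter (s₁ := σ.words m)
    (s₂ := (Finset.univ ×ˢ σ.words m).image fun x : σ.S × List σ.S => x.1 :: x.2)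
    (f := fun γ => M.ev z (M.jet γ) ^ 2)
  rw [Finset.sum_image (by
    rintro ⟨s, γ⟩ _ ⟨s', γ'⟩ _ he
    simpa using he), Finset.sum_product] at h1
  have h2 := sum_nonneg fun γ (_ : γ ∈ σ.words m ∩
    (Finset.univ ×ˢ σ.words m).image fun x : σ.S × List σ.S => x.1 :: x.2) =>
    sq_nonneg (M.ev z (M.jet γ))
  unfold energy gain
  linarith

end FlowModel

lemma exists_cubic_le {a ε : ℝ} (ha : 0 ≤ a) (hε : 0 < ε) :
    ∃ K, 0 ≤ K ∧ ∀ x, 0 ≤ x → a * (1 + x) ^ 3 ≤ ε * x ^ 4 + K := by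
  refine ⟨a * (1 + (1 + 8 * a / ε)) ^ 3, by positivity, fun x hx => ?_⟩
  rcases le_total x (1 + 8 * a / ε) with h | h
  · have := mul_le_mul_of_nonneg_left (pow_le_pow_left₀ (by positivity)
      (add_le_add_right h 1) 3) ha
    linarith [show 0 ≤ ε * x ^ 4 by positivity]
  · have h0 : 0 ≤ 8 * a / ε := by positivity
    have h1 : 1 ≤ x := by linarith
    have h2 : 8 * a ≤ ε * x := by
      rw [← div_le_iff₀' hε]; linarith
    have h3 : (1 + x) ^ 3 ≤ (2 * x) ^ 3 := pow_le_pow_left₀ (by positivity) (by linarith) 3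
    have h4 := mul_le_mul_of_nonneg_left h3 ha
    have h5 := mul_le_mul_of_nonneg_right h2 (by positivity : 0 ≤ x ^ 3)
    have h6 : 0 ≤ a * (1 + (1 + 8 * a / ε)) ^ 3 := by positivity
    nlinarith

/-- Absorption of the lower order terms in Bernstein's estimate. -/
lemma exists_bernstein_real {c F1 A1 A2 K0 C : ℝ} (hc : 0 < c) (hF1 : 0 ≤ F1) (hA1 : 0 ≤ A1)
    (hA2 : 0 ≤ A2) (hK0 : 0 < K0) (hC : C ≤ c / 4) :
    ∃ K, 0 ≤ K ∧ ∀ E F G H rE rF X : ℝ, 0 ≤ E → 0 ≤ F → 0 ≤ G → 0 ≤ H → F ≤ F1 → E ≤ F + G →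
      G ≤ E → rF ≤ A2 * (1 + Real.sqrt G) - c * G →
      rE ≤ A1 * Real.sqrt E * (2 + 2 * E + Real.sqrt H) - c * H →
      X ≤ c * K0 / 4 * H + C * E ^ 2 →
      E * rF + (K0 + F) * rE + X ≤ K - c / 2 * E ^ 2 := by
  set A3 := (K0 + F1) * A1 with hA3
  have hA30 : 0 ≤ A3 := by positivity
  obtain ⟨K, hK0', hK⟩ := exists_cubic_le (a := A2 + c * F1 + 2 * A3 + A3 ^ 2 / (2 * c * K0))
    (ε := c / 4) (by positivity) (by positivity)
  refine ⟨K, hK0', fun E F G H rE rF X hE hF hG hH hF1' hEG hGE h1 h2 h3 => ?_⟩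
  have hx := Real.sqrt_nonneg E
  have hxE := Real.sq_sqrt hE
  have hy := Real.sqrt_nonneg H
  have hyH := Real.sq_sqrt hH
  have hGx := Real.sqrt_le_sqrt hGE
  generalize Real.sqrt E = x at *
  generalize Real.sqrt H = y at *
  have q0 : 0 ≤ x ^ 3 := pow_nonneg hx 3
  have q1 : E * (1 + x) ≤ (1 + x) ^ 3 := by rw [← hxE]; nlinarith only [q0, hx, sq_nonneg x]
  have q2 : E ≤ (1 + x) ^ 3 := by rw [← hxE]; nlinarith only [q0, hx, sq_nonneg x]
  have q3 : x * (2 + 2 * E) ≤ 2 * (1 + x) ^ 3 := by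
    rw [← hxE]; nlinarith only [q0, hx, sq_nonneg x]
  have k1 : E * rF ≤ A2 * (E * (1 + x)) - c * E ^ 2 + c * F1 * E := by
    have : rF ≤ A2 * (1 + x) - c * (E - F1) := by
      have := mul_le_mul_of_nonneg_left hGx hA2
      have := mul_le_mul_of_nonneg_left (show E - F1 ≤ G by linarith) hc.le
      linarith
    nlinarith [mul_le_mul_of_nonneg_left this hE]
  have k2 : (K0 + F) * rE ≤ A3 * (x * (2 + 2 * E + y)) - c * K0 * H := by
    have e1 := mul_le_mul_of_nonneg_left h2 (by positivity : 0 ≤ K0 + F)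
    have e2 : (K0 + F) * (A1 * x * (2 + 2 * E + y)) ≤ A3 * (x * (2 + 2 * E + y)) := by
      rw [hA3, show (K0 + F1) * A1 * (x * (2 + 2 * E + y)) = (K0 + F1) * (A1 * x * (2 + 2 * E + y))
        by ring]
      exact mul_le_mul_of_nonneg_right (by linarith) (by positivity)
    have e3 : 0 ≤ F * (c * H) := by positivity
    nlinarith
  have k3 : A3 * (x * y) ≤ c * K0 / 2 * H + A3 ^ 2 / (2 * c * K0) * E := by
    have e : c * K0 / 2 * H + A3 ^ 2 / (2 * c * K0) * E - A3 * (x * y)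
        = (c * K0 * y - A3 * x) ^ 2 / (2 * c * K0) := by
      rw [← hxE, ← hyH]; field_simp; ring
    have : 0 ≤ (c * K0 * y - A3 * x) ^ 2 / (2 * c * K0) := by positivity
    linarith
  have k4 := hK x hx
  have k5 := mul_le_mul_of_nonneg_left q1 hA2
  have k6 := mul_le_mul_of_nonneg_left q2 (by positivity : 0 ≤ c * F1)
  have k7 := mul_le_mul_of_nonneg_left q3 hA30
  have k8 := mul_le_mul_of_nonneg_left q2 (by positivity : 0 ≤ A3 ^ 2 / (2 * c * K0))
  have k9 : x ^ 4 = E ^ 2 := by rw [← hxE]; ring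
  have k10 := mul_le_mul_of_nonneg_right hC (sq_nonneg E)
  have k11 : 0 ≤ c * K0 * H := by positivity
  rw [k9] at k4
  linarith only [k1, k2, k3, k4, k5, k6, k7, k8, k10, k11, h3]

lemma bernstein_cross {k E F W l x y g : ℝ} (hk : 0 < k) (hE : 0 ≤ E) (hF : 0 ≤ F) (l0 : 0 ≤ l)
    (l2 : l ≤ W) (hg : 0 ≤ g) (a1 : x ^ 2 ≤ 4 * (E * g)) (a3 : y ^ 2 ≤ 4 * (F * E)) :
    -(l * (x * y)) ≤ k / 4 * g + 16 * W ^ 2 * F / k * E ^ 2 := by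
  have a4 : (l * (x * y)) ^ 2 ≤ W ^ 2 * (4 * (E * g) * (4 * (F * E))) := by
    rw [mul_pow, mul_pow]
    exact mul_le_mul (pow_le_pow_left₀ l0 l2 2) (mul_le_mul a1 a3 (sq_nonneg _) (by positivity))
      (by positivity) (by positivity)
  have a5 : W ^ 2 * (4 * (E * g) * (4 * (F * E)))
      = 4 * (k / 4 * g) * (16 * W ^ 2 * F / k * E ^ 2) := by field_simp; ring
  have hA : 0 ≤ k / 4 * g := by positivity
  have hB : 0 ≤ 16 * W ^ 2 * F / k * E ^ 2 := by positivity
  generalize k / 4 * g = P at *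
  generalize 16 * W ^ 2 * F / k * E ^ 2 = Q at *
  refine (neg_le_abs _).trans (abs_le_of_sq_le_sq ?_ (add_nonneg hA hB))
  nlinarith only [a4, a5, sq_nonneg (P - Q)]

namespace FlowModel

variable {d : ℕ} {Λ : ℝ} {σ : Stencil d Λ} {M : FlowModel σ}

lemma gain_le_energy (m : ℕ) (z : M.Z) : M.gain m z ≤ M.energy (m + 1) z := by
  classical
  have h1 : M.gain m z = ∑ γ ∈ (Finset.univ ×ˢ σ.words m).image
      fun x : σ.S × List σ.S => x.1 :: x.2, M.ev z (M.jet γ) ^ 2 := by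
    rw [Finset.sum_image (by
      rintro ⟨s, γ⟩ _ ⟨s', γ'⟩ _ he
      simpa using he), Finset.sum_product]
    rfl
  rw [h1]
  refine Finset.sum_le_sum_of_subset_of_nonneg ?_ fun _ _ _ => sq_nonneg _
  intro γ hγ
  obtain ⟨⟨s, γ'⟩, h, rfl⟩ := Finset.mem_image.1 hγ
  have := σ.mem_words.1 (Finset.mem_product.1 h).2
  exact σ.mem_words.2 (by simpa using this)

/-- The contribution of the word derivatives along `s` to the gain. -/
def gainAt (m : ℕ) (z : M.Z) (s : σ.S) : ℝ := ∑ γ ∈ σ.words m, M.ev z (M.jet (s :: γ)) ^ 2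

variable (hM : M.Cts)
include hM

lemma Cts.sq_ev_δ_en (m : ℕ) (z : M.Z) (s : σ.S) :
    M.ev z (M.δ s (M.en m)) ^ 2 ≤ 4 * (M.energy m z * M.gainAt m z s) := by
  have : M.ev z (M.δ s (M.en m)) = 2 * ∑ γ ∈ σ.words m, M.ev z (M.jet γ) * M.ev z (M.jet (s :: γ)) := by
    simp only [en, map_sum, hM.δ_mul, map_add, map_mul, mul_sum, jet_cons]
    exact sum_congr rfl fun γ _ => by ring
  rw [this]
  have := Finset.sum_mul_sq_le_sq_mul_sq (σ.words m) (fun γ => M.ev z (M.jet γ))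
    fun γ => M.ev z (M.jet (s :: γ))
  unfold energy gainAt
  linarith

/-- Bernstein's quantity. -/
lemma Cts.exists_bernstein {m : ℕ} (hm : 2 ≤ m) (b : ℝ) : ∃ K0 K : ℝ, 0 < K0 ∧ 0 ≤ K ∧ ∀ z,
    (∀ i, |M.ev z (M.p i)| ≤ Λ) → M.JetBd {z} m b →
    M.ev z (M.res (M.en (m + 1) * (algebraMap ℝ M.R K0 + M.en m)))
      ≤ K - σ.c0 / 2 * M.energy (m + 1) z ^ 2 := by
  have hc := σ.c0_pos
  have hW := σ.wmax_nonneg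
  set c := σ.c0
  set W := σ.wmax
  set N : ℝ := (Fintype.card σ.S : ℝ)
  set F1 : ℝ := (σ.words m).card * b ^ 2 with hF1
  have hF10 : 0 ≤ F1 := by positivity
  have hN : 0 ≤ N := by positivity
  set K0 : ℝ := 1 + 64 * N * W ^ 2 * F1 / c ^ 2 with hK0
  have hK00 : 0 < K0 := by positivity
  obtain ⟨B1, hB10, hB1⟩ := M.exists_res_bound m b
  obtain ⟨B2, hB20, hB2⟩ := M.exists_res_bound_succ hm b
  have hC : N * (16 * W ^ 2 * F1 / (c * K0)) ≤ c / 4 := by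
    rw [mul_div_assoc', div_le_div_iff₀ (by positivity) (by norm_num)]
    have : c * (c * K0) = c ^ 2 + 64 * N * W ^ 2 * F1 := by rw [hK0]; field_simp
    nlinarith [sq_nonneg c]
  obtain ⟨K, hK0', hK⟩ := exists_bernstein_real (c := c) (F1 := F1)
    (A1 := 2 * (σ.words (m + 1)).card * B2) (A2 := 2 * (σ.words m).card * Real.sqrt F1 * B1)
    (K0 := K0) hc hF10 (by positivity) (by positivity) hK00 hC
  refine ⟨K0, K, hK00, hK0', fun z hz hb => ?_⟩
  have hE := M.energy_nonneg (m + 1) z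
  have hF := M.energy_nonneg m z
  have hG := M.gain_nonneg m z
  have hH := M.gain_nonneg (m + 1) z
  have hFF : M.energy m z ≤ F1 := M.energy_le_of_abs (hb z rfl)
  have hGE := M.gain_le_energy m z
  set E := M.energy (m + 1) z with hE_def
  set F := M.energy m z
  set G := M.gain m z
  set H := M.gain (m + 1) z
  have r1 : M.ev z (M.res (M.en m))
      ≤ 2 * (σ.words m).card * Real.sqrt F1 * B1 * (1 + Real.sqrt G) - c * G := by
    refine (hM.ev_res_en hz (hB1 {z} (hM.sat _) hb hm z rfl)).trans ?_
    have := mul_le_mul_of_nonneg_right (Real.sqrt_le_sqrt hFF)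
      (by positivity : 0 ≤ 2 * (σ.words m).card * (B1 * (1 + Real.sqrt G)))
    linarith
  have r2 : M.ev z (M.res (M.en (m + 1))) ≤ 2 * (σ.words (m + 1)).card * B2 * Real.sqrt E
      * (2 + 2 * E + Real.sqrt H) - c * H := by
    have hμ := Real.sqrt_nonneg E
    have hμE := Real.sq_sqrt hE
    have hb' : M.JetBd {z} (m + 1) (1 + Real.sqrt E) := by
      rintro _ rfl γ hγ
      have := M.abs_jet_le_of_energy hμ hμE.ge hγ
      linarith
    have e := hB2 {z} (1 + Real.sqrt E) (by linarith) (hM.sat _) hb hb' z rfl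
    refine (hM.ev_res_en hz (K := B2 * (2 + 2 * E + Real.sqrt H))
      fun γ hγ => (e γ hγ).trans ?_).trans (le_of_eq ?_)
    · refine mul_le_mul_of_nonneg_left ?_ hB20
      split_ifs <;> nlinarith [sq_nonneg (1 - Real.sqrt E)]
    · ring
  have r3 : -∑ s, M.ev z (M.lam s) * (M.ev z (M.δ s (M.en (m + 1)))
        * M.ev z (M.δ s (algebraMap ℝ M.R K0 + M.en m)))
      ≤ c * K0 / 4 * H + N * (16 * W ^ 2 * F1 / (c * K0)) * E ^ 2 := by
    have hs : ∀ s, -(M.ev z (M.lam s) * (M.ev z (M.δ s (M.en (m + 1)))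
        * M.ev z (M.δ s (algebraMap ℝ M.R K0 + M.en m))))
        ≤ c * K0 / 4 * M.gainAt (m + 1) z s + 16 * W ^ 2 * F1 / (c * K0) * E ^ 2 := by
      intro s
      rw [map_add, δ_algebraMap, zero_add]
      have a1 := hM.sq_ev_δ_en (m + 1) z s
      have a2 := hM.sq_ev_δ_en m z s
      have hg1 : 0 ≤ M.gainAt (m + 1) z s := sum_nonneg fun _ _ => sq_nonneg _
      have hg2 : M.gainAt m z s ≤ E := (single_le_sum (f := M.gainAt m z)
        (fun _ _ => sum_nonneg fun _ _ => sq_nonneg _) (Finset.mem_univ s)).trans hGE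
      have l1 := M.c0_le_lam hz s
      have l2 := M.lam_le_wmax hz s
      have l0 : 0 ≤ M.ev z (M.lam s) := hc.le.trans l1
      set l := M.ev z (M.lam s)
      set x := M.ev z (M.δ s (M.en (m + 1)))
      set y := M.ev z (M.δ s (M.en m))
      set g := M.gainAt (m + 1) z s
      have a3 : y ^ 2 ≤ 4 * (F1 * E) := a2.trans (mul_le_mul_of_nonneg_left
        ((mul_le_mul_of_nonneg_right hFF (sum_nonneg fun _ _ => sq_nonneg _)).trans
          (mul_le_mul_of_nonneg_left hg2 hF10)) (by norm_num))
      exact bernstein_cross (mul_pos hc hK00) hE hF10 l0 l2 hg1 a1 a3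
    rw [← sum_neg_distrib]
    refine (sum_le_sum fun s _ => hs s).trans (le_of_eq ?_)
    rw [sum_add_distrib, ← mul_sum, Finset.sum_const, nsmul_eq_mul, Finset.card_univ,
      ← mul_assoc]
    rfl
  have key := hK E F G H _ _ _ hE hF hG hH hFF (M.energy_succ_le m z) hGE r1 r2 r3
  rw [hM.ev_res_mul, hM.ev_res_add, hM.ev_res_algebraMap, zero_add, ev_en, map_add, ev_en,
    AlgHom.commutes, Algebra.algebraMap_self, RingHom.id_apply]
  linarith

end FlowModel

lemma le_of_quad_le {X a b c : ℝ} (hc : 0 < c) (ha : 0 ≤ a) (hb : 0 ≤ b)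
    (h : c * X ^ 2 ≤ a + b * X) : X ≤ 1 + (a + b) / c := by
  by_contra! hX
  have h0 : 0 ≤ (a + b) / c := by positivity
  have h1 : a + b < c * X := by
    have := (div_lt_iff₀' hc).1 (show (a + b) / c < X by linarith)
    exact this
  nlinarith

namespace FlowModel

variable {d : ℕ} {Λ : ℝ} {σ : Stencil d Λ} {M : FlowModel σ} (hM : M.Cts)
include hM

/-- The maximum point estimate. -/
lemma Cts.exists_bernstein_max {m : ℕ} (hm : 2 ≤ m) (b T S1 : ℝ) (hT : 0 ≤ T) :
    ∃ K0 K : ℝ, 0 < K0 ∧ 0 ≤ K ∧ ∀ (z : M.Z) (θ S : M.R),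
    (∀ i, |M.ev z (M.p i)| ≤ Λ) → M.JetBd {z} m b → (∀ s, M.δ s θ = 0) → M.dt θ = 1 →
    (∀ s, M.δ s S = -M.δ s M.u) → M.dt S = -M.dt M.u →
    0 < M.ev z θ → M.ev z θ ≤ T → 0 < M.ev z S → M.ev z S ≤ S1 →
    (∀ s, M.ev z (M.δ s (θ * (S * S * (M.en (m + 1) * (algebraMap ℝ M.R K0 + M.en m))))) = 0) →
    0 ≤ M.ev z (M.res (θ * (S * S * (M.en (m + 1) * (algebraMap ℝ M.R K0 + M.en m))))) →
    M.ev z (θ * (S * S * (M.en (m + 1) * (algebraMap ℝ M.R K0 + M.en m)))) ≤ K := by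
  obtain ⟨K0, K5, hK0, hK5, hK⟩ := hM.exists_bernstein hm b
  have hc := σ.c0_pos
  have hW := σ.wmax_nonneg
  set K6 := K0 + (σ.words m).card * b ^ 2 with hK6
  set A3 := (Fintype.card σ.S : ℝ) * (σ.wmax * b ^ 2) with hA3
  have hK60 : 0 < K6 := by positivity
  have hA30 : 0 ≤ A3 := by positivity
  set a := (T * S1 ^ 2) ^ 2 * K5
  set B := (S1 ^ 2 + 3 * A3 * T) * K6
  have ha : 0 ≤ a := by positivity
  have hB : 0 ≤ B := by positivity
  refine ⟨K0, K6 * (1 + (a + B) / (σ.c0 / 2)), hK0, by positivity,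
    fun z θ S hz hb hθ1 hθ2 hS1 hS2 hθ hθT hS hSS h1 h2 => ?_⟩
  have hR := hK z hz hb
  have hFF : M.energy m z ≤ (σ.words m).card * b ^ 2 := M.energy_le_of_abs (hb z rfl)
  have hΨ : M.ev z (M.en (m + 1) * (algebraMap ℝ M.R K0 + M.en m))
      = M.energy (m + 1) z * (K0 + M.energy m z) := by
    rw [map_mul, ev_en, map_add, ev_en, AlgHom.commutes, Algebra.algebraMap_self, RingHom.id_apply]
  have hE := M.energy_nonneg (m + 1) z
  have hF := M.energy_nonneg m z
  have hL : ∑ s, M.ev z (M.lam s) * M.ev z (M.δ s M.u) ^ 2 ≤ A3 := by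
    refine (Finset.sum_le_card_nsmul _ _ (σ.wmax * b ^ 2) fun s _ => ?_).trans (by
      rw [nsmul_eq_mul, Finset.card_univ])
    have := abs_le.1 (hb z rfl [s] (by simp; omega))
    exact mul_le_mul (M.lam_le_wmax hz s) (sq_le_sq' this.1 this.2) (sq_nonneg _) hW
  have hθr : M.ev z (M.res θ) = 1 := by
    rw [hM.ev_res, hθ2]; simp [hθ1]
  have hSr : M.ev z (M.res S) = 0 := by
    have : M.ev z (M.res M.u) = 0 := by rw [res_u, map_zero]
    rw [hM.ev_res] at this ⊢
    simp only [hS1, hS2, map_neg, mul_neg, sum_neg_distrib]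
    linarith
  generalize M.en (m + 1) * (algebraMap ℝ M.R K0 + M.en m) = Ψ at *
  have hδ : ∀ s, M.ev z S * M.ev z (M.δ s Ψ) = 2 * M.ev z Ψ * M.ev z (M.δ s M.u) := fun s => by
    have := h1 s
    simp only [hM.δ_mul, hθ1, hS1, map_add, map_mul, map_neg, mul_zero, add_zero] at this
    have h3 : M.ev z θ * M.ev z S ≠ 0 := by positivity
    apply mul_left_cancel₀ h3
    linear_combination this
  have hres : M.ev z (M.res (θ * (S * S * Ψ))) = M.ev z S ^ 2 * M.ev z Ψ + M.ev z θ *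
      (M.ev z S ^ 2 * M.ev z (M.res Ψ)
        + 3 * M.ev z Ψ * ∑ s, M.ev z (M.lam s) * M.ev z (M.δ s M.u) ^ 2) := by
    have e1 : ∀ s, M.ev z (M.lam s) * (M.ev z (M.δ s (S * S)) * M.ev z (M.δ s Ψ))
        = -(4 * M.ev z Ψ * (M.ev z (M.lam s) * M.ev z (M.δ s M.u) ^ 2)) := fun s => by
      simp only [hM.δ_mul, hS1, map_add, map_mul, map_neg]
      linear_combination (-2 * M.ev z (M.lam s) * M.ev z (M.δ s M.u)) * hδ s
    have e2 : ∀ s, M.ev z (M.lam s) * (-M.ev z (M.δ s M.u) * -M.ev z (M.δ s M.u))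
        = M.ev z (M.lam s) * M.ev z (M.δ s M.u) ^ 2 := fun s => by ring
    rw [hM.ev_res_mul, hM.ev_res_mul _ (S * S), hM.ev_res_mul _ S]
    simp only [e1, hθ1, hSr, hθr, hS1, map_mul, map_neg, map_zero, zero_mul, mul_zero,
      Finset.sum_const_zero, sum_neg_distrib, ← mul_sum, e2]
    ring
  rw [hres] at h2
  rw [map_mul, map_mul, map_mul, hΨ]
  rw [hΨ] at h2
  generalize M.ev z θ = t at *
  generalize M.ev z S = y at *
  generalize M.energy (m + 1) z = E at *
  generalize M.energy m z = F at *
  generalize M.ev z (M.res Ψ) = r at *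
  generalize ∑ s, M.ev z (M.lam s) * M.ev z (M.δ s M.u) ^ 2 = l at *
  have hFK : E * (K0 + F) ≤ E * K6 := mul_le_mul_of_nonneg_left (by linarith) hE
  have hys : y ^ 2 ≤ S1 ^ 2 := pow_le_pow_left₀ hS.le hSS 2
  have b1 : 0 ≤ y ^ 2 * (E * K6) + t * (y ^ 2 * (K5 - σ.c0 / 2 * E ^ 2) + 3 * (E * K6) * A3) := by
    have c1 := mul_le_mul_of_nonneg_left hFK (sq_nonneg y)
    have c2 := mul_le_mul_of_nonneg_left hR (mul_nonneg hθ.le (sq_nonneg y))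
    have c3 : t * (3 * (E * (K0 + F)) * l) ≤ t * (3 * (E * K6) * A3) := by
      have : 0 ≤ E * (K0 + F) := by positivity
      have := mul_le_mul_of_nonneg_left hL this
      have := mul_le_mul_of_nonneg_right hFK hA30
      exact mul_le_mul_of_nonneg_left (by linarith) hθ.le
    linarith
  have b2 : σ.c0 / 2 * (t * y ^ 2 * E) ^ 2 ≤ a + B * (t * y ^ 2 * E) := by
    have c1 := mul_nonneg (mul_nonneg hθ.le (sq_nonneg y)) b1
    have c2 : (t * y ^ 2) ^ 2 * K5 ≤ a := mul_le_mul_of_nonneg_right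
      (pow_le_pow_left₀ (by positivity) (mul_le_mul hθT hys (sq_nonneg _) hT) 2) hK5
    have c3 : (y ^ 2 + 3 * A3 * t) * K6 * (t * y ^ 2 * E) ≤ B * (t * y ^ 2 * E) := by
      refine mul_le_mul_of_nonneg_right (mul_le_mul_of_nonneg_right ?_ hK60.le) (by positivity)
      have := mul_le_mul_of_nonneg_left hθT (by positivity : 0 ≤ 3 * A3)
      linarith
    linarith
  have b3 := le_of_quad_le (by positivity) ha hB b2
  have b4 := mul_le_mul_of_nonneg_left hFK (mul_nonneg hθ.le (sq_nonneg y))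
  have b5 := mul_le_mul_of_nonneg_left b3 hK60.le
  linarith

end FlowModel

section

variable {d : ℕ} {Λ : ℝ} {O : Set (𝔼 d × ℝ)} {I : Type}

/-- Iterated directional derivatives. -/
def dW (l : List (𝔼 d × ℝ)) (f : 𝔼 d × ℝ → ℝ) :
    𝔼 d × ℝ → ℝ := l.foldr (fun w f q => fderiv ℝ f q w) f

lemma dW_cons (w) (l : List (𝔼 d × ℝ)) (f) (q) :
    dW (w :: l) f q = fderiv ℝ (dW l f) q w := rfl

lemma contDiffOn_dW (hO : IsOpen O) {f : 𝔼 d × ℝ → ℝ}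
    (hf : ContDiffOn ℝ (⊤ : ℕ∞) f O) (l) : ContDiffOn ℝ (⊤ : ℕ∞) (dW l f) O := by
  induction l with
  | nil => exact hf
  | cons w l ih =>
    exact (ih.fderiv_of_isOpen (m := (⊤ : ℕ∞)) hO (by simp)).clm_apply contDiffOn_const

lemma dW_add_right {f : 𝔼 d × ℝ → ℝ} {w : 𝔼 d × ℝ}
    (h : ∀ q, f (q + w) = f q) (l) (q) : dW l f (q + w) = dW l f q := by
  induction l generalizing q with
  | nil => exact h q
  | cons v l ih =>
    have h' : (fun q => dW l f (q + w)) = dW l f := funext ih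
    have := fderiv_comp_add_right (𝕜 := ℝ) (f := dW l f) (x := q) w
    rw [dW_cons, dW_cons, ← this, h']

lemma Sm.ev_foldr_D (hO : IsOpen O) (F : I → 𝔼 d × ℝ → ℝ)
    (hF : ∀ i, ContDiffOn ℝ (⊤ : ℕ∞) (F i) O) (l) (z : I × O) :
    Sm.ev z (l.foldr (fun w f => Sm.D hO w f) (Sm.ofFn F hF)) = dW l (F z.1) z.2 := by
  induction l generalizing z with
  | nil => rfl
  | cons w l ih =>
    rw [List.foldr_cons, Sm.ev_D, Sm.fderiv_fn_eq hO (F := dW l (F z.1)) ?_ z.2.2]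
    · rfl
    · intro q hq
      have := ih (z.1, ⟨q, hq⟩)
      rwa [← Sm.fn_apply] at this

/-- A stencil direction as a space-time vector. -/
def Stencil.vX (σ : Stencil d Λ) (s : σ.S) : 𝔼 d × ℝ :=
  ∑ a, (σ.dir s a : ℝ) • eX a

lemma Stencil.vX_ι (σ : Stencil d Λ) (i : Fin d) : σ.vX (σ.ι i) = eX i := by
  simp [vX, σ.dir_ι, Pi.single_apply]

lemma Stencil.vX_neg (σ : Stencil d Λ) (s : σ.S) : σ.vX (σ.neg s) = (-1 : ℝ) • σ.vX s := by
  simp [vX, σ.dir_neg, Finset.smul_sum]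

lemma Stencil.vX_snd (σ : Stencil d Λ) (s : σ.S) : (σ.vX s).2 = 0 := by
  simp [vX, Prod.snd_sum, eX]

variable {U : I → 𝔼 d × ℝ → ℝ}

/-- The differential model given by a family of smooth solutions. -/
def smModel (σ : Stencil d Λ) (hO : IsOpen O) (hU : ∀ i, GrSol O (U i)) : FlowModel σ where
  R := Sm I O
  Z := I × O
  ev := Sm.ev
  sh _ z := z
  h := 0
  δ s := (Sm.D hO (σ.vX s)).toLinearMap
  τ _ := AlgHom.id ℝ _
  dt := (Sm.D hO eT).toLinearMap
  u := Sm.ofFn U fun i => (hU i).smooth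
  ρ := (graphData hO U hU).ρ
  τ_eq _ f := by simp
  δ_mul s f g := by
    simp only [Derivation.coeFn_coe, Derivation.leibniz, smul_eq_mul,
      AlgHom.coe_id, id]
    ring
  δ_comm _ _ f := Sm.D_comm hO _ _ f
  δ_h s := map_zero _
  h_δδ s f := by
    simp only [Derivation.coeFn_coe, σ.vX_neg, Sm.D_smul]
    simp
  dt_δ _ f := Sm.D_comm hO _ _ f
  ev_τ _ _ _ := rfl
  ev_h_nonneg z := (map_zero (Sm.ev z)).ge
  ev_h_le z := (map_zero (Sm.ev z)).le.trans zero_le_one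
  ρ_mul := by
    simp only [Derivation.coeFn_coe, σ.vX_ι, pow_two]
    exact (graphData hO U hU).ρ_mul
  dt_u := by
    refine Sm.ext_ev fun z => ?_
    simp only [Derivation.coeFn_coe, σ.vX_neg, σ.vX_ι, Sm.D_smul,
      map_smul, map_sum, map_mul, smul_eq_mul, Sm.D_ofFn_eT, Sm.ev_ofFn, (hU z.1).eq z.2 z.2.2]
    have e1 : ∀ P : MvPolynomial (Fin d) ℝ, Sm.ev z (MvPolynomial.aeval
        (fun i => Sm.D hO (eX i) (Sm.ofFn U fun i => (hU i).smooth)) P)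
        = MvPolynomial.eval (fun i => dX i (U z.1) z.2) P := fun P => by
      rw [MvPolynomial.comp_aeval_apply, MvPolynomial.aeval_eq_eval]
      simp only [Sm.D_ofFn_eX, Sm.ev_ofFn]
    have e2 : ∀ s, Sm.ev z (Sm.D hO (σ.vX s) (Sm.D hO (σ.vX s)
        (Sm.ofFn U fun i => (hU i).smooth)))
        = ∑ i, ∑ j, (σ.dir s i : ℝ) * σ.dir s j * dX i (dX j (U z.1)) z.2 := fun s => by
      simp only [Stencil.vX, Sm.D_sum, Sm.D_smul, Sm.D_ofFn_eX, map_sum, map_smul, Finset.smul_sum,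
        Sm.ev_ofFn, smul_eq_mul, Derivation.map_smul]
      rw [sum_comm]
      exact sum_congr rfl fun i _ => sum_congr rfl fun j _ => by ring
    simp only [e1, e2, ev_graphData_ρ]
    have e3 := σ.sum_form (fun i => dX i (U z.1) z.2) fun i j => dX i (dX j (U z.1)) z.2
    have h0 := (one_add_sum_sq_pos fun i => dX i (U z.1) z.2).ne'
    have e4 : ∀ (x : σ.S → ℝ) (y : σ.S → ℝ) (ρ : ℝ),
        ∑ s, x s * ρ * (-1 * y s) = -ρ * ∑ s, x s * y s := fun x y ρ => by
      rw [mul_sum]; exact sum_congr rfl fun s _ => by ring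
    rw [e4, e3]
    field_simp

variable (σ : Stencil d Λ) (hO : IsOpen O) (hU : ∀ i, GrSol O (U i))

lemma smModel_cts : (smModel σ hO hU).Cts where
  h := rfl
  dt_mul f g := (Sm.D hO eT).leibniz f g
  sh _ _ := rfl

lemma smModel_ev_jet (γ : List σ.S) (z : I × O) : (smModel σ hO hU).ev z ((smModel σ hO hU).jet γ)
    = dW (γ.map σ.vX) (U z.1) z.2 := by
  rw [← Sm.ev_foldr_D hO U fun i => (hU i).smooth, List.foldr_map]
  rfl

lemma smModel_ev_p (i : Fin d) (z : I × O) : (smModel σ hO hU).ev z ((smModel σ hO hU).p i)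
    = dX i (U z.1) z.2 := by
  have := smModel_ev_jet σ hO hU [σ.ι i] z
  rwa [List.map_singleton, σ.vX_ι] at this

/-- The maximum principle at a point. -/
lemma smModel_max {f : (smModel σ hO hU).R} {z : I × O}
    (hz : ∀ i, |dX i (U z.1) z.2| ≤ Λ)
    (h : ∀ᶠ q in 𝓝 (z.2 : 𝔼 d × ℝ),
      q.2 ≤ (z.2 : 𝔼 d × ℝ).2 → Sm.fn f z.1 q ≤ Sm.fn f z.1 z.2) :
    (∀ s, (smModel σ hO hU).ev z ((smModel σ hO hU).δ s f) = 0) ∧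
      0 ≤ (smModel σ hO hU).ev z ((smModel σ hO hU).res f) := by
  have hline : ∀ w : 𝔼 d × ℝ,
      Tendsto (fun r : ℝ => (z.2 : 𝔼 d × ℝ) + r • w) (𝓝 0) (𝓝 z.2) := fun w => by
    have hc : Continuous fun r : ℝ => (z.2 : 𝔼 d × ℝ) + r • w := by fun_prop
    simpa using hc.tendsto 0
  have he := (smModel_cts σ hO hU).ev_res z f
  change Sm I O at f
  have hneg : ∀ q, (-f).fn z.1 q = -f.fn z.1 q := fun q => by
    by_cases hq : q ∈ O
    · have h1 := Sm.fn_apply (-f) z.1 ⟨q, hq⟩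
      have h2 := Sm.fn_apply f z.1 ⟨q, hq⟩
      simp only [map_neg] at h1
      rw [h1, h2]
    · have : ∀ f : Sm I O, f.fn z.1 q = 0 := fun f =>
        Function.extend_apply' _ _ _ (by rintro ⟨a, rfl⟩; exact hq a.2)
      rw [this, this, neg_zero]
  have hsp : ∀ s, Sm.ev z (Sm.D hO (σ.vX s) (-f)) = 0 ∧
      0 ≤ Sm.ev z (Sm.D hO (σ.vX s) (Sm.D hO (σ.vX s) (-f))) := fun s =>
    Sm.min_line hO (((hline _).eventually h).mono fun r hr => by
      rw [hneg, hneg]; exact neg_le_neg (hr (by simp [σ.vX_snd])))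
  have ht : Sm.ev z (Sm.D hO eT (-f)) ≤ 0 := by
    refine Sm.min_past hO ?_
    filter_upwards [((hline eT).eventually h).filter_mono nhdsWithin_le_nhds,
      self_mem_nhdsWithin] with r hr hr0
    rw [hneg, hneg]; exact neg_le_neg (hr (by simpa [eT] using hr0))
  simp only [map_neg, Left.nonneg_neg_iff, neg_eq_zero, Left.neg_nonpos_iff] at hsp ht
  refine ⟨fun s => (hsp s).1, le_of_le_of_eq ?_ he.symm⟩
  have hp : ∀ i, |(smModel σ hO hU).ev z ((smModel σ hO hU).p i)| ≤ Λ := fun i => by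
    rw [smModel_ev_p]; exact hz i
  have h1 : ∑ s, (smModel σ hO hU).ev z ((smModel σ hO hU).lam s)
      * (smModel σ hO hU).ev z ((smModel σ hO hU).δ s ((smModel σ hO hU).δ s f)) ≤ 0 :=
    Finset.sum_nonpos fun s _ => mul_nonpos_of_nonneg_of_nonpos
      (σ.c0_pos.le.trans ((smModel σ hO hU).c0_le_lam hp s)) (hsp s).2
  have h2 : 0 ≤ (smModel σ hO hU).ev z ((smModel σ hO hU).dt f) := ht
  linarith

end

section

variable {d : ℕ} {Λ : ℝ} {I : Type}

/-- Sum of squares of all spatial derivatives of order at most `k` along the stencil. -/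
def Stencil.sqW (σ : Stencil d Λ) (k : ℕ) (f : 𝔼 d × ℝ → ℝ)
    (q : 𝔼 d × ℝ) : ℝ := ∑ γ ∈ σ.words k, dW (γ.map σ.vX) f q ^ 2

lemma Stencil.sqW_nonneg (σ : Stencil d Λ) (k : ℕ) (f) (q) : 0 ≤ σ.sqW k f q :=
  sum_nonneg fun _ _ => sq_nonneg _

lemma smModel_energy {O : Set (𝔼 d × ℝ)}
    {U : I → 𝔼 d × ℝ → ℝ} (σ : Stencil d Λ) (hO : IsOpen O)
    (hU : ∀ i, GrSol O (U i)) (k : ℕ) (z : I × O) :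
    (smModel σ hO hU).energy k z = σ.sqW k (U z.1) z.2 := by
  simp only [FlowModel.energy, smModel_ev_jet, Stencil.sqW]

/-- Local bounds for the derivatives of order at most `m` give local bounds for those of order
`m + 1`, uniformly over families of periodic solutions. -/
lemma bernstein_step (σ : Stencil d Λ) {R : I → ℕ} (hR : ∀ i, 0 < R i) {T : ℝ}
    {g : I → 𝔼 d → ℝ} {U : I → 𝔼 d × ℝ → ℝ}
    (h : ∀ i, PerSol (R i) T (g i) (U i)) {m : ℕ} (hm : 2 ≤ m) {M M' m0 τ τ' b : ℝ} (hM : M < M')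
    (hτ0 : 0 ≤ τ') (hτ : τ' < τ) (hm0 : ∀ i, ∀ q ∈ slab d T, m0 ≤ U i q)
    (hb : ∀ i, ∀ q ∈ slab d T, U i q < M' → τ' < q.2 → (∀ j, |dX j (U i) q| ≤ Λ) ∧
      ∀ γ : List σ.S, γ.length ≤ m → |dW (γ.map σ.vX) (U i) q| ≤ b) :
    ∃ b', ∀ i, ∀ q ∈ slab d T, U i q < M → τ < q.2 →
      ∀ γ : List σ.S, γ.length ≤ m + 1 → |dW (γ.map σ.vX) (U i) q| ≤ b' := by
  have hO := isOpen_slab d T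
  have hU : ∀ i, GrSol (slab d T) (U i) := fun i => (h i).sol
  obtain ⟨K0, K, hK0, hK, hmain⟩ :=
    (smModel_cts σ hO hU).exists_bernstein_max hm b |T| (M' - m0) (abs_nonneg _)
  obtain ⟨t0, ht0⟩ : ∃ t0, t0 = (τ + τ') / 2 := ⟨_, rfl⟩
  have hpos : 0 < (τ - t0) * ((M' - M) ^ 2 * K0) := by
    have h1 : 0 < τ - t0 := by linarith
    have h2 : 0 < M' - M := by linarith
    positivity
  refine ⟨K / ((τ - t0) * ((M' - M) ^ 2 * K0)) + 1, fun i q hq hqM hqτ γ hγ => ?_⟩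
  obtain ⟨F, hF⟩ : ∃ F : 𝔼 d × ℝ → ℝ, F = fun y => (y.2 - t0) *
    ((max (M' - U i y) 0) ^ 2 * (σ.sqW (m + 1) (U i) y * (K0 + σ.sqW m (U i) y))) := ⟨_, rfl⟩
  have hsqc : ∀ k, ContinuousOn (σ.sqW k (U i)) (slab d T) := fun k =>
    continuousOn_finsetSum _ fun γ _ => (contDiffOn_dW hO (hU i).smooth _).continuousOn.pow 2
  have hFc : ContinuousOn F (slab d T) := by
    rw [hF]
    exact (continuous_snd.sub continuous_const).continuousOn.mul
      ((((continuousOn_const.sub (hU i).smooth.continuousOn).sup continuousOn_const).pow 2).mul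
        ((hsqc _).mul (continuousOn_const.add (hsqc _))))
  have hF_per : ∀ e y, F (y + perShift (R i) e) = F y := fun e y => by
    rw [hF]
    simp only [Stencil.sqW, (h i).shift, dW_add_right ((h i).shift e), add_perShift_snd]
  have hcpt : IsCompact (cell d (R i) ×ˢ Icc t0 q.2) := (isCompact_cell d (R i)).prod isCompact_Icc
  have hsub : cell d (R i) ×ˢ Icc t0 q.2 ⊆ slab d T := fun y hy =>
    ⟨by linarith [hy.2.1], hy.2.2.trans_lt hq.2⟩
  have hne : (cell d (R i) ×ˢ Icc t0 q.2).Nonempty := by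
    obtain ⟨e, he⟩ := exists_mem_cell (hR i) q.1
    exact ⟨(_, t0), he, le_rfl, by change t0 ≤ q.2; linarith⟩
  obtain ⟨z, hz, hzmax⟩ := hcpt.exists_isMaxOn hne (hFc.mono hsub)
  have hmax : ∀ y : 𝔼 d × ℝ, t0 ≤ y.2 → y.2 ≤ q.2 → F y ≤ F z := by
    intro y h0 h1
    obtain ⟨e, he⟩ := exists_mem_cell (hR i) y.1
    rw [← hF_per e y]
    exact hzmax ⟨he, by rw [add_perShift_snd]; exact ⟨h0, h1⟩⟩
  have hzs := hsub hz
  have hFK : F z ≤ K := by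
    by_contra! hcon
    have hz0 := hK.trans_lt hcon
    have hzt : t0 < z.2 := by
      rcases hz.2.1.eq_or_lt with h0 | h0
      · rw [hF] at hz0; simp [← h0] at hz0
      · exact h0
    have hzM : U i z < M' := by
      by_contra! hge
      rw [hF] at hz0
      simp [max_eq_right (sub_nonpos.2 hge)] at hz0
    obtain ⟨hb1, hb2⟩ := hb i z hzs hzM (by linarith)
    obtain ⟨θ, hθ⟩ : ∃ θ : Sm I (slab d T), θ = Sm.ofFn (fun _ y => y.2 - t0)
      fun _ => (contDiff_snd.sub contDiff_const).contDiffOn := ⟨_, rfl⟩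
    obtain ⟨S, hS⟩ : ∃ S : Sm I (slab d T), S = algebraMap ℝ _ M' -
      Sm.ofFn U fun i => (hU i).smooth := ⟨_, rfl⟩
    have hSz : ∀ z, Sm.ev z S = M' - U z.1 z.2 := fun z => by
      rw [hS, map_sub, AlgHom.commutes]; rfl
    have hθz : ∀ z, Sm.ev z θ = (z.2 : 𝔼 d × ℝ).2 - t0 := fun z => by
      rw [hθ]; rfl
    have hDθ : ∀ w, Sm.D hO w θ = algebraMap ℝ _ w.2 := fun w => Sm.ext_ev fun z => by
      rw [Sm.ev_D, Sm.fderiv_fn_eq hO (F := fun y => y.2 - t0) (fun y hy => by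
        rw [hθ, Sm.fn_ofFn _ _ _ hy]) z.2.2, AlgHom.commutes]
      have : HasFDerivAt (fun y : 𝔼 d × ℝ => y.2 - t0)
        (ContinuousLinearMap.snd ℝ _ _) z.2 := hasFDerivAt_snd.sub_const _
      rw [this.fderiv]; rfl
    have hDS : ∀ w, Sm.D hO w S = -Sm.D hO w (Sm.ofFn U fun i => (hU i).smooth) := fun w => by
      rw [hS, map_sub, Derivation.map_algebraMap, zero_sub]
    obtain ⟨Ψ, hΨ⟩ : ∃ Ψ : Sm I (slab d T), Ψ =
      (((smModel σ hO hU).en (m + 1) * (algebraMap ℝ (smModel σ hO hU).R K0 +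
        (smModel σ hO hU).en m) : (smModel σ hO hU).R)) := ⟨_, rfl⟩
    have hΨz : ∀ z : I × slab d T, Sm.ev z Ψ = σ.sqW (m + 1) (U z.1) z.2 *
        (K0 + σ.sqW m (U z.1) z.2) := fun z => by
      have e : ∀ z, (smModel σ hO hU).ev z ((smModel σ hO hU).en (m + 1) * (algebraMap ℝ
          (smModel σ hO hU).R K0 + (smModel σ hO hU).en m)) = (smModel σ hO hU).energy (m + 1) z *
          (K0 + (smModel σ hO hU).energy m z) := fun z => by
        rw [map_mul, FlowModel.ev_en, map_add, FlowModel.ev_en, AlgHom.commutes]; rfl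
      rw [hΨ, ← smModel_energy σ hO hU, ← smModel_energy σ hO hU]
      exact e z
    have hfz : ∀ z : I × slab d T, Sm.ev z (θ * (S * S * Ψ)) =
        ((z.2 : 𝔼 d × ℝ).2 - t0) * ((M' - U z.1 z.2) ^ 2 *
          (σ.sqW (m + 1) (U z.1) z.2 * (K0 + σ.sqW m (U z.1) z.2))) := fun z => by
      simp only [map_mul, hθz, hSz, hΨz, pow_two]
    have hUc : ContinuousAt (U i) z := ((hU i).smooth.contDiffAt (hO.mem_nhds hzs)).continuousAt
    have hmx := smModel_max σ hO hU (f := θ * (S * S * Ψ)) (z := (i, ⟨z, hzs⟩))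
      hb1 (by
        filter_upwards [hUc.eventually_lt continuousAt_const hzM, hO.mem_nhds hzs,
          continuousAt_snd.eventually_const_lt hzt] with y hy hys hyt hyz
        have h1 := hmax y hyt.le (le_trans hyz hz.2.2)
        have e1 := Sm.fn_apply (θ * (S * S * Ψ)) i ⟨y, hys⟩
        have e2 := Sm.fn_apply (θ * (S * S * Ψ)) i ⟨z, hzs⟩
        rw [hfz] at e1 e2
        refine e1.le.trans (le_trans ?_ e2.ge)
        rw [hF] at h1
        simp only at h1
        rwa [max_eq_left (by linarith), max_eq_left (by linarith)] at h1)
    have hfin := hmain (i, ⟨z, hzs⟩) θ S (fun j => by rw [smModel_ev_p]; exact hb1 j)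
      (fun w hw γ hγ => by
        obtain rfl : w = (i, ⟨z, hzs⟩) := hw
        exact (congrArg abs (smModel_ev_jet σ hO hU γ (i, ⟨z, hzs⟩))).trans_le (hb2 γ hγ))
      (fun s => (hDθ _).trans (by rw [σ.vX_snd, map_zero]; rfl)) ((hDθ _).trans (by simp [eT]; rfl))
      (fun s => hDS _) (hDS _)
      ((sub_pos.2 hzt).trans_le (hθz (i, ⟨z, hzs⟩)).ge) ((hθz (i, ⟨z, hzs⟩)).le.trans ?_) ((sub_pos.2 hzM).trans_le (hSz (i, ⟨z, hzs⟩)).ge)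
      ((hSz (i, ⟨z, hzs⟩)).le.trans (sub_le_sub_left (hm0 i z hzs) _)) (hΨ ▸ hmx.1) (hΨ ▸ hmx.2)
    · have : Sm.ev (i, ⟨z, hzs⟩) (θ * (S * S * Ψ)) ≤ K := by
        rw [hΨ]; exact hfin
      rw [hfz] at this
      rw [hF] at hcon
      simp only at hcon
      rw [max_eq_left (by linarith)] at hcon
      exact absurd this (not_le.2 hcon)
    · have := hzs.2
      have := le_abs_self T
      change z.2 - t0 ≤ |T|
      linarith
  have hE := σ.sqW_nonneg (m + 1) (U i) q
  have hE' := σ.sqW_nonneg m (U i) q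
  have hq1 : (τ - t0) * ((M' - M) ^ 2 * K0) * σ.sqW (m + 1) (U i) q ≤ K := by
    refine le_trans ?_ ((hmax q (by linarith) le_rfl).trans hFK)
    rw [hF]
    simp only
    rw [max_eq_left (by linarith), mul_assoc, mul_assoc (_ ^ 2), mul_comm K0]
    have h1 : 0 ≤ τ - t0 := by linarith
    have h2 : 0 ≤ M' - M := by linarith
    gcongr <;> linarith
  have hq2 : σ.sqW (m + 1) (U i) q ≤ K / ((τ - t0) * ((M' - M) ^ 2 * K0)) := by
    rw [le_div_iff₀ hpos]; linarith
  have hq3 : dW (γ.map σ.vX) (U i) q ^ 2 ≤ σ.sqW (m + 1) (U i) q :=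
    single_le_sum (f := fun γ : List σ.S => dW (γ.map σ.vX) (U i) q ^ 2)
      (fun _ _ => sq_nonneg _) (σ.mem_words.2 hγ)
  have := hq3.trans hq2
  have : 0 ≤ K / ((τ - t0) * ((M' - M) ^ 2 * K0)) := hE.trans hq2
  exact abs_le_of_sq_le_sq (by nlinarith) (by linarith)

end

namespace FlowModel

variable {d : ℕ} {Λ : ℝ} {σ : Stencil d Λ} {M : FlowModel σ}

lemma Dp.dt_of_cts (hM : M.Cts) {m : ℕ} (hm : 1 ≤ m) {f : M.R} (hf : M.Dp m f) :
    M.Dp (m + 2) (M.dt f) := by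
  have hjet : ∀ γ : List σ.S, M.Dp (γ.length + 2) (M.dt (M.jet γ)) := fun γ => by
    induction γ with
    | nil =>
      have : M.dt M.u = -(1 / 2 : ℝ) • ∑ s, M.lam s * M.jet [σ.neg s, s] := M.dt_u
      rw [jet_nil, this]
      exact (Dp.sum _ fun s _ => (Dp.lam s (by simp)).mul (Dp.jet _ _ (by simp))).smul _
    | cons s γ ih =>
      rw [jet_cons, M.dt_δ]
      exact ih.δ (by omega) s
  induction hf with
  | const a => rw [hM.dt_algebraMap]; exact .zero _
  | h => rw [hM.h, map_zero]; exact .zero _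
  | jet γ hγ => exact (hjet γ).mono (by omega)
  | rho =>
    have h1 := congrArg M.dt M.ρ_mul
    rw [hM.dt_mul, hM.dt_one, map_add, hM.dt_one, zero_add, map_sum] at h1
    have h2 : ∀ i, M.dt (M.δ (σ.ι i) M.u ^ 2) = 2 * (M.p i * M.dt (M.jet [σ.ι i])) := fun i => by
      rw [pow_two, hM.dt_mul]; rw [jet_cons, jet_nil, FlowModel.p]; ring
    simp only [h2] at h1
    have h3 : M.dt M.ρ = -(M.ρ * (M.ρ * ∑ i, 2 * (M.p i * M.dt (M.jet [σ.ι i])))) := by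
      linear_combination M.ρ * h1 - M.dt M.ρ * M.ρ_mul
    rw [h3]
    have hρ := Dp.rho (M := M) (m + 2) (by omega)
    refine (hρ.mul (hρ.mul (Dp.sum _ fun i _ => ?_))).neg
    rw [two_mul]
    have := (Dp.p i (by omega)).mul ((hjet [σ.ι i]).mono (m' := m + 2) (by simp; omega))
    exact this.add this
  | add _ _ h1 h2 => rw [map_add]; exact h1.add h2
  | mul hf hg h1 h2 =>
    rw [hM.dt_mul]
    exact ((hf.mono (by omega)).mul h2).add ((hg.mono (by omega)).mul h1)
  | tau s _ h1 => rwa [hM.τ]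

/-- Mixed space and time derivatives of the solution. -/
def mix (M : FlowModel σ) (l : List (Option (Fin d))) : M.R :=
  l.foldr (fun o f => o.elim (M.dt f) fun i => M.δ (σ.ι i) f) M.u

lemma exists_dp_mix (hM : M.Cts) (l : List (Option (Fin d))) : ∃ m, 1 ≤ m ∧ M.Dp m (M.mix l) := by
  induction l with
  | nil => exact ⟨1, le_rfl, Dp.jet 1 [] (by simp)⟩
  | cons o l ih =>
    obtain ⟨m, hm, h⟩ := ih
    cases o with
    | none => exact ⟨m + 2, by omega, h.dt_of_cts hM hm⟩
    | some i => exact ⟨m + 1, by omega, h.δ hm _⟩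

end FlowModel

section

variable {d : ℕ} {Λ : ℝ} {I : Type}

/-- Coordinate vectors of space-time. -/
def eO (o : Option (Fin d)) : 𝔼 d × ℝ := o.elim eT eX

lemma smModel_ev_mix {O : Set (𝔼 d × ℝ)}
    {U : I → 𝔼 d × ℝ → ℝ} (σ : Stencil d Λ) (hO : IsOpen O)
    (hU : ∀ i, GrSol O (U i)) (l : List (Option (Fin d))) (z : I × O) :
    (smModel σ hO hU).ev z ((smModel σ hO hU).mix l) = dW (l.map eO) (U z.1) z.2 := by
  rw [← Sm.ev_foldr_D hO U fun i => (hU i).smooth, List.foldr_map]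
  have : (smModel σ hO hU).mix l = List.foldr (fun x y => (Sm.D hO (eO x)) y)
      (Sm.ofFn U fun i => (hU i).smooth) l := by
    induction l with
    | nil => rfl
    | cons o l ih =>
      rw [List.foldr_cons, ← ih]
      cases o with
      | none => rfl
      | some i => exact congrArg (fun w => Sm.D hO w _) (σ.vX_ι i)
  exact congrArg (Sm.ev z) this

lemma exists_bound_words (σ : Stencil d Λ) (m : ℕ) {X : Type*} (P : X → Prop)
    (f : List σ.S → X → ℝ) (h : ∀ γ : List σ.S, γ.length ≤ m → ∃ b, ∀ x, P x → |f γ x| ≤ b) :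
    ∃ b, ∀ x, P x → ∀ γ : List σ.S, γ.length ≤ m → |f γ x| ≤ b := by
  choose b hb using fun γ : σ.words m => h γ (σ.mem_words.1 γ.2)
  refine ⟨∑ γ, |b γ|, fun x hx γ hγ => (hb ⟨γ, σ.mem_words.2 hγ⟩ x hx).trans ((le_abs_self _).trans
    (single_le_sum (f := fun γ => |b γ|) (fun _ _ => abs_nonneg _) (Finset.mem_univ _)))⟩

lemma dW_pair {O : Set (𝔼 d × ℝ)} (σ : Stencil d Λ) (hO : IsOpen O)
    {f : 𝔼 d × ℝ → ℝ} (hf : ContDiffOn ℝ (⊤ : ℕ∞) f O) (s s' : σ.S) {q}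
    (hq : q ∈ O) : 2 * dW [σ.vX s, σ.vX s'] f q
      = grQ f q (fun i => (σ.dir s i : ℝ) + σ.dir s' i) - grQ f q (fun i => (σ.dir s i : ℝ))
        - grQ f q (fun i => (σ.dir s' i : ℝ)) := by
  have h1 := Sm.ev_foldr_D hO (fun _ : Unit => f) (fun _ => hf) [σ.vX s, σ.vX s'] ((), ⟨q, hq⟩)
  have h2 : dW [σ.vX s, σ.vX s'] f q
      = ∑ i, ∑ j, (σ.dir s i : ℝ) * σ.dir s' j * dX i (dX j f) q := by
    rw [← h1]
    simp only [List.foldr_cons, List.foldr_nil, Stencil.vX, Sm.D_sum, Sm.D_smul, Sm.D_ofFn_eX,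
      map_sum, map_smul, Finset.smul_sum, Sm.ev_ofFn, smul_eq_mul, Derivation.map_smul]
    rw [sum_comm]
    refine sum_congr rfl fun i _ => sum_congr rfl fun j _ => by
      ring
  have h3 : dW [σ.vX s, σ.vX s'] f q
      = ∑ i, ∑ j, (σ.dir s' i : ℝ) * σ.dir s j * dX i (dX j f) q := by
    rw [h2, sum_comm]
    exact sum_congr rfl fun i _ => sum_congr rfl fun j _ => by
      rw [dX_comm hO hf j i hq]; ring
  rw [two_mul]
  nth_rw 1 [h2]
  rw [h3]
  simp only [grQ, ← sum_sub_distrib, ← sum_add_distrib]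
  exact sum_congr rfl fun i _ => sum_congr rfl fun j _ => by ring

/-- Families of periodic solutions with locally uniform data. -/
structure PerFam (T m0 M K : ℝ) (R : I → ℕ) (g : I → 𝔼 d → ℝ)
    (U : I → 𝔼 d × ℝ → ℝ) : Prop where
  sol : ∀ i, PerSol (R i) T (g i) (U i)
  pos : ∀ i, 0 < R i
  lower : ∀ i y, m0 ≤ g i y
  upper : ∀ i, ∃ b, ∀ y, g i y ≤ b
  slope : ∀ i y, g i y < M + 2 →
    (1 + ∑ j, fderiv ℝ (g i) y (EuclideanSpace.single j 1) ^ 2) * (M + 2 - g i y) ^ 2 ≤ K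
  gap : (M + 2 - m0) ^ 2 ≤ K

namespace PerFam

variable {T m0 M K : ℝ} {R : I → ℕ} {g : I → 𝔼 d → ℝ}
  {U : I → 𝔼 d × ℝ → ℝ} (h : PerFam T m0 M K R g U)
include h

lemma m0_le (i : I) {q} (hq : q ∈ slab d T) : m0 ≤ U i q := by
  obtain ⟨b, hb⟩ := h.upper i
  exact ((h.sol i).range m0 b (fun y => ⟨h.lower i y, hb y⟩) q (slab_subset_slab0 _ _ hq)).1

lemma slope_le (i : I) {q} (hq : q ∈ slab d T) (hqM : U i q < M + 1) :
    1 + ∑ j, dX j (U i) q ^ 2 ≤ K := by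
  obtain ⟨b, hb⟩ := h.upper i
  have h1 := (h.sol i).gradient_bound (h.pos i) (fun y => ⟨h.lower i y, hb y⟩) (h.slope i) h.gap q
    hq (by linarith)
  have h2 := one_add_sum_sq_pos fun j => dX j (U i) q
  have h3 : 1 ≤ (M + 2 - U i q) ^ 2 := by nlinarith
  nlinarith

lemma abs_dX_le (i : I) {q} (hq : q ∈ slab d T) (hqM : U i q < M + 1) (j : Fin d) :
    |dX j (U i) q| ≤ K := by
  have h1 := h.slope_le i hq hqM
  have h2 := single_le_sum (f := fun j => dX j (U i) q ^ 2) (fun _ _ => sq_nonneg _)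
    (Finset.mem_univ j)
  have h3 := sq_nonneg (dX j (U i) q)
  exact abs_le_of_sq_le_sq (by nlinarith) (by linarith)

lemma exists_hessian {M' : ℝ} (hM' : M' < M + 1) : ∃ B, 0 ≤ B ∧ ∀ i, ∀ q ∈ slab d T,
    U i q < M' → ∀ ξ : Fin d → ℝ, √q.2 * |grQ (U i) q ξ| ≤ B * ∑ i, ξ i * ξ i := by
  obtain ⟨W, hW⟩ : ∃ W, W = (32 * K ^ 2 * (M + 1 - m0) ^ 2 + 288 * K ^ 8 * |T|) * K ^ 4 := ⟨_, rfl⟩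
  have hW0 : 0 ≤ W := by rw [hW]; positivity
  have hs : 0 < M + 1 - M' := by linarith
  refine ⟨√W / (M + 1 - M'), by positivity, fun i q hq hqM ξ => ?_⟩
  have hK1 : 1 ≤ K := by
    have := h.slope_le i hq (by linarith)
    have : 0 ≤ ∑ j, dX j (U i) q ^ 2 := sum_nonneg fun _ _ => sq_nonneg _
    linarith
  have h1 := (h.sol i).hessian_bound (h.pos i) (M := M + 1) (V := K) (S := M + 1 - m0) hK1
    (fun q hq hqM => by
      have := h.slope_le i hq hqM
      exact Real.sqrt_le_iff.2 ⟨by linarith, by nlinarith⟩)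
    (fun q hq => by linarith [h.m0_le i hq]) q hq (by linarith) ξ
  have hξ : 0 ≤ ∑ i, ξ i * ξ i := sum_nonneg fun i _ => mul_self_nonneg _
  have hqT : q.2 ≤ |T| := hq.2.le.trans (le_abs_self T)
  have hq0 : 0 ≤ q.2 := hq.1.le
  have h2 : q.2 * (M + 1 - M') ^ 2 * grQ (U i) q ξ ^ 2 ≤ W * (∑ i, ξ i * ξ i) ^ 2 := by
    refine le_trans ?_ (h1.trans ?_)
    · have : M + 1 - M' ≤ M + 1 - U i q := by linarith
      gcongr
    · rw [hW]; gcongr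
  rw [div_mul_eq_mul_div, le_div_iff₀ hs]
  refine (abs_le_of_sq_le_sq ?_ (by positivity)).trans' (le_abs_self _)
  rw [mul_pow, mul_pow, mul_pow, sq_abs, Real.sq_sqrt hq0, Real.sq_sqrt hW0]
  linarith

/-- Interior bounds for spatial derivatives. -/
lemma exists_bound (σ : Stencil d Λ) (hΛ : K ≤ Λ) {m : ℕ} (hm : 2 ≤ m) : ∀ {M' τ : ℝ},
    M' < M + 1 → 0 < τ → ∃ b, ∀ i, ∀ q ∈ slab d T, U i q < M' → τ < q.2 →
      ∀ γ : List σ.S, γ.length ≤ m → |dW (γ.map σ.vX) (U i) q| ≤ b := by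
  induction m, hm using Nat.le_induction with
  | base =>
    intro M' τ hM' hτ
    obtain ⟨W, hW0, hW⟩ := h.exists_hessian hM'
    obtain ⟨B, hB⟩ : ∃ B, ∀ i, ∀ q ∈ slab d T, U i q < M' → τ < q.2 → ∀ ξ : Fin d → ℝ,
        |grQ (U i) q ξ| ≤ B * ∑ i, ξ i * ξ i := by
      refine ⟨W / √τ, fun i q hq hqM hqτ ξ => ?_⟩
      rw [div_mul_eq_mul_div, le_div_iff₀ (Real.sqrt_pos.2 hτ), mul_comm]
      exact (mul_le_mul_of_nonneg_right (Real.sqrt_le_sqrt hqτ.le) (abs_nonneg _)).trans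
        (hW i q hq hqM ξ)
    have := exists_bound_words σ 2
      (fun x : I × 𝔼 d × ℝ => x.2 ∈ slab d T ∧ U x.1 x.2 < M' ∧ τ < x.2.2)
      (fun γ x => dW (γ.map σ.vX) (U x.1) x.2) fun γ hγ => ?_
    · obtain ⟨b, hb⟩ := this
      exact ⟨b, fun i q h1 h2 h3 => hb (i, q) ⟨h1, h2, h3⟩⟩
    match γ, hγ with
    | [], _ =>
      refine ⟨|m0| + |M'|, fun x hx => ?_⟩
      have h1 := h.m0_le x.1 hx.1
      have h2 := hx.2.1
      change |U x.1 x.2| ≤ _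
      rw [abs_le]
      constructor <;> linarith [neg_abs_le m0, le_abs_self M', abs_nonneg m0, abs_nonneg M']
    | [s], _ =>
      refine ⟨∑ a, |(σ.dir s a : ℝ)| * K, fun x hx => ?_⟩
      change |fderiv ℝ (U x.1) x.2 (∑ a, (σ.dir s a : ℝ) • eX a)| ≤ _
      rw [map_sum]
      refine (Finset.abs_sum_le_sum_abs _ _).trans (sum_le_sum fun a _ => ?_)
      rw [map_smul, smul_eq_mul, abs_mul]
      exact mul_le_mul_of_nonneg_left (h.abs_dX_le x.1 hx.1 (by linarith [hx.2.1]) a) (abs_nonneg _)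
    | [s, s'], _ =>
      refine ⟨(B * ∑ i, ((σ.dir s i : ℝ) + σ.dir s' i) * ((σ.dir s i : ℝ) + σ.dir s' i) +
        B * ∑ i, (σ.dir s i : ℝ) * σ.dir s i + B * ∑ i, (σ.dir s' i : ℝ) * σ.dir s' i) / 2,
        fun x hx => ?_⟩
      have h1 := dW_pair σ (isOpen_slab d T) (h.sol x.1).sol.smooth s s' hx.1
      have h2 := abs_le.1 (hB x.1 x.2 hx.1 hx.2.1 hx.2.2 fun i => (σ.dir s i : ℝ) + σ.dir s' i)
      have h3 := abs_le.1 (hB x.1 x.2 hx.1 hx.2.1 hx.2.2 fun i => (σ.dir s i : ℝ))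
      have h4 := abs_le.1 (hB x.1 x.2 hx.1 hx.2.1 hx.2.2 fun i => (σ.dir s' i : ℝ))
      change |dW [σ.vX s, σ.vX s'] (U x.1) x.2| ≤ _
      exact abs_le.2 ⟨by linarith [h2.1, h3.2, h4.2], by linarith [h2.2, h3.1, h4.1]⟩
    | _ :: _ :: _ :: _, hγ => simp at hγ
  | succ m hm ih =>
    intro M' τ hM' hτ
    obtain ⟨b, hb⟩ := ih (M' := (M' + (M + 1)) / 2) (τ := τ / 2) (by linarith) (by linarith)
    exact bernstein_step σ h.pos h.sol hm (M' := (M' + (M + 1)) / 2) (by linarith)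
      (τ' := τ / 2) (by linarith) (by linarith) (fun i q hq => h.m0_le i hq)
      fun i q hq hqM hqτ => ⟨fun j => (h.abs_dX_le i hq (by linarith) j).trans hΛ,
        hb i q hq hqM hqτ⟩

/-- Interior bounds for all derivatives. -/
lemma exists_bound_mix {M' τ : ℝ} (hM' : M' < M + 1) (hτ : 0 < τ) (l : List (Option (Fin d))) :
    ∃ b, ∀ i, ∀ q ∈ slab d T, U i q < M' → τ < q.2 → |dW (l.map eO) (U i) q| ≤ b := by
  have hK : 0 ≤ K := (sq_nonneg _).trans h.gap
  obtain ⟨σ⟩ := nonempty_stencil d hK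
  have hO := isOpen_slab d T
  have hU : ∀ i, GrSol (slab d T) (U i) := fun i => (h.sol i).sol
  obtain ⟨m, hm, hD⟩ := FlowModel.exists_dp_mix (smModel_cts σ hO hU) l
  obtain ⟨b, hb⟩ := h.exists_bound σ le_rfl (m := m + 1) (by omega) hM' hτ
  obtain ⟨B, hB, hB'⟩ := hD.bound b
  refine ⟨B, fun i q hq hqM hqτ => ?_⟩
  have := hB' {((i, ⟨q, hq⟩) : I × slab d T)} ((smModel_cts σ hO hU).sat _) (fun w hw γ hγ => by
    obtain rfl : w = (i, ⟨q, hq⟩) := hw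
    exact (congrArg abs (smModel_ev_jet σ hO hU γ (i, ⟨q, hq⟩))).trans_le
      (hb i q hq hqM hqτ γ (by omega))) _ rfl
  exact (congrArg abs (smModel_ev_mix σ hO hU l (i, ⟨q, hq⟩))).symm.trans_le this

end PerFam

end

section

variable {d : ℕ} {Λ : ℝ} {g : 𝔼 d → ℝ} {T : ℝ}

lemma Stencil.dW_flow {σ : Stencil d Λ} (hT : σ.AllGood g T) (γ : List σ.S) :
    ∀ q ∈ slab d T, dW (γ.map σ.vX) (σ.flow g) q = σ.lim g ((σ.model g).jet γ) q := by
  induction γ with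
  | nil => exact fun q _ => rfl
  | cons s γ ih =>
    intro q hq
    rw [List.map_cons, dW_cons,
      (Filter.eventuallyEq_of_mem ((isOpen_slab d T).mem_nhds hq) ih).fderiv_eq,
      (hasFDerivAt_lim_jet hT hq γ).fderiv, lim_jet_cons hT hq.1.le hq.2.le, vX, map_sum]
    refine sum_congr rfl fun a _ => ?_
    rw [map_smul, stForm_apply, smul_eq_mul, eX]
    simp

open Stencil in
/-- Smooth periodic data have smooth periodic solutions for all times. -/
theorem exists_perSol {R : ℕ} (hR : 0 < R) (hg : ContDiff ℝ (⊤ : ℕ∞) g) (hp : IsPer R g) :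
    ∃ U, ∀ T, 0 < T → PerSol R T g U := by
  obtain ⟨C, hC⟩ := hp.bounded hR hg.continuous
  have hC0 : 0 ≤ C := (abs_nonneg _).trans (hC 0)
  choose C1 hC1 using fun i : Fin d => (hp.fderiv (EuclideanSpace.single i 1)).bounded hR
    ((hg.continuous_fderiv (by simp)).clm_apply continuous_const)
  obtain ⟨K, hK⟩ : ∃ K, K = (1 + ∑ i, C1 i ^ 2) * (2 * C + 2) ^ 2 := ⟨_, rfl⟩
  have hS : 0 ≤ ∑ i, C1 i ^ 2 := sum_nonneg fun _ _ => sq_nonneg _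
  have hfam : ∀ {T : ℝ} {U : 𝔼 d × ℝ → ℝ}, PerSol R T g U →
      PerFam (I := Unit) T (-C) C K (fun _ => R) (fun _ => g) fun _ => U := fun h =>
    { sol := fun _ => h
      pos := fun _ => hR
      lower := fun _ y => (abs_le.1 (hC y)).1
      upper := fun _ => ⟨C, fun y => (abs_le.1 (hC y)).2⟩
      slope := fun _ y _ => by
        rw [hK]
        have h1 := abs_le.1 (hC y)
        have h2 : ∑ j, fderiv ℝ g y (EuclideanSpace.single j 1) ^ 2 ≤ ∑ i, C1 i ^ 2 :=
          sum_le_sum fun i _ => by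
            have := abs_le.1 (hC1 i y)
            exact sq_le_sq' this.1 this.2
        have h3 : C + 2 - g y ≤ 2 * C + 2 := by linarith
        have h4 : 0 ≤ C + 2 - g y := by linarith
        gcongr
      gap := by rw [hK]; nlinarith [sq_nonneg (2 * C + 2)] }
  obtain ⟨Λ, hΛ⟩ : ∃ Λ, Λ = K + 2 + ∑ i, |C1 i| := ⟨_, rfl⟩
  have hK0 : 0 ≤ K := by rw [hK]; positivity
  have hs1 : 0 ≤ ∑ i, |C1 i| := sum_nonneg fun _ _ => abs_nonneg _
  obtain ⟨σ⟩ := nonempty_stencil d (Λ := Λ) (by linarith)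
  obtain ⟨T0, hT0, hgood0⟩ := good_zero (σ := σ) hR hg hp fun y i => by
    have h1 := (hC1 i y).trans (le_abs_self _)
    have h2 := single_le_sum (f := fun i => |C1 i|) (fun _ _ => abs_nonneg _)
      (Finset.mem_univ i)
    linarith
  have hall : ∀ T, σ.Good g T := by
    by_contra! hbad
    obtain ⟨T1, hT1⟩ := hbad
    obtain ⟨s, hs⟩ : ∃ s, s = {T | σ.Good g T} := ⟨_, rfl⟩
    have hbdd : BddAbove s := ⟨T1, fun t ht => by
      by_contra! hlt
      rw [hs] at ht
      exact hT1 (Good.mono ht hlt.le)⟩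
    have hne : s.Nonempty := ⟨T0, by rw [hs]; exact hgood0⟩
    have hpos : 0 < sSup s := hT0.trans_le (le_csSup hbdd (by rw [hs]; exact hgood0))
    have hbelow : ∀ T' < sSup s, σ.AllGood g T' := fun T' hT' => by
      obtain ⟨t, ht, htt⟩ := exists_lt_of_lt_csSup hne hT'
      rw [hs] at ht
      exact (Good.mono ht htt.le).all hR hg hp
    have hfm := hfam (flow_perSol hbelow hpos (hg.differentiable (by simp)) hp)
    obtain ⟨b, hb⟩ := hfm.exists_bound σ (by linarith) (m := 3) (by norm_num)
      (M' := C + 1 / 2) (τ := sSup s / 2) (by linarith) (by linarith)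
    obtain ⟨ε, hε, hext⟩ := good_extend (σ := σ) hR hp b
    obtain ⟨t, ht1, ht2⟩ := exists_between (show max (sSup s / 2) (sSup s - ε) < sSup s from
      max_lt (by linarith) (by linarith))
    have ht3 := (le_max_left _ _).trans_lt ht1
    have ht4 := (le_max_right _ _).trans_lt ht1
    obtain ⟨t', ht5, ht6⟩ := exists_between ht2
    have hrange : ∀ q ∈ slab d (sSup s), σ.flow g q < C + 1 / 2 := fun q hq => by
      have := ((hfm.sol ()).range (-C) C (fun y => abs_le.1 (hC y)) q (slab_subset_slab0 _ _ hq)).2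
      linarith
    have hin : ∀ x, ((x, t) : 𝔼 d × ℝ) ∈ slab d (sSup s) := fun x =>
      ⟨by change 0 < t; linarith, ht2⟩
    have hjet : ∀ γ : List σ.S, ∀ x, σ.lim g ((σ.model g).jet γ) (x, t)
        = dW (γ.map σ.vX) (σ.flow g) (x, t) := fun γ x =>
      (Stencil.dW_flow (hbelow t' ht6) γ (x, t) ⟨(hin x).1, ht5⟩).symm
    have hgood := hext t t (hbelow t ht2) (by linarith) le_rfl
      (fun γ hγ x => by
        rw [hjet]
        exact hb () _ (hin x) (hrange _ (hin x)) ht3 γ hγ)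
      (fun i x => by
        rw [hjet, List.map_singleton, σ.vX_ι]
        have h1 := hfm.abs_dX_le () (hin x) (by linarith [hrange _ (hin x)]) i
        exact h1.trans (by linarith))
    have := le_csSup hbdd (show t + ε ∈ s by rw [hs]; exact hgood)
    linarith
  exact ⟨σ.flow g, fun T hT => flow_perSol (fun T' _ => (hall T').all hR hg hp) hT
    (hg.differentiable (by simp)) hp⟩

end

section

lemma abs_sub_le_of_hasDerivAt {f f' : ℝ → ℝ} {a b C : ℝ} (hab : a ≤ b)
    (hc : ContinuousOn f (Icc a b)) (hd : ∀ t ∈ Ioo a b, HasDerivAt f (f' t) t ∧ |f' t| ≤ C) :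
    |f b - f a| ≤ C * (b - a) := by
  rcases hab.eq_or_lt with rfl | hab
  · simp
  · obtain ⟨c, hcm, h⟩ := exists_hasDerivAt_eq_slope f f' hab hc fun t ht => (hd t ht).1
    have h1 := (hd c hcm).2
    rw [h, abs_div, abs_of_pos (sub_pos.2 hab), div_le_iff₀ (sub_pos.2 hab)] at h1
    exact h1

/-- Truncations are Lipschitz if the derivative is bounded below the truncation height. -/
lemma abs_min_sub_min_le {f f' : ℝ → ℝ} {a b C M : ℝ} (hab : a ≤ b)
    (hc : ContinuousOn f (Icc a b))
    (hd : ∀ t ∈ Ioo a b, f t < M → HasDerivAt f (f' t) t ∧ |f' t| ≤ C) (hC : 0 ≤ C) :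
    |min (f b) M - min (f a) M| ≤ C * (b - a) := by
  have hK : IsCompact {t ∈ Icc a b | M ≤ f t} :=
    isCompact_Icc.of_isClosed_subset (hc.preimage_isClosed_of_isClosed isClosed_Icc isClosed_Ici)
      (sep_subset _ _)
  rcases eq_empty_or_nonempty {t ∈ Icc a b | M ≤ f t} with h0 | h0
  · have h1 : ∀ t ∈ Icc a b, f t < M := fun t ht => by
      by_contra! hcon
      exact (h0 ▸ (show t ∈ {t ∈ Icc a b | M ≤ f t} from ⟨ht, hcon⟩) : t ∈ (∅ : Set ℝ))
    rw [min_eq_left (h1 b ⟨hab, le_rfl⟩).le, min_eq_left (h1 a ⟨le_rfl, hab⟩).le]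
    exact abs_sub_le_of_hasDerivAt hab hc fun t ht => hd t ht (h1 t (Ioo_subset_Icc_self ht))
  · obtain ⟨c, hc1, hc2⟩ := hK.exists_isLeast h0
    obtain ⟨e, he1, he2⟩ := hK.exists_isGreatest h0
    have h1 := abs_sub_le_of_hasDerivAt (f' := f') (C := C) hc1.1.1
      (hc.mono (Icc_subset_Icc le_rfl hc1.1.2)) fun t ht => hd t ⟨ht.1, ht.2.trans_le hc1.1.2⟩ (by
        by_contra! hcon
        exact absurd (hc2 ⟨⟨ht.1.le, ht.2.le.trans hc1.1.2⟩, hcon⟩) (not_le.2 ht.2))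
    have h2 := abs_sub_le_of_hasDerivAt (f' := f') (C := C) he1.1.2
      (hc.mono (Icc_subset_Icc he1.1.1 le_rfl)) fun t ht => hd t ⟨he1.1.1.trans_lt ht.1, ht.2⟩ (by
        by_contra! hcon
        exact absurd (he2 ⟨⟨he1.1.1.trans ht.1.le, ht.2.le⟩, hcon⟩) (not_le.2 ht.1))
    have h3 : C * (c - a) ≤ C * (b - a) := by gcongr; exact hc1.1.2
    have h4 : C * (b - e) ≤ C * (b - a) := by gcongr; exact he1.1.1
    have h5 := abs_le.1 (h1.trans h3)
    have h6 := abs_le.1 (h2.trans h4)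
    have h7 : M ≤ f c := hc1.2
    have h8 : M ≤ f e := he1.2
    have h9 : 0 ≤ C * (b - a) := mul_nonneg hC (sub_nonneg.2 hab)
    have hb : M - C * (b - a) ≤ min (f b) M := le_min (by linarith) (by linarith)
    have ha : M - C * (b - a) ≤ min (f a) M := le_min (by linarith) (by linarith)
    rw [abs_le]
    constructor <;> linarith [min_le_right (f a) M, min_le_right (f b) M]

end

section

variable {d : ℕ} {I : Type}

lemma fderiv_apply_eq (A : 𝔼 d × ℝ →L[ℝ] ℝ)
    (w : 𝔼 d × ℝ) : A w = ∑ i, w.1 i * A (eX i) + w.2 * A eT := by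
  have : w = ∑ i, w.1 i • eX i + w.2 • eT := by
    refine Prod.ext ?_ (by simp [eX, eT, Prod.snd_sum])
    ext j
    simp [eX, eT, Prod.fst_sum, Finset.sum_apply, Pi.single_apply]
  conv_lhs => rw [this]
  simp only [map_add, map_sum, map_smul, smul_eq_mul]

/-- Parabolic distance. -/
def pDist (q q' : 𝔼 d × ℝ) : ℝ := ‖q'.1 - q.1‖ + |√q'.2 - √q.2|

lemma continuous_pDist (q : 𝔼 d × ℝ) : Continuous (pDist q) := by
  unfold pDist; fun_prop

namespace PerFam

variable {T m0 M K : ℝ} {R : I → ℕ} {g : I → 𝔼 d → ℝ}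
  {U : I → 𝔼 d × ℝ → ℝ} (h : PerFam T m0 M K R g U)
include h

lemma hasFDerivAt (i : I) {q} (hq : q ∈ slab d T) : HasFDerivAt (U i) (fderiv ℝ (U i) q) q :=
  (((h.sol i).sol.smooth.contDiffAt ((isOpen_slab d T).mem_nhds hq)).differentiableAt
    (by simp)).hasFDerivAt

lemma space_lip (i : I) {x y : 𝔼 d} {t : ℝ} (h0 : 0 < t) (hT : t < T) :
    |min (U i (y, t)) M - min (U i (x, t)) M| ≤ d * K * ‖y - x‖ := by
  have hK : 0 ≤ K := (sq_nonneg _).trans h.gap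
  have hs : ∀ z, ((z, t) : 𝔼 d × ℝ) ∈ slab d T := fun z => ⟨h0, hT⟩
  have hd : ∀ r : ℝ, HasDerivAt (fun r : ℝ => U i (x + r • (y - x), t))
      (fderiv ℝ (U i) (x + r • (y - x), t) (y - x, 0)) r := fun r => by
    have h1 : HasDerivAt (fun r : ℝ => ((x + r • (y - x), t) : 𝔼 d × ℝ))
        (y - x, 0) r := by
      have := (((hasDerivAt_id r).smul_const (y - x)).const_add x)
      simpa using this.prodMk (hasDerivAt_const r t)
    exact (h.hasFDerivAt i (hs _)).comp_hasDerivAt r h1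
  have := abs_min_sub_min_le (M := M) (C := d * K * ‖y - x‖) zero_le_one
    (fun r _ => (hd r).continuousAt.continuousWithinAt) (fun r _ hr => ⟨hd r, ?_⟩) (by positivity)
  · simpa using this
  · rw [fderiv_apply_eq]
    simp only [zero_mul, add_zero]
    refine (Finset.abs_sum_le_sum_abs _ _).trans ((Finset.sum_le_card_nsmul _ _
      (‖y - x‖ * K) fun j _ => ?_).trans_eq ?_)
    · rw [abs_mul]
      gcongr
      · exact EuclideanSpace.norm_eq (y - x) ▸ Real.abs_le_sqrt (by
          simpa using single_le_sum (f := fun j => ‖(y - x) j‖ ^ 2)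
            (fun _ _ => sq_nonneg _) (Finset.mem_univ j))
      · exact h.abs_dX_le i (hs _) (by linarith) j
    · rw [Finset.card_univ, Fintype.card_fin, nsmul_eq_mul]; ring

lemma exists_dT_bound : ∃ C, 0 ≤ C ∧ ∀ i, ∀ q ∈ slab d T, U i q < M → √q.2 * |dT (U i) q| ≤ C := by
  obtain ⟨B, hB0, hB⟩ := h.exists_hessian (M' := M) (by linarith)
  refine ⟨B * (d + 1), by positivity, fun i q hq hqM => ?_⟩
  have h1 : ∀ a, dX a (dX a (U i)) q = grQ (U i) q (Pi.single a 1) := fun a => by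
    simp [grQ, Pi.single_apply]
  rw [(h.sol i).sol.eq q hq]
  obtain ⟨p, hp⟩ : ∃ p : Fin d → ℝ, p = fun a => dX a (U i) q := ⟨_, rfl⟩
  have h2 : ∑ a, ∑ b, dX a (U i) q * dX b (U i) q * dX a (dX b (U i)) q = grQ (U i) q p := by
    rw [hp]; rfl
  have hpos := one_add_sum_sq_pos p
  have h3 : √q.2 * |∑ a, dX a (dX a (U i)) q| ≤ B * d := by
    refine (mul_le_mul_of_nonneg_left (Finset.abs_sum_le_sum_abs _ _) (Real.sqrt_nonneg _)).trans ?_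
    rw [mul_sum]
    refine (Finset.sum_le_card_nsmul _ _ B fun a _ => ?_).trans_eq
      (by rw [Finset.card_univ, Fintype.card_fin, nsmul_eq_mul, mul_comm])
    rw [h1]
    refine (hB i q hq hqM _).trans_eq ?_
    simp [Pi.single_apply]
  have h4 : √q.2 * |(1 + ∑ i, p i ^ 2)⁻¹ * grQ (U i) q p| ≤ B := by
    rw [abs_mul, abs_of_pos (inv_pos.2 hpos), mul_left_comm, inv_mul_le_iff₀ hpos]
    refine (hB i q hq hqM p).trans ?_
    simp only [← pow_two]
    nlinarith
  have h5 : (1 + ∑ j, dX j (U i) q ^ 2) = 1 + ∑ i, p i ^ 2 := by rw [hp]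
  rw [h2, h5]
  refine (mul_le_mul_of_nonneg_left (abs_sub _ _) (Real.sqrt_nonneg _)).trans ?_
  rw [mul_add]; linarith

lemma exists_time_lip : ∃ C, 0 ≤ C ∧ ∀ i x s t, 0 ≤ s → s ≤ t → t < T →
    |min (U i (x, t)) M - min (U i (x, s)) M| ≤ C * |√t - √s| := by
  obtain ⟨C, hC0, hC⟩ := h.exists_dT_bound
  refine ⟨2 * C, by positivity, fun i x s t h0 hst hT => ?_⟩
  have hle := Real.sqrt_le_sqrt hst
  have h1 := abs_min_sub_min_le (M := M) (C := 2 * C) (f := fun r => U i (x, r ^ 2))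
    (f' := fun r => fderiv ℝ (U i) (x, r ^ 2) (0, 2 * r)) hle ?_ (fun r hr hrM => ?_)
    (by positivity)
  · simp only [Real.sq_sqrt h0, Real.sq_sqrt (h0.trans hst)] at h1
    rwa [abs_of_nonneg (sub_nonneg.2 hle)]
  · refine (h.sol i).cont.comp (f := fun r : ℝ => (x, r ^ 2)) (by fun_prop) fun r hr => ?_
    refine ⟨sq_nonneg r, lt_of_le_of_lt ?_ hT⟩
    exact (Real.le_sqrt' · |>.1 hr.2) |> fun f => by
      rcases (Real.sqrt_nonneg s).trans hr.1 |>.eq_or_lt with h2 | h2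
      · simpa [← h2] using h0.trans hst
      · exact f h2
  · have hr0 : 0 < r := (Real.sqrt_nonneg s).trans_lt hr.1
    have hrt : r ^ 2 < t := (Real.lt_sqrt hr0.le).1 hr.2
    have hq : ((x, r ^ 2) : 𝔼 d × ℝ) ∈ slab d T :=
      ⟨by change 0 < r ^ 2; positivity, hrt.trans hT⟩
    have h2 : HasDerivAt (fun r : ℝ => ((x, r ^ 2) : 𝔼 d × ℝ)) (0, 2 * r) r :=
      by simpa using (hasDerivAt_const r x).prodMk (hasDerivAt_pow 2 r)
    refine ⟨(h.hasFDerivAt i hq).comp_hasDerivAt r h2, ?_⟩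
    rw [fderiv_apply_eq]
    have h3 := hC i _ hq hrM
    rw [Real.sqrt_sq hr0.le] at h3
    simp only [PiLp.zero_apply, zero_mul, Finset.sum_const_zero, zero_add]
    rw [abs_mul, abs_of_pos (by positivity : 0 < 2 * r)]
    change 2 * r * |dT (U i) _| ≤ _
    linarith

/-- Truncated solutions are uniformly Hölder continuous up to the initial time. -/
lemma exists_lip : ∃ C, 0 ≤ C ∧ ∀ i, ∀ q ∈ slab0 d T, ∀ q' ∈ slab0 d T,
    |min (U i q') M - min (U i q) M| ≤ C * pDist q q' := by
  obtain ⟨C, hC0, hC⟩ := h.exists_time_lip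
  have hK : 0 ≤ K := (sq_nonneg _).trans h.gap
  have hsp : ∀ i x y t, 0 ≤ t → t < T →
      |min (U i (y, t)) M - min (U i (x, t)) M| ≤ d * K * ‖y - x‖ := fun i x y t h0 hT => by
    rcases h0.eq_or_lt with rfl | h0
    · have hc : ∀ z, Tendsto (fun t => min (U i (z, t)) M) (𝓝[>] 0) (𝓝 (min (U i (z, 0)) M)) :=
        fun z => by
          refine Tendsto.min (((h.sol i).cont (z, 0) ⟨le_rfl, hT⟩).tendsto.comp
            (tendsto_nhdsWithin_iff.2 ⟨?_, ?_⟩)) tendsto_const_nhds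
          · exact ((Continuous.prodMk_right z).tendsto 0).mono_left nhdsWithin_le_nhds
          · filter_upwards [Ioo_mem_nhdsGT hT] with t ht using ⟨ht.1.le, ht.2⟩
      refine le_of_tendsto ((hc y).sub (hc x)).abs ?_
      filter_upwards [Ioo_mem_nhdsGT hT] with t ht using h.space_lip i ht.1 ht.2
    · exact h.space_lip i h0 hT
  have ht : ∀ i x s t, 0 ≤ s → s < T → 0 ≤ t → t < T →
      |min (U i (x, t)) M - min (U i (x, s)) M| ≤ C * |√t - √s| := fun i x s t hs hsT ht htT => by
    rcases le_total s t with hst | hst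
    · exact hC i x s t hs hst htT
    · rw [abs_sub_comm, abs_sub_comm √t]
      exact hC i x t s ht hst hsT
  refine ⟨C + d * K, by positivity, fun i q hq q' hq' => ?_⟩
  have h1 := hsp i q.1 q'.1 q.2 hq.1 hq.2
  have h2 := ht i q'.1 q.2 q'.2 hq.1 hq.2 hq'.1 hq'.2
  have h3 := abs_sub_le (min (U i q') M) (min (U i (q'.1, q.2)) M) (min (U i q) M)
  have h4 : 0 ≤ C * ‖q'.1 - q.1‖ := by positivity
  have h5 : 0 ≤ d * K * |√q'.2 - √q.2| := by positivity
  rw [pDist]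
  nlinarith

end PerFam

end

section

variable {d : ℕ} {O : Set (𝔼 d × ℝ)}

lemma norm_le_sum_eO (A : 𝔼 d × ℝ →L[ℝ] ℝ) : ‖A‖ ≤ ∑ o, |A (eO o)| := by
  refine A.opNorm_le_bound (sum_nonneg fun _ _ => abs_nonneg _) fun w => ?_
  rw [fderiv_apply_eq, Fintype.sum_option, Real.norm_eq_abs, add_mul, add_comm, sum_mul]
  refine (abs_add_le _ _).trans (add_le_add ?_ ?_)
  · rw [abs_mul, mul_comm]
    exact mul_le_mul_of_nonneg_left (norm_snd_le w) (abs_nonneg _)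
  · refine (Finset.abs_sum_le_sum_abs _ _).trans (sum_le_sum fun i _ => ?_)
    rw [abs_mul, mul_comm]
    refine mul_le_mul_of_nonneg_left (le_trans ?_ (norm_fst_le w)) (abs_nonneg _)
    exact PiLp.norm_apply_le w.1 i

/-- Limits along the ultrafilter of derivatives. -/
def limW (f : ℕ → 𝔼 d × ℝ → ℝ) (l : List (Option (Fin d)))
    (q : 𝔼 d × ℝ) : ℝ := ulim fun N => dW (l.map eO) (f N) q

/-- Uniform local control of all derivatives. -/
structure LocBdd (O : Set (𝔼 d × ℝ))
    (f : ℕ → 𝔼 d × ℝ → ℝ) : Prop where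
  isOpen : IsOpen O
  convex : Convex ℝ O
  smooth : ∀ᶠ N in 𝔲, ContDiffOn ℝ (⊤ : ℕ∞) (f N) O
  bound : ∀ l : List (Option (Fin d)), ∃ b, ∀ᶠ N in 𝔲,
    ∀ q ∈ O, |dW (l.map eO) (f N) q| ≤ b

namespace LocBdd

variable {f : ℕ → 𝔼 d × ℝ → ℝ} (h : LocBdd O f)
include h

lemma tendsto (l : List (Option (Fin d))) {q} (hq : q ∈ O) :
    Tendsto (fun N => dW (l.map eO) (f N) q) 𝔲 (𝓝 (limW f l q)) := by
  obtain ⟨b, hb⟩ := h.bound l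
  exact tendsto_ulim (hb.mono fun N hN => hN q hq)

lemma exists_quadratic (l : List (Option (Fin d))) : ∃ C, ∀ᶠ N in 𝔲,
    ∀ q ∈ O, ∀ q' ∈ O, |dW (l.map eO) (f N) q' - dW (l.map eO) (f N) q
      - fderiv ℝ (dW (l.map eO) (f N)) q (q' - q)| ≤ C * ‖q' - q‖ ^ 2 := by
  choose b hb using fun o o' => h.bound (o :: o' :: l)
  refine ⟨∑ o', ∑ o, b o o', ?_⟩
  filter_upwards [h.smooth, eventually_all.2 fun o => eventually_all.2 fun o' => hb o o']
    with N hs hN q hq q' hq'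
  have hd : ∀ l : List (Option (Fin d)), ∀ z ∈ O, DifferentiableAt ℝ (dW (l.map eO) (f N)) z :=
    fun l z hz => ((contDiffOn_dW h.isOpen hs _).contDiffAt (h.isOpen.mem_nhds hz)).differentiableAt
      (by simp)
  have h1 : ∀ o', ∀ z ∈ O, |dW ((o' :: l).map eO) (f N) z - dW ((o' :: l).map eO) (f N) q|
      ≤ (∑ o, b o o') * ‖z - q‖ := fun o' z hz =>
    Convex.norm_image_sub_le_of_norm_fderiv_le (hd (o' :: l))
      (fun z hz => (norm_le_sum_eO _).trans (sum_le_sum fun o _ => hN o o' z hz))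
      h.convex hq hz
  have hb0 : ∀ o', 0 ≤ ∑ o, b o o' := fun o' => sum_nonneg fun o _ =>
    (abs_nonneg _).trans (hN o o' q hq)
  have h2 := Convex.norm_image_sub_le_of_norm_fderiv_le' (𝕜 := ℝ) (f := dW (l.map eO) (f N))
    (s := O ∩ closedBall q ‖q' - q‖) (x := q) (y := q')
    (φ := fderiv ℝ (dW (l.map eO) (f N)) q) (C := (∑ o', ∑ o, b o o') * ‖q' - q‖)
    (fun z hz => hd l z hz.1) (fun z hz => ?_) (h.convex.inter (convex_closedBall _ _))
    ⟨hq, by simp⟩ ⟨hq', by simp [dist_eq_norm]⟩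
  · rw [pow_two, ← mul_assoc]; exact h2
  · refine (norm_le_sum_eO _).trans ?_
    rw [sum_mul]
    refine sum_le_sum fun o' _ => (h1 o' z hz.1).trans ?_
    exact mul_le_mul_of_nonneg_left (by simpa [dist_eq_norm] using hz.2) (hb0 o')

lemma hasFDerivAt (l : List (Option (Fin d))) {q} (hq : q ∈ O) :
    HasFDerivAt (limW f l)
      (stForm (fun i => limW f (some i :: l) q) (limW f (none :: l) q)) q := by
  obtain ⟨C, hC⟩ := h.exists_quadratic l
  refine hasFDerivAt_of_quadratic (C := C) ?_
  filter_upwards [h.isOpen.mem_nhds hq] with q' hq'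
  refine le_of_tendsto ((((h.tendsto l hq').sub (h.tendsto l hq)).sub ?_).abs)
    (hC.mono fun N hN => hN q hq q' hq')
  have e : stForm (fun i => limW f (some i :: l) q) (limW f (none :: l) q) (q' - q)
      = ∑ i, (q' - q).1 i * limW f (some i :: l) q + (q' - q).2 * limW f (none :: l) q := by
    rw [stForm_apply]; simp only [mul_comm]
  rw [e]
  exact ((tendsto_finsetSum Finset.univ fun i _ =>
    (h.tendsto (some i :: l) hq).const_mul ((q' - q).1 i)).add
    ((h.tendsto (none :: l) hq).const_mul (q' - q).2)).congr fun N =>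
      (fderiv_apply_eq (fderiv ℝ (dW (l.map eO) (f N)) q) (q' - q)).symm

lemma contDiffOn (n : ℕ) (l : List (Option (Fin d))) : ContDiffOn ℝ n (limW f l) O := by
  induction n generalizing l with
  | zero =>
    rw [Nat.cast_zero, contDiffOn_zero]
    exact fun q hq => (h.hasFDerivAt l hq).continuousAt.continuousWithinAt
  | succ n ih =>
    rw [Nat.cast_succ, contDiffOn_succ_iff_fderiv_of_isOpen h.isOpen]
    exact ⟨fun q hq => (h.hasFDerivAt l hq).differentiableAt.differentiableWithinAt, by simp,
      (contDiff_stForm (fun i => ih (some i :: l)) (ih (none :: l))).congr fun q hq =>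
        (h.hasFDerivAt l hq).fderiv⟩

lemma dX_limW (l : List (Option (Fin d))) (i : Fin d) {q} (hq : q ∈ O) :
    dX i (limW f l) q = limW f (some i :: l) q := by
  rw [dX, (h.hasFDerivAt l hq).fderiv, stForm_apply, eX]
  simp

/-- Limits of solutions are solutions. -/
lemma grSol (hf : ∀ᶠ N in 𝔲, GrSol O (f N)) : GrSol O (limW f []) := by
  refine ⟨contDiffOn_infty.2 fun n => h.contDiffOn n [], fun q hq => ?_⟩
  have e2 : ∀ i j, dX i (dX j (limW f [])) q = limW f [some i, some j] q := fun i j => by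
    rw [Stencil.dX_congr h.isOpen (fun q hq => h.dX_limW [] j hq) i hq, h.dX_limW _ _ hq]
  have e3 : dT (limW f []) q = limW f [none] q := by
    rw [dT, (h.hasFDerivAt [] hq).fderiv, stForm_apply, eT]; simp
  simp only [e2, e3, h.dX_limW [] _ hq]
  have t1 := fun i => h.tendsto [some i] hq
  have t2 := fun i j => h.tendsto [some i, some j] hq
  refine tendsto_nhds_unique ((h.tendsto [none] hq).congr' (hf.mono fun N hN => hN.eq q hq))
    ((tendsto_finsetSum _ fun a _ => t2 a a).sub (Tendsto.mul (Tendsto.inv₀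
      (tendsto_const_nhds.add (tendsto_finsetSum _ fun i _ => (t1 i).pow 2))
      (one_add_sum_sq_pos _).ne') (tendsto_finsetSum _ fun a _ => tendsto_finsetSum _ fun b _ =>
        ((t1 a).mul (t1 b)).mul (t2 a b))))

end LocBdd

end

section

variable {d : ℕ} {O : Set (𝔼 d × ℝ)} {U : 𝔼 d × ℝ → ℝ}

lemma hasFDerivAt_slice {f : 𝔼 d × ℝ → ℝ} {x : 𝔼 d}
    {t : ℝ} (hf : DifferentiableAt ℝ f (x, t)) : HasFDerivAt (fun y => f (y, t))
      ((fderiv ℝ f (x, t)).comp (ContinuousLinearMap.inl ℝ _ _)) x :=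
  hf.hasFDerivAt.comp x (hasFDerivAt_prodMk_left x t)

lemma spatialGrad_eq {x : 𝔼 d} {t : ℝ} (hU : DifferentiableAt ℝ U (x, t)) :
    spatialGrad U x t = WithLp.toLp 2 fun i => dX i U (x, t) := by
  ext i
  have h1 := (hasFDerivAt_slice hU).hasGradientAt.gradient
  rw [spatialGrad, h1]
  have h2 : ∀ w : 𝔼 d, w i = inner ℝ w (EuclideanSpace.single i 1) := fun w => by
    simp [EuclideanSpace.inner_single_right]
  rw [h2, InnerProductSpace.toDual_symm_apply]
  rfl

lemma GrSol.mcfEqAt (hO : IsOpen O) (h : GrSol O U) {x : 𝔼 d} {t : ℝ}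
    (hq : (x, t) ∈ O) : mcfEqAt U x t := by
  have hd : ∀ {f : 𝔼 d × ℝ → ℝ}, ContDiffOn ℝ (⊤ : ℕ∞) f O →
      ∀ q ∈ O, DifferentiableAt ℝ f q := fun hf q hq =>
    (hf.contDiffAt (hO.mem_nhds hq)).differentiableAt (by simp)
  have hnear : ∀ᶠ y in 𝓝 x, (y, t) ∈ O :=
    (Continuous.prodMk_left t).continuousAt.preimage_mem_nhds (hO.mem_nhds hq)
  obtain ⟨p, hp⟩ : ∃ p : Fin d → 𝔼 d → ℝ, p = fun i y => dX i U (y, t) :=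
    ⟨_, rfl⟩
  obtain ⟨S, hS⟩ : ∃ S : 𝔼 d → ℝ, S = fun y => 1 + ∑ i, p i y ^ 2 := ⟨_, rfl⟩
  have hSpos : ∀ y, 0 < S y := fun y => by rw [hS]; exact one_add_sum_sq_pos _
  have hg : ∀ y, (y, t) ∈ O → gradFn U y t = √(S y) := fun y hy => by
    rw [gradFn, spatialGrad_eq (hd h.smooth _ hy), EuclideanSpace.norm_sq_eq, hS, hp]
    simp
  have hdp : ∀ i, HasFDerivAt (p i) ((fderiv ℝ (dX i U) (x, t)).comp
      (ContinuousLinearMap.inl ℝ _ _)) x := fun i => by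
    rw [hp]; exact hasFDerivAt_slice (hd (contDiffOn_dX hO h.smooth i) _ hq)
  have hpe : ∀ i j, fderiv ℝ (p i) x (EuclideanSpace.single j 1) = dX j (dX i U) (x, t) :=
    fun i j => by rw [(hdp i).fderiv]; rfl
  have hdS : HasFDerivAt S (∑ i, (2 * p i x) • fderiv ℝ (p i) x) x := by
    rw [hS]
    have := (HasFDerivAt.fun_sum fun i (_ : i ∈ Finset.univ) =>
      (hdp i).differentiableAt.hasFDerivAt.pow 2).const_add 1
    simpa using this
  have hdr := (hasDerivAt_inv (Real.sqrt_pos.2 (hSpos x)).ne').comp_hasFDerivAt x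
    (hdS.sqrt (hSpos x).ne')
  have hX := fun i => hdr.mul (hdp i).differentiableAt.hasFDerivAt
  obtain ⟨X, hXd⟩ : ∃ X : 𝔼 d → 𝔼 d,
    X = fun y => WithLp.toLp 2 fun i => (√(S y))⁻¹ * p i y := ⟨_, rfl⟩
  have hXdiff : DifferentiableAt ℝ X x := differentiableAt_euclidean.2 fun i => by
    rw [hXd]; exact (hX i).differentiableAt
  have hXi : ∀ i w, fderiv ℝ X x w i = fderiv ℝ (fun y => (√(S y))⁻¹ * p i y) x w := fun i w => by
    have := (EuclideanSpace.proj i : 𝔼 d →L[ℝ] ℝ).hasFDerivAt.comp x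
      hXdiff.hasFDerivAt
    have h2 : (EuclideanSpace.proj i : 𝔼 d →L[ℝ] ℝ) ∘ X
        = fun y => (√(S y))⁻¹ * p i y := by rw [hXd]; rfl
    rw [← h2, this.fderiv]; rfl
  have hXe : (fun y => (gradFn U y t)⁻¹ • spatialGrad U y t) =ᶠ[𝓝 x] X := by
    filter_upwards [hnear] with y hy
    rw [hg y hy, spatialGrad_eq (hd h.smooth _ hy), hXd, hp]
    rfl
  have ht : HasDerivAt (fun s => U (x, s)) (dT U (x, t)) t :=
    (hd h.smooth _ hq).hasFDerivAt.comp_hasDerivAt t ((hasDerivAt_const t x).prodMk (hasDerivAt_id t))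
  rw [_root_.mcfEqAt, ht.deriv, vecDiv, hXe.fderiv_eq, hg x hq, h.eq _ hq]
  simp only [hXi]
  have hs := Real.sqrt_pos.2 (hSpos x)
  have hss := Real.mul_self_sqrt (hSpos x).le
  obtain ⟨r, hr⟩ : ∃ r, r = √(S x) := ⟨_, rfl⟩
  have hterm : ∀ i, √(S x) * fderiv ℝ (fun y => (√(S y))⁻¹ * p i y) x (EuclideanSpace.single i 1)
      = dX i (dX i U) (x, t)
        - (S x)⁻¹ * ∑ j, p i x * p j x * dX i (dX j U) (x, t) := fun i => by
    rw [(show HasFDerivAt (fun y => (√(S y))⁻¹ * p i y) _ x from hX i).fderiv]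
    simp only [ContinuousLinearMap.add_apply, ContinuousLinearMap.smul_apply, smul_eq_mul,
      ContinuousLinearMap.sum_apply, hpe, Function.comp_apply]
    rw [← hr] at hs hss ⊢
    rw [← hss]
    have e : ∑ j, 2 * p j x * dX i (dX j U) (x, t) = 2 * ∑ j, p j x * dX i (dX j U) (x, t) := by
      rw [mul_sum]; exact sum_congr rfl fun j _ => by ring
    have e' : ∑ j, p i x * p j x * dX i (dX j U) (x, t)
        = p i x * ∑ j, p j x * dX i (dX j U) (x, t) := by
      rw [mul_sum]; exact sum_congr rfl fun j _ => by ring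
    rw [e, e']
    field_simp
    ring
  rw [mul_sum _ _ √(S x), sum_congr rfl fun i _ => hterm i, sum_sub_distrib,
    ← mul_sum, hS, hp]

end

section

variable {d : ℕ}

/-- Smooth periodic approximations of initial data which blow up outside `A`. -/
structure ApproxData (A : Set (𝔼 d)) (u₀ : 𝔼 d → ℝ)
    (m0 : ℝ) (R : ℕ → ℕ) (g : ℕ → 𝔼 d → ℝ) : Prop where
  pos : ∀ L, 0 < R L
  smooth : ∀ L, ContDiff ℝ (⊤ : ℕ∞) (g L)
  per : ∀ L, IsPer (R L) (g L)
  lower : ∀ L y, m0 ≤ g L y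
  upper : ∀ L, ∃ b, ∀ y, g L y ≤ b
  slope : ∀ M, ∃ K N0, ∀ L, N0 ≤ L → ∀ y, g L y < M →
    1 + ∑ j, fderiv ℝ (g L) y (EuclideanSpace.single j 1) ^ 2 ≤ K
  inn : ∀ x ∈ A, Tendsto (fun L => g L x) atTop (𝓝 (u₀ x))
  out : ∀ x ∉ A, Tendsto (fun L => g L x) atTop atTop

/-- The space-time region where the limit is finite. -/
def finSet (U : ℕ → 𝔼 d × ℝ → ℝ) : Set (𝔼 d × ℝ) :=
  {q | 0 ≤ q.2 ∧ ∃ M, ∀ᶠ L in 𝔲, U L q < M}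

/-- Limit of the truncations. -/
def truncLim (U : ℕ → 𝔼 d × ℝ → ℝ) (M : ℝ)
    (q : 𝔼 d × ℝ) : ℝ := ulim fun L => min (U L q) M

namespace ApproxData

variable {A : Set (𝔼 d)} {u₀ : 𝔼 d → ℝ} {m0 : ℝ}
  {R : ℕ → ℕ} {g : ℕ → 𝔼 d → ℝ} (h : ApproxData A u₀ m0 R g)
  {U : ℕ → 𝔼 d × ℝ → ℝ} (hU : ∀ L T, 0 < T → PerSol (R L) T (g L) (U L))
include h hU

lemma exists_perFam {T : ℝ} (hT : 0 < T) (M : ℝ) : ∃ K N0, PerFam (I := {L : ℕ // N0 ≤ L}) T m0 M K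
    (fun L => R L) (fun L => g L) (fun L => U L) := by
  obtain ⟨K, N0, hK⟩ := h.slope (M + 2)
  refine ⟨max 1 K * (M + 2 - m0) ^ 2, N0, fun L => hU L T hT, fun L => h.pos L, fun L => h.lower L,
    fun L => h.upper L, fun L y hy => ?_, ?_⟩
  · have h1 := hK L L.2 y hy
    have h2 := h.lower L y
    have h3 : M + 2 - g L y ≤ M + 2 - m0 := by linarith
    have h4 : 0 ≤ M + 2 - g L y := by linarith
    have h5 := h1.trans (le_max_right 1 K)
    gcongr
  · nlinarith [sq_nonneg (M + 2 - m0), le_max_left 1 K]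

lemma m0_le (L : ℕ) {q : 𝔼 d × ℝ} (hq : 0 ≤ q.2) : m0 ≤ U L q := by
  obtain ⟨b, hb⟩ := h.upper L
  exact ((hU L (q.2 + 1) (by linarith)).range m0 b (fun y => ⟨h.lower L y, hb y⟩) q
    ⟨hq, by linarith⟩).1

lemma tendsto_truncLim (M : ℝ) {q : 𝔼 d × ℝ} (hq : 0 ≤ q.2) :
    Tendsto (fun L => min (U L q) M) 𝔲 (𝓝 (truncLim U M q)) :=
  tendsto_ulim (B := |m0| + |M|) <| .of_forall fun L => by
    have := h.m0_le hU L hq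
    rw [abs_le]
    constructor
    · refine le_min ?_ ?_ <;> linarith [neg_abs_le m0, neg_abs_le M, abs_nonneg m0, abs_nonneg M]
    · exact (min_le_right _ _).trans ((le_abs_self M).trans (by linarith [abs_nonneg m0]))

lemma tendsto_of_mem {q} (hq : q ∈ finSet U) :
    Tendsto (fun L => U L q) 𝔲 (𝓝 (limW U [] q)) := by
  obtain ⟨h0, M, hM⟩ := hq
  refine tendsto_ulim (B := |m0| + |M|) <| hM.mono fun L hL => ?_
  have h1 := h.m0_le hU L h0
  change |U L q| ≤ _
  rw [abs_le]
  constructor <;> linarith [neg_abs_le m0, le_abs_self M, abs_nonneg m0, abs_nonneg M]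

lemma truncLim_eq_min (M : ℝ) {q} (hq : q ∈ finSet U) : truncLim U M q = min (limW U [] q) M :=
  tendsto_nhds_unique (h.tendsto_truncLim hU M hq.1) ((h.tendsto_of_mem hU hq).min tendsto_const_nhds)

lemma mem_finSet {M : ℝ} {q : 𝔼 d × ℝ} (hq : 0 ≤ q.2)
    (hM : truncLim U M q < M) : q ∈ finSet U :=
  ⟨hq, M, ((h.tendsto_truncLim hU M hq).eventually_lt_const hM).mono fun L hL => by
    simpa using hL⟩

lemma truncLim_eq_of_notMem (M : ℝ) {q : 𝔼 d × ℝ} (hq : 0 ≤ q.2)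
    (hn : q ∉ finSet U) : truncLim U M q = M :=
  le_antisymm (le_of_tendsto (h.tendsto_truncLim hU M hq) (.of_forall fun _ => min_le_right _ _))
    (not_lt.1 fun hlt => hn (h.mem_finSet hU hq hlt))

lemma tendsto_truncLim_nhds (M : ℝ) {p : 𝔼 d × ℝ} (hp : 0 ≤ p.2) :
    Tendsto (truncLim U M) (𝓝[{q | 0 ≤ q.2}] p) (𝓝 (truncLim U M p)) := by
  obtain ⟨K, N0, hf⟩ := h.exists_perFam hU (T := p.2 + 1) (by linarith) M
  obtain ⟨C, -, hC⟩ := hf.exists_lip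
  have h0 : Tendsto (fun q => C * pDist p q) (𝓝[{q | 0 ≤ q.2}] p) (𝓝 0) := by
    have := ((continuous_pDist p).const_mul C).tendsto p
    rw [show C * pDist p p = 0 by simp [pDist]] at this
    exact this.mono_left nhdsWithin_le_nhds
  refine tendsto_iff_dist_tendsto_zero.2 (squeeze_zero' (.of_forall fun _ => dist_nonneg) ?_ h0)
  filter_upwards [self_mem_nhdsWithin, mem_nhdsWithin_of_mem_nhds
    ((isOpen_lt continuous_snd continuous_const).mem_nhds (show p.2 < p.2 + 1 by linarith))]
    with q hq hq1
  exact le_of_tendsto ((h.tendsto_truncLim hU M hq).sub (h.tendsto_truncLim hU M hp)).abs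
    (((eventually_ge_atTop N0).filter_mono Nat.hyperfilter_le_atTop).mono fun L hL =>
      hC ⟨L, hL⟩ p ⟨hp, by linarith⟩ q ⟨hq, hq1⟩)

lemma eventually_mem {p} (hp : p ∈ finSet U) : ∀ᶠ q in 𝓝[{q | 0 ≤ q.2}] p,
    q ∈ finSet U ∧ limW U [] q = truncLim U (limW U [] p + 1) q := by
  have h1 := (h.tendsto_truncLim_nhds hU (limW U [] p + 1) hp.1).eventually_lt_const
    (show _ < limW U [] p + 1 by rw [h.truncLim_eq_min hU _ hp]; simp)
  filter_upwards [h1, self_mem_nhdsWithin] with q hq hq0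
  have hm := h.mem_finSet hU hq0 hq
  rw [h.truncLim_eq_min hU _ hm] at hq ⊢
  exact ⟨hm, (min_eq_left (le_of_lt (by simpa using hq))).symm⟩

lemma exists_isOpen : ∃ V, IsOpen V ∧ finSet U = V ∩ {p | 0 ≤ p.2} := by
  refine ⟨interior {q | 0 ≤ q.2 → q ∈ finSet U}, isOpen_interior, Subset.antisymm
    (fun p hp => ⟨mem_interior_iff_mem_nhds.2 ?_, hp.1⟩) fun p hp => interior_subset hp.1 hp.2⟩
  exact eventually_nhdsWithin_iff.1 ((h.eventually_mem hU hp).mono fun q hq => hq.1)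

lemma continuousOn : ContinuousOn (limW U []) (finSet U) := fun p hp => by
  refine Tendsto.mono_left ?_ (nhdsWithin_mono p fun q (hq : q ∈ finSet U) => hq.1)
  refine ((h.tendsto_truncLim_nhds hU (limW U [] p + 1) hp.1).congr'
    ((h.eventually_mem hU hp).mono fun q hq => hq.2.symm)).trans_eq ?_
  rw [h.truncLim_eq_min hU _ hp]; simp

lemma tendsto_atTop_of_notMem {p : 𝔼 d × ℝ} (hp : 0 ≤ p.2)
    (hn : p ∉ finSet U) : Tendsto (limW U []) (𝓝[finSet U] p) atTop := tendsto_atTop.2 fun b => by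
  have h1 := ((h.tendsto_truncLim_nhds hU (b + 1) hp).mono_left
    (nhdsWithin_mono p fun q (hq : q ∈ finSet U) => hq.1)).eventually_const_lt (u := b)
    (by rw [h.truncLim_eq_of_notMem hU _ hp hn]; linarith)
  filter_upwards [h1, self_mem_nhdsWithin] with q hq hqm
  rw [h.truncLim_eq_min hU _ hqm] at hq
  exact (hq.trans_le (min_le_left _ _)).le

lemma init_of_mem {x} (hx : x ∈ A) : (x, (0 : ℝ)) ∈ finSet U ∧ limW U [] (x, 0) = u₀ x := by
  have h1 : Tendsto (fun L => U L (x, 0)) 𝔲 (𝓝 (u₀ x)) :=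
    ((h.inn x hx).congr fun L => ((hU L 1 one_pos).init x).symm).mono_left Nat.hyperfilter_le_atTop
  have hm : (x, (0 : ℝ)) ∈ finSet U :=
    ⟨le_rfl, u₀ x + 1, h1.eventually_lt_const (by linarith)⟩
  exact ⟨hm, tendsto_nhds_unique (h.tendsto_of_mem hU hm) h1⟩

lemma init_of_notMem {x} (hx : x ∉ A) : (x, (0 : ℝ)) ∉ finSet U := fun ⟨_, M, hM⟩ => by
  obtain ⟨L, h1, h2⟩ := (hM.and (Nat.hyperfilter_le_atTop
    ((h.out x hx).eventually_ge_atTop M))).exists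
  rw [(hU L 1 one_pos).init x] at h1
  exact h1.not_ge h2

lemma exists_grSol {p} (hp : p ∈ finSet U) (hp0 : 0 < p.2) :
    ∃ O, IsOpen O ∧ p ∈ O ∧ GrSol O (limW U []) := by
  obtain ⟨M, hM⟩ : ∃ M, M = limW U [] p + 1 := ⟨_, rfl⟩
  obtain ⟨K, N0, hf⟩ := h.exists_perFam hU (T := p.2 + 1) (by linarith) M
  obtain ⟨C, -, hC⟩ := hf.exists_lip
  have hnear : ∀ᶠ q in 𝓝 p, C * pDist p q < 1 / 2 ∧ p.2 / 2 < q.2 ∧ q.2 < p.2 + 1 := by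
    have h1 := ((continuous_pDist p).const_mul C).tendsto p
    rw [show C * pDist p p = 0 by simp [pDist]] at h1
    exact (h1.eventually_lt_const (by norm_num)).and
      ((continuous_snd.continuousAt.eventually_const_lt (by linarith)).and
        (continuous_snd.continuousAt.eventually_lt_const (by linarith)))
  obtain ⟨ε, hε, hball⟩ := Metric.eventually_nhds_iff_ball.1 hnear
  have hslab : ball p ε ⊆ slab d (p.2 + 1) := fun q hq =>
    ⟨by have := (hball q hq).2.1; change 0 < q.2; linarith, (hball q hq).2.2⟩
  have hev : ∀ᶠ L in 𝔲, N0 ≤ L ∧ ∀ q ∈ ball p ε, U L q < M := by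
    filter_upwards [Nat.hyperfilter_le_atTop (eventually_ge_atTop N0),
      (h.tendsto_of_mem hU hp).eventually_lt_const (show _ < limW U [] p + 1 / 4 by linarith)]
      with L hL hLp
    refine ⟨hL, fun q hq => ?_⟩
    have h1 := (abs_le.1 (hC ⟨L, hL⟩ p ⟨hp0.le, by linarith⟩ q
      (slab_subset_slab0 _ _ (hslab hq)))).2
    have h2 := (hball q hq).1
    have h3 : min (U L q) M < M := by
      have : min (U L p) M ≤ U L p := min_le_left _ _
      change min (U L q) M - min (U L p) M ≤ _ at h1
      linarith
    simpa using h3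
  have hs : ∀ L, GrSol (ball p ε) (U L) := fun L =>
    have := (hU L (p.2 + 1) (by linarith)).sol
    ⟨this.smooth.mono hslab, fun q hq => this.eq q (hslab hq)⟩
  have hL : LocBdd (ball p ε) U := ⟨isOpen_ball, convex_ball _ _, .of_forall fun L => (hs L).smooth,
    fun l => by
      obtain ⟨b, hb⟩ := hf.exists_bound_mix (M' := M) (τ := p.2 / 2) (by linarith) (by linarith) l
      exact ⟨b, hev.mono fun L hL q hq =>
        hb ⟨L, hL.1⟩ q (hslab hq) (hL.2 q hq) (hball q hq).2.1⟩⟩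
  exact ⟨ball p ε, isOpen_ball, mem_ball_self hε, hL.grSol (.of_forall hs)⟩

end ApproxData

end

section

variable {d : ℕ}

lemma abs_integral_normed_mul_le (φ : ContDiffBump (0 : 𝔼 d))
    {f : 𝔼 d → ℝ} {c : ℝ} (h : ∀ t, ‖t‖ < φ.rOut → |f t| ≤ c) :
    |∫ t, φ.normed MeasureTheory.volume t * f t| ≤ c := by
  have := MeasureTheory.norm_integral_le_of_norm_le (f := fun t => φ.normed MeasureTheory.volume t * f t)
    ((φ.integrable_normed (μ := MeasureTheory.volume)).mul_const c) (.of_forall fun t => by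
      rw [norm_mul, Real.norm_of_nonneg (φ.nonneg_normed t)]
      by_cases ht : ‖t‖ < φ.rOut
      · exact mul_le_mul_of_nonneg_left (h t ht) (φ.nonneg_normed t)
      · have : φ.normed MeasureTheory.volume t = 0 := by
          rw [← Function.notMem_support, φ.support_normed_eq, mem_ball_zero_iff]; exact ht
        simp [this])
  rwa [MeasureTheory.integral_mul_const, φ.integral_normed, one_mul] at this

/-- Mollification of periodic Lipschitz functions, respecting slopes on sublevel sets. -/
lemma exists_mollify {R : ℕ} {W : 𝔼 d → ℝ} {K ε : ℝ}
    (hW : ∀ x y, |W x - W y| ≤ K * ‖x - y‖) (hK : 0 ≤ K) (hp : IsPer R W) (hε : 0 < ε)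
    (hε2 : ε ≤ 1 / 2) : ∃ g, ContDiff ℝ (⊤ : ℕ∞) g ∧ IsPer R g ∧ (∀ y, |g y - W y| ≤ ε) ∧
      ∀ M K', 0 ≤ K' → (∀ x y, |min (W x) M - min (W y) M| ≤ K' * ‖x - y‖) →
        ∀ y, g y < M - 1 → ‖fderiv ℝ g y‖ ≤ K' := by
  obtain ⟨δ, hδ⟩ : ∃ δ, δ = ε / (2 * (K + 1)) := ⟨_, rfl⟩
  have hδ0 : 0 < δ := by rw [hδ]; positivity
  have hδK : K * (2 * δ) ≤ ε := by
    have : δ * (2 * (K + 1)) = ε := by rw [hδ]; field_simp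
    nlinarith
  obtain ⟨φ, hφ⟩ : ∃ φ : ContDiffBump (0 : 𝔼 d), φ.rOut = δ :=
    ⟨⟨δ / 2, δ, half_pos hδ0, half_lt_self hδ0⟩, rfl⟩
  have hWc : Continuous W := (LipschitzWith.of_dist_le_mul (K := ⟨K, hK⟩) fun x y => by
    rw [Real.dist_eq, dist_eq_norm]; exact hW x y).continuous
  have hi : ∀ x, MeasureTheory.Integrable fun t => φ.normed MeasureTheory.volume t * W (x - t) :=
    fun x => (φ.continuous_normed.mul (by fun_prop)).integrable_of_hasCompactSupport
      φ.hasCompactSupport_normed.mul_right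
  obtain ⟨g, hg⟩ : ∃ g : 𝔼 d → ℝ,
    g = fun x => ∫ t, φ.normed MeasureTheory.volume t * W (x - t) := ⟨_, rfl⟩
  have hgW : ∀ y, |g y - W y| ≤ ε := fun y => by
    have : g y - W y = ∫ t, φ.normed MeasureTheory.volume t * (W (y - t) - W y) := by
      simp_rw [mul_sub]
      rw [MeasureTheory.integral_sub (hi y) (φ.integrable_normed.mul_const _),
        MeasureTheory.integral_mul_const, φ.integral_normed, one_mul, hg]
    rw [this]
    refine abs_integral_normed_mul_le φ fun t ht => (hW _ _).trans ?_
    rw [sub_sub_cancel_left, norm_neg]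
    nlinarith
  refine ⟨g, ?_, fun y e => ?_, hgW, fun M K' hK' hM y hy => norm_fderiv_le_of_lip' ℝ hK' ?_⟩
  · rw [hg]
    exact φ.hasCompactSupport_normed.contDiff_convolution_left (.lsmul ℝ ℝ)
      φ.contDiff_normed hWc.locallyIntegrable
  · simp only [hg, add_sub_right_comm, hp _ e]
  · filter_upwards [ball_mem_nhds y hδ0] with x hx
    have : g x - g y = ∫ t, φ.normed MeasureTheory.volume t * (W (x - t) - W (y - t)) := by
      simp_rw [mul_sub]
      rw [MeasureTheory.integral_sub (hi x) (hi y), hg]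
    rw [this]
    refine abs_integral_normed_mul_le φ fun t ht => ?_
    have h1 : ∀ z ∈ ball y δ, W (z - t) ≤ M := fun z hz => by
      have h2 := (abs_le.1 (hW (z - t) y)).2
      have h3 := norm_sub_le (z - y) t
      rw [sub_right_comm] at h3
      have h4 := (abs_le.1 (hgW y)).1
      have h5 := mem_ball_iff_norm.1 hz
      have h6 : K * ‖z - t - y‖ ≤ K * (2 * δ) := by gcongr; linarith
      linarith
    have := hM (x - t) (y - t)
    rwa [min_eq_left (h1 x hx), min_eq_left (h1 y (mem_ball_self hδ0)), sub_sub_sub_cancel_right]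
      at this

/-- Periodic folding of the line. -/
def fold (R : ℕ) (s : ℝ) : ℝ := ‖((s + R / 4 : ℝ) : AddCircle (R : ℝ))‖ - R / 4

lemma abs_fold_sub_le (R : ℕ) (s s' : ℝ) : |fold R s - fold R s'| ≤ |s - s'| := by
  rw [fold, fold, sub_sub_sub_cancel_right]
  refine (abs_norm_sub_norm_le _ _).trans ?_
  rw [← AddCircle.coe_sub, add_sub_add_right_eq_sub]
  exact QuotientAddGroup.norm_mk_le_norm

lemma fold_periodic (R : ℕ) (s : ℝ) (e : ℤ) : fold R (s + R * e) = fold R s := by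
  have : (((R : ℝ) * e : ℝ) : AddCircle (R : ℝ)) = 0 :=
    AddCircle.coe_eq_zero_iff _ |>.2 ⟨e, by rw [zsmul_eq_mul, mul_comm]⟩
  rw [fold, add_right_comm, AddCircle.coe_add, this, add_zero, fold]

lemma fold_eq {R : ℕ} (hR : 0 < R) {s : ℝ} (h : |s| ≤ R / 4) : fold R s = s := by
  have h1 := abs_le.1 h
  have hR' : (0 : ℝ) < R := Nat.cast_pos.2 hR
  have h2 : |s + R / 4| = s + R / 4 := abs_of_nonneg (by linarith)
  rw [fold, (AddCircle.norm_coe_eq_abs_iff _ hR'.ne').2 (by rw [h2, abs_of_pos hR']; linarith), h2]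
  ring

/-- Periodic folding of Euclidean space. -/
def foldE (R : ℕ) (x : 𝔼 d) : 𝔼 d :=
  WithLp.toLp 2 fun i => fold R (x i)

lemma norm_foldE_sub_le (R : ℕ) (x y : 𝔼 d) :
    ‖foldE R x - foldE R y‖ ≤ ‖x - y‖ := by
  rw [EuclideanSpace.norm_eq, EuclideanSpace.norm_eq]
  exact Real.sqrt_le_sqrt (sum_le_sum fun i _ =>
    pow_le_pow_left₀ (norm_nonneg _) (abs_fold_sub_le R (x i) (y i)) 2)

variable {A : Set (𝔼 d)} {u₀ : 𝔼 d → ℝ}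

open Classical in
/-- Truncated initial datum, extended by the truncation level. -/
def truncDatum (A : Set (𝔼 d)) (u₀ : 𝔼 d → ℝ) (M : ℝ)
    (x : 𝔼 d) : ℝ := if x ∈ A then min (u₀ x) M else M

lemma truncDatum_of_mem {x} (hx : x ∈ A) (M : ℝ) : truncDatum A u₀ M x = min (u₀ x) M := if_pos hx

lemma truncDatum_of_notMem {x} (hx : x ∉ A) (M : ℝ) : truncDatum A u₀ M x = M := if_neg hx

lemma truncDatum_le (M : ℝ) (x) : truncDatum A u₀ M x ≤ M := by
  unfold truncDatum; split_ifs <;> simp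

lemma min_truncDatum {M M' : ℝ} (h : M' ≤ M) (x) :
    min (truncDatum A u₀ M x) M' = truncDatum A u₀ M' x := by
  unfold truncDatum; split_ifs
  · rw [min_assoc, min_eq_right h]
  · exact min_eq_right h

section

variable (hA : IsOpen A) (hb : Bornology.IsBounded A)
  (hlip : ∀ x ∈ A, ∃ K : NNReal, ∃ s ∈ 𝓝[A] x, LipschitzOnWith K u₀ s)
  (hbd : ∀ x₀ ∈ frontier A, Tendsto u₀ (𝓝[A] x₀) atTop)
include hA hlip hbd

lemma locallyLipschitz_truncDatum (M : ℝ) : LocallyLipschitz (truncDatum A u₀ M) := fun x => by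
  by_cases hx : x ∈ A
  · obtain ⟨K, s, hs, hK⟩ := hlip x hx
    rw [hA.nhdsWithin_eq hx] at hs
    refine ⟨K, s ∩ A, inter_mem hs (hA.mem_nhds hx), .of_dist_le_mul fun y hy z hz => ?_⟩
    rw [truncDatum_of_mem hy.2, truncDatum_of_mem hz.2]
    refine le_trans ?_ (hK.dist_le_mul y hy.1 z hz.1)
    simpa using! abs_min_sub_min_le_max (u₀ y) M (u₀ z) M
  · have h1 : ∀ᶠ y in 𝓝[A] x, M ≤ u₀ y := by
      by_cases hc : x ∈ closure A
      · exact (hbd x ⟨hc, by rwa [hA.interior_eq]⟩).eventually_ge_atTop M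
      · rw [notMem_closure_iff_nhdsWithin_eq_bot.1 hc]; exact eventually_bot
    refine ⟨0, _, eventually_nhdsWithin_iff.1 h1, ?_⟩
    have h2 : ∀ y, (y ∈ A → M ≤ u₀ y) → truncDatum A u₀ M y = M := fun y hy => by
      by_cases hyA : y ∈ A
      · rw [truncDatum_of_mem hyA, min_eq_right (hy hyA)]
      · exact truncDatum_of_notMem hyA M
    intro y hy z hz
    rw [h2 y hy, h2 z hz]; simp

include hb

lemma exists_le_truncDatum : ∃ m0 ≤ 0, ∀ M, 0 ≤ M → ∀ x, m0 ≤ truncDatum A u₀ M x := by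
  obtain ⟨ρ, hρ⟩ := hb.subset_closedBall 0
  obtain ⟨m, hm⟩ := (isCompact_closedBall (0 : 𝔼 d) ρ).bddBelow_image
    (locallyLipschitz_truncDatum hA hlip hbd 0).continuous.continuousOn
  refine ⟨min m 0, min_le_right _ _, fun M hM x => ?_⟩
  by_cases hx : x ∈ A
  · have h1 := hm (mem_image_of_mem _ (hρ hx))
    rw [truncDatum_of_mem hx] at h1 ⊢
    exact le_min ((min_le_left _ _).trans (h1.trans (min_le_left _ _)))
      ((min_le_right _ _).trans hM)
  · rw [truncDatum_of_notMem hx]; exact (min_le_right _ _).trans hM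

lemma exists_lip_truncDatum {M : ℝ} (hM : 0 ≤ M) : ∃ K, 0 ≤ K ∧ ∀ x y,
    |truncDatum A u₀ M x - truncDatum A u₀ M y| ≤ K * ‖x - y‖ := by
  obtain ⟨ρ, hρ⟩ := hb.subset_closedBall 0
  obtain ⟨m0, hm0, hm⟩ := exists_le_truncDatum hA hb hlip hbd
  obtain ⟨K, hK⟩ := LocallyLipschitzOn.exists_lipschitzOnWith_of_compact
    (isCompact_closedBall (0 : 𝔼 d) (ρ + 1))
    (locallyLipschitz_truncDatum hA hlip hbd M).locallyLipschitzOn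
  have key : ∀ x y, y ∉ closedBall (0 : 𝔼 d) (ρ + 1) →
      |truncDatum A u₀ M x - truncDatum A u₀ M y| ≤ (M - m0) * ‖x - y‖ := fun x y hy => by
    have hyA : y ∉ A := fun h => hy (closedBall_subset_closedBall (by linarith) (hρ h))
    rw [truncDatum_of_notMem hyA]
    by_cases hx : x ∈ A
    · have h1 := mem_closedBall_zero_iff.1 (hρ hx)
      have h2 : ρ + 1 < ‖y‖ := by simpa using hy
      have h3 := norm_sub_norm_le y x
      rw [norm_sub_rev] at h3
      have h4 := hm M hM x
      have h5 := truncDatum_le (A := A) (u₀ := u₀) M x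
      rw [abs_le]
      constructor <;> nlinarith
    · rw [truncDatum_of_notMem hx, sub_self, abs_zero]
      exact mul_nonneg (by linarith) (norm_nonneg _)
  refine ⟨K + (M - m0), add_nonneg K.2 (by linarith), fun x y => ?_⟩
  have hn := norm_nonneg (x - y)
  have hKn := mul_nonneg K.2 hn
  change 0 ≤ (K : ℝ) * _ at hKn
  have hMn : 0 ≤ (M - m0) * ‖x - y‖ := mul_nonneg (by linarith) hn
  rw [add_mul]
  by_cases hy : y ∈ closedBall (0 : 𝔼 d) (ρ + 1)
  · by_cases hx : x ∈ closedBall (0 : 𝔼 d) (ρ + 1)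
    · have := hK.dist_le_mul x hx y hy
      rw [Real.dist_eq, dist_eq_norm] at this
      linarith
    · have := key y x hx
      rw [abs_sub_comm, norm_sub_rev] at this
      linarith
  · linarith [key x y hy]

lemma exists_approxData : ∃ m0 R g, ApproxData A u₀ m0 R g := by
  obtain ⟨m0, hm0, hm⟩ := exists_le_truncDatum hA hb hlip hbd
  choose! K hK0 hK using fun M (hM : 0 ≤ M) => exists_lip_truncDatum hA hb hlip hbd hM
  obtain ⟨W, hWd⟩ : ∃ W : ℕ → 𝔼 d → ℝ,
    W = fun (L : ℕ) x => truncDatum A u₀ L (foldE (L + 1) x) := ⟨_, rfl⟩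
  have hWM : ∀ L : ℕ, ∀ M : ℝ, 0 ≤ M → M ≤ L → ∀ x y,
      |min (W L x) M - min (W L y) M| ≤ K M * ‖x - y‖ := fun L M hM hML x y => by
    simp only [hWd, min_truncDatum hML]
    exact (hK M hM _ _).trans (mul_le_mul_of_nonneg_left (norm_foldE_sub_le _ _ _) (hK0 M hM))
  have hL0 : ∀ L : ℕ, (0 : ℝ) ≤ L := fun L => Nat.cast_nonneg L
  have hWle : ∀ (L : ℕ) x, W L x ≤ L := fun L x => by rw [hWd]; exact truncDatum_le _ _
  have hW0 : ∀ (L : ℕ) x y, |W L x - W L y| ≤ K L * ‖x - y‖ := fun L x y => by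
    have := hWM L L (hL0 L) le_rfl x y
    rwa [min_eq_left (hWle L x), min_eq_left (hWle L y)] at this
  have hWx : ∀ x, ∀ᶠ L : ℕ in atTop, W L x = truncDatum A u₀ L x := fun x => by
    filter_upwards [eventually_ge_atTop ⌈4 * ‖x‖⌉₊] with L hL
    rw [hWd]
    refine congrArg (truncDatum A u₀ L) (PiLp.ext fun i => fold_eq L.succ_pos ?_)
    have h1 := PiLp.norm_apply_le x i
    rw [Real.norm_eq_abs] at h1
    have h2 := Nat.ceil_le.1 hL
    push_cast
    linarith
  choose g hg1 hg2 hg3 hg4 using fun L : ℕ => exists_mollify (R := L + 1) (ε := 1 / ((L : ℝ) + 2))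
    (hW0 L) (hK0 L (hL0 L)) (fun y e => by
      rw [hWd]
      exact congrArg (truncDatum A u₀ L) (PiLp.ext fun i => fold_periodic _ (y i) (e i)))
    (by have := hL0 L; positivity)
    (by have := hL0 L; gcongr; linarith)
  have hε : ∀ L : ℕ, 1 / ((L : ℝ) + 2) ≤ 1 := fun L => by
    rw [div_le_one (by linarith [hL0 L])]; linarith [hL0 L]
  refine ⟨m0 - 1, fun L => L + 1, g, fun L => L.succ_pos, hg1, hg2, fun L y => ?_,
    fun L => ⟨L + 1, fun y => ?_⟩, fun M => ?_, fun x hx => ?_, fun x hx => ?_⟩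
  · have h1 : m0 ≤ W L y := by rw [hWd]; exact hm L (hL0 L) _
    linarith [(abs_le.1 (hg3 L y)).1, hε L]
  · linarith [(abs_le.1 (hg3 L y)).2, hε L, hWle L y]
  · refine ⟨1 + ∑ _j : Fin d, K (max M 0 + 1) ^ 2, ⌈max M 0 + 1⌉₊, fun L hL y hy => ?_⟩
    have h0 : 0 ≤ max M 0 + 1 := by positivity
    have h1 := hg4 L (max M 0 + 1) _ (hK0 _ h0) (hWM L _ h0 (Nat.ceil_le.1 hL)) y
      (by linarith [le_max_left M 0])
    gcongr 1 + ∑ j, ?_ with j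
    rw [← sq_abs]
    refine pow_le_pow_left₀ (abs_nonneg _) (((fderiv ℝ (g L) y).le_opNorm _).trans ?_) 2
    simpa using h1
  · have h1 : Tendsto (fun L : ℕ => 1 / ((L : ℝ) + 2)) atTop (𝓝 0) :=
      tendsto_const_nhds.div_atTop (tendsto_natCast_atTop_atTop.atTop_add tendsto_const_nhds)
    refine tendsto_iff_dist_tendsto_zero.2 (squeeze_zero' (.of_forall fun _ => dist_nonneg) ?_ h1)
    filter_upwards [hWx x, eventually_ge_atTop ⌈u₀ x⌉₊] with L hL hLu
    have := hg3 L x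
    rwa [hL, truncDatum_of_mem hx, min_eq_left (Nat.ceil_le.1 hLu)] at this
  · refine tendsto_atTop_mono' atTop ?_ (tendsto_atTop_add_const_right atTop (-1)
      tendsto_natCast_atTop_atTop)
    filter_upwards [hWx x] with L hL
    have := (abs_le.1 (hg3 L x)).1
    rw [hL, truncDatum_of_notMem hx] at this
    linarith [hε L]

end

end

end

/-- **Existence on bounded domains.**  Let `A ⊂ ℝ^{n+1}` be a bounded open set and
`u₀ : A → ℝ` locally Lipschitz with `u₀(x) → ∞` as `x → x₀` for every `x₀ ∈ ∂A`.
Then there is a relatively open `Ω ⊂ ℝ^{n+1} × [0,∞)` and `u : Ω → ℝ` solving graphical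
mean curvature flow on `Ω ∖ (Ω₀ × {0})`, smooth for `t > 0`, continuous up to `t = 0`,
with `Ω₀ = A`, `u(·,0) = u₀` on `A`, and `u(x,t) → ∞` as `(x,t)` approaches the relative
boundary of `Ω` in `ℝ^{n+1} × [0,∞)`. -/
theorem mcf_existence_bounded_domains (n : ℕ) (hn : 1 ≤ n)
    (A : Set (EuclideanSpace ℝ (Fin (n + 1)))) (hA_open : IsOpen A)
    (hA_bdd : Bornology.IsBounded A)
    (u₀ : EuclideanSpace ℝ (Fin (n + 1)) → ℝ)
    (hu₀_lip : ∀ x ∈ A, ∃ K : NNReal, ∃ s ∈ 𝓝[A] x, LipschitzOnWith K u₀ s)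
    (hu₀_bdry : ∀ x₀ ∈ frontier A, Tendsto u₀ (𝓝[A] x₀) atTop) :
    ∃ (Ω : Set (EuclideanSpace ℝ (Fin (n + 1)) × ℝ))
      (u : EuclideanSpace ℝ (Fin (n + 1)) × ℝ → ℝ),
      -- Ω is relatively open in ℝ^{n+1} × [0,∞)
      (∃ U, IsOpen U ∧ Ω = U ∩ {p | 0 ≤ p.2}) ∧
      -- u solves graphical mean curvature flow on Ω ∖ (Ω₀ × {0})
      (∀ p ∈ Ω, 0 < p.2 → mcfEqAt u p.1 p.2) ∧
      -- u is smooth for t > 0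
      ContDiffOn ℝ (⊤ : ℕ∞) u (Ω ∩ {p | 0 < p.2}) ∧
      -- and continuous up to t = 0
      ContinuousOn u Ω ∧
      -- Ω₀ = A
      {x | (x, (0 : ℝ)) ∈ Ω} = A ∧
      -- u(·,0) = u₀ on A
      (∀ x ∈ A, u (x, 0) = u₀ x) ∧
      -- u(x,t) → ∞ as (x,t) → ∂Ω (relative boundary in ℝ^{n+1} × [0,∞))
      (∀ p : EuclideanSpace ℝ (Fin (n + 1)) × ℝ,
        0 ≤ p.2 → p ∈ closure Ω → p ∉ Ω → Tendsto u (𝓝[Ω] p) atTop) := by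
  obtain ⟨m0, R, g, h⟩ := exists_approxData hA_open hA_bdd hu₀_lip hu₀_bdry
  choose U hU using fun L => exists_perSol (h.pos L) (h.smooth L) (h.per L)
  have hsol : ∀ p ∈ finSet U, 0 < p.2 → ∃ O, IsOpen O ∧ p ∈ O ∧ GrSol O (limW U []) :=
    fun p hp hp0 => h.exists_grSol hU hp hp0
  refine ⟨finSet U, limW U [], h.exists_isOpen hU, fun p hp hp0 => ?_, fun p hp => ?_,
    h.continuousOn hU, ?_, fun x hx => (h.init_of_mem hU hx).2,
    fun p hp _ hn => h.tendsto_atTop_of_notMem hU hp hn⟩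
  · obtain ⟨O, hO, hpO, hs⟩ := hsol p hp hp0
    exact hs.mcfEqAt hO hpO
  · obtain ⟨O, hO, hpO, hs⟩ := hsol p hp.1 hp.2
    exact (hs.smooth.contDiffAt (hO.mem_nhds hpO)).contDiffWithinAt
  · ext x
    exact ⟨fun hx => by_contra fun hxA => h.init_of_notMem hU hxA hx,
      fun hx => (h.init_of_mem hU hx).1⟩
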